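/- Let O_K be the ring of integers of K = Q(√−163) and let N = 16·O_K = (2O_K)⁴. Let Γ₀(N) be the subgroup of GL₂(O_K) consisting of those matrices whose lower-left entry lies in N. Then for every prime l ≥ 19, the abelianization Γ₀(N)^{ab} has no element of order l. -/

import Mathlib

open NumberField Matrix

/-- The congruence subgroup `Γ₀(N)` of `GL₂(R)`: invertible matrices whose lower-left entry
lies in the ideal `N`. -/
def Gamma0 {R : Type*} [CommRing R] (N : Ideal R) : Subgroup (GL (Fin 2) R) where
  carrier := {A | (A : Matrix (Fin 2) (Fin 2) R) 1 0 ∈ N}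
  one_mem' := by
    simp [Matrix.one_apply]
  mul_mem' := by
    intro A B ha hb
    simp only [Set.mem_setOf_eq, Units.val_mul, Matrix.mul_apply, Fin.sum_univ_two] at *
    exact N.add_mem (Ideal.mul_mem_right _ N ha) (Ideal.mul_mem_left N _ hb)
  inv_mem' := by
    intro A ha
    simp only [Set.mem_setOf_eq] at *
    rw [Matrix.coe_units_inv, Matrix.inv_def, Matrix.smul_apply, Matrix.adjugate_fin_two,
      smul_eq_mul]
    exact Ideal.mul_mem_left N _ (by simpa using N.neg_mem ha)

/-- Index of a disc: the letter `j`, possibly inverted (`e`), possibly reflected (`s`). -/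
structure DiscIx where
  s : Bool
  j : ℕ
  e : Bool

/-- The generators of a group modelled on the stabiliser of infinity together with letters. -/
structure Sys (E : Type*) [Group E] where
  t1 : E
  t2 : E
  d : E
  z : E
  a : ℕ → E
  comm : Commute t1 t2
  dd : d * d = 1
  dt1 : d * t1 = t1⁻¹ * d
  dt2 : d * t2 = t2⁻¹ * d
  zz : z * z = 1
  zt1 : Commute z t1
  zt2 : Commute z t2
  zd : Commute z d
  za : ∀ j, Commute z (a j)

/-- The action of the reflection on translations. -/
def flipBy (s : Bool) (b : ℤ × ℤ) : ℤ × ℤ := if s then -b else b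

namespace Sys

variable {E : Type*} [Group E] (S : Sys E)

def tr (b : ℤ × ℤ) : E := S.t1 ^ b.1 * S.t2 ^ b.2

def dp (s : Bool) : E := if s then S.d else 1

def zp (s : Bool) : E := if s then S.z else 1

def letter (j : ℕ) (e : Bool) : E := if e then (S.a j)⁻¹ else S.a j

def g (k : DiscIx) : E := S.dp k.s * S.letter k.j k.e

def disc (p : (ℤ × ℤ) × DiscIx) : E := S.tr p.1 * S.g p.2

def bel (b : (ℤ × ℤ) × Bool × Bool) : E := S.tr b.1 * S.dp b.2.1 * S.zp b.2.2

theorem tr_add (b c : ℤ × ℤ) : S.tr (b + c) = S.tr b * S.tr c := by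
  have h : Commute (S.t2 ^ b.2) (S.t1 ^ c.1) := (S.comm.symm.zpow_zpow _ _)
  simp only [tr, Prod.fst_add, Prod.snd_add, _root_.zpow_add, mul_assoc]
  rw [← mul_assoc (S.t2 ^ b.2), h.eq, mul_assoc]

@[simp] theorem tr_zero : S.tr 0 = 1 := by simp [tr]

theorem tr_neg (b : ℤ × ℤ) : S.tr (-b) = (S.tr b)⁻¹ := by
  rw [eq_inv_iff_mul_eq_one, ← tr_add]; simp

theorem d_tr (b : ℤ × ℤ) : S.d * S.tr b = S.tr (-b) * S.d := by
  have h1 : SemiconjBy S.d S.t1 S.t1⁻¹ := S.dt1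
  have h2 : SemiconjBy S.d S.t2 S.t2⁻¹ := S.dt2
  have := (h1.zpow_right b.1).mul_right (h2.zpow_right b.2)
  rw [_root_.inv_zpow', _root_.inv_zpow'] at this
  exact this

theorem dp_tr (s : Bool) (b : ℤ × ℤ) : S.dp s * S.tr b = S.tr (flipBy s b) * S.dp s := by
  cases s
  · simp [dp, flipBy]
  · simpa [dp, flipBy] using S.d_tr b

theorem dp_dp (s s' : Bool) : S.dp s * S.dp s' = S.dp (xor s s') := by
  cases s <;> cases s' <;> simp [dp, S.dd]

theorem zp_zp (s s' : Bool) : S.zp s * S.zp s' = S.zp (xor s s') := by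
  cases s <;> cases s' <;> simp [zp, S.zz]

theorem zp_tr (s : Bool) (b : ℤ × ℤ) : Commute (S.zp s) (S.tr b) := by
  cases s
  · simp [zp]
  · exact (S.zt1.zpow_right _).mul_right (S.zt2.zpow_right _)

theorem zp_dp (s s' : Bool) : Commute (S.zp s) (S.dp s') := by
  cases s <;> cases s' <;> simp [zp, dp, S.zd]

theorem zp_letter (s : Bool) (j : ℕ) (e : Bool) : Commute (S.zp s) (S.letter j e) := by
  cases s <;> cases e <;> simp [zp, letter, S.za j]

theorem zp_disc (s : Bool) (p : (ℤ × ℤ) × DiscIx) : Commute (S.zp s) (S.disc p) :=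
  (S.zp_tr _ _).mul_right ((S.zp_dp _ _).mul_right (S.zp_letter _ _ _))

theorem bel_zero : S.bel (0, false, false) = 1 := by simp [bel, dp, zp]

theorem bel_mul (b c : (ℤ × ℤ) × Bool × Bool) :
    S.bel b * S.bel c = S.bel (b.1 + flipBy b.2.1 c.1, xor b.2.1 c.2.1, xor b.2.2 c.2.2) := by
  obtain ⟨b, s, e⟩ := b
  obtain ⟨c, s', e'⟩ := c
  simp only [bel, tr_add, ← dp_dp, ← zp_zp]
  have h1 := (S.zp_tr e c).eq
  have h2 := (S.zp_dp e s').eq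
  have h3 := S.dp_tr s c
  simp only [mul_assoc]
  rw [← mul_assoc (S.zp e), h1, mul_assoc, ← mul_assoc (S.zp e), h2, mul_assoc,
    ← mul_assoc (S.dp s), h3, mul_assoc]

theorem exists_bel_inv (b : (ℤ × ℤ) × Bool × Bool) : ∃ c, S.bel b * S.bel c = 1 ∧
    ∀ {F : Type*} [Group F] (S' : Sys F), S'.bel b * S'.bel c = 1 := by
  refine ⟨(-(flipBy b.2.1 b.1), b.2.1, b.2.2), ?_, fun S' => ?_⟩ <;>
  · rw [bel_mul]
    have : b.1 + flipBy b.2.1 (-(flipBy b.2.1 b.1)) = 0 := by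
      cases b.2.1 <;> simp [flipBy]
    simp only [this, Bool.xor_self]
    exact bel_zero _

theorem bel_disc (b : (ℤ × ℤ) × Bool × Bool) (p : (ℤ × ℤ) × DiscIx) :
    S.bel b * S.disc p =
      S.disc (b.1 + flipBy b.2.1 p.1, ⟨xor b.2.1 p.2.s, p.2.j, p.2.e⟩) *
        S.bel (0, false, b.2.2) := by
  obtain ⟨b, s, e⟩ := b
  obtain ⟨c, k⟩ := p
  have h1 := (S.zp_disc e (c, k)).eq
  have h3 := S.dp_tr s c
  have : S.bel (0, false, e) = S.zp e := by simp [bel, dp]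
  rw [this]
  simp only [bel]
  rw [mul_assoc, h1, ← mul_assoc]
  congr 1
  simp only [disc, g, tr_add, ← dp_dp, mul_assoc]
  rw [← mul_assoc (S.dp s), h3, mul_assoc]

theorem letter_inv (j : ℕ) (e : Bool) : (S.letter j e)⁻¹ = S.letter j (!e) := by
  cases e <;> simp [letter]

theorem disc_inv (p : (ℤ × ℤ) × DiscIx) : S.disc p *
    (S.disc (0, ⟨false, p.2.j, !p.2.e⟩) * S.bel (flipBy p.2.s (-p.1), p.2.s, false)) = 1 := by
  obtain ⟨b, s, j, e⟩ := p
  have h : S.disc (0, ⟨false, j, !e⟩) = (S.letter j e)⁻¹ := by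
    simp [disc, g, dp, letter_inv]
  rw [h]
  have h2 : S.bel (flipBy s (-b), s, false) = S.dp s * (S.tr b)⁻¹ := by
    simp [bel, zp, ← dp_tr, tr_neg]
  rw [h2]
  have h3 := S.dp_dp s s
  simp only [Bool.xor_self] at h3
  simp only [disc, g, mul_assoc]
  rw [mul_inv_cancel_left, ← mul_assoc (S.dp s), h3]
  simp [dp]

end Sys

section Extension

variable {G E : Type*} [Group G] [Group E] (S0 : Sys G) (S : Sys E) (ht : G → ℕ) (J : ℕ)

/-- Pairs in `G × E` reachable from the disc `p0` through elements decreasing the height of `g`. -/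
inductive Conn (g : G) (p0 : (ℤ × ℤ) × DiscIx) : G → E → Prop
  | base : Conn g p0 (S0.disc p0) (S.disc p0)
  | bmul {x : G} {y : E} (b : (ℤ × ℤ) × Bool × Bool) (h : Conn g p0 x y) :
      Conn g p0 (x * S0.bel b) (y * S.bel b)
  | step {x : G} {y : E} (p : (ℤ × ℤ) × DiscIx) (hp : p.2.j < J) (h : Conn g p0 x y)
      (hx : ht (g * x) < ht g) : Conn g p0 (x * S0.disc p) (y * S.disc p)

/-- Every element of positive height is lowered by some disc, and all discs which do not
increase the height are connected to it. -/
def Geo : Prop := ∀ g, 0 < ht g → ∃ p0 : (ℤ × ℤ) × DiscIx, p0.2.j < J ∧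
  ht (g * S0.disc p0) < ht g ∧ ∀ p : (ℤ × ℤ) × DiscIx, p.2.j < J → ht (g * S0.disc p) ≤ ht g →
    Conn S0 S ht J g p0 (S0.disc p) (S.disc p)

variable {S0 S ht J}

open Classical in
/-- The extension of the values on generators obtained by lowering heights. -/
noncomputable def descent (geo : Geo S0 S ht J)
    (h0 : ∀ g, ht g = 0 → ∃ b, g = S0.bel b) (g : G) : E :=
  if h : 0 < ht g then
    descent geo h0 (g * S0.disc (geo g h).choose) * (S.disc (geo g h).choose)⁻¹
  else S.bel (h0 g (Nat.eq_zero_of_not_pos h)).choose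
termination_by ht g
decreasing_by exact (geo g h).choose_spec.2.1

theorem descent_bel (geo : Geo S0 S ht J) (hb : ∀ g b, ht (g * S0.bel b) = ht g)
    (h0 : ∀ g, ht g = 0 → ∃ b, g = S0.bel b) (h1 : ht 1 = 0) (hinj : Function.Injective S0.bel)
    (b : (ℤ × ℤ) × Bool × Bool) : descent geo h0 (S0.bel b) = S.bel b := by
  have hz : ht (S0.bel b) = 0 := by rw [← one_mul (S0.bel b), hb, h1]
  rw [descent, dif_neg (by omega)]
  congr 1
  exact (hinj (h0 _ hz).choose_spec).symm

/-- Compatibility with generators below height `m`. -/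
def CompatBelow (geo : Geo S0 S ht J)
    (h0 : ∀ g, ht g = 0 → ∃ b, g = S0.bel b) (m : ℕ) : Prop :=
  (∀ g b, ht g < m → descent geo h0 (g * S0.bel b) = descent geo h0 g * S.bel b) ∧
  ∀ g (p : (ℤ × ℤ) × DiscIx), p.2.j < J → ht g < m → ht (g * S0.disc p) < m →
    descent geo h0 (g * S0.disc p) = descent geo h0 g * S.disc p

theorem descent_strict (geo : Geo S0 S ht J) (hb : ∀ g b, ht (g * S0.bel b) = ht g)
    (h0 : ∀ g, ht g = 0 → ∃ b, g = S0.bel b)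
    {m : ℕ} (ih : CompatBelow geo h0 m) {g : G} (hg : ht g = m) (hm : 0 < m)
    (p : (ℤ × ℤ) × DiscIx) (hp : p.2.j < J) (hs : ht (g * S0.disc p) < m) :
    descent geo h0 (g * S0.disc p) = descent geo h0 g * S.disc p := by
  obtain ⟨p0, hp0, hs0, hc⟩ := geo g (by omega)
  have key : ∀ x y, Conn S0 S ht J g p0 x y → ht (g * x) < m →
      descent geo h0 (g * x) = (descent geo h0 (g * S0.disc p0) * (S.disc p0)⁻¹) * y := by
    intro x y h
    induction h with
    | base => intro _; group
    | bmul b h ihc =>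
      intro hx
      rw [← mul_assoc, hb] at hx
      rw [← mul_assoc, ih.1 _ _ hx, ihc hx, mul_assoc]
    | step p hp h hx ihc =>
      intro hx'
      rw [hg] at hx
      rw [← mul_assoc] at hx' ⊢
      rw [ih.2 _ p hp hx hx', ihc hx, mul_assoc]
  have hgd : descent geo h0 g = descent geo h0 (g * S0.disc p0) * (S.disc p0)⁻¹ := by
    have hpos : 0 < ht g := by omega
    obtain ⟨hq, hqs, -⟩ := (geo g hpos).choose_spec
    rw [descent, dif_pos hpos]
    rw [key _ _ (hc _ hq hqs.le) (hg ▸ hqs), mul_inv_cancel_right]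
  rw [hgd]
  exact key _ _ (hc p hp (by omega)) hs

theorem compatBelow (geo : Geo S0 S ht J) (hb : ∀ g b, ht (g * S0.bel b) = ht g)
    (h0 : ∀ g, ht g = 0 → ∃ b, g = S0.bel b) (h1 : ht 1 = 0) (hinj : Function.Injective S0.bel)
    (hd : ∀ p : (ℤ × ℤ) × DiscIx, p.2.j < J → 0 < ht (S0.disc p)) (m : ℕ) :
    CompatBelow geo h0 m := by
  induction m with
  | zero => exact ⟨fun _ _ h => absurd h (by omega), fun _ _ _ h => absurd h (by omega)⟩
  | succ m ih =>
    rcases Nat.eq_zero_or_pos m with rfl | hm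
    · have hB : ∀ g b, ht g < 0 + 1 →
          descent geo h0 (g * S0.bel b) = descent geo h0 g * S.bel b := by
        intro g b hg
        obtain ⟨c, rfl⟩ := h0 g (by omega)
        rw [Sys.bel_mul, descent_bel geo hb h0 h1 hinj, descent_bel geo hb h0 h1 hinj,
          Sys.bel_mul]
      refine ⟨hB, fun g p hp hg hgp => ?_⟩
      obtain ⟨c, rfl⟩ := h0 g (by omega)
      rw [Sys.bel_disc, hb] at hgp
      exact absurd (hd (c.1 + flipBy c.2.1 p.1, ⟨xor c.2.1 p.2.s, p.2.j, p.2.e⟩) hp) (by omega)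
    · have A : ∀ g, ht g = m → ∀ p : (ℤ × ℤ) × DiscIx, p.2.j < J → ht (g * S0.disc p) < m →
          descent geo h0 (g * S0.disc p) = descent geo h0 g * S.disc p :=
        fun g hg p hp hs => descent_strict geo hb h0 ih hg hm p hp hs
      have hB : ∀ g b, ht g < m + 1 →
          descent geo h0 (g * S0.bel b) = descent geo h0 g * S.bel b := by
        intro g b hg
        rcases Nat.lt_succ_iff_lt_or_eq.1 hg with hlt | heq
        · exact ih.1 g b hlt
        · have hgb : ht (g * S0.bel b) = m := by rw [hb, heq]
          obtain ⟨p, hp, hs, -⟩ := geo (g * S0.bel b) (by omega)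
          rw [hgb] at hs
          have e1 := A _ hgb p hp hs
          have e0 := S0.bel_disc b p
          have e2 := S.bel_disc b p
          rw [mul_assoc, e0, ← mul_assoc, hb] at hs
          have e3 := A g heq (b.1 + flipBy b.2.1 p.1, ⟨xor b.2.1 p.2.s, p.2.j, p.2.e⟩) hp hs
          rw [mul_assoc, e0, ← mul_assoc, ih.1 _ _ hs, e3, mul_assoc, ← e2, ← mul_assoc] at e1
          exact (mul_right_cancel e1).symm
      have C : ∀ g (p : (ℤ × ℤ) × DiscIx), p.2.j < J → ht g < m → ht (g * S0.disc p) < m + 1 →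
          descent geo h0 (g * S0.disc p) = descent geo h0 g * S.disc p := by
        intro g p hp hg hgp
        rcases Nat.lt_succ_iff_lt_or_eq.1 hgp with hlt | heq
        · exact ih.2 g p hp hg hlt
        · have e0 := S0.disc_inv p
          have e1 : g * S0.disc p * S0.disc (0, ⟨false, p.2.j, !p.2.e⟩) *
              S0.bel (flipBy p.2.s (-p.1), p.2.s, false) = g := by
            rw [mul_assoc, mul_assoc, e0, mul_one]
          have hs : ht (g * S0.disc p * S0.disc (0, ⟨false, p.2.j, !p.2.e⟩)) < m := by
            rw [← hb _ (flipBy p.2.s (-p.1), p.2.s, false), e1]; exact hg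
          have e2 := A _ heq (0, ⟨false, p.2.j, !p.2.e⟩) hp hs
          have e3 := ih.1 _ (flipBy p.2.s (-p.1), p.2.s, false) hs
          rw [e1, e2, mul_assoc] at e3
          rw [e3, mul_assoc, eq_inv_of_mul_eq_one_right (S.disc_inv p), inv_mul_cancel, mul_one]
      refine ⟨hB, fun g p hp hg hgp => ?_⟩
      rcases Nat.lt_succ_iff_lt_or_eq.1 hg with hlt | heq
      · exact C g p hp hlt hgp
      · obtain ⟨p0, hp0, hs0, hc⟩ := geo g (by omega)
        have key : ∀ x y, Conn S0 S ht J g p0 x y → ht (g * x) < m + 1 →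
            descent geo h0 (g * x) = descent geo h0 g * y := by
          intro x y h
          induction h with
          | base => intro _; exact A g heq p0 hp0 (heq ▸ hs0)
          | bmul b h ihc =>
            intro hx
            rw [← mul_assoc, hb] at hx
            rw [← mul_assoc, hB _ _ hx, ihc hx, mul_assoc]
          | step p hp h hx ihc =>
            intro hx'
            rw [heq] at hx
            rw [← mul_assoc] at hx' ⊢
            rw [C _ p hp hx hx', ihc (by omega), mul_assoc]
        exact key _ _ (hc p hp (by omega)) hgp

/-- Generators satisfying the geometric relations extend to a homomorphism. -/
theorem exists_extension (geo : Geo S0 S ht J) (hb : ∀ g b, ht (g * S0.bel b) = ht g)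
    (h0 : ∀ g, ht g = 0 → ∃ b, g = S0.bel b) (h1 : ht 1 = 0) (hinj : Function.Injective S0.bel)
    (hd : ∀ p : (ℤ × ℤ) × DiscIx, p.2.j < J → 0 < ht (S0.disc p)) :
    ∃ σ : G →* E, (∀ b, σ (S0.bel b) = S.bel b) ∧
      ∀ p : (ℤ × ℤ) × DiscIx, p.2.j < J → σ (S0.disc p) = S.disc p := by
  have hB : ∀ g b, descent geo h0 (g * S0.bel b) = descent geo h0 g * S.bel b := fun g b =>
    (compatBelow geo hb h0 h1 hinj hd (ht g + 1)).1 g b (by omega)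
  have hD : ∀ g (p : (ℤ × ℤ) × DiscIx), p.2.j < J →
      descent geo h0 (g * S0.disc p) = descent geo h0 g * S.disc p := fun g p hp =>
    (compatBelow geo hb h0 h1 hinj hd (ht g + ht (g * S0.disc p) + 1)).2 g p hp
      (by omega) (by omega)
  have hone : descent geo h0 1 = 1 := by
    rw [← S0.bel_zero, descent_bel geo hb h0 h1 hinj, S.bel_zero]
  have hmul : ∀ n x, ht x = n → ∀ g,
      descent geo h0 (g * x) = descent geo h0 g * descent geo h0 x := by
    intro n
    induction n using Nat.strong_induction_on with
    | _ n ih =>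
      intro x hx g
      rcases Nat.eq_zero_or_pos n with rfl | hn
      · obtain ⟨b, rfl⟩ := h0 x hx
        rw [hB, descent_bel geo hb h0 h1 hinj]
      · obtain ⟨p, hp, hs, -⟩ := geo x (by omega)
        have e := ih _ (hx ▸ hs) _ rfl g
        rw [← mul_assoc, hD _ _ hp, hD _ _ hp, ← mul_assoc] at e
        exact mul_right_cancel e
  refine ⟨⟨⟨descent geo h0, hone⟩, fun x y => hmul _ y rfl x⟩, fun b => ?_, fun p hp => ?_⟩
  · simpa using descent_bel geo hb h0 h1 hinj b
  · have := hD 1 p hp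
    rw [one_mul, hone, one_mul] at this
    exact this

end Extension

/-- The quadratic order `ℤ[ω]` with `ω² = ω - 41`. -/
abbrev Zw := QuadraticAlgebra ℤ (-41) 1

/-- The norm form of `ℤ[ω]`. -/
def nrm (z : Zw) : ℤ := z.re ^ 2 + z.re * z.im + 41 * z.im ^ 2

theorem nrm_mul (a b : Zw) : nrm (a * b) = nrm a * nrm b := by
  simp only [nrm, QuadraticAlgebra.re_mul, QuadraticAlgebra.im_mul]
  ring

theorem nrm_nonneg (a : Zw) : 0 ≤ nrm a := by
  unfold nrm
  nlinarith [sq_nonneg (2 * a.re + a.im), sq_nonneg a.im]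

theorem nrm_eq_zero {a : Zw} : nrm a = 0 ↔ a = 0 := by
  constructor
  · intro h
    unfold nrm at h
    have h1 : a.im ^ 2 ≤ 0 := by nlinarith [sq_nonneg (2 * a.re + a.im), sq_nonneg a.im]
    have h2 : a.im = 0 := by nlinarith
    have h3 : a.re = 0 := by rw [h2] at h; nlinarith
    exact QuadraticAlgebra.ext h3 h2
  · rintro rfl; simp [nrm]

theorem nrm_one : nrm 1 = 1 := by simp [nrm, QuadraticAlgebra.re_one, QuadraticAlgebra.im_one]

theorem eq_one_or_of_nrm {a : Zw} (h : nrm a = 1) : a = 1 ∨ a = -1 := by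
  unfold nrm at h
  have h2 : a.im = 0 := by
    have : a.im ^ 2 < 1 := by nlinarith [sq_nonneg (2 * a.re + a.im), sq_nonneg a.im]
    nlinarith
  rw [h2] at h
  have h3 : (a.re - 1) * (a.re + 1) = 0 := by linarith
  rcases mul_eq_zero.1 h3 with h3 | h3
  · left; apply QuadraticAlgebra.ext <;> simp only [QuadraticAlgebra.re_one, QuadraticAlgebra.im_one] <;> omega
  · right
    apply QuadraticAlgebra.ext <;>
      simp only [QuadraticAlgebra.re_neg, QuadraticAlgebra.im_neg, QuadraticAlgebra.re_one, QuadraticAlgebra.im_one] <;> omega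

theorem eq_one_or_of_isUnit {a : Zw} (h : IsUnit a) : a = 1 ∨ a = -1 := by
  obtain ⟨b, hb⟩ := h.exists_right_inv
  apply eq_one_or_of_nrm
  have := congrArg nrm hb
  rw [nrm_mul, nrm_one] at this
  exact Int.eq_one_of_mul_eq_one_right (nrm_nonneg a) this

/-- Elements of `ℤ[ω]` in coordinates. -/
abbrev RawZ := ℤ × ℤ

namespace RawZ

def add (a b : RawZ) : RawZ := (a.1 + b.1, a.2 + b.2)

def neg (a : RawZ) : RawZ := (-a.1, -a.2)

def mul (a b : RawZ) : RawZ :=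
  (a.1 * b.1 - 41 * (a.2 * b.2), a.1 * b.2 + a.2 * b.1 + a.2 * b.2)

def toZ (a : RawZ) : Zw := ⟨a.1, a.2⟩

theorem toZ_add (a b : RawZ) : toZ (add a b) = toZ a + toZ b := by
  ext <;> simp [toZ, add]

theorem toZ_neg (a : RawZ) : toZ (neg a) = -toZ a := by
  ext <;> simp [toZ, neg]

theorem toZ_mul (a b : RawZ) : toZ (mul a b) = toZ a * toZ b := by
  ext <;> simp [toZ, mul]
  ring

end RawZ

/-- Two by two matrices over `ℤ[ω]` in coordinates. -/
structure RawM where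
  a : RawZ
  b : RawZ
  c : RawZ
  d : RawZ

namespace RawM

open RawZ

def mul (x y : RawM) : RawM :=
  ⟨(x.a.mul y.a).add (x.b.mul y.c), (x.a.mul y.b).add (x.b.mul y.d),
    (x.c.mul y.a).add (x.d.mul y.c), (x.c.mul y.b).add (x.d.mul y.d)⟩

def det (x : RawM) : RawZ := (x.a.mul x.d).add (x.b.mul x.c).neg

def adj (x : RawM) : RawM := ⟨x.d, x.b.neg, x.c.neg, x.a⟩

def one : RawM := ⟨(1, 0), (0, 0), (0, 0), (1, 0)⟩

def toMat (x : RawM) : Matrix (Fin 2) (Fin 2) Zw := !![toZ x.a, toZ x.b; toZ x.c, toZ x.d]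

theorem toMat_mul (x y : RawM) : toMat (x.mul y) = toMat x * toMat y := by
  simp [toMat, mul, toZ_add, toZ_mul]

theorem toMat_one : toMat one = 1 := by
  rw [Matrix.one_fin_two]; rfl

theorem det_toMat (x : RawM) : (toMat x).det = toZ x.det := by
  simp [toMat, det, Matrix.det_fin_two, toZ_add, toZ_neg, toZ_mul, sub_eq_add_neg]

theorem toMat_adj (x : RawM) : toMat x.adj = (toMat x).adjugate := by
  simp [toMat, adj, Matrix.adjugate_fin_two, toZ_neg]

/-- The invertible matrix with the given coordinates, or `1`. -/
noncomputable def toGL (x : RawM) : GL (Fin 2) Zw :=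
  open Classical in
  if h : IsUnit (toMat x).det then Matrix.GeneralLinearGroup.mk'' _ h else 1

theorem toGL_val {x : RawM} (h : x.det = (1, 0) ∨ x.det = (-1, 0)) :
    (toGL x : Matrix (Fin 2) (Fin 2) Zw) = toMat x := by
  have : IsUnit (toMat x).det := by
    rw [det_toMat]
    rcases h with h | h <;> rw [h]
    · exact isUnit_one
    · rw [show toZ (-1, 0) = -1 by ext <;> simp [RawZ.toZ, QuadraticAlgebra.re_one, QuadraticAlgebra.im_one]]; exact isUnit_one.neg
  rw [toGL, dif_pos this]
  rfl

/-- `x` lists the coordinates of `g`. -/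
def Is (g : GL (Fin 2) Zw) (x : RawM) : Prop := (g : Matrix (Fin 2) (Fin 2) Zw) = toMat x

theorem Is.mul {g h : GL (Fin 2) Zw} {x y : RawM} (hg : Is g x) (hh : Is h y) :
    Is (g * h) (x.mul y) := by
  rw [Is, Units.val_mul, hg, hh, toMat_mul]

theorem Is.inv {g : GL (Fin 2) Zw} {x : RawM} (hg : Is g x) (h : x.det = (1, 0)) :
    Is g⁻¹ x.adj := by
  have h1 : toMat x * toMat x.adj = 1 := by
    rw [toMat_adj, Matrix.mul_adjugate, det_toMat, h]
    exact one_smul _ _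
  have h2 : (g : Matrix (Fin 2) (Fin 2) Zw) * ((g⁻¹ : GL (Fin 2) Zw) : Matrix _ _ Zw) = 1 := by
    rw [← Units.val_mul]; simp
  rw [← hg] at h1
  have := congrArg (((g⁻¹ : GL (Fin 2) Zw) : Matrix _ _ Zw) * ·) (h2.trans h1.symm)
  rwa [← mul_assoc, ← mul_assoc, ← Units.val_mul, inv_mul_cancel, Units.val_one, one_mul,
    one_mul] at this

theorem Is.one : Is 1 RawM.one := toMat_one.symm

theorem Is.ext {g h : GL (Fin 2) Zw} {x : RawM} (hg : Is g x) (hh : Is h x) : g = h :=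
  Units.ext (hg.trans hh.symm)

end RawM

/-- The letters generating `GL₂` over the translations and the reflection. -/
def rawLetters : List RawM :=
  [⟨(0, 0), (-1, 0), (1, 0), (0, 0)⟩,
   ⟨(-1, -1), (-21, 1), (2, 0), (0, -1)⟩,
   ⟨(-1, -1), (13, -1), (3, 0), (1, 1)⟩,
   ⟨(-1, 1), (-14, 0), (3, 0), (0, 1)⟩,
   ⟨(-2, -1), (-10, 1), (4, 0), (-1, -1)⟩,
   ⟨(-1, 1), (10, 0), (4, 0), (0, -1)⟩,
   ⟨(-2, -2), (17, 0), (5, 0), (-2, 1)⟩,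
   ⟨(-2, -1), (-17, 1), (5, 0), (1, -2)⟩,
   ⟨(-2, 2), (-33, 0), (5, 0), (0, 2)⟩,
   ⟨(-1, -2), (16, -1), (5, 0), (1, 1)⟩,
   ⟨(-1, 1), (8, 0), (5, 0), (0, -1)⟩,
   ⟨(-3, -1), (-6, 1), (6, 0), (-2, -1)⟩,
   ⟨(-2, 1), (7, 0), (6, 0), (-1, -1)⟩,
   ⟨(-1, 1), (-7, 0), (6, 0), (0, 1)⟩,
   ⟨(-17, 0), (0, 5), (-1, 1), (12, 0)⟩,
   ⟨(-17, 0), (-5, 5), (0, 1), (12, 0)⟩,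
   ⟨(-18, 0), (-5, -5), (-2, 1), (-12, 0)⟩,
   ⟨(-17, 1), (-19, -4), (1, 1), (-11, 1)⟩,
   ⟨(-17, -1), (-1, 3), (-3, 1), (7, 0)⟩,
   ⟨(-15, -1), (-18, 4), (-3, 1), (10, 1)⟩,
   ⟨(-18, 1), (-2, 3), (2, 1), (7, 0)⟩,
   ⟨(-16, 1), (14, 4), (2, 1), (11, -1)⟩,
   ⟨(-3, -1), (12, -1), (7, 0), (-1, 2)⟩,
   ⟨(-3, 2), (-24, 0), (7, 0), (1, 2)⟩,
   ⟨(-2, -3), (52, -3), (7, 0), (2, 3)⟩,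
   ⟨(-16, -1), (-1, -3), (-4, 1), (-8, 0)⟩,
   ⟨(-14, 2), (-18, -1), (3, 1), (-5, 1)⟩]

/-- The letter with a given index. -/
def rawLetter (j : ℕ) : RawM := rawLetters.getD j RawM.one

theorem det_rawLetter (j : ℕ) : (rawLetter j).det = (1, 0) := by
  have h : ∀ x ∈ rawLetters, x.det = (1, 0) := by decide
  rw [rawLetter, List.getD_eq_getElem?_getD]
  rcases hj : rawLetters[j]? with _ | x
  · rfl
  · exact h x (List.mem_of_getElem? hj)

theorem c_rawLetter {j : ℕ} (hj : j < 27) : (rawLetter j).c ≠ (0, 0) := by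
  revert j
  decide

/-- The translation by `b`. -/
def rawT (b : RawZ) : RawM := ⟨(1, 0), b, (0, 0), (1, 0)⟩

/-- The reflection or the identity. -/
def rawD (s : Bool) : RawM := if s then ⟨(1, 0), (0, 0), (0, 0), (-1, 0)⟩ else RawM.one

/-- The matrix `-1` or the identity. -/
def rawN (s : Bool) : RawM := if s then ⟨(-1, 0), (0, 0), (0, 0), (-1, 0)⟩ else RawM.one

/-- A letter or its inverse. -/
def rawL (j : ℕ) (e : Bool) : RawM := if e then (rawLetter j).adj else rawLetter j

/-- The coordinates of `Sys.g`. -/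
def rawG (k : DiscIx) : RawM := (rawD k.s).mul (rawL k.j k.e)

/-- The coordinates of `Sys.disc`. -/
def rawDisc (p : (ℤ × ℤ) × DiscIx) : RawM := (rawT p.1).mul (rawG p.2)

/-- The coordinates of `Sys.bel`. -/
def rawBel (b : (ℤ × ℤ) × Bool × Bool) : RawM := ((rawT b.1).mul (rawD b.2.1)).mul (rawN b.2.2)

theorem is_toGL {x : RawM} (h : x.det = (1, 0) ∨ x.det = (-1, 0)) : RawM.Is x.toGL x :=
  RawM.toGL_val h

theorem RawM.Is.of_eq {g : GL (Fin 2) Zw} {x y : RawM} (h : Is g x) (e : x = y) : Is g y := e ▸ h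

theorem is_rawT (b : RawZ) : RawM.Is (rawT b).toGL (rawT b) :=
  is_toGL (Or.inl (by simp [rawT, RawM.det, RawZ.add, RawZ.mul, RawZ.neg]))

theorem is_rawD (s : Bool) : RawM.Is (rawD s).toGL (rawD s) :=
  is_toGL (by cases s <;> decide)

theorem is_rawN (s : Bool) : RawM.Is (rawN s).toGL (rawN s) :=
  is_toGL (by cases s <;> decide)

theorem rawT_mul (b c : RawZ) : (rawT b).mul (rawT c) = rawT (b + c) := by
  simp [rawT, RawM.mul, RawZ.add, RawZ.mul, Prod.ext_iff, add_comm]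

theorem toGL_rawT_add (b c : RawZ) : (rawT (b + c)).toGL = (rawT b).toGL * (rawT c).toGL :=
  (is_rawT _).ext (((is_rawT b).mul (is_rawT c)).of_eq (rawT_mul b c))

theorem toGL_rawT_zero : (rawT 0).toGL = 1 := (is_rawT 0).ext RawM.Is.one

theorem toGL_rawT_neg (b : RawZ) : (rawT (-b)).toGL = (rawT b).toGL⁻¹ := by
  rw [eq_inv_iff_mul_eq_one, ← toGL_rawT_add, neg_add_cancel, toGL_rawT_zero]

theorem rawN_comm (g : GL (Fin 2) Zw) : Commute (rawN true).toGL g := by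
  have h : RawM.toMat (rawN true) = -1 := by
    rw [Matrix.one_fin_two]
    refine Matrix.ext fun i j => ?_
    fin_cases i <;> fin_cases j <;> rfl
  refine Units.ext ?_
  rw [Units.val_mul, Units.val_mul, is_rawN true, h]
  simp

/-- The standard generators of `GL₂(ℤ[ω])`. -/
noncomputable def stdSys : Sys (GL (Fin 2) Zw) where
  t1 := (rawT (1, 0)).toGL
  t2 := (rawT (0, 1)).toGL
  d := (rawD true).toGL
  z := (rawN true).toGL
  a j := (rawLetter j).toGL
  comm := (((is_rawT _).mul (is_rawT _)).ext ((is_rawT _).mul (is_rawT _)))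
  dd := ((is_rawD _).mul (is_rawD _)).ext RawM.Is.one
  dt1 := by
    rw [← toGL_rawT_neg]
    exact ((is_rawD _).mul (is_rawT _)).ext ((is_rawT _).mul (is_rawD _))
  dt2 := by
    rw [← toGL_rawT_neg]
    exact ((is_rawD _).mul (is_rawT _)).ext ((is_rawT _).mul (is_rawD _))
  zz := ((is_rawN _).mul (is_rawN _)).ext RawM.Is.one
  zt1 := rawN_comm _
  zt2 := rawN_comm _
  zd := rawN_comm _
  za _ := rawN_comm _

theorem std_tr (b : ℤ × ℤ) : stdSys.tr b = (rawT b).toGL := by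
  let φ : Multiplicative (ℤ × ℤ) →* GL (Fin 2) Zw :=
    ⟨⟨fun b => (rawT b.toAdd).toGL, toGL_rawT_zero⟩, fun b c => toGL_rawT_add b.toAdd c.toAdd⟩
  have h1 : φ (Multiplicative.ofAdd ((1, 0) : ℤ × ℤ)) = stdSys.t1 := rfl
  have h2 : φ (Multiplicative.ofAdd ((0, 1) : ℤ × ℤ)) = stdSys.t2 := rfl
  have h3 : Multiplicative.ofAdd ((1, 0) : ℤ × ℤ) ^ b.1 * Multiplicative.ofAdd ((0, 1) : ℤ × ℤ) ^ b.2
      = Multiplicative.ofAdd b := by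
    rw [← ofAdd_zsmul, ← ofAdd_zsmul, ← ofAdd_add]
    simp
  rw [Sys.tr, ← h1, ← h2, ← map_zpow φ, ← map_zpow φ, ← map_mul φ, h3]
  rfl

theorem std_dp (s : Bool) : stdSys.dp s = (rawD s).toGL := by
  cases s
  · exact RawM.Is.one.ext (is_rawD false)
  · rfl

theorem std_zp (s : Bool) : stdSys.zp s = (rawN s).toGL := by
  cases s
  · exact RawM.Is.one.ext (is_rawN false)
  · rfl

theorem is_letter (j : ℕ) (e : Bool) : RawM.Is (stdSys.letter j e) (rawL j e) := by
  cases e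
  · exact is_toGL (Or.inl (det_rawLetter j))
  · exact (is_toGL (Or.inl (det_rawLetter j))).inv (det_rawLetter j)

theorem is_g (k : DiscIx) : RawM.Is (stdSys.g k) (rawG k) :=
  ((std_dp k.s ▸ is_rawD k.s : RawM.Is (stdSys.dp k.s) _)).mul (is_letter _ _)

theorem is_disc (p : (ℤ × ℤ) × DiscIx) : RawM.Is (stdSys.disc p) (rawDisc p) :=
  ((std_tr p.1 ▸ is_rawT p.1 : RawM.Is (stdSys.tr p.1) _)).mul (is_g _)

theorem is_bel (b : (ℤ × ℤ) × Bool × Bool) : RawM.Is (stdSys.bel b) (rawBel b) :=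
  (((std_tr b.1 ▸ is_rawT b.1 : RawM.Is (stdSys.tr b.1) _)).mul
    ((std_dp b.2.1 ▸ is_rawD b.2.1 : RawM.Is (stdSys.dp b.2.1) _))).mul
    ((std_zp b.2.2 ▸ is_rawN b.2.2 : RawM.Is (stdSys.zp b.2.2) _))

/-- The sign encoded by a Boolean. -/
def bsign (s : Bool) : ℤ := if s then -1 else 1

theorem rawBel_eq (b : (ℤ × ℤ) × Bool × Bool) : rawBel b =
    ⟨(bsign b.2.2, 0), (b.1.1 * (bsign b.2.1 * bsign b.2.2), b.1.2 * (bsign b.2.1 * bsign b.2.2)),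
      (0, 0), (bsign b.2.1 * bsign b.2.2, 0)⟩ := by
  obtain ⟨b, s, e⟩ := b
  cases s <;> cases e <;> simp [rawBel, rawT, rawD, rawN, RawM.mul, RawM.one, RawZ.add, RawZ.mul,
    bsign]

/-- The height of a matrix: the norm of its lower left entry. -/
def ht (g : GL (Fin 2) Zw) : ℕ := (nrm ((g : Matrix (Fin 2) (Fin 2) Zw) 1 0)).toNat

theorem ht_cast (g : GL (Fin 2) Zw) :
    (ht g : ℤ) = nrm ((g : Matrix (Fin 2) (Fin 2) Zw) 1 0) :=
  Int.toNat_of_nonneg (nrm_nonneg _)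

theorem mul_one_zero (g : GL (Fin 2) Zw) {h : GL (Fin 2) Zw} {x : RawM} (hx : RawM.Is h x) :
    ((g * h : GL (Fin 2) Zw) : Matrix (Fin 2) (Fin 2) Zw) 1 0 =
      (g : Matrix (Fin 2) (Fin 2) Zw) 1 0 * x.a.toZ +
        (g : Matrix (Fin 2) (Fin 2) Zw) 1 1 * x.c.toZ := by
  rw [Units.val_mul, hx, Matrix.mul_apply, Fin.sum_univ_two]
  rfl

theorem mul_one_one (g : GL (Fin 2) Zw) {h : GL (Fin 2) Zw} {x : RawM} (hx : RawM.Is h x) :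
    ((g * h : GL (Fin 2) Zw) : Matrix (Fin 2) (Fin 2) Zw) 1 1 =
      (g : Matrix (Fin 2) (Fin 2) Zw) 1 0 * x.b.toZ +
        (g : Matrix (Fin 2) (Fin 2) Zw) 1 1 * x.d.toZ := by
  rw [Units.val_mul, hx, Matrix.mul_apply, Fin.sum_univ_two]
  rfl

theorem toZ_zero : RawZ.toZ (0, 0) = 0 := rfl

theorem nrm_bsign (s : Bool) : nrm (RawZ.toZ (bsign s, 0)) = 1 := by
  cases s <;> rfl

theorem ht_mul_bel (g : GL (Fin 2) Zw) (b : (ℤ × ℤ) × Bool × Bool) :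
    ht (g * stdSys.bel b) = ht g := by
  unfold ht
  rw [mul_one_zero g (is_bel b), rawBel_eq]
  simp only [toZ_zero, mul_zero, add_zero, nrm_mul, nrm_bsign, mul_one]

theorem ht_one : ht 1 = 0 := by simp [ht, nrm]

theorem exists_bel_of_ht {g : GL (Fin 2) Zw} (h : ht g = 0) : ∃ b, g = stdSys.bel b := by
  have hc : (g : Matrix (Fin 2) (Fin 2) Zw) 1 0 = 0 := by
    rw [← nrm_eq_zero, ← ht_cast, h]; rfl
  have hu : IsUnit (g : Matrix (Fin 2) (Fin 2) Zw).det :=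
    (Matrix.isUnit_iff_isUnit_det _).1 g.isUnit
  rw [Matrix.det_fin_two, hc, mul_zero, sub_zero] at hu
  have key : ∀ a : Zw, IsUnit a → ∃ s, a = RawZ.toZ (bsign s, 0) := by
    intro a ha
    rcases eq_one_or_of_isUnit ha with rfl | rfl
    · exact ⟨false, rfl⟩
    · exact ⟨true, by ext <;> simp [RawZ.toZ, bsign, QuadraticAlgebra.re_one,
        QuadraticAlgebra.im_one]⟩
  obtain ⟨e, he⟩ := key _ (isUnit_of_mul_isUnit_left hu)
  obtain ⟨s, hs⟩ := key _ (isUnit_of_mul_isUnit_right hu)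
  set B : Zw := (g : Matrix (Fin 2) (Fin 2) Zw) 0 1 with hB
  refine ⟨((B.re * bsign s, B.im * bsign s), xor s e, e), ?_⟩
  refine Units.ext ?_
  rw [is_bel, rawBel_eq]
  have e1 : bsign (xor s e) * bsign e = bsign s := by cases s <;> cases e <;> rfl
  have e2 : bsign s * bsign s = 1 := by cases s <;> rfl
  simp only [e1, mul_assoc, e2, mul_one, RawM.toMat]
  rw [← hs, ← he]
  refine Matrix.ext fun i j => ?_
  fin_cases i <;> fin_cases j
  · rfl
  · exact hB.symm
  · exact hc
  · rfl

theorem bel_injective : Function.Injective stdSys.bel := by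
  rintro ⟨⟨x, y⟩, s, e⟩ ⟨⟨x', y'⟩, s', e'⟩ h
  have h1 : (rawBel ((x, y), s, e)).toMat = (rawBel ((x', y'), s', e')).toMat := by
    rw [← is_bel, ← is_bel, h]
  rw [rawBel_eq, rawBel_eq] at h1
  have ha := congrArg QuadraticAlgebra.re (congrFun (congrFun h1 0) 0)
  have hb1 := congrArg QuadraticAlgebra.re (congrFun (congrFun h1 0) 1)
  have hb2 := congrArg QuadraticAlgebra.im (congrFun (congrFun h1 0) 1)
  have hd := congrArg QuadraticAlgebra.re (congrFun (congrFun h1 1) 1)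
  cases s <;> cases e <;> cases s' <;> cases e' <;>
    simp_all [RawM.toMat, RawZ.toZ, bsign]

theorem ht_disc_pos (p : (ℤ × ℤ) × DiscIx) (hp : p.2.j < 27) : 0 < ht (stdSys.disc p) := by
  by_contra h0
  have h : ht (stdSys.disc p) = 0 := by omega
  have hc : RawZ.toZ (rawDisc p).c = 0 := by
    have h1 : (stdSys.disc p : Matrix (Fin 2) (Fin 2) Zw) 1 0 = 0 := by
      rw [← nrm_eq_zero, ← ht_cast, h]; rfl
    rw [is_disc] at h1
    exact h1
  obtain ⟨b, s, j, e⟩ := p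
  have hj := c_rawLetter hp
  have h1 := congrArg QuadraticAlgebra.re hc
  have h2 := congrArg QuadraticAlgebra.im hc
  apply hj
  cases s <;> cases e <;> simp [rawDisc, rawG, rawT, rawD, rawL, RawM.mul, RawM.one, RawM.adj,
    RawZ.add, RawZ.mul, RawZ.toZ, RawZ.neg] at h1 h2 <;> exact Prod.ext h1 h2

/-- Quadratic functions `a (x² + x y + 41 y²) + bx + cy + d` with `b, c, d` given as differences. -/
structure QF where
  a : ℕ
  bp : ℕ
  bm : ℕ
  cp : ℕ
  cm : ℕ
  dp : ℕ
  dm : ℕ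

namespace QF

def eval (f : QF) (x y : ℚ) : ℚ :=
  f.a * (x ^ 2 + x * y + 41 * y ^ 2) + (f.bp - f.bm) * x + (f.cp - f.cm) * y + (f.dp - f.dm)

/-- Negativity at an integral point. -/
def negAt (f : QF) (x y : ℕ) : Bool :=
  Nat.blt (Nat.add (Nat.mul f.a (Nat.add (Nat.mul x (Nat.add x y)) (Nat.mul 41 (Nat.mul y y))))
    (Nat.add (Nat.mul f.bp x) (Nat.add (Nat.mul f.cp y) f.dp)))
    (Nat.add (Nat.mul f.bm x) (Nat.add (Nat.mul f.cm y) f.dm))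

theorem negAt_sound {f : QF} {x y : ℕ} (h : f.negAt x y = true) : f.eval x y < 0 := by
  have h1 : f.a * (x * (x + y) + 41 * (y * y)) + (f.bp * x + (f.cp * y + f.dp)) <
      f.bm * x + (f.cm * y + f.dm) := by
    simpa [negAt, Nat.blt_eq] using h
  have h2 : ((f.a * (x * (x + y) + 41 * (y * y)) + (f.bp * x + (f.cp * y + f.dp)) : ℕ) : ℚ) <
      ((f.bm * x + (f.cm * y + f.dm) : ℕ) : ℚ) := by exact_mod_cast h1
  push_cast at h2
  unfold eval
  linarith

/-- Negativity at the corners of a box. -/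
def negBox (f : QF) (x0 x1 y0 y1 : ℕ) : Bool :=
  f.negAt x0 y0 && f.negAt x0 y1 && f.negAt x1 y0 && f.negAt x1 y1

theorem convex_neg {α β γ x0 x1 x : ℚ} (hα : 0 ≤ α) (h0 : α * x0 ^ 2 + β * x0 + γ < 0)
    (h1 : α * x1 ^ 2 + β * x1 + γ < 0) (hx0 : x0 ≤ x) (hx1 : x ≤ x1) :
    α * x ^ 2 + β * x + γ < 0 := by
  rcases eq_or_lt_of_le hx0 with rfl | hx0
  · exact h0
  have hd : 0 < x1 - x0 := by linarith
  by_contra hn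
  push Not at hn
  have e1 : (x1 - x) * (α * x0 ^ 2 + β * x0 + γ) ≤ 0 :=
    mul_nonpos_of_nonneg_of_nonpos (by linarith) h0.le
  have e2 : (x - x0) * (α * x1 ^ 2 + β * x1 + γ) < 0 := mul_neg_of_pos_of_neg (by linarith) h1
  have e3 : 0 ≤ α * ((x - x0) * (x1 - x) * (x1 - x0)) := by
    apply mul_nonneg hα
    apply mul_nonneg (mul_nonneg _ _) hd.le <;> linarith
  have e4 : 0 ≤ (x1 - x0) * (α * x ^ 2 + β * x + γ) := mul_nonneg hd.le hn
  have e5 : (x1 - x) * (α * x0 ^ 2 + β * x0 + γ) + (x - x0) * (α * x1 ^ 2 + β * x1 + γ)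
      = (x1 - x0) * (α * x ^ 2 + β * x + γ) + α * ((x - x0) * (x1 - x) * (x1 - x0)) := by ring
  linarith

theorem negBox_sound {f : QF} {x0 x1 y0 y1 : ℕ} (h : f.negBox x0 x1 y0 y1 = true) {x y : ℚ}
    (hx0 : x0 ≤ x) (hx1 : x ≤ x1) (hy0 : y0 ≤ y) (hy1 : y ≤ y1) : f.eval x y < 0 := by
  simp only [negBox, Bool.and_eq_true] at h
  obtain ⟨⟨⟨h00, h01⟩, h10⟩, h11⟩ := h
  have hy : ∀ t : ℕ, f.negAt t y0 = true → f.negAt t y1 = true → f.eval t y < 0 := by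
    intro t h0 h1
    have h0 := negAt_sound h0
    have h1 := negAt_sound h1
    have e : ∀ s : ℚ, f.eval t s = (f.a * 41) * s ^ 2 + (f.a * t + (f.cp - f.cm)) * s +
        (f.a * t ^ 2 + (f.bp - f.bm) * t + (f.dp - f.dm)) := by intro s; unfold eval; ring
    rw [e] at h0 h1 ⊢
    exact convex_neg (by positivity) h0 h1 hy0 hy1
  have h0 := hy x0 h00 h01
  have h1 := hy x1 h10 h11
  have e : ∀ s : ℚ, f.eval s y = f.a * s ^ 2 + (f.a * y + (f.bp - f.bm)) * s +
      (f.a * 41 * y ^ 2 + (f.cp - f.cm) * y + (f.dp - f.dm)) := by intro s; unfold eval; ring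
  rw [e] at h0 h1 ⊢
  exact convex_neg (by positivity) h0 h1 hx0 hx1

/-- Minus four times the tangent function at the centre of a box. -/
def disj (f : QF) (x0 x1 y0 y1 : ℕ) : QF :=
  let u := Nat.add x0 x1
  let v := Nat.add y0 y1
  ⟨0, Nat.mul 4 f.bm, Nat.add (Nat.mul 4 f.bp) (Nat.mul f.a (Nat.mul 2 (Nat.add (Nat.mul 2 u) v))),
    Nat.mul 4 f.cm, Nat.add (Nat.mul 4 f.cp) (Nat.mul f.a (Nat.mul 2 (Nat.add u (Nat.mul 82 v)))),
    Nat.add (Nat.mul 4 f.dm)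
      (Nat.mul f.a (Nat.add (Nat.mul u (Nat.add u v)) (Nat.mul 41 (Nat.mul v v)))),
    Nat.mul 4 f.dp⟩

theorem disj_sound (f : QF) (x0 x1 y0 y1 : ℕ) (x y : ℚ) :
    0 ≤ 4 * f.eval x y + (f.disj x0 x1 y0 y1).eval x y := by
  have e : 4 * f.eval x y + (f.disj x0 x1 y0 y1).eval x y =
      f.a * ((2 * x - (x0 + x1)) ^ 2 + (2 * x - (x0 + x1)) * (2 * y - (y0 + y1)) +
        41 * (2 * y - (y0 + y1)) ^ 2) := by
    simp only [eval, disj, Nat.add_eq, Nat.mul_eq]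
    push_cast
    ring
  rw [e]
  apply mul_nonneg (by positivity)
  nlinarith [sq_nonneg (2 * (2 * x - (x0 + x1)) + (2 * y - (y0 + y1))),
    sq_nonneg (2 * y - (y0 + y1))]

/-- The function `q.a * p - p.a * q`, which is affine. -/
def dom (p q : QF) : QF :=
  ⟨0, Nat.add (Nat.mul q.a p.bp) (Nat.mul p.a q.bm), Nat.add (Nat.mul q.a p.bm) (Nat.mul p.a q.bp),
    Nat.add (Nat.mul q.a p.cp) (Nat.mul p.a q.cm), Nat.add (Nat.mul q.a p.cm) (Nat.mul p.a q.cp),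
    Nat.add (Nat.mul q.a p.dp) (Nat.mul p.a q.dm), Nat.add (Nat.mul q.a p.dm) (Nat.mul p.a q.dp)⟩

theorem eval_dom (p q : QF) (x y : ℚ) :
    (p.dom q).eval x y = q.a * p.eval x y - p.a * q.eval x y := by
  simp only [eval, dom, Nat.add_eq, Nat.mul_eq]
  push_cast
  ring

/-- A test for `p` to be negative wherever `q` is nonpositive. -/
def lower (p q : QF) (x0 x1 y0 y1 : ℕ) : Bool :=
  p.negBox x0 x1 y0 y1 || (p.dom q).negBox x0 x1 y0 y1

theorem lower_sound {p q : QF} {x0 x1 y0 y1 : ℕ} (h : p.lower q x0 x1 y0 y1 = true) {x y : ℚ}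
    (hx0 : x0 ≤ x) (hx1 : x ≤ x1) (hy0 : y0 ≤ y) (hy1 : y ≤ y1) (hq : q.eval x y ≤ 0) :
    p.eval x y < 0 := by
  simp only [lower, Bool.or_eq_true] at h
  rcases h with h | h
  · exact negBox_sound h hx0 hx1 hy0 hy1
  · have := negBox_sound h hx0 hx1 hy0 hy1
    rw [eval_dom] at this
    by_contra hn
    push Not at hn
    have e1 : 0 ≤ (q.a : ℚ) * p.eval x y := by positivity
    have e2 : (p.a : ℚ) * q.eval x y ≤ 0 := mul_nonpos_of_nonneg_of_nonpos (by positivity) hq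
    linarith

/-- The function attached to a column `(m, l)`. -/
def ofCol (m l : RawZ) : QF :=
  let k : RawZ := ((l.1 + 2 * m.1) * 2048, (l.2 + 2 * m.2) * 2048)
  let n : RawZ := l.mul (k.1 + k.2, -k.2)
  let b := -(2 * n.1 + n.2)
  let c := 81 * n.2 - n.1
  let d := k.1 * k.1 + k.1 * k.2 + 41 * (k.2 * k.2) - 16777216
  ⟨(l.1 * l.1 + l.1 * l.2 + 41 * (l.2 * l.2)).toNat, b.toNat, (-b).toNat, c.toNat, (-c).toNat,
    d.toNat, (-d).toNat⟩

theorem toNat_sub_neg (b : ℤ) : ((b.toNat : ℚ) - ((-b).toNat : ℚ)) = b := by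
  have := Int.toNat_sub_toNat_neg b
  exact_mod_cast this

theorem a_ofCol (m l : RawZ) : ((ofCol m l).a : ℤ) = nrm l.toZ := by
  have h := nrm_nonneg l.toZ
  simp only [nrm, RawZ.toZ] at h ⊢
  simp only [ofCol]
  rw [Int.toNat_of_nonneg (by nlinarith)]
  ring

theorem eval_ofCol (m l : RawZ) (r s : ℚ) :
    (ofCol m l).eval (4096 * r + 2048) (4096 * s) = 16777216 *
      ((l.1 * r - 41 * l.2 * s - m.1) ^ 2 +
        (l.1 * r - 41 * l.2 * s - m.1) * (l.1 * s + l.2 * r + l.2 * s - m.2) +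
        41 * (l.1 * s + l.2 * r + l.2 * s - m.2) ^ 2 - 1) := by
  have h : ((ofCol m l).a : ℚ) = (l.1 : ℚ) ^ 2 + l.1 * l.2 + 41 * l.2 ^ 2 := by
    have := a_ofCol m l
    simp only [nrm, RawZ.toZ] at this
    exact_mod_cast this
  unfold eval
  rw [h]
  simp only [ofCol, toNat_sub_neg, RawZ.mul]
  push_cast
  ring

end QF

/-- Binary trees representing finite maps from natural numbers. -/
inductive BT (α : Type) where
  | nil : BT α
  | node : α → BT α → BT α → BT α

/-- Look-up in a binary tree. -/
def BT.get {α : Type} : BT α → ℕ → Option α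
  | .nil, _ => none
  | .node v l r, n =>
    match n with
    | 0 => some v
    | m + 1 => match Nat.beq (m % 2) 0 with
      | true => l.get (m / 2)
      | false => r.get (m / 2)

/-- All values of a tree satisfy a test. -/
def BT.all {α : Type} (P : α → Bool) : BT α → Bool
  | .nil => true
  | .node v l r => P v && (l.all P && r.all P)

theorem BT.all_get {α : Type} {P : α → Bool} {t : BT α} (h : t.all P = true) {n : ℕ} {v : α}
    (hv : t.get n = some v) : P v = true := by
  induction t generalizing n with
  | nil => cases hv
  | node w l r ihl ihr =>
    simp only [BT.all, Bool.and_eq_true] at h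
    cases n with
    | zero => cases hv; exact h.1
    | succ m =>
      simp only [BT.get] at hv
      split at hv
      · exact ihl h.2.1 hv
      · exact ihr h.2.2 hv

/-- The disc index with a given code. -/
def dix (k : ℕ) : DiscIx := ⟨Nat.beq (k % 2) 1, k / 4, Nat.beq (k / 2 % 2) 1⟩

/-- The disc with a given code. -/
def dec (c : ℕ) : (ℤ × ℤ) × DiscIx :=
  ((Int.ofNat (c / 128 % 16) - 8, Int.ofNat (c / 2048) - 8), dix (c % 128))

/-- The function attached to a disc. -/
def qfOf (c : ℕ) : QF := QF.ofCol (rawDisc (dec c)).a (rawDisc (dec c)).c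

/-- A relation expressing a product of discs through a single one. -/
structure Lk where
  k : ℕ
  w : List ((ℤ × ℤ) × ℕ)
  b : (ℤ × ℤ) × Bool × Bool

/-- The relation holds for given generators. -/
def Lk.Holds {E : Type*} [Group E] (S : Sys E) (r : Lk) : Prop :=
  (r.w.map fun p => S.disc (p.1, dix p.2)).prod = S.g (dix r.k) * S.bel r.b

/-- All letters of a relation exist. -/
def Lk.valid (r : Lk) : Bool := r.w.all fun p => Nat.blt p.2 108

/-- Look-up of a disc in a list. -/
def findQ (c : ℕ) : List (ℕ × QF) → Option QF
  | [] => none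
  | it :: l => match Nat.beq it.1 c with
    | true => some it.2
    | false => findQ c l

theorem findQ_mem {c : ℕ} {l : List (ℕ × QF)} {f : QF} (h : findQ c l = some f) : (c, f) ∈ l := by
  induction l with
  | nil => cases h
  | cons it l ih =>
    simp only [findQ] at h
    split at h
    · rename_i hb
      cases h
      rw [Nat.beq_eq] at hb
      subst hb
      simp
    · exact List.mem_cons_of_mem _ (ih h)

/-- All proper prefixes of a word lower heights on a box. -/
def midsOk (β : RawZ) (q : QF) (x0 x1 y0 y1 : ℕ) : RawM → List ((ℤ × ℤ) × ℕ) → Bool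
  | _, [] => true
  | M, p :: t => match t with
    | [] => true
    | _ :: _ =>
      let Mp := M.mul (rawDisc (p.1, dix p.2))
      (QF.ofCol (Mp.a.add (β.mul Mp.c)) Mp.c).lower q x0 x1 y0 y1 && midsOk β q x0 x1 y0 y1 Mp t

/-- The relation `r` connects the disc `q'` to the disc `q`. -/
def linkOk (x0 x1 y0 y1 : ℕ) (r : Lk) (q q' : ℕ) (f f' : QF) : Bool :=
  match r.w with
  | [] => false
  | p :: t => Nat.beq (q % 128) r.k && (Nat.beq (q' % 128) p.2 &&
      (decide ((dec q').1.1 = (dec q).1.1 + p.1.1) && (decide ((dec q').1.2 = (dec q).1.2 + p.1.2) &&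
      match t with
      | [] => true
      | _ :: _ => f'.lower f x0 x1 y0 y1 &&
          midsOk (dec q).1 f x0 x1 y0 y1 (rawDisc (p.1, dix p.2)) t)))

/-- The discs in the second list are connected to all discs in `L`. -/
def runLeaf (lk : BT Lk) (L : List (ℕ × QF)) (x0 x1 y0 y1 : ℕ) :
    List (ℕ × ℕ × ℕ) → List (ℕ × QF) → Bool
  | [], G => L.all fun it => (findQ it.1 G).isSome
  | (i, q, q') :: ds, G =>
    match lk.get i, findQ q L, findQ q' G with
    | some r, some f, some f' =>
      linkOk x0 x1 y0 y1 r q q' f f' && runLeaf lk L x0 x1 y0 y1 ds ((q, f) :: G)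
    | _, _, _ => false

/-- Discs which may lower heights on a box. -/
def near (x0 x1 y0 y1 : ℕ) : List (ℕ × QF) → List (ℕ × QF)
  | [] => []
  | it :: l => match (it.2.disj x0 x1 y0 y1).negBox x0 x1 y0 y1 with
    | true => near x0 x1 y0 y1 l
    | false => it :: near x0 x1 y0 y1 l

/-- Subdivisions of a box. -/
inductive Tr where
  | x : Tr → Tr → Tr
  | y : Tr → Tr → Tr
  | leaf : ℕ → List (ℕ × ℕ × ℕ) → Tr

/-- The connectedness test on a subdivided box. -/
def Tr.check (lk : BT Lk) : Tr → ℕ → ℕ → ℕ → ℕ → List (ℕ × QF) → Bool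
  | .x l r, x0, x1, y0, y1, L =>
    l.check lk x0 (Nat.div (Nat.add x0 x1) 2) y0 y1 (near x0 x1 y0 y1 L) &&
      r.check lk (Nat.div (Nat.add x0 x1) 2) x1 y0 y1 (near x0 x1 y0 y1 L)
  | .y l r, x0, x1, y0, y1, L =>
    l.check lk x0 x1 y0 (Nat.div (Nat.add y0 y1) 2) (near x0 x1 y0 y1 L) &&
      r.check lk x0 x1 (Nat.div (Nat.add y0 y1) 2) y1 (near x0 x1 y0 y1 L)
  | .leaf p ds, x0, x1, y0, y1, L =>
    match findQ p (near x0 x1 y0 y1 L) with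
    | none => false
    | some f => f.negBox x0 x1 y0 y1 &&
        runLeaf lk (near x0 x1 y0 y1 L) x0 x1 y0 y1 ds [(p, f)]

/-- The discs meeting the fundamental box. -/
def rootList : List (ℕ × QF) :=
  (List.range 1620).map fun i =>
    (i % 108 + 128 * (i / 108 % 5 + 6 + 16 * (i / 540 + 7)),
      qfOf (i % 108 + 128 * (i / 108 % 5 + 6 + 16 * (i / 540 + 7))))

/-- Relations between discs. -/
def links : BT Lk :=
  (.node ⟨0, [((1, 0), 0), ((1, 0), 0)], ((-1, 0), false, false)⟩
(.node ⟨0, [((-1, 0), 0), ((-1, 0), 0)], ((1, 0), false, true)⟩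
(.node ⟨40, [((0, 0), 48), ((0, 0), 42), ((0, 0), 48)], ((0, 0), false, true)⟩
(.node ⟨55, [((0, 0), 0), ((0, 0), 52), ((0, 0), 43)], ((0, 0), false, false)⟩
(.node ⟨50, [((0, 0), 74), ((0, 0), 80)], ((0, 0), false, false)⟩
(.node ⟨27, [((-1, 0), 45), ((0, 0), 107)], ((0, 0), true, true)⟩
(.node ⟨40, [((0, 0), 20), ((0, 0), 42), ((0, 0), 20)], ((0, 0), false, true)⟩
(.node ⟨91, [((0, 0), 62), ((0, 0), 80)], ((-1, 0), true, false)⟩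
(.node ⟨97, [((0, 0), 6), ((-1, -1), 97), ((0, -1), 6)], ((0, 0), false, true)⟩
.nil
.nil)
.nil)
(.node ⟨30, [((0, 0), 32), ((0, 0), 36)], ((0, 0), false, false)⟩
.nil
.nil))
(.node ⟨18, [((0, 0), 39), ((0, 0), 69)], ((0, 0), false, false)⟩
(.node ⟨100, [((0, 0), 15), ((0, 0), 91)], ((0, 0), false, true)⟩
.nil
.nil)
(.node ⟨37, [((0, 0), 35), ((0, 0), 30)], ((0, 0), false, false)⟩
.nil
.nil)))
(.node ⟨50, [((0, 0), 55), ((0, 0), 55)], ((0, 0), false, true)⟩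
(.node ⟨45, [((0, 0), 46), ((-1, 0), 49)], ((0, 0), false, false)⟩
(.node ⟨22, [((0, 0), 58), ((0, 0), 6), ((0, -1), 60)], ((0, 0), false, false)⟩
(.node ⟨4, [((-1, -1), 64), ((0, 0), 8), ((0, 0), 70)], ((0, 0), false, false)⟩
.nil
.nil)
.nil)
(.node ⟨60, [((0, 0), 80), ((-1, 0), 89)], ((0, 0), true, false)⟩
.nil
.nil))
(.node ⟨92, [((0, 0), 78), ((0, 0), 12)], ((0, 0), false, true)⟩
(.node ⟨15, [((0, 0), 9), ((-1, 0), 13)], ((0, 0), true, true)⟩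
.nil
.nil)
(.node ⟨68, [((0, 0), 35), ((0, 0), 76)], ((-1, 0), true, false)⟩
.nil
.nil))))
(.node ⟨82, [((-1, 0), 89), ((0, 0), 63)], ((0, 0), false, false)⟩
(.node ⟨0, [((0, 0), 52), ((0, 0), 43), ((0, 0), 52)], ((0, 0), true, true)⟩
(.node ⟨55, [((0, 0), 50), ((0, 0), 52)], ((0, 0), true, true)⟩
(.node ⟨15, [((0, 0), 91), ((0, 0), 106)], ((-1, 0), false, true)⟩
(.node ⟨32, [((-1, 0), 25), ((1, 0), 28)], ((0, 0), true, true)⟩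
.nil
.nil)
.nil)
(.node ⟨80, [((0, 0), 32), ((0, 0), 101)], ((-1, 0), true, false)⟩
.nil
.nil))
(.node ⟨67, [((0, 0), 18), ((-1, 0), 26)], ((0, 0), true, false)⟩
(.node ⟨9, [((0, 0), 95), ((0, 0), 20), ((0, 0), 95)], ((-1, 0), true, true)⟩
.nil
.nil)
(.node ⟨72, [((0, 0), 56), ((0, 0), 91)], ((0, 0), true, true)⟩
.nil
.nil)))
(.node ⟨52, [((0, 0), 40), ((0, 0), 55), ((0, 0), 0)], ((0, 0), true, true)⟩
(.node ⟨74, [((0, 0), 46), ((0, 0), 28)], ((0, 0), false, true)⟩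
(.node ⟨30, [((0, 0), 76), ((-1, 0), 17)], ((0, 0), true, false)⟩
(.node ⟨7, [((0, -1), 6)], ((-1, -1), true, true)⟩
.nil
.nil)
.nil)
(.node ⟨35, [((0, 0), 30), ((-1, 0), 26)], ((-1, 0), true, true)⟩
.nil
.nil))
(.node ⟨17, [((1, 0), 78), ((0, 0), 30)], ((0, 0), true, false)⟩
(.node ⟨37, [((0, 0), 100), ((0, 0), 44)], ((0, 0), true, true)⟩
.nil
.nil)
(.node ⟨68, [((0, 0), 37), ((0, 0), 19)], ((0, 0), false, false)⟩
.nil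
.nil)))))
(.node ⟨45, [((1, 0), 82), ((0, 0), 30)], ((0, 0), true, true)⟩
(.node ⟨107, [((0, 0), 89), ((0, 0), 14)], ((1, 0), false, true)⟩
(.node ⟨103, [((0, 0), 45), ((0, 0), 39)], ((0, 0), true, true)⟩
(.node ⟨42, [((0, 0), 22), ((0, 0), 40), ((0, 0), 22)], ((0, 0), false, true)⟩
(.node ⟨91, [((0, 0), 22), ((0, 0), 91), ((-1, 0), 0)], ((0, 0), false, false)⟩
(.node ⟨64, [((0, 0), 25), ((1, 0), 16)], ((0, 0), true, false)⟩
.nil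
.nil)
.nil)
(.node ⟨104, [((1, 0), 32), ((0, 0), 73)], ((0, 0), true, true)⟩
.nil
.nil))
(.node ⟨17, [((0, 0), 18), ((-1, 0), 21)], ((0, 0), false, false)⟩
(.node ⟨18, [((0, 0), 86), ((0, 0), 30)], ((0, 0), false, false)⟩
.nil
.nil)
(.node ⟨30, [((0, 0), 72), ((0, 0), 46)], ((0, 0), false, true)⟩
.nil
.nil)))
(.node ⟨20, [((0, 0), 27), ((0, 0), 96), ((0, 0), 36)], ((0, 0), true, false)⟩
(.node ⟨0, [((-1, 0), 89), ((0, 0), 21), ((0, 0), 91)], ((0, 0), true, true)⟩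
(.node ⟨32, [((0, 0), 12), ((0, 0), 59)], ((0, 0), true, true)⟩
(.node ⟨1, [((0, 0), 0)], ((0, 0), true, true)⟩
.nil
.nil)
.nil)
(.node ⟨32, [((0, 0), 80), ((-1, 0), 103)], ((0, 0), true, false)⟩
.nil
.nil))
(.node ⟨12, [((0, 0), 62), ((0, 0), 32)], ((0, 0), false, true)⟩
(.node ⟨12, [((-1, 0), 9), ((0, 0), 14)], ((0, 0), true, false)⟩
.nil
.nil)
(.node ⟨9, [((0, 0), 37), ((0, 0), 51), ((0, 0), 27)], ((0, 0), false, true)⟩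
.nil
.nil))))
(.node ⟨89, [((1, 0), 82), ((0, 0), 60)], ((0, 0), true, false)⟩
(.node ⟨52, [((0, 0), 55), ((0, 0), 48)], ((0, 0), true, true)⟩
(.node ⟨50, [((0, 0), 39), ((0, 0), 8), ((0, 0), 24)], ((0, 0), true, true)⟩
(.node ⟨62, [((0, 0), 91), ((-1, 0), 83)], ((0, 0), false, false)⟩
(.node ⟨25, [((0, 0), 97), ((0, 0), 36), ((0, 0), 23)], ((0, 0), true, false)⟩
.nil
.nil)
.nil)
(.node ⟨60, [((0, 1), 4), ((0, 0), 56), ((0, 0), 22)], ((0, 0), false, false)⟩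
.nil
.nil))
(.node ⟨86, [((0, 0), 18), ((0, 0), 28)], ((0, 0), false, false)⟩
(.node ⟨9, [((0, 0), 67), ((1, 1), 4), ((0, 0), 68)], ((0, 0), false, false)⟩
.nil
.nil)
(.node ⟨6, [((1, 1), 4), ((1, 1), 4)], ((-1, -1), false, true)⟩
.nil
.nil)))
(.node ⟨27, [((-1, 0), 17), ((0, 0), 67)], ((0, 0), true, false)⟩
(.node ⟨27, [((-1, 0), 29), ((0, 0), 35)], ((-1, 0), true, true)⟩
(.node ⟨9, [((0, 0), 15), ((0, 0), 15)], ((-1, 0), true, true)⟩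
(.node ⟨99, [((0, 0), 97)], ((0, 0), false, true)⟩
.nil
.nil)
.nil)
(.node ⟨15, [((0, 0), 35), ((0, 0), 60)], ((0, 0), false, true)⟩
.nil
.nil))
(.node ⟨9, [((1, 0), 12), ((0, 0), 13)], ((0, 0), false, false)⟩
(.node ⟨25, [((0, 0), 9), ((0, 0), 36), ((0, 0), 51)], ((0, 0), true, false)⟩
.nil
.nil)
(.node ⟨35, [((0, 0), 68), ((-1, 0), 79)], ((0, 0), false, false)⟩
.nil
.nil))))))
(.node ⟨46, [((0, 0), 50), ((-1, 0), 45)], ((0, 0), true, false)⟩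
(.node ⟨74, [((0, 0), 0), ((0, 0), 82), ((0, 1), 4)], ((0, 0), false, true)⟩
(.node ⟨103, [((1, 0), 82), ((0, 0), 32)], ((0, 0), true, false)⟩
(.node ⟨82, [((-1, 0), 45), ((0, 0), 29)], ((0, 0), false, true)⟩
(.node ⟨22, [((0, 0), 42), ((0, 0), 20), ((0, 0), 42)], ((0, 0), false, true)⟩
(.node ⟨15, [((0, 0), 12), ((0, 0), 8)], ((-1, 0), true, true)⟩
(.node ⟨37, [((0, 0), 25), ((0, 0), 41)], ((0, 0), true, false)⟩
.nil
.nil)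
.nil)
(.node ⟨76, [((0, 0), 32), ((0, 0), 69)], ((-1, 0), true, false)⟩
.nil
.nil))
(.node ⟨46, [((0, 0), 39), ((0, 0), 101)], ((0, 0), false, true)⟩
(.node ⟨58, [((0, 0), 95), ((-1, 0), 71)], ((0, 0), false, false)⟩
.nil
.nil)
(.node ⟨6, [((0, 0), 72), ((0, 0), 0), ((0, 0), 82)], ((0, -1), false, true)⟩
.nil
.nil)))
(.node ⟨40, [((0, 0), 42), ((0, 0), 42)], ((0, 0), false, false)⟩
(.node ⟨103, [((0, 0), 107), ((0, 0), 9)], ((0, 0), true, false)⟩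
(.node ⟨95, [((0, 0), 58), ((0, 0), 68)], ((-1, 0), true, false)⟩
(.node ⟨97, [((0, 0), 64), ((0, 0), 70)], ((0, 0), true, false)⟩
.nil
.nil)
.nil)
(.node ⟨6, [((0, 1), 4), ((0, 1), 4)], ((0, -1), false, false)⟩
.nil
.nil))
(.node ⟨62, [((0, 0), 92), ((0, 0), 66)], ((-1, 0), false, true)⟩
(.node ⟨95, [((0, 0), 67), ((1, 0), 60)], ((0, 0), false, true)⟩
.nil
.nil)
(.node ⟨15, [((0, 0), 100), ((0, 0), 88)], ((0, 0), true, true)⟩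
.nil
.nil))))
(.node ⟨46, [((0, 0), 45), ((0, 0), 50)], ((-1, 0), true, false)⟩
(.node ⟨55, [((0, 0), 52), ((0, 0), 51)], ((0, 0), false, true)⟩
(.node ⟨0, [((0, 0), 74), ((0, 0), 6), ((0, -1), 80)], ((0, 0), false, true)⟩
(.node ⟨22, [((0, 0), 91), ((0, 0), 0), ((1, 0), 88)], ((0, 0), true, true)⟩
(.node ⟨4, [((-1, -1), 97), ((0, -1), 6), ((0, 0), 96)], ((0, 0), true, false)⟩
.nil
.nil)
.nil)
(.node ⟨25, [((0, 0), 64), ((0, 0), 19)], ((1, 0), false, false)⟩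
.nil
.nil))
(.node ⟨17, [((0, 0), 29), ((0, 0), 84)], ((0, 0), false, false)⟩
(.node ⟨18, [((0, 0), 67), ((0, 0), 25)], ((-1, 0), false, false)⟩
.nil
.nil)
(.node ⟨35, [((0, 0), 56), ((0, 0), 15)], ((0, 0), false, true)⟩
.nil
.nil)))
(.node ⟨18, [((0, 0), 17), ((0, 0), 22)], ((-1, 0), true, false)⟩
(.node ⟨89, [((0, 0), 107), ((1, 0), 12)], ((0, 0), false, true)⟩
(.node ⟨104, [((1, 0), 12), ((0, 0), 90)], ((0, 0), false, true)⟩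
(.node ⟨11, [((0, 0), 9)], ((0, 0), false, true)⟩
.nil
.nil)
.nil)
(.node ⟨76, [((0, 0), 30), ((0, 0), 19)], ((-1, 0), true, false)⟩
.nil
.nil))
(.node ⟨20, [((0, 0), 62), ((0, 1), 4), ((0, 0), 56)], ((0, 0), false, false)⟩
(.node ⟨37, [((0, 0), 9), ((0, 0), 24), ((0, 0), 49)], ((0, 0), true, true)⟩
.nil
.nil)
(.node ⟨68, [((0, 0), 6), ((-1, -1), 64), ((0, 0), 8)], ((0, 0), false, false)⟩
.nil
.nil)))))
(.node ⟨89, [((1, 0), 0), ((0, 0), 89), ((0, 0), 23)], ((0, 0), true, true)⟩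
(.node ⟨107, [((0, 0), 74), ((0, 0), 35)], ((1, 0), false, true)⟩
(.node ⟨29, [((1, 0), 27), ((-1, 0), 33)], ((0, 0), true, true)⟩
(.node ⟨18, [((0, 0), 22), ((-1, 0), 17)], ((0, 0), true, false)⟩
(.node ⟨95, [((0, 0), 22), ((0, 0), 92), ((0, 0), 8)], ((-1, 0), true, true)⟩
(.node ⟨9, [((0, 0), 104), ((0, 0), 102)], ((0, 0), true, false)⟩
.nil
.nil)
.nil)
(.node ⟨32, [((0, 0), 76), ((-1, 0), 71)], ((0, 0), true, false)⟩
.nil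
.nil))
(.node ⟨29, [((0, 0), 18), ((-1, 0), 79)], ((0, 0), false, false)⟩
(.node ⟨67, [((0, 0), 95), ((0, 0), 62)], ((1, 0), false, true)⟩
.nil
.nil)
(.node ⟨6, [((0, 0), 56), ((0, 0), 22), ((0, 0), 62)], ((0, -1), false, false)⟩
.nil
.nil)))
(.node ⟨45, [((1, 0), 27), ((0, 0), 105)], ((0, 0), true, true)⟩
(.node ⟨39, [((0, 0), 46), ((0, 0), 102)], ((0, 0), true, true)⟩
(.node ⟨60, [((0, 0), 32), ((0, 0), 14)], ((0, 0), false, true)⟩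
(.node ⟨3, [((0, 0), 0)], ((0, 0), true, false)⟩
.nil
.nil)
.nil)
(.node ⟨15, [((0, 0), 84), ((0, 0), 95)], ((0, 0), false, true)⟩
.nil
.nil))
(.node ⟨92, [((0, 0), 20), ((0, 0), 95), ((-1, 0), 9)], ((0, 0), false, false)⟩
(.node ⟨92, [((-1, 0), 71), ((0, 0), 56)], ((0, 0), true, false)⟩
.nil
.nil)
(.node ⟨35, [((0, 0), 37), ((0, 0), 28)], ((0, 0), false, false)⟩
.nil
.nil))))
(.node ⟨52, [((0, 0), 48), ((0, 0), 55)], ((0, 0), true, true)⟩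
(.node ⟨27, [((0, 0), 40), ((0, 0), 39)], ((0, 0), false, false)⟩
(.node ⟨42, [((0, 0), 39), ((0, 0), 24)], ((0, 0), true, false)⟩
(.node ⟨91, [((0, 0), 12), ((0, 0), 101)], ((0, 0), false, true)⟩
(.node ⟨64, [((0, 0), 97), ((0, 0), 69)], ((0, 0), false, false)⟩
.nil
.nil)
.nil)
(.node ⟨32, [((0, 0), 30), ((0, 0), 38)], ((0, 0), false, false)⟩
.nil
.nil))
(.node ⟨71, [((0, 0), 17), ((0, 0), 39)], ((0, 0), true, false)⟩
(.node ⟨9, [((0, 0), 71), ((0, 0), 6), ((-1, -1), 64)], ((0, 0), false, true)⟩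
.nil
.nil)
(.node ⟨56, [((0, 0), 6), ((0, -1), 60), ((0, 0), 20)], ((0, 0), false, false)⟩
.nil
.nil)))
(.node ⟨17, [((1, 0), 20), ((0, 0), 18)], ((0, 0), true, false)⟩
(.node ⟨45, [((0, 0), 29), ((0, 0), 72)], ((0, 0), false, true)⟩
(.node ⟨30, [((0, 0), 84), ((0, 0), 18)], ((0, 0), false, false)⟩
.nil
.nil)
(.node ⟨84, [((0, 0), 35), ((-1, 0), 64)], ((0, 0), true, true)⟩
.nil
.nil))
(.node ⟨71, [((0, 0), 9), ((0, 0), 66), ((1, 1), 4)], ((0, 0), false, true)⟩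
(.node ⟨12, [((0, 0), 32), ((0, 0), 57)], ((0, 0), true, true)⟩
.nil
.nil)
(.node ⟨56, [((0, 0), 68), ((-1, 0), 93)], ((0, 0), true, false)⟩
.nil
.nil)))))))
(.node ⟨48, [((0, 0), 0), ((0, 0), 50), ((0, 0), 0), ((0, 0), 50), ((0, 0), 0)], ((0, 0), false, false)⟩
(.node ⟨50, [((0, 0), 0), ((0, 0), 48), ((0, 0), 0), ((0, 0), 48), ((0, 0), 0)], ((0, 0), false, true)⟩
(.node ⟨42, [((0, 0), 55), ((0, 0), 0), ((0, 0), 55)], ((0, 0), false, true)⟩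
(.node ⟨89, [((0, 0), 0), ((-1, 0), 89), ((0, 0), 21)], ((0, 0), true, false)⟩
(.node ⟨48, [((-1, 0), 45), ((0, 0), 45)], ((0, 0), false, false)⟩
(.node ⟨22, [((0, 0), 20), ((0, 0), 20)], ((0, 0), false, false)⟩
(.node ⟨92, [((0, 0), 62), ((-1, 0), 64)], ((0, 0), false, true)⟩
(.node ⟨9, [((0, 0), 25), ((0, 0), 49), ((0, 0), 39)], ((0, 0), false, false)⟩
.nil
.nil)
.nil)
(.node ⟨64, [((1, 0), 60), ((0, 0), 92)], ((0, 0), false, true)⟩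
.nil
.nil))
(.node ⟨22, [((0, 0), 39), ((0, 0), 96), ((0, 0), 24)], ((0, 0), true, true)⟩
(.node ⟨95, [((0, 0), 86), ((0, 0), 15)], ((0, 0), false, true)⟩
.nil
.nil)
(.node ⟨56, [((0, 0), 72), ((0, 0), 89)], ((0, 0), true, true)⟩
.nil
.nil)))
(.node ⟨55, [((0, 0), 42), ((0, 0), 52), ((0, 0), 0)], ((0, 0), true, true)⟩
(.node ⟨89, [((0, 0), 74), ((0, 0), 56)], ((0, 0), true, true)⟩
(.node ⟨91, [((0, 0), 58), ((0, 0), 72)], ((0, 0), true, true)⟩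
(.node ⟨60, [((-1, 0), 64), ((0, 0), 94)], ((0, 0), false, true)⟩
.nil
.nil)
.nil)
(.node ⟨4, [((0, -1), 80), ((0, 0), 0), ((0, 0), 74)], ((0, 0), false, false)⟩
.nil
.nil))
(.node ⟨12, [((0, 0), 92), ((0, 0), 87)], ((0, 0), true, true)⟩
(.node ⟨86, [((0, 0), 67), ((1, 0), 32)], ((0, 0), true, true)⟩
.nil
.nil)
(.node ⟨9, [((0, 0), 100), ((0, 0), 106)], ((0, 0), true, true)⟩
.nil
.nil))))
(.node ⟨0, [((0, 0), 82), ((0, 1), 4), ((0, 0), 72)], ((0, 0), false, false)⟩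
(.node ⟨48, [((0, 0), 52), ((0, 0), 53)], ((0, 0), true, true)⟩
(.node ⟨74, [((0, 0), 50), ((0, 0), 82)], ((0, 0), false, false)⟩
(.node ⟨20, [((0, 0), 91), ((-1, 0), 0), ((0, 0), 88)], ((0, 0), true, false)⟩
(.node ⟨97, [((0, 0), 25), ((0, 0), 21), ((0, 0), 39)], ((0, 0), false, false)⟩
.nil
.nil)
.nil)
(.node ⟨4, [((0, -1), 60), ((0, 0), 20), ((0, 0), 58)], ((0, 0), false, false)⟩
.nil
.nil))
(.node ⟨86, [((0, 0), 22), ((0, 0), 78)], ((0, 0), false, false)⟩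
(.node ⟨15, [((0, 0), 95), ((0, 0), 78)], ((0, 0), false, true)⟩
.nil
.nil)
(.node ⟨35, [((0, 0), 72), ((0, 0), 107)], ((-1, 0), false, true)⟩
.nil
.nil)))
(.node ⟨20, [((0, 0), 40), ((0, 0), 22), ((0, 0), 40)], ((0, 0), false, true)⟩
(.node ⟨107, [((0, 0), 46), ((-1, 0), 26)], ((0, 0), true, true)⟩
(.node ⟨84, [((0, 0), 76), ((0, 0), 20)], ((0, 0), false, false)⟩
(.node ⟨10, [((0, 0), 8)], ((0, 0), false, true)⟩
.nil
.nil)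
.nil)
(.node ⟨56, [((0, 0), 35), ((0, 0), 12)], ((0, 0), true, true)⟩
.nil
.nil))
(.node ⟨71, [((1, 0), 92), ((0, 0), 59)], ((0, 0), false, false)⟩
(.node ⟨100, [((0, 0), 9), ((0, 0), 105)], ((0, 0), false, true)⟩
.nil
.nil)
(.node ⟨97, [((0, 0), 37), ((0, 0), 23), ((0, 0), 27)], ((0, 0), false, true)⟩
.nil
.nil)))))
(.node ⟨29, [((0, 0), 45), ((0, 0), 74)], ((0, 0), false, true)⟩
(.node ⟨46, [((0, 0), 107), ((0, 0), 25)], ((-1, 0), false, true)⟩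
(.node ⟨27, [((0, 0), 48), ((0, 0), 39), ((0, 0), 8)], ((0, 0), false, true)⟩
(.node ⟨20, [((0, 0), 22), ((0, 0), 22)], ((0, 0), false, false)⟩
(.node ⟨15, [((0, 0), 58), ((0, 0), 35)], ((0, 0), false, true)⟩
(.node ⟨32, [((-1, 0), 104), ((0, 0), 75)], ((0, 0), true, true)⟩
.nil
.nil)
.nil)
(.node ⟨12, [((0, 0), 76), ((0, 0), 92)], ((0, 0), false, true)⟩
.nil
.nil))
(.node ⟨22, [((0, 0), 18), ((0, 0), 19)], ((-1, 0), true, false)⟩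
(.node ⟨22, [((0, 0), 95), ((-1, 0), 9), ((0, 0), 94)], ((0, 0), false, false)⟩
.nil
.nil)
(.node ⟨80, [((0, 0), 72), ((0, 0), 50)], ((0, 0), false, false)⟩
.nil
.nil)))
(.node ⟨40, [((0, 0), 27), ((0, 0), 36)], ((0, 0), true, false)⟩
(.node ⟨29, [((0, 0), 46), ((-1, 0), 83)], ((0, 0), false, true)⟩
(.node ⟨35, [((0, 0), 15), ((0, 0), 62)], ((0, 0), false, true)⟩
(.node ⟨2, [((0, 0), 0)], ((0, 0), false, true)⟩
.nil
.nil)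
.nil)
(.node ⟨72, [((0, 0), 80), ((0, 0), 48)], ((0, 0), false, false)⟩
.nil
.nil))
(.node ⟨91, [((0, 0), 20), ((0, 0), 91), ((0, 0), 0)], ((-1, 0), false, true)⟩
(.node ⟨78, [((-1, 0), 71), ((0, 0), 35)], ((0, 0), false, false)⟩
.nil
.nil)
(.node ⟨25, [((0, 0), 37), ((0, 0), 43)], ((0, 0), true, false)⟩
.nil
.nil))))
(.node ⟨0, [((0, 0), 48), ((0, 0), 0), ((0, 0), 48), ((0, 0), 0), ((0, 0), 48)], ((0, 0), false, false)⟩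
(.node ⟨40, [((0, 0), 52), ((0, 0), 0), ((0, 0), 53)], ((0, 0), true, true)⟩
(.node ⟨29, [((0, 0), 39), ((0, 0), 34)], ((0, 0), false, false)⟩
(.node ⟨58, [((0, 0), 15), ((0, 0), 32)], ((0, 0), true, true)⟩
(.node ⟨37, [((0, 0), 97), ((0, 0), 24), ((0, 0), 21)], ((0, 0), true, true)⟩
.nil
.nil)
.nil)
(.node ⟨64, [((1, 1), 4), ((0, 0), 68), ((0, 0), 8)], ((0, 0), false, true)⟩
.nil
.nil))
(.node ⟨29, [((0, 0), 17), ((0, 0), 86)], ((0, 0), false, false)⟩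
(.node ⟨71, [((0, 0), 67), ((0, 0), 97)], ((0, 0), true, false)⟩
.nil
.nil)
(.node ⟨72, [((0, 0), 6), ((0, -1), 80), ((0, 0), 0)], ((0, 0), false, false)⟩
.nil
.nil)))
(.node ⟨78, [((0, 0), 20), ((0, 0), 86)], ((0, 0), false, false)⟩
(.node ⟨39, [((0, 0), 29), ((0, 0), 32)], ((0, 0), false, false)⟩
(.node ⟨84, [((0, 0), 15), ((0, 0), 92)], ((0, 0), true, true)⟩
.nil
.nil)
(.node ⟨30, [((0, 0), 35), ((-1, 0), 25)], ((-1, 0), false, true)⟩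
.nil
.nil))
(.node ⟨62, [((0, 0), 12), ((0, 0), 34)], ((0, 0), false, true)⟩
(.node ⟨104, [((0, 0), 9), ((0, 0), 101)], ((0, 0), false, false)⟩
.nil
.nil)
(.node ⟨37, [((0, 0), 68), ((0, 0), 16)], ((0, 0), true, false)⟩
.nil
.nil))))))
(.node ⟨52, [((0, 0), 0), ((0, 0), 55), ((0, 0), 40)], ((0, 0), true, true)⟩
(.node ⟨82, [((0, 0), 0), ((0, 0), 74), ((0, 0), 6)], ((0, 1), false, false)⟩
(.node ⟨103, [((0, 0), 89), ((0, 0), 13)], ((0, 0), true, true)⟩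
(.node ⟨107, [((0, 0), 103), ((0, 0), 9)], ((0, 0), true, true)⟩
(.node ⟨39, [((0, 0), 42), ((0, 0), 27)], ((0, 0), false, false)⟩
(.node ⟨58, [((0, 0), 22), ((0, 0), 62), ((0, 1), 4)], ((0, 0), false, false)⟩
(.node ⟨104, [((0, 0), 25), ((1, 0), 44)], ((0, 0), true, true)⟩
.nil
.nil)
.nil)
(.node ⟨80, [((0, 0), 60), ((0, 0), 91)], ((-1, 0), true, false)⟩
.nil
.nil))
(.node ⟨39, [((0, 0), 22), ((0, 0), 27), ((0, 0), 96)], ((0, 0), false, false)⟩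
(.node ⟨86, [((0, 0), 95), ((0, 0), 12)], ((0, 0), true, true)⟩
.nil
.nil)
(.node ⟨4, [((0, -1), 6), ((0, -1), 6)], ((0, 1), false, false)⟩
.nil
.nil)))
(.node ⟨17, [((1, 0), 27), ((0, 0), 65)], ((0, 0), true, false)⟩
(.node ⟨0, [((0, 0), 89), ((0, 0), 23), ((0, 0), 91)], ((-1, 0), true, false)⟩
(.node ⟨91, [((0, 0), 15), ((-1, 0), 104)], ((0, 0), false, true)⟩
(.node ⟨97, [((1, 1), 4), ((0, 0), 97), ((0, 0), 4)], ((0, -1), false, true)⟩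
.nil
.nil)
.nil)
(.node ⟨30, [((0, 0), 80), ((-1, 0), 45)], ((0, 0), true, true)⟩
.nil
.nil))
(.node ⟨62, [((0, 0), 20), ((0, 0), 58), ((0, 0), 6)], ((0, 1), false, false)⟩
(.node ⟨17, [((0, 0), 71), ((0, 0), 37)], ((0, 0), true, false)⟩
.nil
.nil)
(.node ⟨35, [((0, 0), 100), ((-1, 0), 83)], ((0, 0), false, false)⟩
.nil
.nil))))
(.node ⟨48, [((0, 0), 82), ((0, 0), 72)], ((0, 0), false, false)⟩
(.node ⟨0, [((0, 0), 55), ((0, 0), 40), ((0, 0), 55)], ((0, 0), false, false)⟩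
(.node ⟨39, [((0, 0), 50), ((0, 0), 27), ((0, 0), 8)], ((0, 0), false, false)⟩
(.node ⟨58, [((0, 0), 91), ((0, 0), 75)], ((0, 0), false, true)⟩
(.node ⟨6, [((0, 0), 97), ((0, 0), 4), ((0, 1), 96)], ((-1, -1), true, false)⟩
.nil
.nil)
.nil)
(.node ⟨32, [((0, 0), 60), ((0, 0), 12)], ((0, 0), false, true)⟩
.nil
.nil))
(.node ⟨18, [((0, 0), 29), ((0, 0), 76)], ((-1, 0), true, false)⟩
(.node ⟨67, [((0, 0), 9), ((0, 0), 70), ((0, 0), 6)], ((1, 1), false, false)⟩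
.nil
.nil)
(.node ⟨80, [((0, 1), 4), ((0, 0), 72), ((0, 0), 0)], ((0, 0), false, true)⟩
.nil
.nil)))
(.node ⟨20, [((-1, 0), 17), ((0, 0), 17)], ((0, 0), false, false)⟩
(.node ⟨89, [((0, 0), 103), ((0, 0), 15)], ((0, 0), true, true)⟩
(.node ⟨25, [((0, 0), 104), ((0, 0), 47)], ((1, 0), false, true)⟩
(.node ⟨98, [((0, 0), 96)], ((0, 0), false, true)⟩
.nil
.nil)
.nil)
(.node ⟨84, [((0, 0), 30), ((0, 0), 16)], ((0, 0), false, false)⟩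
.nil
.nil))
(.node ⟨78, [((0, 0), 92), ((0, 0), 14)], ((0, 0), false, true)⟩
(.node ⟨95, [((0, 0), 9), ((-1, 0), 93), ((0, 0), 23)], ((0, 0), false, true)⟩
.nil
.nil)
(.node ⟨6, [((0, 0), 68), ((0, 0), 8), ((0, 0), 66)], ((-1, -1), false, true)⟩
.nil
.nil)))))
(.node ⟨74, [((0, 0), 89), ((0, 0), 59)], ((0, 0), false, true)⟩
(.node ⟨45, [((0, 0), 103), ((0, 0), 37)], ((0, 0), true, true)⟩
(.node ⟨45, [((1, 0), 48), ((0, 0), 46)], ((0, 0), true, false)⟩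
(.node ⟨0, [((0, 0), 50), ((0, 0), 0), ((0, 0), 50), ((0, 0), 0), ((0, 0), 50)], ((0, 0), false, true)⟩
(.node ⟨12, [((0, 0), 91), ((0, 0), 102)], ((0, 0), true, true)⟩
(.node ⟨12, [((-1, 0), 104), ((0, 0), 88)], ((0, 0), false, true)⟩
.nil
.nil)
.nil)
(.node ⟨72, [((0, 0), 30), ((0, 0), 44)], ((0, 0), false, true)⟩
.nil
.nil))
(.node ⟨39, [((0, 0), 18), ((0, 0), 70)], ((0, 0), true, false)⟩
(.node ⟨95, [((0, 0), 15), ((0, 0), 76)], ((0, 0), false, true)⟩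
.nil
.nil)
(.node ⟨68, [((0, 0), 56), ((0, 0), 95)], ((-1, 0), true, false)⟩
.nil
.nil)))
(.node ⟨48, [((0, 0), 27), ((0, 0), 8), ((0, 0), 36)], ((0, 0), true, false)⟩
(.node ⟨50, [((0, 0), 46), ((0, 0), 47)], ((-1, 0), true, false)⟩
(.node ⟨76, [((0, 0), 12), ((0, 0), 94)], ((0, 0), false, true)⟩
(.node ⟨5, [((1, 1), 4)], ((0, 1), true, true)⟩
.nil
.nil)
.nil)
(.node ⟨35, [((0, 0), 84), ((0, 0), 67)], ((-1, 0), false, true)⟩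
.nil
.nil))
(.node ⟨9, [((1, 0), 92), ((0, 0), 23), ((0, 0), 92)], ((0, 0), false, false)⟩
(.node ⟨92, [((-1, 0), 9), ((0, 0), 94), ((0, 0), 20)], ((0, 0), true, false)⟩
.nil
.nil)
(.node ⟨100, [((0, 0), 37), ((0, 0), 47)], ((0, 0), false, true)⟩
.nil
.nil))))
(.node ⟨82, [((0, 0), 48), ((0, 0), 74)], ((0, 0), false, false)⟩
(.node ⟨42, [((0, 0), 40), ((0, 0), 40)], ((0, 0), false, false)⟩
(.node ⟨46, [((0, 0), 74), ((0, 0), 30)], ((0, 0), false, true)⟩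
(.node ⟨12, [((0, 0), 15), ((-1, 0), 9)], ((0, 0), false, false)⟩
(.node ⟨68, [((0, 0), 97), ((0, 0), 65)], ((0, 0), false, true)⟩
.nil
.nil)
.nil)
(.node ⟨80, [((0, 0), 30), ((0, 0), 47)], ((-1, 0), true, true)⟩
.nil
.nil))
(.node ⟨78, [((-1, 0), 17), ((0, 0), 29)], ((0, 0), false, false)⟩
(.node ⟨67, [((0, 0), 71), ((0, 0), 97)], ((0, 0), true, true)⟩
.nil
.nil)
(.node ⟨4, [((-1, -1), 6), ((-1, -1), 6)], ((1, 1), false, true)⟩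
.nil
.nil)))
(.node ⟨27, [((0, 0), 20), ((0, 0), 39), ((0, 0), 96)], ((0, 0), false, true)⟩
(.node ⟨46, [((0, 0), 29), ((0, 0), 80)], ((-1, 0), true, true)⟩
(.node ⟨76, [((0, 0), 84), ((0, 0), 22)], ((0, 0), false, false)⟩
.nil
.nil)
(.node ⟨100, [((0, 0), 35), ((0, 0), 80)], ((-1, 0), true, false)⟩
.nil
.nil))
(.node ⟨92, [((0, 0), 12), ((0, 0), 85)], ((0, 0), true, true)⟩
(.node ⟨25, [((1, 0), 32), ((0, 0), 31)], ((1, 0), false, true)⟩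
.nil
.nil)
(.node ⟨97, [((0, 0), 68), ((0, 0), 66)], ((0, 0), true, true)⟩
.nil
.nil))))))))

/-- The subdivision of the fundamental box. -/
def boxTree : Tr :=
  (.y (.y (.x (.leaf 17408 [(0, 17280, 17408), (1, 17536, 17408), (2, 17456, 17408), (3, 17448, 17456), (4, 17458, 17408), (5, 17454, 17458), (6, 17460, 17408), (7, 17463, 17408), (8, 17450, 17463), (9, 17482, 17408), (10, 17490, 17408), (11, 17325, 17490), (12, 17309, 17325), (13, 17369, 17408), (14, 17354, 17369), (15, 17330, 17354), (16, 17497, 17408), (17, 17383, 17490), (18, 17511, 17497), (19, 17387, 17369), (20, 17326, 17387), (21, 17515, 17482), (275, 17281, 17280), (275, 17409, 17408), (275, 17537, 17536), (276, 17282, 17280), (276, 17410, 17408), (276, 17538, 17536), (277, 17283, 17280), (277, 17411, 17408), (277, 17539, 17536)])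
(.y (.leaf 17408 [(0, 17280, 17408), (1, 17536, 17408), (275, 17281, 17280), (275, 17409, 17408), (275, 17537, 17536), (276, 17282, 17280), (276, 17410, 17408), (276, 17538, 17536), (277, 17283, 17280), (277, 17411, 17408), (277, 17539, 17536)])
(.x (.leaf 17408 [(1, 17536, 17408), (4, 17458, 17408), (7, 17463, 17408), (9, 17482, 17408), (16, 17497, 17408), (18, 17511, 17497), (21, 17515, 17482), (5, 17454, 17458), (275, 17409, 17408), (275, 17537, 17536), (276, 17410, 17408), (276, 17538, 17536), (277, 17411, 17408), (277, 17539, 17536)])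
(.leaf 17408 [(1, 17536, 17408), (4, 17458, 17408), (9, 17482, 17408), (16, 17497, 17408), (18, 17511, 17497), (19, 17515, 17497), (22, 17453, 17511), (23, 17618, 17497), (275, 17409, 17408), (275, 17537, 17536), (276, 17410, 17408), (276, 17538, 17536), (277, 17411, 17408), (277, 17539, 17536)]))))
(.x (.y (.x (.y (.x (.y (.x (.leaf 17408 [(0, 17280, 17408), (10, 17490, 17408), (13, 17369, 17408), (17, 17383, 17490), (19, 17387, 17369), (11, 17325, 17490), (275, 17281, 17280), (275, 17409, 17408), (276, 17282, 17280), (276, 17410, 17408), (277, 17283, 17280), (277, 17411, 17408)])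
(.leaf 17408 [(2, 17456, 17408), (10, 17490, 17408), (13, 17369, 17408), (17, 17383, 17490), (11, 17325, 17490), (275, 17409, 17408), (276, 17410, 17408), (277, 17411, 17408)]))
(.leaf 17490 [(11, 17325, 17490), (17, 17383, 17490), (24, 17408, 17490), (25, 17326, 17325), (26, 17456, 17490), (27, 17369, 17490), (19, 17387, 17369), (275, 17409, 17408), (276, 17410, 17408), (277, 17411, 17408)]))
(.y (.leaf 17408 [(2, 17456, 17408), (10, 17490, 17408), (275, 17409, 17408), (276, 17410, 17408), (277, 17411, 17408)])
(.x (.y (.leaf 17408 [(10, 17490, 17408), (11, 17325, 17490), (26, 17456, 17490), (275, 17409, 17408), (276, 17410, 17408), (277, 17411, 17408)])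
(.leaf 17490 [(11, 17325, 17490), (26, 17456, 17490), (28, 17408, 17456), (29, 17460, 17456), (275, 17409, 17408), (276, 17410, 17408), (277, 17411, 17408)]))
(.y (.leaf 17408 [(2, 17456, 17408), (6, 17460, 17408), (10, 17490, 17408), (275, 17409, 17408), (276, 17410, 17408), (277, 17411, 17408)])
(.leaf 17456 [(28, 17408, 17456), (29, 17460, 17456), (30, 17490, 17456), (275, 17409, 17408), (276, 17410, 17408), (277, 17411, 17408)])))))
(.x (.y (.leaf 17325 [(12, 17309, 17325), (25, 17326, 17325), (31, 17435, 17325), (32, 17456, 17325), (33, 17490, 17325), (27, 17369, 17490), (17, 17383, 17490), (34, 17387, 17383)])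
(.x (.leaf 17325 [(31, 17435, 17325), (12, 17309, 17325), (25, 17326, 17325), (32, 17456, 17325), (30, 17490, 17456), (35, 17383, 17325)])
(.leaf 17456 [(3, 17448, 17456), (30, 17490, 17456), (36, 17435, 17456), (37, 17309, 17435), (38, 17325, 17456)])))
(.y (.leaf 17456 [(36, 17435, 17456), (3, 17448, 17456), (38, 17325, 17456), (29, 17460, 17456), (30, 17490, 17456)])
(.leaf 17456 [(36, 17435, 17456), (3, 17448, 17456), (38, 17325, 17456), (29, 17460, 17456)]))))
(.y (.x (.y (.leaf 17408 [(2, 17456, 17408), (6, 17460, 17408), (275, 17409, 17408), (276, 17410, 17408), (277, 17411, 17408)])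
(.x (.y (.leaf 17408 [(2, 17456, 17408), (6, 17460, 17408), (275, 17409, 17408), (276, 17410, 17408), (277, 17411, 17408)])
(.leaf 17460 [(39, 17408, 17460), (40, 17456, 17460), (275, 17409, 17408), (276, 17410, 17408), (277, 17411, 17408)]))
(.y (.leaf 17408 [(6, 17460, 17408), (275, 17409, 17408), (276, 17410, 17408), (277, 17411, 17408)])
(.leaf 17460 [(39, 17408, 17460), (40, 17456, 17460), (41, 17463, 17460), (275, 17409, 17408), (276, 17410, 17408), (277, 17411, 17408)]))))
(.y (.leaf 17408 [(6, 17460, 17408), (7, 17463, 17408), (275, 17409, 17408), (276, 17410, 17408), (277, 17411, 17408)])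
(.x (.leaf 17408 [(6, 17460, 17408), (7, 17463, 17408), (275, 17409, 17408), (276, 17410, 17408), (277, 17411, 17408)])
(.y (.leaf 17408 [(6, 17460, 17408), (7, 17463, 17408), (275, 17409, 17408), (276, 17410, 17408), (277, 17411, 17408)])
(.leaf 17463 [(42, 17408, 17463), (43, 17460, 17463), (275, 17409, 17408), (276, 17410, 17408), (277, 17411, 17408)])))))
(.x (.leaf 17460 [(39, 17408, 17460), (40, 17456, 17460), (41, 17463, 17460), (44, 17448, 17460), (45, 17435, 17448), (46, 17450, 17448), (275, 17409, 17408), (276, 17410, 17408), (277, 17411, 17408)])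
(.y (.leaf 17463 [(42, 17408, 17463), (8, 17450, 17463), (43, 17460, 17463), (44, 17448, 17460), (47, 17458, 17463), (275, 17409, 17408), (276, 17410, 17408), (277, 17411, 17408)])
(.x (.y (.leaf 17460 [(44, 17448, 17460), (41, 17463, 17460), (8, 17450, 17463)])
(.x (.leaf 17460 [(44, 17448, 17460), (46, 17450, 17448), (41, 17463, 17460)])
(.leaf 17448 [(46, 17450, 17448), (48, 17463, 17450), (43, 17460, 17463)])))
(.leaf 17450 [(48, 17463, 17450), (47, 17458, 17463), (43, 17460, 17463), (49, 17448, 17450)]))))))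
(.x (.y (.x (.leaf 17435 [(37, 17309, 17435), (50, 17297, 17435), (51, 17428, 17435), (52, 17448, 17435), (53, 17325, 17435), (54, 17456, 17435)])
(.y (.leaf 17435 [(52, 17448, 17435), (54, 17456, 17435), (55, 17460, 17448)])
(.x (.y (.leaf 17435 [(52, 17448, 17435)])
(.leaf 17435 [(50, 17297, 17435), (51, 17428, 17435), (52, 17448, 17435)]))
(.leaf 17435 [(52, 17448, 17435), (56, 17428, 17448)]))))
(.x (.leaf 17297 [(57, 17298, 17297), (58, 17428, 17297), (59, 17435, 17297), (37, 17309, 17435), (52, 17448, 17435), (60, 17486, 17428)])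
(.y (.x (.leaf 17428 [(61, 17297, 17428), (62, 17435, 17428), (63, 17448, 17428)])
(.leaf 17428 [(61, 17297, 17428), (62, 17435, 17428), (63, 17448, 17428)]))
(.leaf 17428 [(61, 17297, 17428), (64, 17430, 17428)]))))
(.y (.x (.leaf 17448 [(56, 17428, 17448), (64, 17430, 17428), (45, 17435, 17448), (46, 17450, 17448), (55, 17460, 17448), (48, 17463, 17450), (40, 17456, 17460)])
(.leaf 17450 [(49, 17448, 17450), (55, 17460, 17448), (48, 17463, 17450), (56, 17428, 17448), (65, 17430, 17450), (66, 17447, 17450)]))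
(.x (.y (.leaf 17428 [(64, 17430, 17428), (62, 17435, 17428), (63, 17448, 17428), (46, 17450, 17448)])
(.leaf 17428 [(61, 17297, 17428), (64, 17430, 17428)]))
(.y (.x (.y (.x (.leaf 17428 [(64, 17430, 17428), (63, 17448, 17428), (67, 17450, 17430)])
(.leaf 17430 [(67, 17450, 17430), (49, 17448, 17450), (68, 17428, 17430)]))
(.leaf 17428 [(64, 17430, 17428), (63, 17448, 17428), (67, 17450, 17430)]))
(.leaf 17430 [(68, 17428, 17430), (67, 17450, 17430), (49, 17448, 17450)]))
(.leaf 17430 [(68, 17428, 17430), (69, 17426, 17430)]))))))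
(.y (.x (.y (.x (.y (.leaf 17408 [(4, 17458, 17408), (7, 17463, 17408), (275, 17409, 17408), (276, 17410, 17408), (277, 17411, 17408)])
(.x (.y (.leaf 17408 [(4, 17458, 17408), (7, 17463, 17408), (275, 17409, 17408), (276, 17410, 17408), (277, 17411, 17408)])
(.leaf 17463 [(42, 17408, 17463), (47, 17458, 17463), (275, 17409, 17408), (276, 17410, 17408), (277, 17411, 17408)]))
(.y (.leaf 17408 [(4, 17458, 17408), (7, 17463, 17408), (275, 17409, 17408), (276, 17410, 17408), (277, 17411, 17408)])
(.leaf 17463 [(42, 17408, 17463), (47, 17458, 17463), (275, 17409, 17408), (276, 17410, 17408), (277, 17411, 17408)]))))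
(.y (.leaf 17408 [(4, 17458, 17408), (9, 17482, 17408), (275, 17409, 17408), (276, 17410, 17408), (277, 17411, 17408)])
(.x (.y (.leaf 17408 [(4, 17458, 17408), (7, 17463, 17408), (9, 17482, 17408), (275, 17409, 17408), (276, 17410, 17408), (277, 17411, 17408)])
(.leaf 17458 [(5, 17454, 17458), (70, 17408, 17458), (71, 17463, 17458), (72, 17482, 17458), (275, 17409, 17408), (276, 17410, 17408), (277, 17411, 17408)]))
(.leaf 17482 [(15, 17458, 17482), (21, 17515, 17482), (5, 17454, 17458), (73, 17408, 17482), (275, 17409, 17408), (276, 17410, 17408), (277, 17411, 17408)]))))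
(.x (.y (.leaf 17463 [(42, 17408, 17463), (8, 17450, 17463), (47, 17458, 17463), (43, 17460, 17463), (74, 17447, 17458), (275, 17409, 17408), (276, 17410, 17408), (277, 17411, 17408)])
(.x (.leaf 17450 [(66, 17447, 17450), (48, 17463, 17450), (47, 17458, 17463), (43, 17460, 17463)])
(.y (.leaf 17458 [(74, 17447, 17458), (71, 17463, 17458), (8, 17450, 17463)])
(.leaf 17450 [(66, 17447, 17450), (48, 17463, 17450), (75, 17458, 17447)]))))
(.y (.leaf 17458 [(74, 17447, 17458), (5, 17454, 17458), (71, 17463, 17458), (72, 17482, 17458), (21, 17515, 17482), (8, 17450, 17463)])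
(.leaf 17458 [(74, 17447, 17458), (5, 17454, 17458), (71, 17463, 17458), (72, 17482, 17458), (76, 17437, 17447), (77, 17450, 17447)]))))
(.y (.x (.y (.x (.leaf 17408 [(9, 17482, 17408), (16, 17497, 17408), (21, 17515, 17482), (20, 17454, 17515), (275, 17409, 17408), (276, 17410, 17408), (277, 17411, 17408)])
(.y (.leaf 17408 [(1, 17536, 17408), (9, 17482, 17408), (16, 17497, 17408), (21, 17515, 17482), (275, 17409, 17408), (275, 17537, 17536), (276, 17410, 17408), (276, 17538, 17536), (277, 17411, 17408), (277, 17539, 17536)])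
(.leaf 17497 [(14, 17482, 17497), (18, 17511, 17497), (21, 17515, 17482), (73, 17408, 17482), (20, 17454, 17515), (275, 17409, 17408), (276, 17410, 17408), (277, 17411, 17408)])))
(.leaf 17482 [(73, 17408, 17482), (15, 17458, 17482), (21, 17515, 17482), (78, 17454, 17482), (79, 17453, 17454), (80, 17497, 17482), (81, 17511, 17515), (275, 17409, 17408), (276, 17410, 17408), (277, 17411, 17408)]))
(.y (.leaf 17497 [(14, 17482, 17497), (23, 17618, 17497), (18, 17511, 17497), (19, 17515, 17497), (11, 17453, 17618), (78, 17454, 17482), (82, 17408, 17497), (83, 17536, 17497), (275, 17409, 17408), (275, 17537, 17536), (276, 17410, 17408), (276, 17538, 17536), (277, 17411, 17408), (277, 17539, 17536)])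
(.leaf 17497 [(82, 17408, 17497), (83, 17536, 17497), (14, 17482, 17497), (23, 17618, 17497), (18, 17511, 17497), (19, 17515, 17497), (22, 17453, 17511), (20, 17454, 17515), (26, 17584, 17618), (275, 17409, 17408), (275, 17537, 17536), (276, 17410, 17408), (276, 17538, 17536), (277, 17411, 17408), (277, 17539, 17536)])))
(.x (.leaf 17454 [(79, 17453, 17454), (33, 17618, 17453), (84, 17437, 17454), (85, 17447, 17454), (86, 17458, 17454), (87, 17482, 17454), (80, 17497, 17482), (88, 17515, 17454), (81, 17511, 17515)])
(.y (.x (.leaf 17453 [(12, 17437, 17453), (25, 17454, 17453), (87, 17482, 17454), (33, 17618, 17453), (35, 17511, 17453), (88, 17515, 17454), (89, 17497, 17515)])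
(.leaf 17453 [(12, 17437, 17453), (25, 17454, 17453), (32, 17584, 17453), (87, 17482, 17454), (33, 17618, 17453), (35, 17511, 17453), (34, 17515, 17511), (90, 17497, 17511)]))
(.leaf 17437 [(91, 17563, 17437), (92, 17447, 17437), (93, 17453, 17437), (32, 17584, 17453), (33, 17618, 17453), (35, 17511, 17453), (94, 17454, 17437), (88, 17515, 17454)])))))
(.x (.y (.x (.y (.leaf 17450 [(66, 17447, 17450), (49, 17448, 17450), (75, 17458, 17447), (48, 17463, 17450)])
(.x (.leaf 17450 [(65, 17430, 17450), (66, 17447, 17450), (49, 17448, 17450)])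
(.y (.leaf 17447 [(77, 17450, 17447)])
(.leaf 17447 [(77, 17450, 17447), (65, 17430, 17450), (69, 17426, 17430)]))))
(.leaf 17447 [(76, 17437, 17447), (77, 17450, 17447), (75, 17458, 17447), (48, 17463, 17450), (95, 17426, 17447), (96, 17430, 17447), (97, 17454, 17447)]))
(.x (.y (.x (.leaf 17430 [(69, 17426, 17430), (67, 17450, 17430), (66, 17447, 17450)])
(.y (.leaf 17430 [(69, 17426, 17430), (67, 17450, 17430), (98, 17447, 17430)])
(.leaf 17430 [(69, 17426, 17430), (98, 17447, 17430), (67, 17450, 17430)])))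
(.leaf 17430 [(69, 17426, 17430), (68, 17428, 17430)]))
(.leaf 17426 [(99, 17425, 17426), (100, 17430, 17426), (67, 17450, 17430), (101, 17437, 17426), (102, 17447, 17426), (103, 17475, 17426), (104, 17494, 17430)])))
(.y (.leaf 17437 [(91, 17563, 17437), (92, 17447, 17437), (77, 17450, 17447), (93, 17453, 17437), (94, 17454, 17437), (32, 17584, 17453), (86, 17458, 17454), (105, 17425, 17437), (106, 17426, 17437)])
(.x (.leaf 17426 [(99, 17425, 17426), (100, 17430, 17426), (101, 17437, 17426), (102, 17447, 17426), (107, 17494, 17426)])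
(.leaf 17425 [(57, 17426, 17425), (58, 17556, 17425), (59, 17563, 17425), (102, 17447, 17426), (108, 17437, 17425), (109, 17479, 17425), (110, 17614, 17425)])))))))
(.y (.x (.y (.x (.y (.x (.y (.leaf 17297 [(57, 17298, 17297), (58, 17428, 17297), (109, 17351, 17297), (110, 17486, 17297), (111, 17500, 17486)])
(.leaf 17297 [(58, 17428, 17297), (109, 17351, 17297), (110, 17486, 17297), (111, 17500, 17486), (112, 17420, 17500), (113, 17470, 17500)]))
(.y (.leaf 17428 [(61, 17297, 17428), (64, 17430, 17428), (60, 17486, 17428), (111, 17500, 17486), (114, 17470, 17428)])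
(.x (.y (.leaf 17297 [(58, 17428, 17297), (114, 17470, 17428), (60, 17486, 17428), (111, 17500, 17486)])
(.leaf 17428 [(61, 17297, 17428), (114, 17470, 17428), (60, 17486, 17428), (111, 17500, 17486), (112, 17420, 17500)]))
(.leaf 17428 [(61, 17297, 17428), (114, 17470, 17428), (60, 17486, 17428), (115, 17420, 17470), (116, 17499, 17428), (117, 17500, 17428)]))))
(.x (.y (.x (.leaf 17486 [(111, 17500, 17486), (112, 17420, 17500), (113, 17470, 17500), (118, 17289, 17500), (119, 17297, 17486), (120, 17351, 17500), (281, 17291, 17289)])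
(.leaf 17500 [(118, 17289, 17500), (112, 17420, 17500), (113, 17470, 17500), (120, 17351, 17500), (121, 17428, 17470), (122, 17486, 17500), (119, 17297, 17486), (281, 17291, 17289)]))
(.leaf 17420 [(123, 17289, 17420), (124, 17470, 17420), (125, 17351, 17289), (126, 17500, 17420), (122, 17486, 17500), (281, 17291, 17289)]))
(.y (.leaf 17470 [(115, 17420, 17470), (121, 17428, 17470), (61, 17297, 17428), (127, 17499, 17470), (128, 17500, 17470), (122, 17486, 17500)])
(.leaf 17420 [(123, 17289, 17420), (124, 17470, 17420), (127, 17499, 17470), (128, 17500, 17470), (122, 17486, 17500), (129, 17423, 17420), (281, 17291, 17289)]))))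
(.y (.x (.y (.leaf 17428 [(61, 17297, 17428), (64, 17430, 17428), (116, 17499, 17428)])
(.x (.y (.leaf 17428 [(64, 17430, 17428), (114, 17470, 17428), (116, 17499, 17428)])
(.leaf 17428 [(64, 17430, 17428), (114, 17470, 17428), (116, 17499, 17428)]))
(.leaf 17428 [(64, 17430, 17428), (114, 17470, 17428), (116, 17499, 17428), (130, 17466, 17430)])))
(.y (.leaf 17430 [(69, 17426, 17430), (68, 17428, 17430), (130, 17466, 17430), (131, 17499, 17430)])
(.x (.leaf 17430 [(68, 17428, 17430), (130, 17466, 17430), (131, 17499, 17430)])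
(.leaf 17430 [(68, 17428, 17430), (130, 17466, 17430), (131, 17499, 17430), (132, 17423, 17466), (133, 17503, 17430)]))))
(.x (.y (.leaf 17499 [(134, 17420, 17499), (135, 17423, 17499), (136, 17428, 17499), (137, 17430, 17499), (138, 17466, 17499), (139, 17470, 17499)])
(.leaf 17420 [(129, 17423, 17420), (124, 17470, 17420), (140, 17466, 17423), (141, 17499, 17420)]))
(.y (.leaf 17466 [(132, 17423, 17466), (142, 17420, 17423), (143, 17430, 17466), (68, 17428, 17430), (144, 17499, 17466), (139, 17470, 17499), (145, 17503, 17466)])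
(.leaf 17423 [(142, 17420, 17423), (140, 17466, 17423), (124, 17470, 17420), (145, 17503, 17466), (146, 17499, 17423)])))))
(.x (.leaf 17420 [(123, 17289, 17420), (129, 17423, 17420), (140, 17466, 17423), (124, 17470, 17420), (125, 17351, 17289), (127, 17499, 17470), (126, 17500, 17420), (122, 17486, 17500), (147, 17440, 17420), (148, 17443, 17423), (149, 17468, 17440), (150, 17484, 17420), (151, 17438, 17484), (152, 17492, 17484), (153, 17384, 17420), (154, 17305, 17384), (281, 17291, 17289)])
(.y (.leaf 17423 [(142, 17420, 17423), (140, 17466, 17423), (124, 17470, 17420), (146, 17499, 17423), (155, 17417, 17423), (281, 17419, 17417)])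
(.x (.y (.leaf 17420 [(129, 17423, 17420), (150, 17484, 17420), (156, 17492, 17423)])
(.x (.y (.leaf 17420 [(129, 17423, 17420), (150, 17484, 17420), (152, 17492, 17484)])
(.leaf 17420 [(129, 17423, 17420), (150, 17484, 17420), (152, 17492, 17484), (151, 17438, 17484)]))
(.y (.leaf 17420 [(129, 17423, 17420), (150, 17484, 17420), (156, 17492, 17423)])
(.leaf 17423 [(142, 17420, 17423), (156, 17492, 17423), (157, 17438, 17492), (158, 17484, 17492)]))))
(.leaf 17423 [(155, 17417, 17423), (142, 17420, 17423), (148, 17443, 17423), (156, 17492, 17423), (157, 17438, 17492), (158, 17484, 17492), (159, 17508, 17423), (281, 17419, 17417)])))))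
(.y (.x (.y (.x (.y (.leaf 17430 [(69, 17426, 17430), (68, 17428, 17430), (130, 17466, 17430), (104, 17494, 17430), (133, 17503, 17430)])
(.x (.leaf 17430 [(69, 17426, 17430), (130, 17466, 17430), (104, 17494, 17430), (131, 17499, 17430), (133, 17503, 17430), (132, 17423, 17466)])
(.y (.leaf 17426 [(100, 17430, 17426), (130, 17466, 17430), (104, 17494, 17430), (133, 17503, 17430)])
(.leaf 17430 [(69, 17426, 17430), (130, 17466, 17430), (103, 17475, 17426), (104, 17494, 17430), (133, 17503, 17430), (132, 17423, 17466)]))))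
(.y (.leaf 17426 [(99, 17425, 17426), (100, 17430, 17426), (103, 17475, 17426), (107, 17494, 17426), (160, 17503, 17494)])
(.leaf 17426 [(100, 17430, 17426), (103, 17475, 17426), (107, 17494, 17426), (160, 17503, 17494), (161, 17466, 17503)])))
(.x (.y (.x (.leaf 17466 [(132, 17423, 17466), (143, 17430, 17466), (144, 17499, 17466), (145, 17503, 17466), (162, 17494, 17503)])
(.leaf 17466 [(132, 17423, 17466), (145, 17503, 17466), (155, 17417, 17423), (162, 17494, 17503), (163, 17426, 17494), (164, 17430, 17503), (165, 17475, 17503), (281, 17419, 17417)]))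
(.leaf 17423 [(155, 17417, 17423), (140, 17466, 17423), (144, 17499, 17466), (166, 17503, 17423), (162, 17494, 17503), (281, 17419, 17417)]))
(.y (.x (.leaf 17494 [(163, 17426, 17494), (100, 17430, 17426), (160, 17503, 17494), (161, 17466, 17503), (165, 17475, 17503), (167, 17417, 17503), (168, 17423, 17503), (281, 17419, 17417)])
(.leaf 17503 [(167, 17417, 17503), (168, 17423, 17503), (165, 17475, 17503), (162, 17494, 17503), (169, 17426, 17475), (281, 17419, 17417)]))
(.leaf 17423 [(155, 17417, 17423), (140, 17466, 17423), (166, 17503, 17423), (162, 17494, 17503), (170, 17475, 17417), (281, 17419, 17417)]))))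
(.y (.x (.y (.leaf 17426 [(99, 17425, 17426), (100, 17430, 17426), (103, 17475, 17426), (109, 17479, 17425), (107, 17494, 17426), (160, 17503, 17494)])
(.leaf 17426 [(99, 17425, 17426), (103, 17475, 17426), (107, 17494, 17426), (160, 17503, 17494), (171, 17417, 17475), (172, 17479, 17475), (281, 17419, 17417)]))
(.y (.leaf 17425 [(57, 17426, 17425), (58, 17556, 17425), (103, 17475, 17426), (109, 17479, 17425), (110, 17614, 17425), (111, 17628, 17614)])
(.leaf 17425 [(57, 17426, 17425), (109, 17479, 17425), (110, 17614, 17425), (111, 17628, 17614), (173, 17417, 17479), (174, 17475, 17479), (281, 17419, 17417)])))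
(.x (.y (.x (.leaf 17475 [(171, 17417, 17475), (169, 17426, 17475), (172, 17479, 17475), (175, 17423, 17417), (176, 17494, 17475), (177, 17503, 17475), (281, 17419, 17417)])
(.y (.leaf 17475 [(171, 17417, 17475), (169, 17426, 17475), (172, 17479, 17475), (176, 17494, 17475), (178, 17425, 17479), (281, 17419, 17417)])
(.leaf 17417 [(170, 17475, 17417), (125, 17479, 17417), (281, 17419, 17417)])))
(.leaf 17417 [(175, 17423, 17417), (170, 17475, 17417), (125, 17479, 17417), (176, 17494, 17475), (177, 17503, 17475), (179, 17548, 17417), (281, 17419, 17417)]))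
(.y (.leaf 17479 [(173, 17417, 17479), (179, 17548, 17417), (178, 17425, 17479), (57, 17426, 17425), (174, 17475, 17479), (180, 17614, 17479), (181, 17628, 17479), (281, 17419, 17417)])
(.leaf 17417 [(179, 17548, 17417), (170, 17475, 17417), (125, 17479, 17417), (180, 17614, 17479), (182, 17628, 17417), (281, 17419, 17417)])))))
(.x (.y (.leaf 17423 [(155, 17417, 17423), (142, 17420, 17423), (140, 17466, 17423), (170, 17475, 17417), (166, 17503, 17423), (281, 17419, 17417)])
(.x (.leaf 17423 [(155, 17417, 17423), (142, 17420, 17423), (148, 17443, 17423), (156, 17492, 17423), (159, 17508, 17423), (183, 17445, 17508), (281, 17419, 17417)])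
(.y (.leaf 17417 [(175, 17423, 17417), (159, 17508, 17423), (281, 17419, 17417)])
(.x (.leaf 17417 [(175, 17423, 17417), (148, 17443, 17423), (184, 17508, 17417), (183, 17445, 17508), (281, 17419, 17417)])
(.leaf 17417 [(175, 17423, 17417), (184, 17508, 17417), (185, 17445, 17417), (281, 17419, 17417)])))))
(.y (.leaf 17417 [(179, 17548, 17417), (175, 17423, 17417), (170, 17475, 17417), (182, 17628, 17417), (153, 17512, 17548), (186, 17503, 17417), (281, 17419, 17417)])
(.x (.leaf 17417 [(179, 17548, 17417), (175, 17423, 17417), (185, 17445, 17417), (184, 17508, 17417), (187, 17433, 17417), (188, 17512, 17417), (281, 17419, 17417)])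
(.y (.leaf 17417 [(179, 17548, 17417), (153, 17512, 17548), (281, 17419, 17417)])
(.leaf 17417 [(179, 17548, 17417), (187, 17433, 17417), (147, 17568, 17548), (188, 17512, 17417), (281, 17419, 17417)])))))))
(.x (.y (.x (.y (.x (.leaf 17440 [(149, 17468, 17440), (189, 17420, 17440), (123, 17289, 17420), (190, 17305, 17440), (191, 17438, 17440), (192, 17344, 17468), (193, 17484, 17440), (194, 17488, 17468), (195, 17384, 17440), (281, 17291, 17289)])
(.y (.x (.leaf 17440 [(189, 17420, 17440), (191, 17438, 17440), (149, 17468, 17440), (193, 17484, 17440), (195, 17384, 17440)])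
(.leaf 17484 [(151, 17438, 17484), (152, 17492, 17484), (196, 17420, 17484), (197, 17440, 17484)]))
(.leaf 17440 [(191, 17438, 17440), (149, 17468, 17440), (193, 17484, 17440), (152, 17492, 17484), (198, 17480, 17438), (199, 17488, 17440)])))
(.x (.y (.leaf 17440 [(190, 17305, 17440), (191, 17438, 17440), (149, 17468, 17440), (192, 17344, 17468), (194, 17488, 17468), (200, 19460, 17468), (278, 17285, 19460)])
(.x (.y (.leaf 17468 [(200, 19460, 17468), (192, 17344, 17468), (201, 17305, 17344), (202, 17440, 17468), (278, 17285, 19460)])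
(.leaf 19460 [(203, 17468, 19460), (202, 17440, 17468), (204, 17344, 19460), (278, 17285, 19460)]))
(.leaf 17468 [(200, 19460, 17468), (202, 17440, 17468), (192, 17344, 17468), (194, 17488, 17468), (278, 17285, 19460)])))
(.y (.x (.leaf 17440 [(191, 17438, 17440), (149, 17468, 17440), (194, 17488, 17468)])
(.leaf 17438 [(198, 17480, 17438), (205, 17440, 17438), (193, 17484, 17440), (206, 17488, 17438), (207, 17468, 17488)]))
(.leaf 17488 [(207, 17468, 17488), (208, 19460, 17488), (209, 17414, 19460), (210, 17438, 17488), (211, 17440, 17488), (212, 17480, 17488), (278, 17285, 19460), (279, 19463, 17414)]))))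
(.y (.x (.y (.leaf 17484 [(196, 17420, 17484), (151, 17438, 17484), (197, 17440, 17484), (152, 17492, 17484), (213, 17423, 17492), (214, 17443, 17492)])
(.leaf 17438 [(205, 17440, 17438), (149, 17468, 17440), (198, 17480, 17438), (206, 17488, 17438), (215, 17443, 17438), (216, 17464, 17443), (217, 17484, 17438), (218, 17492, 17438)]))
(.y (.x (.leaf 17492 [(213, 17423, 17492), (157, 17438, 17492), (214, 17443, 17492), (158, 17484, 17492)])
(.leaf 17443 [(216, 17464, 17443), (219, 17423, 17443), (220, 17438, 17443), (221, 17492, 17443), (222, 17508, 17443)]))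
(.leaf 17443 [(220, 17438, 17443), (216, 17464, 17443), (198, 17480, 17438), (217, 17484, 17438), (221, 17492, 17443), (222, 17508, 17443), (223, 17445, 17443)])))
(.x (.y (.leaf 17438 [(205, 17440, 17438), (215, 17443, 17438), (149, 17468, 17440), (198, 17480, 17438), (217, 17484, 17438), (206, 17488, 17438), (218, 17492, 17438), (224, 17464, 17480)])
(.x (.leaf 17488 [(208, 19460, 17488), (210, 17438, 17488), (212, 17480, 17488), (225, 17414, 17480), (278, 17285, 19460), (279, 19463, 17414)])
(.leaf 17480 [(225, 17414, 17480), (224, 17464, 17480), (226, 19460, 17414), (227, 17438, 17480), (215, 17443, 17438), (228, 17488, 17480), (278, 17285, 19460), (279, 19463, 17414)])))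
(.y (.leaf 17443 [(220, 17438, 17443), (223, 17445, 17443), (216, 17464, 17443), (206, 17488, 17438), (221, 17492, 17443), (229, 17414, 17464), (230, 17476, 17464), (231, 17480, 17464), (279, 19463, 17414)])
(.x (.leaf 17480 [(225, 17414, 17480), (227, 17438, 17480), (224, 17464, 17480), (228, 17488, 17480), (232, 17443, 17480), (279, 19463, 17414)])
(.leaf 17464 [(229, 17414, 17464), (230, 17476, 17464), (231, 17480, 17464), (227, 17438, 17480), (233, 17443, 17464), (279, 19463, 17414)]))))))
(.x (.y (.leaf 19460 [(209, 17414, 19460), (203, 17468, 19460), (204, 17344, 19460), (202, 17440, 17468), (234, 17488, 19460), (210, 17438, 17488), (212, 17480, 17488), (278, 17285, 19460), (279, 19463, 17414)])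
(.leaf 19460 [(209, 17414, 19460), (235, 17286, 19460), (278, 17285, 19460), (279, 19335, 17286), (279, 19463, 17414)]))
(.y (.x (.y (.x (.leaf 19460 [(209, 17414, 19460), (234, 17488, 19460), (236, 17480, 17414), (278, 17285, 19460), (279, 19463, 17414)])
(.leaf 17414 [(226, 19460, 17414), (236, 17480, 17414), (228, 17488, 17480), (278, 17285, 19460), (279, 19463, 17414)]))
(.leaf 19460 [(209, 17414, 19460), (278, 17285, 19460), (279, 19463, 17414)]))
(.leaf 17414 [(226, 19460, 17414), (236, 17480, 17414), (228, 17488, 17480), (237, 17464, 17414), (278, 17285, 19460), (279, 19463, 17414)]))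
(.leaf 17414 [(226, 19460, 17414), (238, 19588, 17414), (278, 17285, 19460), (278, 17413, 19588), (279, 19463, 17414)]))))
(.y (.x (.y (.x (.leaf 17443 [(219, 17423, 17443), (220, 17438, 17443), (223, 17445, 17443), (216, 17464, 17443), (221, 17492, 17443), (222, 17508, 17443), (155, 17417, 17423), (239, 17476, 17443), (281, 17419, 17417)])
(.y (.x (.leaf 17508 [(183, 17445, 17508), (240, 17417, 17508), (241, 17423, 17508), (242, 17443, 17508), (281, 17419, 17417)])
(.leaf 17445 [(243, 17417, 17445), (175, 17423, 17417), (244, 17433, 17445), (245, 17443, 17445), (246, 17508, 17445), (281, 17419, 17417)]))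
(.leaf 17445 [(244, 17433, 17445), (245, 17443, 17445), (216, 17464, 17443), (246, 17508, 17445), (247, 17476, 17445), (248, 17505, 17445), (283, 17507, 17505)])))
(.x (.y (.leaf 17443 [(220, 17438, 17443), (223, 17445, 17443), (216, 17464, 17443), (230, 17476, 17464), (231, 17480, 17464), (229, 17414, 17464), (279, 19463, 17414)])
(.x (.y (.leaf 17464 [(229, 17414, 17464), (233, 17443, 17464), (223, 17445, 17443), (230, 17476, 17464), (236, 17480, 17414), (279, 19463, 17414)])
(.leaf 17414 [(237, 17464, 17414), (233, 17443, 17464), (249, 17476, 17414), (279, 19463, 17414)]))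
(.leaf 17476 [(250, 17414, 17476), (251, 17443, 17476), (252, 17445, 17476), (253, 17464, 17476), (279, 19463, 17414)])))
(.y (.leaf 17445 [(244, 17433, 17445), (245, 17443, 17445), (247, 17476, 17445), (248, 17505, 17445), (253, 17464, 17476), (283, 17507, 17505)])
(.x (.leaf 17476 [(250, 17414, 17476), (251, 17443, 17476), (252, 17445, 17476), (253, 17464, 17476), (254, 17505, 17476), (279, 19463, 17414), (283, 17507, 17505)])
(.y (.leaf 17476 [(250, 17414, 17476), (252, 17445, 17476), (254, 17505, 17476), (244, 17433, 17445), (279, 19463, 17414), (283, 17507, 17505)])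
(.leaf 17414 [(238, 19588, 17414), (249, 17476, 17414), (252, 17445, 17476), (255, 17505, 17414), (278, 17413, 19588), (279, 19463, 17414), (283, 17507, 17505)]))))))
(.y (.x (.y (.x (.leaf 17445 [(243, 17417, 17445), (244, 17433, 17445), (246, 17508, 17445), (281, 17419, 17417)])
(.leaf 17433 [(256, 17417, 17433), (257, 17445, 17433), (258, 17512, 17433), (281, 17419, 17417)]))
(.leaf 17433 [(257, 17445, 17433), (247, 17476, 17445), (248, 17505, 17445), (246, 17508, 17445), (258, 17512, 17433), (259, 17472, 17433), (283, 17507, 17505)]))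
(.y (.x (.leaf 17433 [(256, 17417, 17433), (179, 17548, 17417), (257, 17445, 17433), (258, 17512, 17433), (260, 17568, 17512), (281, 17419, 17417)])
(.leaf 17433 [(258, 17512, 17433), (260, 17568, 17512), (261, 17417, 17512), (262, 17548, 17512), (281, 17419, 17417)]))
(.leaf 17433 [(257, 17445, 17433), (259, 17472, 17433), (258, 17512, 17433), (263, 17568, 17433), (149, 17596, 17568)])))
(.x (.y (.leaf 17433 [(257, 17445, 17433), (259, 17472, 17433), (247, 17476, 17445), (264, 17505, 17433), (283, 17507, 17505)])
(.x (.leaf 17505 [(265, 19588, 17505), (266, 17414, 17505), (267, 17433, 17505), (268, 17445, 17505), (269, 17472, 17505), (270, 17476, 17505), (278, 17413, 19588), (279, 19463, 17414), (283, 17507, 17505)])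
(.y (.leaf 17505 [(265, 19588, 17505), (267, 17433, 17505), (268, 17445, 17505), (269, 17472, 17505), (270, 17476, 17505), (278, 17413, 19588), (283, 17507, 17505)])
(.leaf 17505 [(265, 19588, 17505), (235, 17414, 19588), (267, 17433, 17505), (269, 17472, 17505), (278, 17413, 19588), (279, 19463, 17414), (283, 17507, 17505)]))))
(.y (.leaf 17433 [(263, 17568, 17433), (257, 17445, 17433), (259, 17472, 17433), (264, 17505, 17433), (271, 19588, 17472), (272, 17596, 17472), (278, 17413, 19588), (283, 17507, 17505)])
(.leaf 17472 [(271, 19588, 17472), (201, 17433, 17472), (272, 17596, 17472), (202, 17568, 17596), (273, 17505, 17472), (278, 17413, 19588), (283, 17507, 17505)])))))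
(.x (.leaf 17414 [(226, 19460, 17414), (238, 19588, 17414), (237, 17464, 17414), (249, 17476, 17414), (236, 17480, 17414), (255, 17505, 17414), (267, 17433, 17505), (233, 17443, 17464), (252, 17445, 17476), (269, 17472, 17505), (278, 17285, 19460), (278, 17413, 19588), (279, 19463, 17414), (283, 17507, 17505)])
(.y (.x (.y (.x (.leaf 19588 [(235, 17414, 19588), (204, 17472, 19588), (249, 17476, 17414), (255, 17505, 17414), (278, 17413, 19588), (279, 19463, 17414), (283, 17507, 17505)])
(.leaf 19588 [(235, 17414, 19588), (204, 17472, 19588), (274, 17505, 19588), (278, 17413, 19588), (279, 19463, 17414), (283, 17507, 17505)]))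
(.leaf 19588 [(235, 17414, 19588), (274, 17505, 19588), (278, 17413, 19588), (279, 19463, 17414), (283, 17507, 17505)]))
(.leaf 19588 [(235, 17414, 19588), (203, 17596, 19588), (204, 17472, 19588), (274, 17505, 19588), (278, 17413, 19588), (279, 19463, 17414), (283, 17507, 17505)]))
(.leaf 19588 [(235, 17414, 19588), (209, 17542, 19588), (278, 17413, 19588), (279, 19463, 17414), (279, 19591, 17542)])))))))

/-- The point `r + sω` is the cusp `-d / c` of a matrix with lower row `(c, d)`. -/
structure CuspAt (g : GL (Fin 2) Zw) (r s : ℚ) : Prop where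
  re : (((g : Matrix (Fin 2) (Fin 2) Zw) 1 1).re : ℚ) =
    -(((g : Matrix (Fin 2) (Fin 2) Zw) 1 0).re * r -
      41 * ((g : Matrix (Fin 2) (Fin 2) Zw) 1 0).im * s)
  im : (((g : Matrix (Fin 2) (Fin 2) Zw) 1 1).im : ℚ) =
    -(((g : Matrix (Fin 2) (Fin 2) Zw) 1 0).re * s +
      ((g : Matrix (Fin 2) (Fin 2) Zw) 1 0).im * r + ((g : Matrix (Fin 2) (Fin 2) Zw) 1 0).im * s)

theorem nrm_cast (z : Zw) : (nrm z : ℚ) = (z.re : ℚ) ^ 2 + z.re * z.im + 41 * (z.im : ℚ) ^ 2 := by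
  simp [nrm]

theorem ht_rat (g : GL (Fin 2) Zw) :
    (ht g : ℚ) = (nrm ((g : Matrix (Fin 2) (Fin 2) Zw) 1 0) : ℚ) := by
  rw [← ht_cast]
  simp

theorem CuspAt.ht_mul {g : GL (Fin 2) Zw} {r s : ℚ} (hc : CuspAt g r s) {h : GL (Fin 2) Zw}
    {m : RawM} (hm : RawM.Is h m) : (ht (g * h) : ℚ) =
      ht g * ((QF.ofCol m.a m.c).eval (4096 * r + 2048) (4096 * s) / 16777216 + 1) := by
  rw [ht_rat, ht_rat, QF.eval_ofCol, mul_one_zero g hm, nrm_cast, nrm_cast]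
  simp only [QuadraticAlgebra.re_add, QuadraticAlgebra.im_add, QuadraticAlgebra.re_mul,
    QuadraticAlgebra.im_mul, RawZ.toZ]
  push_cast
  rw [hc.re, hc.im]
  ring

theorem CuspAt.lt_iff {g : GL (Fin 2) Zw} {r s : ℚ} (hc : CuspAt g r s) (h0 : 0 < ht g)
    {h : GL (Fin 2) Zw} {m : RawM} (hm : RawM.Is h m) :
    ht (g * h) < ht g ↔ (QF.ofCol m.a m.c).eval (4096 * r + 2048) (4096 * s) < 0 := by
  have h1 : (0 : ℚ) < ht g := by exact_mod_cast h0
  rw [← Nat.cast_lt (α := ℚ), hc.ht_mul hm]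
  constructor
  · intro h
    by_contra hn
    push Not at hn
    nlinarith [mul_nonneg h1.le hn]
  · intro h
    nlinarith [mul_neg_of_pos_of_neg h1 h]

theorem CuspAt.le_iff {g : GL (Fin 2) Zw} {r s : ℚ} (hc : CuspAt g r s) (h0 : 0 < ht g)
    {h : GL (Fin 2) Zw} {m : RawM} (hm : RawM.Is h m) :
    ht (g * h) ≤ ht g ↔ (QF.ofCol m.a m.c).eval (4096 * r + 2048) (4096 * s) ≤ 0 := by
  have h1 : (0 : ℚ) < ht g := by exact_mod_cast h0
  rw [← Nat.cast_le (α := ℚ), hc.ht_mul hm]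
  constructor
  · intro h
    by_contra hn
    push Not at hn
    nlinarith [mul_pos h1 hn]
  · intro h
    nlinarith [mul_nonneg h1.le (sub_nonneg.2 h)]

section Local

variable {E : Type*} [Group E] {S : Sys E} {g : GL (Fin 2) Zw} {r s : ℚ}

theorem rawT_mul_col (β : RawZ) (m : RawM) :
    ((rawT β).mul m).a = m.a.add (β.mul m.c) ∧ ((rawT β).mul m).c = m.c := by
  constructor
  · simp [rawT, RawM.mul, RawZ.add, RawZ.mul]
  · simp [rawT, RawM.mul, RawZ.add, RawZ.mul]

theorem is_tr (b : ℤ × ℤ) : RawM.Is (stdSys.tr b) (rawT b) := by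
  rw [std_tr]
  exact is_rawT b

theorem mids_sound (hc : CuspAt g r s) (h0 : 0 < ht g) {x0 x1 y0 y1 : ℕ}
    (hx0 : x0 ≤ 4096 * r + 2048) (hx1 : 4096 * r + 2048 ≤ x1) (hy0 : y0 ≤ 4096 * s)
    (hy1 : 4096 * s ≤ y1) {q : QF} (hq : q.eval (4096 * r + 2048) (4096 * s) ≤ 0) {β : RawZ}
    {p0 : (ℤ × ℤ) × DiscIx} (t : List ((ℤ × ℤ) × ℕ)) :
    ∀ {m : RawM} {x : GL (Fin 2) Zw} {y : E}, RawM.Is x m →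
      midsOk β q x0 x1 y0 y1 m t = true → (t.all fun p => Nat.blt p.2 108) = true →
      (t ≠ [] → ht (g * (stdSys.tr β * x)) < ht g) →
      Conn stdSys S ht 27 g p0 (stdSys.tr β * x) y →
      Conn stdSys S ht 27 g p0
        (stdSys.tr β * (x * (t.map fun p => stdSys.disc (p.1, dix p.2)).prod))
        (y * (t.map fun p => S.disc (p.1, dix p.2)).prod) := by
  induction t with
  | nil =>
    intro m x y _ _ _ _ h
    simpa using h
  | cons p t ih =>
    intro m x y hm hmid hv hlt h
    simp only [List.all_cons, Bool.and_eq_true, Nat.blt_eq] at hv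
    have hst : Conn stdSys S ht 27 g p0 (stdSys.tr β * (x * stdSys.disc (p.1, dix p.2)))
        (y * S.disc (p.1, dix p.2)) := by
      rw [← mul_assoc]
      refine Conn.step (p.1, dix p.2) ?_ h (hlt (List.cons_ne_nil _ _))
      change p.2 / 4 < 27
      omega
    have hm' := hm.mul (is_disc (p.1, dix p.2))
    rw [List.map_cons, List.map_cons, List.prod_cons, List.prod_cons, ← mul_assoc x, ← mul_assoc y]
    cases t with
    | nil => simpa using hst
    | cons p' t =>
      simp only [midsOk, Bool.and_eq_true] at hmid
      refine ih hm' hmid.2 hv.2 (fun _ => ?_) hst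
      rw [hc.lt_iff h0 ((is_tr β).mul hm'), (rawT_mul_col _ _).1, (rawT_mul_col _ _).2]
      exact QF.lower_sound hmid.1 hx0 hx1 hy0 hy1 hq

/-- If a disc does not increase the height then it is connected to `p0`. -/
def Good (S : Sys E) (g : GL (Fin 2) Zw) (p0 : (ℤ × ℤ) × DiscIx) (c : ℕ) : Prop :=
  ht (g * stdSys.disc (dec c)) ≤ ht g →
    Conn stdSys S ht 27 g p0 (stdSys.disc (dec c)) (S.disc (dec c))

theorem Sys.tr_mul_disc {F : Type*} [Group F] (S : Sys F) (β b : ℤ × ℤ) (k : DiscIx) :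
    S.tr β * S.disc (b, k) = S.disc (β + b, k) := by
  simp only [Sys.disc, Sys.tr_add, mul_assoc]

theorem link_sound (hc : CuspAt g r s) (h0 : 0 < ht g) {x0 x1 y0 y1 : ℕ}
    (hx0 : x0 ≤ 4096 * r + 2048) (hx1 : 4096 * r + 2048 ≤ x1) (hy0 : y0 ≤ 4096 * s)
    (hy1 : 4096 * s ≤ y1) {p0 : (ℤ × ℤ) × DiscIx} {l : Lk} {q q' : ℕ}
    (h : linkOk x0 x1 y0 y1 l q q' (qfOf q) (qfOf q') = true) (hv : l.valid = true)
    (hl0 : l.Holds stdSys) (hl : l.Holds S) (hg : Good S g p0 q') : Good S g p0 q := by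
  obtain ⟨k, w, b⟩ := l
  cases w with
  | nil => simp [linkOk] at h
  | cons p t =>
    simp only [linkOk, Bool.and_eq_true, Nat.beq_eq, decide_eq_true_eq] at h
    obtain ⟨hk, hk', hb1, hb2, ht'⟩ := h
    simp only [Lk.Holds, List.map_cons, List.prod_cons] at hl0 hl
    simp only [Lk.valid, List.all_cons, Bool.and_eq_true] at hv
    have hq : dec q = ((dec q).1, dix k) := by rw [← hk]; rfl
    have hq' : dec q' = ((dec q).1 + p.1, dix p.2) := by
      rw [← hk']
      refine Prod.ext (Prod.ext hb1 hb2) rfl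
    set β := (dec q).1 with hβ
    obtain ⟨c, hc1, hc2⟩ := stdSys.exists_bel_inv b
    have hc2 := hc2 S
    have e0 : stdSys.disc (dec q) = stdSys.tr β * (stdSys.disc (p.1, dix p.2) *
        (t.map fun p => stdSys.disc (p.1, dix p.2)).prod) * stdSys.bel c := by
      rw [hl0, hq, Sys.disc, mul_assoc, mul_assoc, hc1, mul_one]
    have e1 : S.disc (dec q) = S.disc (dec q') *
        (t.map fun p => S.disc (p.1, dix p.2)).prod * S.bel c := by
      rw [hq', ← Sys.tr_mul_disc, mul_assoc (S.tr β), hl, hq, Sys.disc, mul_assoc, mul_assoc, hc2,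
        mul_one]
    intro hle
    have hfq := (hc.le_iff h0 (is_disc (dec q))).1 hle
    cases t with
    | nil =>
      simp only [List.map_nil, List.prod_nil, mul_one] at e0 e1
      rw [Sys.tr_mul_disc, ← hq'] at e0
      rw [e0, e1]
      refine Conn.bmul c (hg ?_)
      rwa [e0, ← mul_assoc, ht_mul_bel] at hle
    | cons p' t =>
      simp only [Bool.and_eq_true] at ht'
      have hlt : ht (g * stdSys.disc (dec q')) < ht g := by
        rw [hc.lt_iff h0 (is_disc _)]
        exact QF.lower_sound ht'.1 hx0 hx1 hy0 hy1 hfq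
      have hconn := hg hlt.le
      rw [e0, e1]
      refine Conn.bmul c ?_
      have e2 : stdSys.disc (dec q') = stdSys.tr β * stdSys.disc (p.1, dix p.2) := by
        rw [hq', Sys.tr_mul_disc]
      refine mids_sound hc h0 hx0 hx1 hy0 hy1 hfq (p' :: t) (is_disc (p.1, dix p.2)) ht'.2 hv.2
        (fun _ => ?_) ?_
      · rwa [← e2]
      · rwa [← e2]

theorem leaf_sound (hc : CuspAt g r s) (h0 : 0 < ht g) {x0 x1 y0 y1 : ℕ}
    (hx0 : x0 ≤ 4096 * r + 2048) (hx1 : 4096 * r + 2048 ≤ x1) (hy0 : y0 ≤ 4096 * s)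
    (hy1 : 4096 * s ≤ y1) {p0 : (ℤ × ℤ) × DiscIx} {lk : BT Lk}
    (hlk : ∀ i l, lk.get i = some l → l.valid = true ∧ l.Holds stdSys ∧ l.Holds S)
    {L : List (ℕ × QF)} (hL : ∀ it ∈ L, it.2 = qfOf it.1) (ds : List (ℕ × ℕ × ℕ)) :
    ∀ {G : List (ℕ × QF)}, (∀ it ∈ G, it.2 = qfOf it.1 ∧ Good S g p0 it.1) →
      runLeaf lk L x0 x1 y0 y1 ds G = true → ∀ it ∈ L, Good S g p0 it.1 := by
  induction ds with
  | nil =>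
    intro G hG h it hit
    simp only [runLeaf, List.all_eq_true] at h
    obtain ⟨f, hf⟩ := Option.isSome_iff_exists.1 (h it hit)
    exact (hG _ (findQ_mem hf)).2
  | cons d ds ih =>
    obtain ⟨i, q, q'⟩ := d
    intro G hG h
    simp only [runLeaf] at h
    split at h
    · rename_i l f f' h1 h2 h3
      simp only [Bool.and_eq_true] at h
      have hf : f = qfOf q := hL _ (findQ_mem h2)
      obtain ⟨hf', hg'⟩ := hG _ (findQ_mem h3)
      simp only at hf' hg'
      subst hf hf'
      obtain ⟨a, b, c⟩ := hlk i l h1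
      have hq := link_sound hc h0 hx0 hx1 hy0 hy1 h.1 a b c hg'
      refine ih (fun it hit => ?_) h.2
      rcases List.mem_cons.1 hit with rfl | hit
      · exact ⟨rfl, hq⟩
      · exact hG it hit
    · cases h

theorem mem_near {x0 x1 y0 y1 : ℕ} {L : List (ℕ × QF)} {it : ℕ × QF}
    (h : it ∈ near x0 x1 y0 y1 L) : it ∈ L := by
  induction L with
  | nil => exact h
  | cons a L ih =>
    simp only [near] at h
    split at h
    · exact List.mem_cons_of_mem _ (ih h)
    · rcases List.mem_cons.1 h with rfl | h
      · simp
      · exact List.mem_cons_of_mem _ (ih h)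

theorem near_sound (hc : CuspAt g r s) (h0 : 0 < ht g) {x0 x1 y0 y1 : ℕ}
    (hx0 : x0 ≤ 4096 * r + 2048) (hx1 : 4096 * r + 2048 ≤ x1) (hy0 : y0 ≤ 4096 * s)
    (hy1 : 4096 * s ≤ y1) {p0 : (ℤ × ℤ) × DiscIx} {L : List (ℕ × QF)}
    (hL : ∀ it ∈ L, it.2 = qfOf it.1)
    (h : ∀ it ∈ near x0 x1 y0 y1 L, Good S g p0 it.1) : ∀ it ∈ L, Good S g p0 it.1 := by
  induction L with
  | nil => simp
  | cons a L ih =>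
    intro it hit
    simp only [near] at h
    rcases List.mem_cons.1 hit with rfl | hit
    · split at h
      · rename_i hd
        intro hle
        have h1 := QF.negBox_sound hd hx0 hx1 hy0 hy1
        have h2 := QF.disj_sound it.2 x0 x1 y0 y1 (4096 * r + 2048) (4096 * s)
        have h3 := (hc.le_iff h0 (is_disc (dec it.1))).1 hle
        rw [hL it (by simp)] at h1 h2
        change QF.eval (qfOf it.1) _ _ ≤ 0 at h3
        linarith
      · exact h it (by simp)
    · refine ih (fun it hit => hL it (by simp [hit])) (fun it hit => h it ?_) it hit
      split
      · exact hit
      · simp [hit]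

theorem check_sound (hc : CuspAt g r s) (h0 : 0 < ht g) {lk : BT Lk}
    (hlk : ∀ i l, lk.get i = some l → l.valid = true ∧ l.Holds stdSys ∧ l.Holds S) (t : Tr) :
    ∀ {x0 x1 y0 y1 : ℕ} {L : List (ℕ × QF)}, x0 ≤ 4096 * r + 2048 → 4096 * r + 2048 ≤ x1 →
    y0 ≤ 4096 * s → 4096 * s ≤ y1 → (∀ it ∈ L, it.2 = qfOf it.1) →
    t.check lk x0 x1 y0 y1 L = true → ∃ p0, (∃ f, (p0, f) ∈ L) ∧
      ht (g * stdSys.disc (dec p0)) < ht g ∧ ∀ it ∈ L, Good S g (dec p0) it.1 := by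
  have cl : ∀ {x0 x1 y0 y1 : ℕ} {L : List (ℕ × QF)}, x0 ≤ 4096 * r + 2048 →
      4096 * r + 2048 ≤ x1 → y0 ≤ 4096 * s → 4096 * s ≤ y1 → (∀ it ∈ L, it.2 = qfOf it.1) →
      (∃ p0, (∃ f, (p0, f) ∈ near x0 x1 y0 y1 L) ∧
      ht (g * stdSys.disc (dec p0)) < ht g ∧
        ∀ it ∈ near x0 x1 y0 y1 L, Good S g (dec p0) it.1) →
      ∃ p0, (∃ f, (p0, f) ∈ L) ∧
      ht (g * stdSys.disc (dec p0)) < ht g ∧ ∀ it ∈ L, Good S g (dec p0) it.1 := by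
    rintro x0 x1 y0 y1 L hx0 hx1 hy0 hy1 hL ⟨p0, ⟨f, hf⟩, h2, h3⟩
    exact ⟨p0, ⟨f, mem_near hf⟩, h2, near_sound hc h0 hx0 hx1 hy0 hy1 hL h3⟩
  induction t with
  | x a b iha ihb =>
    intro x0 x1 y0 y1 L hx0 hx1 hy0 hy1 hL h
    simp only [Tr.check, Bool.and_eq_true] at h
    refine cl hx0 hx1 hy0 hy1 hL ?_
    have hL' : ∀ it ∈ near x0 x1 y0 y1 L, it.2 = qfOf it.1 := fun it hit => hL it (mem_near hit)
    rcases le_total (4096 * r + 2048) (Nat.div (Nat.add x0 x1) 2 : ℕ) with hx | hx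
    · exact iha hx0 hx hy0 hy1 hL' h.1
    · exact ihb hx hx1 hy0 hy1 hL' h.2
  | y a b iha ihb =>
    intro x0 x1 y0 y1 L hx0 hx1 hy0 hy1 hL h
    simp only [Tr.check, Bool.and_eq_true] at h
    refine cl hx0 hx1 hy0 hy1 hL ?_
    have hL' : ∀ it ∈ near x0 x1 y0 y1 L, it.2 = qfOf it.1 := fun it hit => hL it (mem_near hit)
    rcases le_total (4096 * s) (Nat.div (Nat.add y0 y1) 2 : ℕ) with hx | hx
    · exact iha hx0 hx1 hy0 hx hL' h.1
    · exact ihb hx0 hx1 hx hy1 hL' h.2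
  | leaf p ds =>
    intro x0 x1 y0 y1 L hx0 hx1 hy0 hy1 hL h
    simp only [Tr.check] at h
    refine cl hx0 hx1 hy0 hy1 hL ?_
    have hL' : ∀ it ∈ near x0 x1 y0 y1 L, it.2 = qfOf it.1 := fun it hit => hL it (mem_near hit)
    split at h
    · cases h
    · rename_i f hf
      simp only [Bool.and_eq_true] at h
      have hfq : f = qfOf p := hL' _ (findQ_mem hf)
      refine ⟨p, ⟨f, findQ_mem hf⟩, ?_, ?_⟩
      · rw [hc.lt_iff h0 (is_disc _)]
        change QF.eval (qfOf p) _ _ < 0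
        rw [← hfq]
        exact QF.negBox_sound h.1 hx0 hx1 hy0 hy1
      · refine leaf_sound hc h0 hx0 hx1 hy0 hy1 hlk hL' ds (fun it hit => ?_) h.2
        rw [List.mem_singleton] at hit
        subst hit
        exact ⟨hfq, fun _ => Conn.base⟩

end Local

section Reduction

variable {E : Type*} [Group E] {S : Sys E}

theorem exists_cuspAt {g : GL (Fin 2) Zw} (h : 0 < ht g) : ∃ r s, CuspAt g r s := by
  set c := (g : Matrix (Fin 2) (Fin 2) Zw) 1 0 with hc
  set d := (g : Matrix (Fin 2) (Fin 2) Zw) 1 1 with hd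
  have hn : ((c.re : ℚ) ^ 2 + c.re * c.im + 41 * (c.im : ℚ) ^ 2) ≠ 0 := by
    rw [← nrm_cast, ← ht_rat]
    exact_mod_cast h.ne'
  obtain ⟨i, hi⟩ : ∃ i : ℚ, ((c.re : ℚ) ^ 2 + c.re * c.im + 41 * (c.im : ℚ) ^ 2) * i = 1 :=
    ⟨_, mul_inv_cancel₀ hn⟩
  refine ⟨-(d.re * (c.re + c.im) + 41 * (d.im * c.im)) * i, -(d.im * c.re - d.re * c.im) * i,
    ⟨?_, ?_⟩⟩
  · rw [← hc, ← hd]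
    linear_combination (-(d.re : ℚ)) * hi
  · rw [← hc, ← hd]
    linear_combination (-(d.im : ℚ)) * hi

theorem CuspAt.mul_bel {g : GL (Fin 2) Zw} {r s : ℚ} (hc : CuspAt g r s) (b : ℤ × ℤ) (e : Bool) :
    CuspAt (g * stdSys.bel (b, e, false)) (bsign e * (r - b.1)) (bsign e * (s - b.2)) := by
  have h1 := mul_one_zero g (is_bel (b, e, false))
  have h2 := mul_one_one g (is_bel (b, e, false))
  rw [rawBel_eq] at h1 h2
  constructor <;> rw [h1, h2] <;>
  cases e <;>
  · simp [RawZ.toZ, bsign, hc.re, hc.im]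
    try ring

theorem exists_box {g : GL (Fin 2) Zw} (h : 0 < ht g) : ∃ b e r s,
    CuspAt (g * stdSys.bel (b, e, false)) r s ∧ -(1 / 2) ≤ r ∧ r ≤ 1 / 2 ∧ 0 ≤ s ∧ s ≤ 1 / 2 := by
  obtain ⟨r, s, hc⟩ := exists_cuspAt h
  have hr := abs_le.1 (abs_sub_round r)
  have hs := abs_le.1 (abs_sub_round s)
  rcases le_total 0 (s - round s) with h0 | h0
  · refine ⟨(round r, round s), false, _, _, hc.mul_bel _ _, ?_⟩
    simp only [bsign]
    norm_num
    exact ⟨by linarith, by linarith, by linarith, by linarith⟩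
  · refine ⟨(round r, round s), true, _, _, hc.mul_bel _ _, ?_⟩
    simp only [bsign]
    norm_num
    exact ⟨by linarith, by linarith, by linarith, by linarith⟩

theorem Conn.bel_mul {g : GL (Fin 2) Zw} {p0 p1 : (ℤ × ℤ) × DiscIx}
    {b : (ℤ × ℤ) × Bool × Bool} (h0 : stdSys.bel b * stdSys.disc p0 = stdSys.disc p1)
    (h1 : S.bel b * S.disc p0 = S.disc p1) {x : GL (Fin 2) Zw} {y : E}
    (h : Conn stdSys S ht 27 (g * stdSys.bel b) p0 x y) :
    Conn stdSys S ht 27 g p1 (stdSys.bel b * x) (S.bel b * y) := by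
  induction h with
  | base => rw [h0, h1]; exact Conn.base
  | bmul c _ ih => rw [← mul_assoc, ← mul_assoc]; exact ih.bmul c
  | step p hp _ hx ih =>
    rw [← mul_assoc, ← mul_assoc]
    refine ih.step p hp ?_
    rwa [ht_mul_bel, mul_assoc] at hx

/-- The code of a disc. -/
def DiscIx.toNat (k : DiscIx) : ℕ := 4 * k.j + (if k.e then 2 else 0) + if k.s then 1 else 0

theorem dix_toNat (k : DiscIx) : dix k.toNat = k := by
  obtain ⟨s, j, e⟩ := k
  have h1 : ∀ a b : ℕ, b < 4 → (4 * j + b) / 4 = j ∧ (4 * j + b) % 2 = b % 2 ∧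
      (4 * j + b) / 2 % 2 = b / 2 := by omega
  cases s <;> cases e <;> simp only [DiscIx.toNat, dix, if_true, if_false, Bool.false_eq_true]
  · obtain ⟨a, b, c⟩ := h1 0 0 (by omega); simp only [add_zero] at *; rw [a, b, c]; rfl
  · obtain ⟨a, b, c⟩ := h1 0 2 (by omega); simp only [add_zero] at *; rw [a, b, c]; rfl
  · obtain ⟨a, b, c⟩ := h1 0 1 (by omega); simp only [add_zero] at *; rw [a, b, c]; rfl
  · obtain ⟨a, b, c⟩ := h1 0 3 (by omega); simp only [add_assoc] at *; rw [a, b, c]; rfl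

theorem toNat_lt {k : DiscIx} (h : k.j < 27) : k.toNat < 108 := by
  obtain ⟨s, j, e⟩ := k
  simp only at h
  cases s <;> cases e <;> simp [DiscIx.toNat] <;> omega

theorem near_center : ∀ k < 108,
    let l := (rawG (dix k)).c
    let m := (rawG (dix k)).a.mul (l.1 + l.2, -l.2)
    let n := l.1 * l.1 + l.1 * l.2 + 41 * (l.2 * l.2)
    1 ≤ n ∧ 2 * m.1 ≤ n ∧ -n ≤ 2 * m.1 ∧ 2 * m.2 ≤ n ∧ -n ≤ 2 * m.2 := by
  decide +kernel

theorem bound_of_le {g : GL (Fin 2) Zw} {r s : ℚ} (hc : CuspAt g r s) (h0 : 0 < ht g)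
    (hr0 : -(1 / 2) ≤ r) (hr1 : r ≤ 1 / 2) (hs0 : 0 ≤ s) (hs1 : s ≤ 1 / 2)
    {p : (ℤ × ℤ) × DiscIx} (hp : p.2.j < 27) (hle : ht (g * stdSys.disc p) ≤ ht g) :
    (-2 ≤ p.1.1 ∧ p.1.1 ≤ 2) ∧ -1 ≤ p.1.2 ∧ p.1.2 ≤ 1 := by
  rw [hc.le_iff h0 (is_disc p), QF.eval_ofCol, rawDisc, (rawT_mul_col _ _).1,
    (rawT_mul_col _ _).2] at hle
  have hk := near_center _ (toNat_lt hp)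
  rw [dix_toNat] at hk
  obtain ⟨⟨β1, β2⟩, k⟩ := p
  simp only [RawZ.add, RawZ.mul] at hle hk ⊢
  generalize (rawG k).c = l at *
  generalize (rawG k).a = m at *
  obtain ⟨l1, l2⟩ := l
  obtain ⟨m1, m2⟩ := m
  simp only at *
  obtain ⟨k1, k2, k3, k4, k5⟩ := hk
  set n : ℤ := l1 * l1 + l1 * l2 + 41 * (l2 * l2) with hn
  set a : ℤ := m1 * (l1 + l2) - 41 * (m2 * -l2) with ha
  set b : ℤ := m1 * -l2 + m2 * (l1 + l2) + m2 * -l2 with hb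
  have c1 : (1 : ℚ) ≤ n := by exact_mod_cast k1
  have c2 : (2 : ℚ) * a ≤ n := by exact_mod_cast k2
  have c3 : -(n : ℚ) ≤ 2 * a := by exact_mod_cast k3
  have c4 : (2 : ℚ) * b ≤ n := by exact_mod_cast k4
  have c5 : -(n : ℚ) ≤ 2 * b := by exact_mod_cast k5
  obtain ⟨X, hX⟩ : ∃ X : ℚ, X = n * (r - β1) - a := ⟨_, rfl⟩
  obtain ⟨Y, hY⟩ : ∃ Y : ℚ, Y = n * (s - β2) - b := ⟨_, rfl⟩
  have key : X ^ 2 + X * Y + 41 * Y ^ 2 ≤ n := by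
    push_cast at hle
    have e : X ^ 2 + X * Y + 41 * Y ^ 2 = n * (
        (l1 * r - 41 * l2 * s - (m1 + (β1 * l1 - 41 * (β2 * l2)))) ^ 2 +
        (l1 * r - 41 * l2 * s - (m1 + (β1 * l1 - 41 * (β2 * l2)))) *
          (l1 * s + l2 * r + l2 * s - (m2 + (β1 * l2 + β2 * l1 + β2 * l2))) +
        41 * (l1 * s + l2 * r + l2 * s - (m2 + (β1 * l2 + β2 * l1 + β2 * l2))) ^ 2) := by
      rw [hX, hY, ha, hb, hn]
      push_cast
      ring
    rw [e]
    nlinarith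
  have hX1 : 163 * X ^ 2 ≤ 164 * n := by nlinarith [sq_nonneg (82 * Y + X)]
  have hY1 : 163 * Y ^ 2 ≤ 4 * n := by nlinarith [sq_nonneg (2 * X + Y)]
  have hXn : |X| ≤ (101 / 100) * n := by
    rw [← sq_le_sq₀ (abs_nonneg _) (by positivity), sq_abs]; nlinarith
  have hYn : |Y| ≤ (1 / 6) * n := by
    rw [← sq_le_sq₀ (abs_nonneg _) (by positivity), sq_abs]; nlinarith
  rw [abs_le] at hXn hYn
  have hn0 : (0 : ℚ) < n := by linarith
  have i1 : r - β1 ≤ 151 / 100 := by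
    rw [← mul_le_mul_iff_right₀ hn0]; linarith
  have i2 : -(151 / 100) ≤ r - β1 := by
    rw [← mul_le_mul_iff_right₀ hn0]; linarith
  have i3 : s - β2 ≤ 2 / 3 := by
    rw [← mul_le_mul_iff_right₀ hn0]; linarith
  have i4 : -(2 / 3) ≤ s - β2 := by
    rw [← mul_le_mul_iff_right₀ hn0]; linarith
  have q1 : (β1 : ℚ) < ((3 : ℤ) : ℚ) := by push_cast; linarith
  have q2 : ((-3 : ℤ) : ℚ) < β1 := by push_cast; linarith
  have q3 : (β2 : ℚ) < ((2 : ℤ) : ℚ) := by push_cast; linarith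
  have q4 : ((-2 : ℤ) : ℚ) < β2 := by push_cast; linarith
  rw [Int.cast_lt] at q1 q2 q3 q4
  omega

theorem mem_rootList {p : (ℤ × ℤ) × DiscIx} (hp : p.2.j < 27)
    (h : (-2 ≤ p.1.1 ∧ p.1.1 ≤ 2) ∧ -1 ≤ p.1.2 ∧ p.1.2 ≤ 1) :
    ∃ it ∈ rootList, dec it.1 = p := by
  obtain ⟨⟨β1, β2⟩, k⟩ := p
  simp only at h hp
  have hk := toNat_lt hp
  obtain ⟨u, hu⟩ : ∃ u : ℕ, β1 = (u : ℤ) - 2 := ⟨(β1 + 2).toNat, by omega⟩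
  obtain ⟨v, hv⟩ : ∃ v : ℕ, β2 = (v : ℤ) - 1 := ⟨(β2 + 1).toNat, by omega⟩
  refine ⟨_, List.mem_map.2 ⟨k.toNat + 108 * (u + 5 * v), List.mem_range.2 (by omega), rfl⟩, ?_⟩
  have e1 : (k.toNat + 108 * (u + 5 * v)) % 108 = k.toNat := by omega
  have e2 : (k.toNat + 108 * (u + 5 * v)) / 108 % 5 = u := by omega
  have e3 : (k.toNat + 108 * (u + 5 * v)) / 540 = v := by omega
  simp only [e1, e2, e3]
  generalize hK : k.toNat = K at *
  have f1 : (K + 128 * (u + 6 + 16 * (v + 7))) % 128 = K := by omega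
  have f2 : (K + 128 * (u + 6 + 16 * (v + 7))) / 128 % 16 = u + 6 := by omega
  have f3 : (K + 128 * (u + 6 + 16 * (v + 7))) / 2048 = v + 7 := by omega
  rw [dec, f1, f2, f3, ← hK, dix_toNat]
  refine Prod.ext (Prod.ext ?_ ?_) rfl
  · simp only [Int.ofNat_eq_natCast]; push_cast; omega
  · simp only [Int.ofNat_eq_natCast]; push_cast; omega

theorem eq_of_mem_rootList {it : ℕ × QF} (h : it ∈ rootList) : it.2 = qfOf it.1 := by
  obtain ⟨i, -, rfl⟩ := List.mem_map.1 h
  rfl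

theorem valid_of_mem_rootList {it : ℕ × QF} (h : it ∈ rootList) : (dec it.1).2.j < 27 := by
  obtain ⟨i, -, rfl⟩ := List.mem_map.1 h
  change (i % 108 + 128 * (i / 108 % 5 + 6 + 16 * (i / 540 + 7))) % 128 / 4 < 27
  omega

theorem geo_of_check {lk : BT Lk} {t : Tr} (ht' : t.check lk 0 4096 0 2048 rootList = true)
    (hlk : ∀ i l, lk.get i = some l → l.valid = true ∧ l.Holds stdSys ∧ l.Holds S) :
    Geo stdSys S ht 27 := by
  intro g hg
  obtain ⟨b, e, r, s, hc, hr0, hr1, hs0, hs1⟩ := exists_box hg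
  have hg' : 0 < ht (g * stdSys.bel (b, e, false)) := by rwa [ht_mul_bel]
  obtain ⟨q0, ⟨f, hf⟩, hlt, hall⟩ := check_sound (S := S) hc hg' hlk t
    (by push_cast; linarith) (by push_cast; linarith) (by push_cast; linarith)
    (by push_cast; linarith) (fun _ => eq_of_mem_rootList) ht'
  have hv := valid_of_mem_rootList hf
  simp only at hv
  generalize dec q0 = p0 at *
  have B0 := stdSys.bel_disc (b, e, false) p0
  have B1 := S.bel_disc (b, e, false) p0
  simp only [Sys.bel_zero, mul_one] at B0 B1
  set p1 : (ℤ × ℤ) × DiscIx := (b + flipBy e p0.1, ⟨xor e p0.2.s, p0.2.j, p0.2.e⟩) with hp1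
  refine ⟨p1, hv, ?_, fun p hp hle => ?_⟩
  · rw [ht_mul_bel] at hlt
    rwa [← B0, ← mul_assoc]
  · obtain ⟨c, hc1, hc2⟩ := stdSys.exists_bel_inv (b, e, false)
    have hc2 := hc2 S
    have D0 := stdSys.bel_disc c p
    have D1 := S.bel_disc c p
    set p' : (ℤ × ℤ) × DiscIx := (c.1 + flipBy c.2.1 p.1, ⟨xor c.2.1 p.2.s, p.2.j, p.2.e⟩) with hp'
    have F0 : stdSys.disc p =
        stdSys.bel (b, e, false) * stdSys.disc p' * stdSys.bel (0, false, c.2.2) := by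
      rw [mul_assoc, ← D0, ← mul_assoc, hc1, one_mul]
    have F1 : S.disc p = S.bel (b, e, false) * S.disc p' * S.bel (0, false, c.2.2) := by
      rw [mul_assoc, ← D1, ← mul_assoc, hc2, one_mul]
    have hle' : ht (g * stdSys.bel (b, e, false) * stdSys.disc p') ≤
        ht (g * stdSys.bel (b, e, false)) := by
      rw [F0, ← mul_assoc, ht_mul_bel, ← mul_assoc] at hle
      rwa [ht_mul_bel g]
    obtain ⟨it, hit, hdec⟩ := mem_rootList (p := p') hp
      (bound_of_le hc hg' hr0 hr1 hs0 hs1 (p := p') hp hle')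
    have hgood := hall it hit
    rw [Good, hdec] at hgood
    rw [F0, F1]
    exact (Conn.bel_mul B0 B1 (hgood hle')).bmul _

end Reduction

theorem check_boxTree : boxTree.check links 0 4096 0 2048 rootList = true := by decide +kernel

/-- Equality of matrices in coordinates. -/
def RawM.beq (x y : RawM) : Bool :=
  decide (x.a = y.a) && decide (x.b = y.b) && decide (x.c = y.c) && decide (x.d = y.d)

theorem RawM.eq_of_beq {x y : RawM} (h : x.beq y = true) : x = y := by
  obtain ⟨a, b, c, d⟩ := x
  obtain ⟨a', b', c', d'⟩ := y
  simp only [RawM.beq, Bool.and_eq_true, decide_eq_true_eq] at h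
  simp only [RawM.mk.injEq]
  tauto

/-- The relation holds for matrices. -/
def Lk.rawCheck (l : Lk) : Bool :=
  l.valid && ((l.w.map fun p => rawDisc (p.1, dix p.2)).foldl RawM.mul RawM.one).beq
    ((rawG (dix l.k)).mul (rawBel l.b))

theorem is_foldl (w : List ((ℤ × ℤ) × ℕ)) : ∀ {x : GL (Fin 2) Zw} {m : RawM}, RawM.Is x m →
    RawM.Is (x * (w.map fun p => stdSys.disc (p.1, dix p.2)).prod)
      ((w.map fun p => rawDisc (p.1, dix p.2)).foldl RawM.mul m) := by
  induction w with
  | nil => intro x m h; simpa using h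
  | cons p w ih =>
    intro x m h
    rw [List.map_cons, List.map_cons, List.prod_cons, ← mul_assoc]
    exact ih (h.mul (is_disc _))

theorem Lk.rawCheck_sound {l : Lk} (h : l.rawCheck = true) : l.valid = true ∧ l.Holds stdSys := by
  simp only [Lk.rawCheck, Bool.and_eq_true] at h
  refine ⟨h.1, ?_⟩
  have h1 := is_foldl l.w RawM.Is.one
  rw [one_mul, RawM.eq_of_beq h.2] at h1
  exact h1.ext ((is_g _).mul (is_bel _))

theorem rawCheck_links : links.all Lk.rawCheck = true := by decide +kernel

/-- Generators in a group satisfying all relations extend to a homomorphism from matrices. -/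
theorem exists_hom_of_links {E : Type*} [Group E] (S : Sys E)
    (h : ∀ i l, links.get i = some l → l.Holds S) :
    ∃ σ : GL (Fin 2) Zw →* E, (∀ b, σ (stdSys.bel b) = S.bel b) ∧
      ∀ p : (ℤ × ℤ) × DiscIx, p.2.j < 27 → σ (stdSys.disc p) = S.disc p := by
  have geo : Geo stdSys S ht 27 := geo_of_check check_boxTree fun i l hl =>
    have := Lk.rawCheck_sound (BT.all_get rawCheck_links hl)
    ⟨this.1, this.2, h i l hl⟩
  exact exists_extension geo ht_mul_bel (fun _ => exists_bel_of_ht) ht_one bel_injective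
    ht_disc_pos

theorem geo_std : Geo stdSys stdSys ht 27 := geo_of_check check_boxTree fun _ _ hl =>
  have := Lk.rawCheck_sound (BT.all_get rawCheck_links hl)
  ⟨this.1, this.2, this.2⟩

/-- A subgroup containing the standard generators is everything. -/
theorem mem_of_generators (K : Subgroup (GL (Fin 2) Zw)) (hb : ∀ b, stdSys.bel b ∈ K)
    (hd : ∀ p : (ℤ × ℤ) × DiscIx, p.2.j < 27 → stdSys.disc p ∈ K) (g : GL (Fin 2) Zw) :
    g ∈ K := by
  induction h : ht g using Nat.strong_induction_on generalizing g with
  | _ n ih =>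
    rcases Nat.eq_zero_or_pos (ht g) with h0 | h0
    · obtain ⟨b, rfl⟩ := exists_bel_of_ht h0
      exact hb b
    · obtain ⟨p, hp, hs, -⟩ := geo_std g h0
      have := ih _ (h ▸ hs) _ rfl
      exact (K.mul_mem_cancel_right (hd p hp)).1 this

namespace Sys

variable {E : Type*} [Group E] (S : Sys E)

/-- The generators other than `z`, numbered consecutively. -/
def gen : ℕ → E
  | 0 => S.t1
  | 1 => S.t2
  | 2 => S.d
  | j + 3 => S.a j

end Sys

theorem mem_of_gen (K : Subgroup (GL (Fin 2) Zw)) (hz : stdSys.z ∈ K)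
    (h : ∀ s < 30, stdSys.gen s ∈ K) (g : GL (Fin 2) Zw) : g ∈ K := by
  have h1 : stdSys.t1 ∈ K := h 0 (by norm_num)
  have h2 : stdSys.t2 ∈ K := h 1 (by norm_num)
  have h3 : stdSys.d ∈ K := h 2 (by norm_num)
  have ht : ∀ b, stdSys.tr b ∈ K := fun b => K.mul_mem (K.zpow_mem h1 _) (K.zpow_mem h2 _)
  have hdp : ∀ s, stdSys.dp s ∈ K := fun s => by
    cases s
    · exact K.one_mem
    · exact h3
  refine mem_of_generators K (fun b => ?_) (fun p hp => ?_) g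
  · refine K.mul_mem (K.mul_mem (ht _) (hdp _)) ?_
    cases b.2.2
    · exact K.one_mem
    · exact hz
  · refine K.mul_mem (ht _) (K.mul_mem (hdp _) ?_)
    have ha : stdSys.a p.2.j ∈ K := h (p.2.j + 3) (by omega)
    unfold Sys.letter
    split
    · exact K.inv_mem ha
    · exact ha

/-- Homomorphisms agreeing on generators are equal. -/
theorem hom_ext_gen {E : Type*} [Group E] {σ τ : GL (Fin 2) Zw →* E}
    (hz : σ stdSys.z = τ stdSys.z) (h : ∀ s < 30, σ (stdSys.gen s) = τ (stdSys.gen s)) : σ = τ :=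
  MonoidHom.ext fun g => mem_of_gen (σ.eqLocus τ) hz h g

/-- A word in numbered generators and their inverses. -/
abbrev Wd := List (ℕ × Bool)

/-- The value of a word. -/
def Wd.ev {E : Type*} [Group E] (γ : ℕ → E) : Wd → E
  | [] => 1
  | (s, b) :: w => (if b then (γ s)⁻¹ else γ s) * Wd.ev γ w

theorem Wd.ev_append {E : Type*} [Group E] (γ : ℕ → E) (v w : Wd) :
    Wd.ev γ (v ++ w) = Wd.ev γ v * Wd.ev γ w := by
  induction v with
  | nil => simp [Wd.ev]
  | cons p v ih => obtain ⟨s, b⟩ := p; simp [Wd.ev, ih, mul_assoc]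

/-- The power of a generator. -/
def Wd.pw (s : ℕ) : ℤ → Wd
  | Int.ofNat n => List.replicate n (s, false)
  | Int.negSucc n => List.replicate (n + 1) (s, true)

theorem Wd.ev_pw {E : Type*} [Group E] (γ : ℕ → E) (s : ℕ) (n : ℤ) :
    Wd.ev γ (Wd.pw s n) = γ s ^ n := by
  have h : ∀ (b : Bool) (k : ℕ), Wd.ev γ (List.replicate k (s, b)) =
      (if b then (γ s)⁻¹ else γ s) ^ k := by
    intro b k
    induction k with
    | zero => simp [Wd.ev]
    | succ k ih => rw [List.replicate_succ, Wd.ev, ih, pow_succ']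
  rcases n with n | n
  · simp [Wd.pw, h]
  · rw [Wd.pw, h]; simp

/-- The word of a translation. -/
def Wd.tr (b : ℤ × ℤ) : Wd := Wd.pw 0 b.1 ++ Wd.pw 1 b.2

/-- The word of a reflection. -/
def Wd.dp (s : Bool) : Wd := if s then [(2, false)] else []

/-- The word of `Sys.g`. -/
def Wd.g (k : DiscIx) : Wd := Wd.dp k.s ++ [(k.j + 3, k.e)]

/-- The word of the left hand side of a relation. -/
def Lk.lhs (l : Lk) : Wd := l.w.flatMap fun p => Wd.tr p.1 ++ Wd.g (dix p.2)

/-- The word of the right hand side of a relation, up to `z`. -/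
def Lk.rhs (l : Lk) : Wd := Wd.g (dix l.k) ++ (Wd.tr l.b.1 ++ Wd.dp l.b.2.1)

section
variable {E : Type*} [Group E] (S : Sys E)

theorem Wd.ev_tr (b : ℤ × ℤ) : Wd.ev S.gen (Wd.tr b) = S.tr b := by
  rw [Wd.tr, Wd.ev_append, Wd.ev_pw, Wd.ev_pw]; rfl

theorem Wd.ev_dp (s : Bool) : Wd.ev S.gen (Wd.dp s) = S.dp s := by
  cases s <;> simp [Wd.dp, Wd.ev, Sys.dp, Sys.gen]

theorem Wd.ev_g (k : DiscIx) : Wd.ev S.gen (Wd.g k) = S.g k := by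
  rw [Wd.g, Wd.ev_append, Wd.ev_dp]
  simp [Wd.ev, Sys.g, Sys.letter, Sys.gen]

theorem Lk.ev_lhs (l : Lk) :
    Wd.ev S.gen l.lhs = (l.w.map fun p => S.disc (p.1, dix p.2)).prod := by
  unfold Lk.lhs
  induction l.w with
  | nil => rfl
  | cons p w ih =>
    rw [List.flatMap_cons, Wd.ev_append, ih, Wd.ev_append, Wd.ev_tr, Wd.ev_g, List.map_cons,
      List.prod_cons]
    rfl

theorem Lk.ev_rhs (l : Lk) : Wd.ev S.gen l.rhs * S.zp l.b.2.2 = S.g (dix l.k) * S.bel l.b := by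
  rw [Lk.rhs, Wd.ev_append, Wd.ev_append, Wd.ev_tr, Wd.ev_g, Wd.ev_dp, Sys.bel, mul_assoc]

theorem Lk.holds_iff (l : Lk) :
    l.Holds S ↔ Wd.ev S.gen l.lhs = Wd.ev S.gen l.rhs * S.zp l.b.2.2 := by
  rw [Lk.ev_lhs, Lk.ev_rhs]; rfl

end

/-- Group elements together with functions, multiplied like values of cocycles. -/
@[ext] structure Coc (G A : Type*) where
  c : G → A
  x : G

namespace Coc

variable {G A : Type*} [Group G] [AddCommGroup A]

instance : Mul (Coc G A) := ⟨fun p q => ⟨fun g => p.c g + q.c (g * p.x), p.x * q.x⟩⟩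
instance : One (Coc G A) := ⟨⟨fun _ => 0, 1⟩⟩
instance : Inv (Coc G A) := ⟨fun p => ⟨fun g => -p.c (g * p.x⁻¹), p.x⁻¹⟩⟩

@[simp] theorem mul_c (p q : Coc G A) (g : G) : (p * q).c g = p.c g + q.c (g * p.x) := rfl
@[simp] theorem mul_x (p q : Coc G A) : (p * q).x = p.x * q.x := rfl
@[simp] theorem one_c (g : G) : (1 : Coc G A).c g = 0 := rfl
@[simp] theorem one_x : (1 : Coc G A).x = 1 := rfl
@[simp] theorem inv_c (p : Coc G A) (g : G) : p⁻¹.c g = -p.c (g * p.x⁻¹) := rfl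
@[simp] theorem inv_x (p : Coc G A) : p⁻¹.x = p.x⁻¹ := rfl

instance : Group (Coc G A) := Group.ofLeftAxioms
  (fun p q r => Coc.ext (funext fun g => by simp [add_assoc, mul_assoc]) (by simp [mul_assoc]))
  (fun p => Coc.ext (funext fun g => by simp) (by simp))
  (fun p => Coc.ext (funext fun g => by simp) (by simp))

/-- The underlying group element. -/
def xHom : Coc G A →* G := ⟨⟨Coc.x, rfl⟩, fun _ _ => rfl⟩

/-- Functoriality in the values. -/
def map {B : Type*} [AddCommGroup B] (π : A →+ B) : Coc G A →* Coc G B where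
  toFun p := ⟨fun g => π (p.c g), p.x⟩
  map_one' := Coc.ext (funext fun _ => by simp) rfl
  map_mul' p q := Coc.ext (funext fun _ => by simp) rfl

/-- The coboundary of a function. -/
def cob (H : G → A) : G →* Coc G A where
  toFun x := ⟨fun g => H (g * x) - H g, x⟩
  map_one' := Coc.ext (funext fun _ => by simp) rfl
  map_mul' p q := Coc.ext (funext fun _ => by simp [mul_assoc]) rfl

end Coc

/-- The change of sign given by a Boolean. -/
def bact {A : Type*} [AddCommGroup A] (e : Bool) (a : A) : A := if e then -a else a

section bact
variable {A : Type*} [AddCommGroup A]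

@[simp] theorem bact_false (a : A) : bact false a = a := rfl
@[simp] theorem bact_true (a : A) : bact true a = -a := rfl
theorem bact_xor (e f : Bool) (a : A) : bact (xor e f) a = bact e (bact f a) := by
  cases e <;> cases f <;> simp
theorem bact_add (e : Bool) (a b : A) : bact e (a + b) = bact e a + bact e b := by
  cases e <;> simp [add_comm]
@[simp] theorem bact_zero (e : Bool) : bact e (0 : A) = 0 := by cases e <;> simp
theorem bact_not (e : Bool) (a : A) : bact (!e) a = -bact e a := by cases e <;> simp
theorem bact_neg (e : Bool) (a : A) : bact e (-a) = -bact e a := by cases e <;> simp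
theorem map_bact {B : Type*} [AddCommGroup B] (π : A →+ B) (e : Bool) (a : A) :
    π (bact e a) = bact e (π a) := by cases e <;> simp
end bact

/-- Codes of the fifteen lines of the plane over the field with four elements, with a generator. -/
inductive St
  | s1 | s2 | s3 | s4 | s5 | s6 | s7 | s8 | s9 | s10 | s11 | s12 | s13 | s14 | s15

/-- Transitions between states, with signs, for generators and their inverses. -/
structure Walker where
  nx : ℕ → Bool → St → St
  sg : ℕ → Bool → St → Bool

/-- The edges traversed by a word. -/
def Walker.walk (t : Walker) : Wd → St → Bool → List (Bool × ℕ × St)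
  | [], _, _ => []
  | (s, false) :: w, n, e => (e, s, n) :: t.walk w (t.nx s false n) (xor e (t.sg s false n))
  | (s, true) :: w, n, e =>
    (!xor e (t.sg s true n), s, t.nx s true n) ::
      t.walk w (t.nx s true n) (xor e (t.sg s true n))

/-- The signed sum of values along edges. -/
def lsum {A : Type*} [AddCommGroup A] (y : ℕ → St → A) (l : List (Bool × ℕ × St)) : A :=
  (l.map fun p => bact p.1 (y p.2.1 p.2.2)).sum

/-- States of group elements compatible with transitions. -/
structure Walker.Compat (t : Walker) (n : GL (Fin 2) Zw → St) (e : GL (Fin 2) Zw → Bool) : Prop where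
  nx : ∀ s < 30, ∀ g, n (g * stdSys.gen s) = t.nx s false (n g)
  sg : ∀ s < 30, ∀ g, e (g * stdSys.gen s) = xor (e g) (t.sg s false (n g))
  nxi : ∀ s < 30, ∀ g, n (g * (stdSys.gen s)⁻¹) = t.nx s true (n g)
  sgi : ∀ s < 30, ∀ g, e (g * (stdSys.gen s)⁻¹) = xor (e g) (t.sg s true (n g))
  nz : ∀ g, n (g * stdSys.z) = n g
  ez : ∀ g, e (g * stdSys.z) = e g

/-- All letters of a word exist. -/
def Wd.ok (w : Wd) : Prop := ∀ p ∈ w, p.1 < 30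

theorem Walker.Compat.ev_c {t : Walker} {n : GL (Fin 2) Zw → St} {e : GL (Fin 2) Zw → Bool}
    (ht : t.Compat n e) {A : Type*} [AddCommGroup A] {y : ℕ → St → A}
    {γ : ℕ → Coc (GL (Fin 2) Zw) A} (hx : ∀ s < 30, (γ s).x = stdSys.gen s)
    (hc : ∀ s < 30, ∀ g, (γ s).c g = bact (e g) (y s (n g))) :
    ∀ (w : Wd), w.ok → ∀ g, (Wd.ev γ w).c g = lsum y (t.walk w (n g) (e g)) := by
  intro w
  induction w with
  | nil => intro _ g; rfl
  | cons p w ih =>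
    intro hw g
    obtain ⟨s, b⟩ := p
    have hs : s < 30 := hw (s, b) (by simp)
    have ih' := ih fun p hp => hw p (by simp [hp])
    cases b
    · simp only [Wd.ev, Bool.false_eq_true, if_false, Coc.mul_c, Walker.walk, lsum, List.map_cons,
        List.sum_cons]
      rw [ih', hc s hs, hx s hs, ht.nx s hs, ht.sg s hs]
      rfl
    · simp only [Wd.ev, if_true, Coc.mul_c, Walker.walk, lsum, List.map_cons, List.sum_cons,
        Coc.inv_c, Coc.inv_x]
      rw [ih', hc s hs, hx s hs, ht.nxi s hs, ht.sgi s hs, bact_not]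
      rfl

theorem Wd.ev_x {A : Type*} [AddCommGroup A] {γ : ℕ → Coc (GL (Fin 2) Zw) A}
    (hx : ∀ s < 30, (γ s).x = stdSys.gen s) : ∀ (w : Wd), w.ok →
      (Wd.ev γ w).x = Wd.ev stdSys.gen w := by
  intro w
  induction w with
  | nil => intro _; rfl
  | cons p w ih =>
    intro hw
    obtain ⟨s, b⟩ := p
    have hs : s < 30 := hw (s, b) (by simp)
    have ih' := ih fun p hp => hw p (by simp [hp])
    cases b <;> simp [Wd.ev, ih', hx s hs]

theorem Wd.ok_append {v w : Wd} (hv : v.ok) (hw : w.ok) : (v ++ w).ok := by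
  intro p hp
  rcases List.mem_append.1 hp with h | h
  · exact hv p h
  · exact hw p h

theorem Wd.ok_pw {s : ℕ} (hs : s < 30) (n : ℤ) : (Wd.pw s n).ok := by
  intro p hp
  rcases n with n | n <;> rw [List.eq_of_mem_replicate hp] <;> exact hs

theorem Wd.ok_tr (b : ℤ × ℤ) : (Wd.tr b).ok :=
  ok_append (ok_pw (by norm_num) _) (ok_pw (by norm_num) _)

theorem Wd.ok_dp (s : Bool) : (Wd.dp s).ok := by
  intro p hp
  cases s
  · simp [Wd.dp] at hp
  · simp only [Wd.dp, if_true, List.mem_singleton] at hp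
    subst hp; norm_num

theorem Wd.ok_g {k : DiscIx} (hk : k.j < 27) : (Wd.g k).ok :=
  ok_append (ok_dp _) (by
    intro p hp
    rw [List.mem_singleton] at hp
    subst hp
    simp only; omega)

/-- All letters of a relation exist. -/
def Lk.ok (l : Lk) : Bool := Nat.blt l.k 108 && l.valid

theorem Lk.ok_lhs {l : Lk} (h : l.ok = true) : l.lhs.ok := by
  simp only [Lk.ok, Lk.valid, Bool.and_eq_true, List.all_eq_true] at h
  intro q hq
  obtain ⟨p, hp, hq⟩ := List.mem_flatMap.1 hq
  refine Wd.ok_append (Wd.ok_tr _) (Wd.ok_g ?_) q hq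
  have := Nat.le_of_ble_eq_true (h.2 p hp)
  simp only [dix]; omega

theorem Lk.ok_rhs {l : Lk} (h : l.ok = true) : l.rhs.ok := by
  simp only [Lk.ok, Bool.and_eq_true] at h
  refine Wd.ok_append (Wd.ok_g ?_) (Wd.ok_append (Wd.ok_tr _) (Wd.ok_dp _))
  have := Nat.le_of_ble_eq_true h.1
  simp only [dix]; omega

theorem ok_links : links.all Lk.ok = true := by decide +kernel

/-- The relations between translations and the reflection. -/
def basicRels : List (Wd × Wd) :=
  [([(0, false), (1, false)], [(1, false), (0, false)]),
   ([(2, false), (2, false)], []),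
   ([(2, false), (0, false)], [(0, true), (2, false)]),
   ([(2, false), (1, false)], [(1, true), (2, false)])]

/-- A numbered relation. -/
def rel (r : ℕ) : Wd × Wd :=
  if r < 4 then basicRels.getD r ([], []) else
    match links.get (r - 4) with
    | none => ([], [])
    | some l => (l.lhs, l.rhs)

theorem rel_ok (r : ℕ) : (rel r).1.ok ∧ (rel r).2.ok := by
  have h0 : ∀ q ∈ basicRels, (∀ p ∈ q.1, p.1 < 30) ∧ ∀ p ∈ q.2, p.1 < 30 := by
    decide
  have hn : Wd.ok [] := fun p hp => by cases hp
  unfold rel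
  split
  · rw [List.getD_eq_getElem?_getD]
    rcases hq : basicRels[r]? with _ | q
    · exact ⟨hn, hn⟩
    · exact h0 q (List.mem_of_getElem? hq)
  · rcases hl : links.get (r - 4) with _ | l
    · exact ⟨hn, hn⟩
    · exact ⟨l.ok_lhs (BT.all_get ok_links hl), l.ok_rhs (BT.all_get ok_links hl)⟩

theorem rel_std (r : ℕ) : Wd.ev stdSys.gen (rel r).1 = Wd.ev stdSys.gen (rel r).2 ∨
    Wd.ev stdSys.gen (rel r).1 = Wd.ev stdSys.gen (rel r).2 * stdSys.z := by
  have h0 : ∀ q ∈ basicRels, Wd.ev stdSys.gen q.1 = Wd.ev stdSys.gen q.2 := by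
    intro q hq
    simp only [basicRels, List.mem_cons, List.not_mem_nil, or_false] at hq
    rcases hq with rfl | rfl | rfl | rfl
    · simpa [Wd.ev, Sys.gen] using stdSys.comm.eq
    · simpa [Wd.ev, Sys.gen] using stdSys.dd
    · simpa [Wd.ev, Sys.gen] using stdSys.dt1
    · simpa [Wd.ev, Sys.gen] using stdSys.dt2
  unfold rel
  split
  · rw [List.getD_eq_getElem?_getD]
    rcases hq : basicRels[r]? with _ | q
    · exact Or.inl rfl
    · exact Or.inl (h0 q (List.mem_of_getElem? hq))
  · rcases hl : links.get (r - 4) with _ | l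
    · exact Or.inl rfl
    · have := (l.holds_iff stdSys).1 (Lk.rawCheck_sound (BT.all_get rawCheck_links hl)).2
      simp only
      rw [this]
      cases l.b.2.2
      · exact Or.inl (mul_one _)
      · exact Or.inr rfl

/-- Values on edges satisfy all relations. -/
def Solves (t : Walker) {A : Type*} [AddCommGroup A] (y : ℕ → St → A) : Prop :=
  ∀ r n, lsum y (t.walk (rel r).1 n false) = lsum y (t.walk (rel r).2 n false)

theorem Walker.walk_xor (t : Walker) {A : Type*} [AddCommGroup A] (y : ℕ → St → A) (w : Wd) :
    ∀ n e f, lsum y (t.walk w n (xor f e)) = bact f (lsum y (t.walk w n e)) := by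
  induction w with
  | nil => intro n e f; simp [lsum, Walker.walk]
  | cons p w ih =>
    intro n e f
    obtain ⟨s, b⟩ := p
    have hl : ∀ p l, lsum y (p :: l) = bact p.1 (y p.2.1 p.2.2) + lsum y l := fun p l => by
      simp [lsum]
    cases b
    · simp only [Walker.walk, hl, bact_add]
      rw [← ih, Bool.xor_assoc, bact_xor]
    · simp only [Walker.walk, hl, bact_add]
      rw [← ih, Bool.xor_assoc, bact_not, bact_xor, bact_not, bact_neg]

theorem Solves.of_hom {t : Walker} {n : GL (Fin 2) Zw → St} {e : GL (Fin 2) Zw → Bool}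
    (ht : t.Compat n e) {R : St → GL (Fin 2) Zw} (hR : ∀ m, n (R m) = m) (hR' : ∀ m, e (R m) = false)
    {A : Type*} [AddCommGroup A] {y : ℕ → St → A} {σ : GL (Fin 2) Zw →* Coc (GL (Fin 2) Zw) A}
    (hx : ∀ g, (σ g).x = g) (hz : ∀ g, (σ stdSys.z).c g = 0)
    (hc : ∀ s < 30, ∀ g, (σ (stdSys.gen s)).c g = bact (e g) (y s (n g))) : Solves t y := by
  intro r m
  have hev : ∀ w, Wd.ev (fun s => σ (stdSys.gen s)) w = σ (Wd.ev stdSys.gen w) := by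
    intro w
    induction w with
    | nil => simp [Wd.ev]
    | cons p w ih => obtain ⟨s, b⟩ := p; cases b <;> simp [Wd.ev, ih]
  have h := fun w hw => ht.ev_c (γ := fun s => σ (stdSys.gen s)) (fun s _ => hx _) hc w hw (R m)
  simp only [hR, hR', hev] at h
  rw [← h _ (rel_ok r).1, ← h _ (rel_ok r).2]
  rcases rel_std r with h1 | h1 <;> rw [h1]
  rw [map_mul, Coc.mul_c, hz, add_zero]

theorem Solves.exists_hom {t : Walker} {n : GL (Fin 2) Zw → St} {e : GL (Fin 2) Zw → Bool}
    (ht : t.Compat n e) {A : Type*} [AddCommGroup A] {y : ℕ → St → A} (hy : Solves t y) :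
    ∃ σ : GL (Fin 2) Zw →* Coc (GL (Fin 2) Zw) A, (σ stdSys.z = ⟨fun _ => 0, stdSys.z⟩) ∧
      ∀ s < 30, σ (stdSys.gen s) = ⟨fun g => bact (e g) (y s (n g)), stdSys.gen s⟩ := by
  let γ : ℕ → Coc (GL (Fin 2) Zw) A := fun s => ⟨fun g => bact (e g) (y s (n g)), stdSys.gen s⟩
  let ζ : Coc (GL (Fin 2) Zw) A := ⟨fun _ => 0, stdSys.z⟩
  have hγ : ∀ w : Wd, w.ok → ∀ g, (Wd.ev γ w).c g = lsum y (t.walk w (n g) (e g)) :=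
    ht.ev_c (fun _ _ => rfl) (fun _ _ _ => rfl)
  have hγx : ∀ w : Wd, w.ok → (Wd.ev γ w).x = Wd.ev stdSys.gen w := Wd.ev_x (fun _ _ => rfl)
  have hrel : ∀ r, (Wd.ev γ (rel r).1).c = (Wd.ev γ (rel r).2).c := by
    intro r
    funext g
    rw [hγ _ (rel_ok r).1, hγ _ (rel_ok r).2]
    have h1 := t.walk_xor y (rel r).1 (n g) false (e g)
    have h2 := t.walk_xor y (rel r).2 (n g) false (e g)
    rw [Bool.xor_false] at h1 h2
    rw [h1, h2, hy r]
  have hbas : ∀ r, r < 4 → Wd.ev stdSys.gen (rel r).1 = Wd.ev stdSys.gen (rel r).2 →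
      Wd.ev γ (rel r).1 = Wd.ev γ (rel r).2 := fun r _ h =>
    Coc.ext (hrel r) (by rw [hγx _ (rel_ok r).1, hγx _ (rel_ok r).2, h])
  have hzc : ∀ s, Commute ζ (γ s) := fun s => Coc.ext
    (funext fun g => by simp [ζ, γ, ht.nz, ht.ez])
    (by
      show stdSys.z * stdSys.gen s = stdSys.gen s * stdSys.z
      rcases s with _ | _ | _ | s
      · exact stdSys.zt1
      · exact stdSys.zt2
      · exact stdSys.zd
      · exact stdSys.za s)
  have b0 : γ 0 * γ 1 = γ 1 * γ 0 := by
    have h := hbas 0 (by norm_num)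
      (by simpa [Wd.ev, rel, basicRels, Sys.gen] using stdSys.comm.eq)
    simpa [Wd.ev, rel, basicRels] using h
  have b1 : γ 2 * γ 2 = 1 := by
    have h := hbas 1 (by norm_num)
      (by simpa [Wd.ev, rel, basicRels, Sys.gen] using stdSys.dd)
    simpa [Wd.ev, rel, basicRels] using h
  have b2 : γ 2 * γ 0 = (γ 0)⁻¹ * γ 2 := by
    have h := hbas 2 (by norm_num)
      (by simpa [Wd.ev, rel, basicRels, Sys.gen] using stdSys.dt1)
    simpa [Wd.ev, rel, basicRels] using h
  have b3 : γ 2 * γ 1 = (γ 1)⁻¹ * γ 2 := by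
    have h := hbas 3 (by norm_num)
      (by simpa [Wd.ev, rel, basicRels, Sys.gen] using stdSys.dt2)
    simpa [Wd.ev, rel, basicRels] using h
  let S : Sys (Coc (GL (Fin 2) Zw) A) :=
    { t1 := γ 0, t2 := γ 1, d := γ 2, z := ζ, a := fun j => γ (j + 3)
      comm := b0
      dd := b1
      dt1 := b2
      dt2 := b3
      zz := Coc.ext (funext fun g => by simp [ζ]) stdSys.zz
      zt1 := hzc _
      zt2 := hzc _
      zd := hzc _
      za := fun _ => hzc _ }
  have hgen : S.gen = γ := by funext s; rcases s with _ | _ | _ | s <;> rfl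
  obtain ⟨σ, hb, hd⟩ := exists_hom_of_links S (by
    intro i l hl
    rw [Lk.holds_iff, hgen]
    have h1 := hrel (i + 4)
    have e1 : rel (i + 4) = (l.lhs, l.rhs) := by simp [rel, hl]
    rw [e1] at h1
    have hok := BT.all_get ok_links hl
    have h2 := (l.holds_iff stdSys).1 (Lk.rawCheck_sound (BT.all_get rawCheck_links hl)).2
    refine Coc.ext (funext fun g => ?_) ?_
    · rw [Coc.mul_c, h1]
      cases l.b.2.2
      · simp [Sys.zp]
      · simp [Sys.zp, S, ζ]
    · rw [Coc.mul_x, hγx _ (l.ok_lhs hok), hγx _ (l.ok_rhs hok), h2]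
      cases l.b.2.2
      · simp [Sys.zp]
      · simp [Sys.zp, S, ζ])
  have h1 := hb ((1, 0), false, false)
  have h2 := hb ((0, 1), false, false)
  have h3 := hb (0, true, false)
  have h4 := hb (0, false, true)
  simp only [Sys.bel, Sys.tr, Sys.dp, Sys.zp] at h1 h2 h3 h4
  refine ⟨σ, by simpa using h4, fun s hs => ?_⟩
  rcases s with _ | _ | _ | s
  · have h : σ stdSys.t1 = S.t1 := by simpa using h1
    exact h
  · have h : σ stdSys.t2 = S.t2 := by simpa using h2
    exact h
  · have h : σ stdSys.d = S.d := by simpa using h3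
    exact h
  · have h := hd (0, ⟨false, s, false⟩) (by simp only; omega)
    have hk : σ (stdSys.a s) = S.a s := by
      simpa [Sys.disc, Sys.tr, Sys.g, Sys.dp, Sys.letter] using h
    exact hk

/-- A vector of `N` small integers packed in base `B` modulo `B ^ N`. -/
structure Packs (B N v m : ℕ) (c : ℕ → ℤ) : Prop where
  le : ∀ i, |c i| ≤ m
  zero : ∀ i, N ≤ i → c i = 0
  dvd : ((B ^ N : ℕ) : ℤ) ∣ v - ∑ i ∈ Finset.range N, c i * (B : ℤ) ^ i

namespace Packs

variable {B N v w m n : ℕ} {c d : ℕ → ℤ}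

theorem add (h : Packs B N v m c) (h' : Packs B N w n d) :
    Packs B N (v + w) (m + n) (c + d) where
  le i := by
    have := h.le i
    have := h'.le i
    have := abs_add_le (c i) (d i)
    push_cast
    exact this.trans (by linarith)
  zero i hi := by simp [h.zero i hi, h'.zero i hi]
  dvd := by
    have e : ((v + w : ℕ) : ℤ) - ∑ i ∈ Finset.range N, (c + d) i * (B : ℤ) ^ i =
        (v - ∑ i ∈ Finset.range N, c i * (B : ℤ) ^ i) +
          (w - ∑ i ∈ Finset.range N, d i * (B : ℤ) ^ i) := by
      simp only [Pi.add_apply, add_mul, Finset.sum_add_distrib]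
      push_cast
      ring
    rw [e]
    exact dvd_add h.dvd h'.dvd

theorem zero_vec : Packs B N 0 0 0 := ⟨fun _ => by simp, fun _ _ => rfl, by simp⟩

theorem nsmul (k : ℕ) (h : Packs B N v m c) : Packs B N (k * v) (k * m) (k • c) := by
  induction k with
  | zero => simpa using zero_vec
  | succ k ih =>
    rw [succ_nsmul, Nat.succ_mul, Nat.succ_mul]
    exact ih.add h

theorem mod (h : Packs B N v m c) : Packs B N (v % B ^ N) m c where
  le := h.le
  zero := h.zero
  dvd := by
    have e : ((v % B ^ N : ℕ) : ℤ) - ∑ i ∈ Finset.range N, c i * (B : ℤ) ^ i =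
        (v - ∑ i ∈ Finset.range N, c i * (B : ℤ) ^ i) -
          ((v : ℤ) - (v : ℤ) % ((B ^ N : ℕ) : ℤ)) := by
      push_cast
      ring
    rw [e]
    exact dvd_sub h.dvd Int.dvd_self_sub_emod

theorem neg_mod (hB : 0 < B) (h : Packs B N v m c) : Packs B N (B ^ N - v % B ^ N) m (-c) where
  le i := by simpa using h.le i
  zero i hi := by simp [h.zero i hi]
  dvd := by
    have e : ((B ^ N - v % B ^ N : ℕ) : ℤ) - ∑ i ∈ Finset.range N, (-c) i * (B : ℤ) ^ i =
        -((v % B ^ N : ℕ) - ∑ i ∈ Finset.range N, c i * (B : ℤ) ^ i) + (B ^ N : ℕ) := by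
      rw [Nat.cast_sub (Nat.mod_lt _ (pow_pos hB N)).le]
      simp only [Pi.neg_apply, neg_mul, Finset.sum_neg_distrib]
      ring
    rw [e]
    exact dvd_add (dvd_neg.2 h.mod.dvd) dvd_rfl

theorem single {j : ℕ} (hj : j < N) : Packs B N (B ^ j) 1 (Pi.single j 1) where
  le i := by
    by_cases h : i = j
    · subst h; simp
    · simp [Pi.single_eq_of_ne h]
  zero i hi := Pi.single_eq_of_ne (by omega) _
  dvd := by
    rw [Finset.sum_eq_single j]
    · simp
    · intro b _ hb
      simp [Pi.single_eq_of_ne hb]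
    · intro h
      exact absurd (Finset.mem_range.2 hj) h

theorem eq_zero_of_dvd (h : Packs B N v m c) (hm : 2 * m < B) {r : ℕ} (hr : r ≤ N)
    (hv : B ^ r ∣ v) : ∀ i < r, c i = 0 := by
  have hs : ((B ^ r : ℕ) : ℤ) ∣ ∑ i ∈ Finset.range N, c i * (B : ℤ) ^ i := by
    have h1 : ((B ^ r : ℕ) : ℤ) ∣ v - ∑ i ∈ Finset.range N, c i * (B : ℤ) ^ i :=
      (Int.natCast_dvd_natCast.2 (pow_dvd_pow B hr)).trans h.dvd
    have h2 : ((B ^ r : ℕ) : ℤ) ∣ v := Int.natCast_dvd_natCast.2 hv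
    simpa using dvd_sub h2 h1
  intro i
  induction i using Nat.strong_induction_on with
  | _ i ih =>
    intro hi
    have h1 : (B : ℤ) ^ i * B ∣ ∑ i ∈ Finset.range N, c i * (B : ℤ) ^ i := by
      rw [← pow_succ]
      refine dvd_trans ?_ hs
      push_cast
      exact pow_dvd_pow _ hi
    have h2 : (B : ℤ) ^ i * B ∣ ∑ k ∈ (Finset.range N).erase i, c k * (B : ℤ) ^ k := by
      refine Finset.dvd_sum fun k hk => ?_
      rcases lt_trichotomy k i with hk' | hk' | hk'
      · rw [ih k hk' (hk'.trans hi), zero_mul]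
        exact dvd_zero _
      · exact absurd hk' (Finset.ne_of_mem_erase hk)
      · rw [← pow_succ]
        exact (pow_dvd_pow _ hk').mul_left _
    rw [← Finset.add_sum_erase _ _ (Finset.mem_range.2 (hi.trans_le hr))] at h1
    have h3 := (dvd_add_left h2).1 h1
    have hB : (B : ℤ) ^ i ≠ 0 := pow_ne_zero _ (by omega)
    rw [mul_comm (c i)] at h3
    have h4 := (mul_dvd_mul_iff_left hB).1 h3
    refine Int.eq_zero_of_abs_lt_dvd h4 ?_
    have := h.le i
    omega

theorem shift (hB : 0 < B) (h : Packs B N v m c) {r : ℕ} (hr : r ≤ N) (hv : B ^ r ∣ v)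
    (hc : ∀ i < r, c i = 0) : Packs B (N - r) (v / B ^ r) m (fun i => c (i + r)) where
  le i := h.le _
  zero i hi := h.zero _ (by omega)
  dvd := by
    obtain ⟨w, rfl⟩ := hv
    rw [Nat.mul_div_cancel_left _ (pow_pos hB r)]
    have h1 := h.dvd
    obtain ⟨k, rfl⟩ := Nat.exists_eq_add_of_le hr
    rw [Finset.sum_range_add, Finset.sum_eq_zero fun i hi => by
      rw [hc i (Finset.mem_range.1 hi), zero_mul], zero_add] at h1
    have h2 : ∑ x ∈ Finset.range k, c (r + x) * (B : ℤ) ^ (r + x) =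
        (B : ℤ) ^ r * ∑ x ∈ Finset.range k, c (x + r) * (B : ℤ) ^ x := by
      rw [Finset.mul_sum]
      refine Finset.sum_congr rfl fun x _ => ?_
      rw [add_comm x r]
      ring
    rw [h2] at h1
    push_cast at h1 ⊢
    rw [pow_add, ← mul_sub] at h1
    rw [Nat.add_sub_cancel_left]
    exact (mul_dvd_mul_iff_left (pow_ne_zero _ (by exact_mod_cast hB.ne'))).1 h1

end Packs

/-- The combination of `N` elements with integer coefficients. -/
def lin {A : Type*} [AddCommGroup A] (N : ℕ) (u : ℕ → A) : (ℕ → ℤ) →+ A where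
  toFun c := ∑ i ∈ Finset.range N, c i • u i
  map_zero' := by simp
  map_add' c d := by simp [add_smul, Finset.sum_add_distrib]

theorem lin_single {A : Type*} [AddCommGroup A] {N : ℕ} (u : ℕ → A) {j : ℕ} (hj : j < N) :
    lin N u (Pi.single j 1) = u j := by
  show ∑ i ∈ Finset.range N, _ = _
  rw [Finset.sum_eq_single j]
  · simp
  · intro b _ hb
    simp [Pi.single_eq_of_ne hb]
  · intro h
    exact absurd (Finset.mem_range.2 hj) h

theorem lin_shift {A : Type*} [AddCommGroup A] {N r : ℕ} (hr : r ≤ N) (u : ℕ → A) {c : ℕ → ℤ}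
    (hc : ∀ i < r, c i = 0) :
    lin N u c = lin (N - r) (fun i => u (i + r)) (fun i => c (i + r)) := by
  obtain ⟨k, rfl⟩ := Nat.exists_eq_add_of_le hr
  show ∑ i ∈ Finset.range _, _ = ∑ i ∈ Finset.range _, _
  rw [Finset.sum_range_add, Finset.sum_eq_zero fun i hi => by
      rw [hc i (Finset.mem_range.1 hi), zero_smul], zero_add, Nat.add_sub_cancel_left]
  exact Finset.sum_congr rfl fun i _ => by rw [add_comm]

theorem map_lin {A C : Type*} [AddCommGroup A] [AddCommGroup C] (π : A →+ C) (N : ℕ) (u : ℕ → A)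
    (c : ℕ → ℤ) : π (lin N u c) = lin N (fun i => π (u i)) c := by
  show π (∑ i ∈ Finset.range N, _) = ∑ i ∈ Finset.range N, _
  rw [map_sum]
  exact Finset.sum_congr rfl fun i _ => map_zsmul _ _ _

theorem lin_smul {A : Type*} [AddCommGroup A] (N : ℕ) (u : ℕ → A) (s : ℕ) (c : ℕ → ℤ) :
    lin N (fun i => s • u i) c = s • lin N u c := by
  show ∑ i ∈ Finset.range N, _ = s • ∑ i ∈ Finset.range N, _
  rw [Finset.smul_sum]
  exact Finset.sum_congr rfl fun i _ => smul_comm _ _ _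

theorem lin_std {N : ℕ} {c : ℕ → ℤ} (hc : ∀ i, N ≤ i → c i = 0) :
    lin N (fun i => (Pi.single i 1 : ℕ → ℤ)) c = c := by
  funext j
  show (∑ i ∈ Finset.range N, c i • (Pi.single i 1 : ℕ → ℤ)) j = c j
  rw [Finset.sum_apply]
  by_cases hj : j < N
  · rw [Finset.sum_eq_single j]
    · simp
    · intro b _ hb
      simp [Pi.single_eq_of_ne hb.symm]
    · intro h
      exact absurd (Finset.mem_range.2 hj) h
  · rw [hc j (by omega)]
    refine Finset.sum_eq_zero fun i hi => ?_
    have : j ≠ i := by have := Finset.mem_range.1 hi; omega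
    simp [Pi.single_eq_of_ne this]

/-- Fifteen values indexed by states. -/
structure Row (α : Type) where
  (c1 c2 c3 c4 c5 c6 c7 c8 c9 c10 c11 c12 c13 c14 c15 : α)

namespace Row

variable {α : Type}

/-- The value at a state. -/
noncomputable def get (r : Row α) (n : St) : α :=
  Row.rec (fun a1 a2 a3 a4 a5 a6 a7 a8 a9 a10 a11 a12 a13 a14 a15 =>
    St.rec a1 a2 a3 a4 a5 a6 a7 a8 a9 a10 a11 a12 a13 a14 a15 n) r

/-- The row of values of a function. -/
def ofFn (f : St → α) : Row α := ⟨f .s1, f .s2, f .s3, f .s4, f .s5, f .s6, f .s7, f .s8, f .s9, f .s10, f .s11, f .s12, f .s13, f .s14, f .s15⟩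

@[simp] theorem get_ofFn (f : St → α) (n : St) : (ofFn f).get n = f n := by cases n <;> rfl

/-- Change one value and continue. -/
noncomputable def setK (r : Row α) (n : St) (a : α) (k : Row α → Bool) : Bool :=
  Row.rec (fun a1 a2 a3 a4 a5 a6 a7 a8 a9 a10 a11 a12 a13 a14 a15 => St.rec
    (k ⟨a, a2, a3, a4, a5, a6, a7, a8, a9, a10, a11, a12, a13, a14, a15⟩)
    (k ⟨a1, a, a3, a4, a5, a6, a7, a8, a9, a10, a11, a12, a13, a14, a15⟩)
    (k ⟨a1, a2, a, a4, a5, a6, a7, a8, a9, a10, a11, a12, a13, a14, a15⟩)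
    (k ⟨a1, a2, a3, a, a5, a6, a7, a8, a9, a10, a11, a12, a13, a14, a15⟩)
    (k ⟨a1, a2, a3, a4, a, a6, a7, a8, a9, a10, a11, a12, a13, a14, a15⟩)
    (k ⟨a1, a2, a3, a4, a5, a, a7, a8, a9, a10, a11, a12, a13, a14, a15⟩)
    (k ⟨a1, a2, a3, a4, a5, a6, a, a8, a9, a10, a11, a12, a13, a14, a15⟩)
    (k ⟨a1, a2, a3, a4, a5, a6, a7, a, a9, a10, a11, a12, a13, a14, a15⟩)
    (k ⟨a1, a2, a3, a4, a5, a6, a7, a8, a, a10, a11, a12, a13, a14, a15⟩)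
    (k ⟨a1, a2, a3, a4, a5, a6, a7, a8, a9, a, a11, a12, a13, a14, a15⟩)
    (k ⟨a1, a2, a3, a4, a5, a6, a7, a8, a9, a10, a, a12, a13, a14, a15⟩)
    (k ⟨a1, a2, a3, a4, a5, a6, a7, a8, a9, a10, a11, a, a13, a14, a15⟩)
    (k ⟨a1, a2, a3, a4, a5, a6, a7, a8, a9, a10, a11, a12, a, a14, a15⟩)
    (k ⟨a1, a2, a3, a4, a5, a6, a7, a8, a9, a10, a11, a12, a13, a, a15⟩)
    (k ⟨a1, a2, a3, a4, a5, a6, a7, a8, a9, a10, a11, a12, a13, a14, a⟩) n) r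

open Classical in
theorem of_setK {r : Row α} {n : St} {a : α} {k : Row α → Bool} (h : r.setK n a k = true) :
    ∃ r' : Row α, k r' = true ∧ ∀ m, r'.get m = if m = n then a else r.get m := by
  cases n <;> exact ⟨_, h, fun m => by cases m <;> simp [get]⟩

/-- Evaluate all values and continue. -/
noncomputable def forceK (fe : α → (α → Bool) → Bool) (r : Row α) (k : Row α → Bool) : Bool :=
  fe r.c1 fun a1 =>
  fe r.c2 fun a2 =>
  fe r.c3 fun a3 =>
  fe r.c4 fun a4 =>
  fe r.c5 fun a5 =>
  fe r.c6 fun a6 =>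
  fe r.c7 fun a7 =>
  fe r.c8 fun a8 =>
  fe r.c9 fun a9 =>
  fe r.c10 fun a10 =>
  fe r.c11 fun a11 =>
  fe r.c12 fun a12 =>
  fe r.c13 fun a13 =>
  fe r.c14 fun a14 =>
  fe r.c15 fun a15 =>
  k ⟨a1, a2, a3, a4, a5, a6, a7, a8, a9, a10, a11, a12, a13, a14, a15⟩

theorem forceK_eq {fe : α → (α → Bool) → Bool} (h : ∀ a k, fe a k = k a) (r : Row α)
    (k : Row α → Bool) : forceK fe r k = k r := by simp [forceK, h]

end Row

/-- A directed edge of the state graph, by target and sign. -/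
structure Ed where
  tgt : St
  sg : Bool

/-- Evaluate a state and continue. -/
def St.forceK (n : St) (k : St → Bool) : Bool :=
  match n with
  | .s1 => k .s1
  | .s2 => k .s2
  | .s3 => k .s3
  | .s4 => k .s4
  | .s5 => k .s5
  | .s6 => k .s6
  | .s7 => k .s7
  | .s8 => k .s8
  | .s9 => k .s9
  | .s10 => k .s10
  | .s11 => k .s11
  | .s12 => k .s12
  | .s13 => k .s13
  | .s14 => k .s14
  | .s15 => k .s15

theorem St.forceK_eq (n : St) (k : St → Bool) : n.forceK k = k n := by cases n <;> rfl

/-- Evaluate a Boolean and continue. -/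
noncomputable def forceB (b : Bool) (k : Bool → Bool) : Bool := Bool.rec (k false) (k true) b

theorem forceB_eq (b : Bool) (k : Bool → Bool) : forceB b k = k b := by cases b <;> rfl

/-- Evaluate a number and continue. -/
noncomputable def forceN (x : ℕ) (k : ℕ → Bool) : Bool :=
  Nat.rec (k 0) (fun m _ => k (Nat.succ m)) x

theorem forceN_eq (x : ℕ) (k : ℕ → Bool) : forceN x k = k x := by cases x <;> rfl

/-- What is known about a value on an edge: packed coefficients of it and of its negative, together
with a bound. -/
inductive Cl
  | unk
  | targ
  | known (p q m : ℕ)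

/-- Edges labelled by a generator and by its inverse, and values on the former. -/
structure Ent where
  f : Row Ed
  i : Row Ed
  c : Row Cl

/-- Look up a list entry and continue. -/
noncomputable def lookK {α : Type} (l : List α) : ℕ → (α → Bool) → Bool :=
  List.rec (fun _ _ => false) (fun e _ ih s k => Nat.rec (k e) (fun s _ => ih s k) s) l

theorem of_lookK {α : Type} {l : List α} {s : ℕ} {k : α → Bool} (h : lookK l s k = true) :
    ∃ e, l[s]? = some e ∧ k e = true := by
  induction l generalizing s with
  | nil => exact absurd h (by simp [lookK])
  | cons e l ih =>
    cases s with
    | zero => exact ⟨e, rfl, h⟩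
    | succ s => obtain ⟨e', h1, h2⟩ := ih h; exact ⟨e', by simpa using h1, h2⟩

/-- Change the value on an edge and continue. -/
noncomputable def setCK (n : St) (a : Cl) (l : List Ent) : ℕ → (List Ent → Bool) → Bool :=
  List.rec (fun _ _ => false) (fun e l ih s k => Nat.rec
    (Ent.rec (fun f i c => c.setK n a fun c' => k (⟨f, i, c'⟩ :: l)) e)
    (fun s _ => ih s fun l' => k (e :: l')) s) l

open Classical in
theorem of_setCK {n : St} {a : Cl} {l : List Ent} {s : ℕ} {k : List Ent → Bool}
    (h : setCK n a l s k = true) : ∃ l', k l' = true ∧ ∀ s' e', l'[s']? = some e' →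
      ∃ e, l[s']? = some e ∧ e'.f = e.f ∧ e'.i = e.i ∧
        ∀ m, e'.c.get m = if s' = s ∧ m = n then a else e.c.get m := by
  induction l generalizing s k with
  | nil => exact absurd h (by simp [setCK])
  | cons e l ih =>
    cases s with
    | zero =>
      obtain ⟨c', h1, h2⟩ := Row.of_setK (r := e.c) (n := n) (a := a)
        (k := fun c' => k (⟨e.f, e.i, c'⟩ :: l)) h
      refine ⟨_, h1, fun s' e' he => ?_⟩
      cases s' with
      | zero =>
        simp only [List.getElem?_cons_zero, Option.some.injEq] at he
        subst he
        exact ⟨e, rfl, rfl, rfl, fun m => by simpa using h2 m⟩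
      | succ s' => exact ⟨e', by simpa using he, rfl, rfl, fun m => by simp⟩
    | succ s =>
      obtain ⟨l', h1, h2⟩ := ih (k := fun l' => k (e :: l')) h
      refine ⟨_, h1, fun s' e' he => ?_⟩
      cases s' with
      | zero =>
        simp only [List.getElem?_cons_zero, Option.some.injEq] at he
        subst he
        exact ⟨e, rfl, rfl, rfl, fun m => by simp⟩
      | succ s' =>
        obtain ⟨e0, h3, h4⟩ := h2 s' e' (by simpa using he)
        exact ⟨e0, by simpa using h3, by simpa using h4⟩

/-- Decode a packed word. -/
def decW : ℕ → ℕ → Wd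
  | 0, _ => []
  | f + 1, w => match Nat.mod w 64 with
    | 0 => []
    | d + 1 => (Nat.div d 2, Nat.beq (Nat.mod d 2) 1) :: decW f (Nat.div w 64)

/-- Decode a packed word, look up its letters, and continue. -/
noncomputable def decK (db : List Ent) (f : ℕ) : ℕ → (List (Bool × Ent) → Bool) → Bool :=
  Nat.rec (fun _ k => k []) (fun _ ih w k => Nat.rec (k [])
    (fun d _ => lookK db (Nat.div d 2) fun e => forceB (Nat.beq (Nat.mod d 2) 1) fun b =>
      forceN (Nat.div w 64) fun w => ih w fun es => k ((b, e) :: es)) (Nat.mod w 64)) f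

theorem decK_succ (db : List Ent) (f w : ℕ) (k : List (Bool × Ent) → Bool) :
    decK db (f + 1) w k = match Nat.mod w 64 with
      | 0 => k []
      | d + 1 => lookK db (Nat.div d 2) fun e => forceB (Nat.beq (Nat.mod d 2) 1) fun b =>
        forceN (Nat.div w 64) fun w => decK db f w fun es => k ((b, e) :: es) := by
  change Nat.rec (motive := fun _ => Bool) _ _ (Nat.mod w 64) = _
  cases Nat.mod w 64 <;> rfl

/-- Letters with their entries. -/
def Resolves (db : List Ent) : List (Bool × Ent) → Wd → Prop :=
  List.Forall₂ fun p q => p.1 = q.2 ∧ db[q.1]? = some p.2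

theorem of_decK {db : List Ent} {f w : ℕ} {k : List (Bool × Ent) → Bool}
    (h : decK db f w k = true) : ∃ es, Resolves db es (decW f w) ∧ k es = true := by
  induction f generalizing w k with
  | zero => exact ⟨[], .nil, h⟩
  | succ f ih =>
    rw [decK_succ] at h
    unfold decW
    rcases hd : Nat.mod w 64 with _ | d
    · rw [hd] at h
      exact ⟨[], .nil, h⟩
    · rw [hd] at h
      obtain ⟨e, he, h⟩ := of_lookK h
      rw [forceB_eq, forceN_eq] at h
      obtain ⟨es, h1, h2⟩ := ih h
      exact ⟨_, .cons ⟨rfl, he⟩ h1, h2⟩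

/-- Add a value to a running total, which consists of packed coefficients, a bound, and the numbers
of occurrences of the target with either sign. -/
noncomputable def addC (c : Cl) (s : Bool) (p m P Q : ℕ) (k : ℕ → ℕ → ℕ → ℕ → Bool) : Bool :=
  Cl.rec false (Bool.rec (k p m (Nat.succ P) Q) (k p m P (Nat.succ Q)) s)
    (fun a b l => Bool.rec (k (Nat.add p a) (Nat.add m l) P Q)
      (k (Nat.add p b) (Nat.add m l) P Q) s) c

/-- Total the values along a word. -/
noncomputable def evalW (w : List (Bool × Ent)) : St → Bool → ℕ → ℕ → ℕ → ℕ →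
    (ℕ → ℕ → ℕ → ℕ → Bool) → Bool :=
  List.rec (fun _ _ p m P Q k => k p m P Q) (fun x _ ih n s p m P Q k =>
    Prod.rec (fun b e => Bool.rec
      (addC (e.c.get n) s p m P Q fun p m P Q =>
        Ed.rec (fun n' g => forceB (xor s g) fun s => ih n' s p m P Q k) (e.f.get n))
      (Ed.rec (fun n' g => forceB (xor s g) fun s => forceB (!s) fun s' =>
        addC (e.c.get n') s' p m P Q fun p m P Q => ih n' s p m P Q k) (e.i.get n)) b) x) w

section soundness

variable {A : Type*} [AddCommGroup A] (B N : ℕ) (u : ℕ → A)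

/-- The meaning of a cell. -/
def Cl.Sem (z : Option A) (a : A) : Cl → Prop
  | .unk => True
  | .targ => z = some a
  | .known p q m => ∃ c, Packs B N p m c ∧ Packs B N q m (-c) ∧ a = lin N u c

/-- The meaning of a running total. -/
def Totals (z : A) (p m P Q : ℕ) (a : A) : Prop :=
  ∃ c, Packs B N p m c ∧ a = lin N u c + ((P : ℤ) - Q) • z

/-- The meaning of a database of values. -/
def Db (t : Walker) (y : ℕ → St → A) (z : Option A) (db : List Ent) : Prop :=
  ∀ s (e : Ent), db[s]? = some e → ∀ n, e.f.get n = ⟨t.nx s false n, t.sg s false n⟩ ∧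
    e.i.get n = ⟨t.nx s true n, t.sg s true n⟩ ∧ (e.c.get n).Sem B N u z (y s n)

variable {B N u}

theorem Totals.of_addC {z : Option A} {a b : A} {c : Cl} (hc : c.Sem B N u z b) {s : Bool}
    {p m P Q : ℕ} (ha : Totals B N u (z.getD 0) p m P Q a) {k : ℕ → ℕ → ℕ → ℕ → Bool}
    (h : addC c s p m P Q k = true) :
    ∃ p m P Q, k p m P Q = true ∧ Totals B N u (z.getD 0) p m P Q (a + bact s b) := by
  obtain ⟨v, hv, rfl⟩ := ha
  cases c with
  | unk => simp [addC] at h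
  | targ =>
    simp only [Cl.Sem] at hc
    subst hc
    cases s
    · refine ⟨p, m, P + 1, Q, h, v, hv, ?_⟩
      simp only [bact_false, Option.getD_some]
      push_cast
      module
    · refine ⟨p, m, P, Q + 1, h, v, hv, ?_⟩
      simp only [bact_true, Option.getD_some]
      push_cast
      module
  | known p' q' m' =>
    obtain ⟨w, h1, h2, rfl⟩ := hc
    cases s
    · refine ⟨_, _, P, Q, h, v + w, hv.add h1, ?_⟩
      rw [map_add, bact_false]
      abel
    · refine ⟨_, _, P, Q, h, v + -w, hv.add h2, ?_⟩
      rw [map_add, map_neg, bact_true]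
      abel

theorem evalW_false {e : Ent} {n n' : St} {g : Bool} (he : e.f.get n = ⟨n', g⟩)
    (w : List (Bool × Ent)) (s : Bool) (p m P Q : ℕ) (k : ℕ → ℕ → ℕ → ℕ → Bool) :
    evalW ((false, e) :: w) n s p m P Q k = addC (e.c.get n) s p m P Q fun p m P Q =>
      evalW w n' (xor s g) p m P Q k := by
  have h : evalW ((false, e) :: w) n s p m P Q k = addC (e.c.get n) s p m P Q fun p m P Q =>
      Ed.rec (fun n' g => forceB (xor s g) fun s => evalW w n' s p m P Q k) (e.f.get n) := rfl
  simp only [h, he, forceB_eq]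

theorem evalW_true {e : Ent} {n n' : St} {g : Bool} (he : e.i.get n = ⟨n', g⟩)
    (w : List (Bool × Ent)) (s : Bool) (p m P Q : ℕ) (k : ℕ → ℕ → ℕ → ℕ → Bool) :
    evalW ((true, e) :: w) n s p m P Q k = addC (e.c.get n') (!xor s g) p m P Q fun p m P Q =>
      evalW w n' (xor s g) p m P Q k := by
  have h : evalW ((true, e) :: w) n s p m P Q k = Ed.rec (fun n' g => forceB (xor s g) fun s =>
      forceB (!s) fun s' => addC (e.c.get n') s' p m P Q fun p m P Q =>
      evalW w n' s p m P Q k) (e.i.get n) := rfl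
  simp only [h, he, forceB_eq]

theorem Totals.of_evalW {t : Walker} {y : ℕ → St → A} {z : Option A} {db : List Ent}
    (hdb : Db B N u t y z db) {es : List (Bool × Ent)} {w : Wd} (hw : Resolves db es w) :
    ∀ {n : St} {s : Bool} {p m P Q : ℕ} {a : A} {k : ℕ → ℕ → ℕ → ℕ → Bool},
    Totals B N u (z.getD 0) p m P Q a → evalW es n s p m P Q k = true →
    ∃ p m P Q, k p m P Q = true ∧
      Totals B N u (z.getD 0) p m P Q (a + lsum y (t.walk w n s)) := by
  induction hw with
  | nil =>
    intro n s p m P Q a k ha h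
    exact ⟨p, m, P, Q, h, by simpa [lsum, Walker.walk] using ha⟩
  | @cons x q es w hx hw ih =>
    intro n s p m P Q a k ha h
    obtain ⟨b, e⟩ := x
    obtain ⟨j, b'⟩ := q
    obtain ⟨hb, he⟩ := hx
    simp only at hb he
    subst hb
    cases b
    · obtain ⟨e1, -, e3⟩ := hdb j e he n
      rw [evalW_false e1] at h
      obtain ⟨p, m, P, Q, h, ha⟩ := Totals.of_addC e3 ha h
      have := ih ha h
      rw [add_assoc] at this
      simpa [lsum, Walker.walk] using this
    · obtain ⟨-, e2, -⟩ := hdb j e he n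
      rw [evalW_true e2] at h
      obtain ⟨-, -, e3⟩ := hdb j e he (t.nx j true n)
      obtain ⟨p, m, P, Q, h, ha⟩ := Totals.of_addC e3 ha h
      have := ih ha h
      rw [add_assoc] at this
      simpa [lsum, Walker.walk] using this

theorem Db.of_set {t : Walker} {y : ℕ → St → A} {db : List Ent} (hdb : Db B N u t y none db)
    {s : ℕ} {n : St} {c : Cl} {z : Option A} (hc : c.Sem B N u z (y s n)) {k : List Ent → Bool}
    (h : setCK n c db s k = true) : ∃ db', k db' = true ∧ Db B N u t y z db' := by
  classical
  obtain ⟨db', h1, h2⟩ := of_setCK h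
  refine ⟨db', h1, fun s' e' he m => ?_⟩
  obtain ⟨e, h3, h4, h5, h6⟩ := h2 s' e' he
  obtain ⟨f1, f2, f3⟩ := hdb s' e h3 m
  refine ⟨by rw [h4, f1], by rw [h5, f2], ?_⟩
  rw [h6]
  split_ifs with hs
  · rw [hs.1, hs.2]
    exact hc
  · revert f3
    generalize e.c.get m = c'
    cases c' <;> simp [Cl.Sem]

end soundness

/-- The relations, as packed words. -/
def relCodes : List (List (ℕ × ℕ)) := [
  [(193, 67), (325, 0),
   (69, 322), (197, 324),
   (1839553, 135), (1843650, 71),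
   (125859847, 31), (128799, 27),
   (125597639, 32), (7622816, 350),
   (7217479, 353), (7362631, 2181),
   (571766917, 28), (2374663, 44),
   (43783, 240), (93185, 22341)],
  [(182085, 1349), (19424629185, 23749),
   (9460933, 44), (3052, 32),
   (18350887047, 23749), (97281, 24197),
   (3431621, 24197), (60613, 7941),
   (5005061, 158), (98668, 7941),
   (6577797, 22341), (639054146, 48),
   (11309296, 7), (132933, 20638),
   (2800, 31), (154625, 23749)],
  [(522056159, 7), (139615, 353),
   (2847, 48), (1008062786, 21765),
   (487969090, 31), (353751362, 48),
   (2907781, 24325), (6838085, 24197),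
   (2990431, 1285), (24780554561, 21829),
   (124865, 22341), (8765793, 327),
   (135521, 351), (131425, 2181),
   (571848837, 7), (129157, 353)],
  [(8671713, 347), (106843, 1285),
   (1755, 28), (8935557, 32),
   (30812, 22661), (1820, 27),
   (655704385, 21445), (6780165, 337),
   (103685, 347), (991248705, 22341),
   (6599941, 351), (1974619, 353),
   (111771, 17), (74693, 20624),
   (253030722, 17), (672461122, 21765)],
  [(3217, 46), (66625, 21445),
   (14524753, 1285), (71441, 27),
   (1105, 18), (115804, 18),
   (82268, 1669), (75474, 28),
   (1170, 17), (3952786, 336),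
   (538837472, 7), (2144, 22661),
   (3104, 44), (12337836, 7),
   (2965856, 1669), (5027461, 352)],
  [(99973, 1349), (79493, 348),
   (1452, 30), (8147102, 1861),
   (2284, 23749), (2907909, 24197),
   (55923203269, 20615), (3579068232002, 327),
   (12603550, 1349), (3742, 22149),
   (123230, 20640), (1374, 44),
   (82078, 24325), (3415813, 3269),
   (3694213, 23749), (404050242, 1320197)],
  [(95557, 1669), (177477, 1861),
   (193861, 20638), (10770053, 16),
   (5207685, 338), (14964357, 30),
   (14500178, 1669), (4477072, 965),
   (65872, 20626), (12079248, 1349),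
   (2704, 22149), (82064, 23045),
   (2962, 50), (202053, 965),
   (185669, 20624), (1360, 50)],
  [(205765, 1349), (6837189, 23173),
   (353694018, 46), (878, 53),
   (205173, 333), (2613, 166),
   (43281, 230), (1510, 13),
   (2048337, 11525), (11895791953, 53),
   (893934913, 709), (93057, 21445),
   (9461057, 2693), (9212134, 17),
   (949, 46), (3429185, 709)],
  [(1549, 38), (9714434757, 2693),
   (201037, 373), (3046, 1322245),
   (159910, 53), (717, 1319813),
   (2374034, 36), (118178130, 3333),
   (98660, 901), (48466, 1322373),
   (240901, 333), (249093, 9093),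
   (857484549, 337), (855932165, 338),
   (11558149, 36), (806628613, 38)],
  [(95109, 356), (233805, 3333),
   (185869189, 13), (9716388, 18),
   (2788, 23813), (2660, 1322373),
   (15475589, 3333), (147789, 343),
   (156549, 1541), (919, 37),
   (3469, 45), (3952813, 342),
   (1133, 49), (213825, 59),
   (123259, 5317), (3691397, 1319621)],
  [(217989, 369), (1073, 22),
   (1201, 45), (13652869, 57),
   (57714, 3461), (705965445, 36),
   (56709, 370), (1458, 16),
   (58167930245, 18), (159109, 6661),
   (185221, 3461), (907353477, 1319621),
   (191877, 901), (5003781, 144),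
   (2794181, 793093), (44175202821, 709)],
  [(14440965, 23173), (41943607941, 709),
   (14441093, 23045), (219423429, 21381),
   (6035973, 370), (9705989, 3461),
   (6576773, 21445), (3715394, 333),
   (404136258, 46), (9347394, 373),
   (299413826, 373), (1913, 22085),
   (15487685, 57), (521482949, 22085),
   (1243209802437, 3461), (538284741, 21701)],
  [(14963397, 59), (143703, 333),
   (5789121, 5317), (1623, 22),
   (219457, 39), (168279, 20653),
   (213349, 20655), (11294145, 379),
   (3437, 13), (11030701, 343),
   (1878, 43), (233815, 20655),
   (9509188, 9), (65895, 5317),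
   (869, 23), (4862531, 37)],
  [(195334337, 39), (1686, 23),
   (123222, 20655), (13389999, 357),
   (11566020, 9), (2372163, 266),
   (7622831, 342), (15225007, 343),
   (2031, 43), (221553, 901),
   (164209, 9733), (82070, 1320453),
   (54789, 355), (65878, 20653),
   (982, 49), (153093, 901)],
  [(320087557, 150), (10233349, 369),
   (194053, 20665), (91653, 1605),
   (209259, 355), (197099, 266),
   (2638468, 201), (1963, 22),
   (2091, 47), (156835, 266),
   (221539, 20649), (213347, 363),
   (246123, 9733), (57699, 1541),
   (2011715, 47), (9714307265, 16522)],
  [(2027786, 43), (4608266, 35),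
   (10805092610, 12361), (185861, 20649),
   (3897, 21189), (3321, 21381),
   (12603577, 1541), (21567133253, 709),
   (7362117, 21701), (87621, 1541),
   (7886405, 57), (4216389, 41),
   (21563463237, 3525), (194789514, 41),
   (164585, 16522), (12079273, 1541)],
  [(1001, 22085), (13914281, 355),
   (2601, 24005), (692413808778, 3525),
   (28009321669, 709), (7099589, 22085),
   (7607493, 379), (3937477, 359),
   (11558594, 343), (3771, 21189),
   (212674, 13), (352661826, 343),
   (28005651653, 3525), (3790390186242, 329),
   (923573701, 1327242), (303406533, 21701)],
  [(286604741, 22085), (10771909, 39),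
   (10247621, 41), (707686658, 9),
   (223682, 37), (2727, 24005),
   (10587771073, 19909), (7, 20933),
   (7, 8), (7, 20997),
   (37057, 1323589), (644, 84943493),
   (11, 12), (709, 773),
   (55, 56), (3525, 3589)]]

theorem relCodes_check : (List.range 288).all (fun r =>
    decide ((relCodes[r / 16]?.bind fun l => l[r % 16]?).map
      (fun w => (decW 40 w.1, decW 40 w.2)) = some (rel r))) = true := by
  decide +kernel

theorem relCodes_length : relCodes.length = 18 := by decide +kernel

theorem relCodes_eq {r : ℕ} (hr : r < 288) : (relCodes[r / 16]?.bind fun l => l[r % 16]?).map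
    (fun w => (decW 40 w.1, decW 40 w.2)) = some (rel r) :=
  of_decide_eq_true (List.all_eq_true.1 relCodes_check r (List.mem_range.2 hr))

/-- The tree has no entries from position `k` on. -/
def BT.small {α : Type} : BT α → ℕ → Bool
  | .nil, _ => true
  | .node _ l r, k => Nat.blt 0 k && (l.small (k / 2) && r.small ((k - 1) / 2))

theorem BT.get_of_small {α : Type} {t : BT α} {k i : ℕ} (h : t.small k = true) (hi : k ≤ i) :
    t.get i = none := by
  induction t generalizing k i with
  | nil => cases i <;> rfl
  | node v l r hl hr =>
    simp only [BT.small, Bool.and_eq_true] at h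
    have h0 := Nat.le_of_ble_eq_true h.1
    rcases i with _ | i
    · omega
    · simp only [BT.get]
      split
      · rename_i he
        have := Nat.eq_of_beq_eq_true he
        exact hl h.2.1 (by omega)
      · exact hr h.2.2 (by omega)

theorem small_links : links.small 284 = true := by decide +kernel

/-- Look up a relation and continue. -/
noncomputable def relK (r : ℕ) (k : ℕ → ℕ → Bool) : Bool :=
  lookK relCodes (Nat.div r 16) fun l => lookK l (Nat.mod r 16) fun w => match w with
    | (a, b) => k a b

theorem of_relK {r : ℕ} {k : ℕ → ℕ → Bool} (h : relK r k = true) :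
    ∃ a b, rel r = (decW 40 a, decW 40 b) ∧ k a b = true := by
  obtain ⟨l, hl, h⟩ := of_lookK h
  obtain ⟨⟨a, b⟩, hw, h⟩ := of_lookK h
  refine ⟨a, b, ?_, h⟩
  have h1 : r / 16 < 18 := by
    have := (List.getElem?_eq_some_iff.1 hl).1
    rwa [relCodes_length] at this
  have h2 := relCodes_eq (r := r) (by omega)
  rw [show relCodes[r / 16]? = some l from hl, Option.bind_some,
    show l[r % 16]? = some (a, b) from hw, Option.map_some] at h2
  exact (Option.some.inj h2).symm

theorem rel_cases (r : ℕ) : rel r = ([], []) ∨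
    ∃ l ∈ relCodes, ∃ w ∈ l, rel r = (decW 40 w.1, decW 40 w.2) := by
  by_cases hr : r < 288
  · right
    have h2 := relCodes_eq hr
    rw [Option.map_eq_some_iff] at h2
    obtain ⟨w, h3, h4⟩ := h2
    obtain ⟨l, h5, h6⟩ := Option.bind_eq_some_iff.1 h3
    exact ⟨l, List.mem_of_getElem? h5, w, List.mem_of_getElem? h6, h4.symm⟩
  · left
    have h : links.get (r - 4) = none := by
      exact BT.get_of_small small_links (by omega)
    unfold rel
    rw [if_neg (by omega), h]

/-- The states in order. -/
def stL : List St := [.s1, .s2, .s3, .s4, .s5, .s6, .s7, .s8, .s9, .s10, .s11, .s12, .s13, .s14, .s15]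

/-- The state with a given code. -/
def stOf (x : ℕ) : St := stL.getD x .s1

theorem of_lookK_stL {x : ℕ} {k : St → Bool} (h : lookK stL x k = true) : k (stOf x) = true := by
  obtain ⟨n, hn, h⟩ := of_lookK h
  rwa [stOf, List.getD_eq_getElem?_getD, hn, Option.getD_some]

/-- Total the values along both sides of a relation, the right hand side negatively. -/
noncomputable def rowK (db : List Ent) (r : ℕ) (n : St) (k : ℕ → ℕ → ℕ → ℕ → Bool) : Bool :=
  relK r fun a b => decK db 40 a fun es => decK db 40 b fun fs =>
    evalW es n false 0 0 0 0 fun p m P Q => evalW fs n true p m P Q k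

/-- Compute the value on one edge from a relation. -/
noncomputable def stepK (W : ℕ) (db : List Ent) (c : ℕ) (k : List Ent → Bool) : Bool :=
  lookK stL (Nat.mod c 16) fun m0 => forceN (Nat.mod (Nat.div c 16) 32) fun s =>
  lookK stL (Nat.mod (Nat.div c 512) 16) fun n => forceN (Nat.div c 8192) fun r =>
  setCK m0 .targ db s fun db' => rowK db' r n fun p m P Q =>
  forceN (Nat.mod p W) fun x => forceN (Nat.sub W x) fun x' => forceN m fun m =>
  match Nat.beq Q (Nat.succ P) with
  | true => setCK m0 (.known x x' m) db s k
  | false => match Nat.beq P (Nat.succ Q) with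
    | true => setCK m0 (.known x' x m) db s k
    | false => false

/-- Compute the values on many edges. -/
noncomputable def runK (W : ℕ) : List ℕ → List Ent → (List Ent → Bool) → Bool
  | [], db, k => k db
  | c :: l, db, k => stepK W db c fun db => runK W l db k

/-- Assign values to edges. -/
noncomputable def initK (W : ℕ) : List ℕ → List (ℕ × ℕ) → List Ent → (List Ent → Bool) → Bool
  | [], _, db, k => k db
  | _ :: _, [], _, _ => false
  | c :: l, (v, m) :: vs, db, k =>
    lookK stL (Nat.mod c 16) fun n => forceN (Nat.div c 16) fun s => forceN (Nat.mod v W) fun x =>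
    forceN (Nat.sub W x) fun x' => forceN m fun m =>
    setCK n (.known x x' m) db s fun db => initK W l vs db k

section soundness

variable {A : Type*} [AddCommGroup A] {B N : ℕ} {u : ℕ → A} {t : Walker} {y : ℕ → St → A}
  {db : List Ent}

theorem Totals.of_words {z : Option A} (hdb : Db B N u t y z db) {n : St} {a b : ℕ}
    {es fs : List (Bool × Ent)} (he : Resolves db es (decW 40 a)) (hf : Resolves db fs (decW 40 b))
    {k : ℕ → ℕ → ℕ → ℕ → Bool}
    (h : (evalW es n false 0 0 0 0 fun p m P Q => evalW fs n true p m P Q k) = true) :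
    ∃ p m P Q, k p m P Q = true ∧ Totals B N u (z.getD 0) p m P Q
      (lsum y (t.walk (decW 40 a) n false) - lsum y (t.walk (decW 40 b) n false)) := by
  have h0 : Totals B N u (z.getD 0) 0 0 0 0 0 := ⟨0, .zero_vec, by simp⟩
  obtain ⟨p, m, P, Q, h, h1⟩ := Totals.of_evalW hdb he h0 h
  obtain ⟨p, m, P, Q, h, h2⟩ := Totals.of_evalW hdb hf h1 h
  refine ⟨p, m, P, Q, h, ?_⟩
  have h3 := t.walk_xor y (decW 40 b) n false true
  rw [Bool.xor_false] at h3
  rwa [zero_add, h3, bact_true, ← sub_eq_add_neg] at h2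

theorem Totals.of_rowK (hy : Solves t y) {z : Option A} (hdb : Db B N u t y z db) {r : ℕ} {n : St}
    {k : ℕ → ℕ → ℕ → ℕ → Bool} (h : rowK db r n k = true) :
    ∃ p m P Q, k p m P Q = true ∧ Totals B N u (z.getD 0) p m P Q 0 := by
  obtain ⟨a, b, hr, h⟩ := of_relK h
  obtain ⟨es, he, h⟩ := of_decK h
  obtain ⟨fs, hf, h⟩ := of_decK h
  have h1 := Totals.of_words hdb he hf h
  have h2 := hy r n
  rw [hr] at h2
  rwa [h2, sub_self] at h1

theorem Db.of_stepK (hB : 0 < B) (hy : Solves t y) (hdb : Db B N u t y none db) {c : ℕ}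
    {k : List Ent → Bool} (h : stepK (B ^ N) db c k = true) :
    ∃ db', k db' = true ∧ Db B N u t y none db' := by
  have h := of_lookK_stL h
  rw [forceN_eq] at h
  have h := of_lookK_stL h
  rw [forceN_eq] at h
  obtain ⟨db', h, hdb'⟩ := Db.of_set (c := .targ) (z := some _) hdb rfl h
  obtain ⟨p, m, P, Q, h, v, hv, e⟩ := Totals.of_rowK hy hdb' h
  rw [forceN_eq, forceN_eq, forceN_eq] at h
  rw [Option.getD_some] at e
  have h1 := hv.mod
  have h2 := hv.neg_mod hB
  split at h
  · rename_i hQ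
    obtain rfl := Nat.eq_of_beq_eq_true hQ
    refine Db.of_set (z := none) (c := .known _ _ _) hdb ⟨v, h1, h2, ?_⟩ h
    rw [Nat.succ_eq_add_one, Nat.cast_add, Nat.cast_one, sub_add_cancel_left, neg_one_smul,
      ← sub_eq_add_neg] at e
    exact (sub_eq_zero.1 e.symm).symm
  · split at h
    · rename_i hP
      obtain rfl := Nat.eq_of_beq_eq_true hP
      refine Db.of_set (z := none) (c := .known _ _ _) hdb ⟨-v, h2, by rwa [neg_neg], ?_⟩ h
      rw [Nat.succ_eq_add_one, Nat.cast_add, Nat.cast_one, add_sub_cancel_left, one_smul] at e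
      rw [map_neg]
      exact (neg_eq_of_add_eq_zero_right e.symm).symm
    · exact absurd h (by simp)

theorem Db.of_runK (hB : 0 < B) (hy : Solves t y) {l : List ℕ} (hdb : Db B N u t y none db)
    {k : List Ent → Bool} (h : runK (B ^ N) l db k = true) :
    ∃ db', k db' = true ∧ Db B N u t y none db' := by
  induction l generalizing db with
  | nil => exact ⟨db, h, hdb⟩
  | cons c l ih =>
    obtain ⟨db', h, hdb'⟩ := Db.of_stepK hB hy hdb h
    exact ih hdb' h

/-- The value on a coded edge. -/
def edge (y : ℕ → St → A) (c : ℕ) : A := y (c / 16) (stOf (c % 16))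

/-- The meaning of a packed value. -/
def Means (B N : ℕ) (u : ℕ → A) (a : A) (v : ℕ × ℕ) : Prop :=
  ∃ c, Packs B N v.1 v.2 c ∧ a = lin N u c

theorem Db.of_initK (hB : 0 < B) {l : List ℕ} {vs : List (ℕ × ℕ)}
    (hl : List.Forall₂ (fun c v => Means B N u (edge y c) v) l vs) :
    ∀ {db : List Ent}, Db B N u t y none db →
    ∀ {k : List Ent → Bool}, initK (B ^ N) l vs db k = true →
    ∃ db', k db' = true ∧ Db B N u t y none db' := by
  induction hl with
  | nil => intro db hdb k h; exact ⟨db, h, hdb⟩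
  | @cons c v l vs hc hl ih =>
    intro db hdb k h
    have h := of_lookK_stL h
    rw [forceN_eq, forceN_eq, forceN_eq, forceN_eq] at h
    obtain ⟨w, h1, h2⟩ := hc
    obtain ⟨db', h, hdb'⟩ := Db.of_set (z := none) (c := .known _ _ _) hdb ⟨w, h1.mod, h1.neg_mod hB, h2⟩ h
    exact ih hdb' h

end soundness

/-- The position of a state. -/
def St.ix : St → ℕ
  | .s1 => 0
  | .s2 => 1
  | .s3 => 2
  | .s4 => 3
  | .s5 => 4
  | .s6 => 5
  | .s7 => 6
  | .s8 => 7
  | .s9 => 8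
  | .s10 => 9
  | .s11 => 10
  | .s12 => 11
  | .s13 => 12
  | .s14 => 13
  | .s15 => 14

/-- The parity of the bitwise product of two four-bit numbers. -/
def par (x y : ℕ) : Bool :=
  Nat.beq (Nat.mod (Nat.div 27030 (Nat.pow 2 (Nat.land x y))) 2) 1

/-- The edge leaving a state, in a table with eight bits per state. -/
def edT (a mask : ℕ) (n : St) : Ed :=
  ⟨stOf (Nat.mod (Nat.div a (Nat.pow 256 n.ix)) 16),
    par (Nat.mod (Nat.div a (Nat.pow 256 n.ix * 16)) 16) mask⟩

/-- The transitions of a pair of tables. -/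
def Walker.ofTab (tab : List (ℕ × ℕ)) (mask : ℕ) : Walker where
  nx s b n := (edT (bif b then (tab.getD s (0, 0)).2 else (tab.getD s (0, 0)).1) mask n).tgt
  sg s b n := (edT (bif b then (tab.getD s (0, 0)).2 else (tab.getD s (0, 0)).1) mask n).sg

/-- Evaluate an edge and continue. -/
noncomputable def Ed.forceK (e : Ed) (k : Ed → Bool) : Bool :=
  e.tgt.forceK fun n => forceB e.sg fun b => k ⟨n, b⟩

theorem Ed.forceK_eq (e : Ed) (k : Ed → Bool) : e.forceK k = k e := by
  simp [forceK, St.forceK_eq, forceB_eq]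

/-- The database without values. -/
noncomputable def dbK (mask : ℕ) : List (ℕ × ℕ) → (List Ent → Bool) → Bool
  | [], k => k []
  | (a, b) :: l, k => (Row.ofFn (edT a mask)).forceK Ed.forceK fun f =>
    (Row.ofFn (edT b mask)).forceK Ed.forceK fun i =>
    dbK mask l fun db => k (⟨f, i, Row.ofFn fun _ => .unk⟩ :: db)

theorem of_dbK {mask : ℕ} {tab : List (ℕ × ℕ)} {k : List Ent → Bool} (h : dbK mask tab k = true) :
    k (tab.map fun p => ⟨Row.ofFn (edT p.1 mask), Row.ofFn (edT p.2 mask),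
      Row.ofFn fun _ => .unk⟩) = true := by
  induction tab generalizing k with
  | nil => exact h
  | cons p l ih =>
    obtain ⟨a, b⟩ := p
    simp only [dbK, Row.forceK_eq Ed.forceK_eq] at h
    exact ih (k := fun db => k (_ :: db)) h

/-- Packed unit vectors, multiplied by `s`. -/
def units (B s : ℕ) : ℕ → ℕ → List (ℕ × ℕ)
  | 0, _ => []
  | n + 1, j => (Nat.mul s (Nat.pow B j), s) :: units B s n (Nat.succ j)

/-- Compute closed relations between the unit vectors. -/
noncomputable def coreK (W : ℕ) (db : List Ent) : List ℕ → (List (ℕ × ℕ × ℕ) → Bool) → Bool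
  | [], k => k []
  | c :: l, k => lookK stL (Nat.mod c 16) fun n => forceN (Nat.div c 16) fun r =>
    rowK db r n fun p m _ _ => forceN (Nat.mod p W) fun x => forceN (Nat.sub W x) fun x' =>
    forceN m fun m => coreK W db l fun cs => k ((x, x', m) :: cs)

/-- Add a combination of relations, with packed signed coefficients in base `D`. -/
noncomputable def dotK (D : ℕ) : List (ℕ × ℕ × ℕ) → ℕ → ℕ → ℕ → (ℕ → ℕ → Bool) → Bool
  | [], _, p, m, k => k p m
  | (x, x', l) :: cs, row, p, m, k => forceN (Nat.div row D) fun row' =>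
    forceN (Nat.mod row D) fun d => forceN (Nat.div d 2) fun e =>
    match Nat.mod d 2 with
    | 0 => forceN (Nat.add p (Nat.mul e x')) fun p => forceN (Nat.add m (Nat.mul e l)) fun m =>
      dotK D cs row' p m k
    | _ + 1 => forceN (Nat.add p (Nat.mul e x)) fun p => forceN (Nat.add m (Nat.mul e l)) fun m =>
      dotK D cs row' p m k

/-- Express multiples of the first unit vectors by the last ones. -/
noncomputable def pivK (B W Brk s D : ℕ) (cs : List (ℕ × ℕ × ℕ)) :
    List ℕ → ℕ → (List (ℕ × ℕ) → Bool) → Bool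
  | [], _, k => k []
  | row :: rows, i, k => dotK D cs row (Nat.mul s (Nat.pow B i)) s fun p m =>
    forceN (Nat.mod p W) fun x => match Nat.mod x Brk with
    | 0 => match Nat.blt (Nat.mul 2 m) B with
      | true => forceN (Nat.div x Brk) fun v => pivK B W Brk s D cs rows (Nat.succ i) fun vs =>
        k ((v, m) :: vs)
      | false => false
    | _ + 1 => false

/-- Test whether a packed vector vanishes. -/
def zeroK (B W p m : ℕ) : Bool :=
  match Nat.mod p W with
  | 0 => Nat.blt (Nat.mul 2 m) B
  | _ + 1 => false

/-- Test a relation at all states. -/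
noncomputable def vanK (B W : ℕ) (es fs : List (Bool × Ent)) : List St → Bool
  | [] => true
  | n :: l => match evalW es n false 0 0 0 0 fun p m P Q => evalW fs n true p m P Q
      fun p m _ _ => zeroK B W p m with
    | true => vanK B W es fs l
    | false => false

/-- Test a list of relations. -/
noncomputable def relsK (B W : ℕ) (db : List Ent) : List (ℕ × ℕ) → Bool
  | [] => true
  | (a, b) :: l => match decK db 40 a fun es => decK db 40 b fun fs => vanK B W es fs stL with
    | true => relsK B W db l
    | false => false

/-- Test all relations. -/
noncomputable def finalK (B W : ℕ) (db : List Ent) : List (List (ℕ × ℕ)) → Bool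
  | [] => true
  | l :: ls => match relsK B W db l with
    | true => finalK B W db ls
    | false => false

/-- A value is known. -/
def Cl.isKnown : Cl → Bool
  | .known _ _ _ => true
  | _ => false

/-- All values are known. -/
noncomputable def fullK : List Ent → ℕ → Bool
  | [], 0 => true
  | e :: l, n + 1 => match e.c.forceK (fun c k => match c.isKnown with
      | true => k c
      | false => false) (fun _ => true) with
    | true => fullK l n
    | false => false
  | _, _ => false

/-- A certificate for lifting. -/
structure Cert where
  mask : ℕ
  N : ℕ
  rk : ℕ
  s : ℕ
  D : ℕ
  basis : List ℕ
  steps : List ℕ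
  core : List ℕ
  rows : List ℕ

/-- Verify a certificate. -/
noncomputable def Cert.check (tab : List (ℕ × ℕ)) (B : ℕ) (c : Cert) : Bool :=
  match c with
  | ⟨mask, N, rk, s, D, basis, steps, core, rows⟩ =>
  forceN (Nat.pow B N) fun W => forceN (Nat.pow B rk) fun Brk =>
  forceN (Nat.pow B (Nat.sub N rk)) fun W' => dbK mask tab fun db0 =>
  initK W basis (units B 1 N 0) db0 fun db => runK W steps db fun db =>
  coreK W db core fun cs => pivK B W Brk s D cs rows 0 fun vs =>
  initK W' basis (vs ++ units B s (Nat.sub N rk) 0) db0 fun db => runK W' steps db fun db =>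
  fullK db 30 && finalK B W' db relCodes

theorem Means.unit {A : Type*} [AddCommGroup A] {B N : ℕ} (u : ℕ → A) (s : ℕ) {j : ℕ}
    (hj : j < N) : Means B N u (s • u j) (s * B ^ j, s) := by
  refine ⟨s • Pi.single j 1, ?_, ?_⟩
  · simpa using (Packs.single (B := B) hj).nsmul s
  · rw [map_nsmul, lin_single _ hj]

section soundness

variable {A : Type*} [AddCommGroup A] {B N : ℕ} {u : ℕ → A} {y : ℕ → St → A}

theorem Db.of_tab (tab : List (ℕ × ℕ)) (mask : ℕ) :
    Db B N u (.ofTab tab mask) y none (tab.map fun p => ⟨Row.ofFn (edT p.1 mask),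
      Row.ofFn (edT p.2 mask), Row.ofFn fun _ => .unk⟩) := by
  intro s e he n
  rw [List.getElem?_map, Option.map_eq_some_iff] at he
  obtain ⟨p, hp, rfl⟩ := he
  simp only [Row.get_ofFn, Walker.ofTab, List.getD_eq_getElem?_getD, hp, Option.getD_some,
    cond_false, cond_true, true_and]
  trivial

theorem Means.units (s : ℕ) : ∀ n j, j + n ≤ N → ∀ (y : ℕ → A) (l : List ℕ),
    l.length = n → (∀ i (h : i < l.length), y l[i] = s • u (j + i)) →
    List.Forall₂ (fun c v => Means B N u (y c) v) l (units B s n j) := by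
  intro n
  induction n with
  | zero =>
    intro j _ y l hl _
    rw [List.length_eq_zero_iff.1 hl]
    exact .nil
  | succ n ih =>
    intro j hj y l hl hy
    obtain ⟨c, l, rfl⟩ := List.exists_cons_of_length_eq_add_one hl
    refine .cons ?_ (ih (j + 1) (by omega) y l (by simpa using hl) fun i h => ?_)
    · have h0 := hy 0 (by simp)
      rw [List.getElem_cons_zero, add_zero] at h0
      rw [h0]
      exact Means.unit u s (by omega)
    · have h1 := hy (i + 1) (by simpa using h)
      rw [List.getElem_cons_succ] at h1
      rw [h1, add_assoc, add_comm 1 i]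

/-- The meaning of a packed relation. -/
def Core (B N : ℕ) (u : ℕ → A) (x : ℕ × ℕ × ℕ) : Prop :=
  ∃ c, Packs B N x.1 x.2.2 c ∧ Packs B N x.2.1 x.2.2 (-c) ∧ lin N u c = 0

theorem Core.of_coreK {t : Walker} (hB : 0 < B) (hy : Solves t y) {db : List Ent}
    (hdb : Db B N u t y none db) {l : List ℕ} {k : List (ℕ × ℕ × ℕ) → Bool}
    (h : coreK (B ^ N) db l k = true) : ∃ cs, k cs = true ∧ ∀ x ∈ cs, Core B N u x := by
  induction l generalizing k with
  | nil => exact ⟨[], h, by simp⟩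
  | cons c l ih =>
    have h := of_lookK_stL h
    rw [forceN_eq] at h
    obtain ⟨p, m, P, Q, h, v, hv, e⟩ := Totals.of_rowK hy hdb h
    rw [forceN_eq, forceN_eq, forceN_eq] at h
    obtain ⟨cs, h, hcs⟩ := ih h
    refine ⟨_, h, fun x hx => ?_⟩
    rcases List.mem_cons.1 hx with rfl | hx
    · refine ⟨v, hv.mod, hv.neg_mod hB, ?_⟩
      rw [Option.getD_none, smul_zero, add_zero] at e
      exact e.symm
    · exact hcs x hx

theorem Means.of_dotK {D : ℕ} {cs : List (ℕ × ℕ × ℕ)} (hcs : ∀ x ∈ cs, Core B N u x) {a : A} :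
    ∀ {row p m : ℕ} {k : ℕ → ℕ → Bool}, Means B N u a (p, m) → dotK D cs row p m k = true →
    ∃ p m, k p m = true ∧ Means B N u a (p, m) := by
  induction cs with
  | nil => intro row p m k ha h; exact ⟨p, m, h, ha⟩
  | cons x cs ih =>
    intro row p m k ha h
    obtain ⟨x, x', l⟩ := x
    have hcs' : ∀ x ∈ cs, Core B N u x := fun x hx => hcs x (List.mem_cons_of_mem _ hx)
    obtain ⟨w, h1, h2, h3⟩ := hcs _ List.mem_cons_self
    obtain ⟨v, hv, e⟩ := ha
    simp only [dotK, forceN_eq] at h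
    split at h
    · refine ih hcs' ⟨v + (Nat.div (Nat.mod row D) 2) • -w, hv.add (h2.nsmul _), ?_⟩ h
      rw [map_add, map_nsmul, map_neg, h3, neg_zero, smul_zero, add_zero, e]
    · refine ih hcs' ⟨v + (Nat.div (Nat.mod row D) 2) • w, hv.add (h1.nsmul _), ?_⟩ h
      rw [map_add, map_nsmul, h3, smul_zero, add_zero, e]

theorem Means.of_pivK (hB : 0 < B) {rk s D : ℕ} (hrk : rk ≤ N) {cs : List (ℕ × ℕ × ℕ)}
    (hcs : ∀ x ∈ cs, Core B N u x) {rows : List ℕ} :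
    ∀ {i : ℕ} {k : List (ℕ × ℕ) → Bool}, i + rows.length ≤ N →
    pivK B (B ^ N) (B ^ rk) s D cs rows i k = true →
    ∃ vs : List (ℕ × ℕ), k vs = true ∧ vs.length = rows.length ∧ ∀ j (hj : j < vs.length),
      Means B (N - rk) (fun j => u (j + rk)) (s • u (i + j)) vs[j] := by
  induction rows with
  | nil => intro i k _ h; exact ⟨[], h, rfl, by simp⟩
  | cons row rows ih =>
    intro i k hi h
    rw [List.length_cons] at hi
    obtain ⟨p, m, h, v, hv, e⟩ := Means.of_dotK hcs (Means.unit u s (by omega)) h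
    rw [forceN_eq] at h
    split at h
    · rename_i h0
      split at h
      · rename_i hm
        rw [forceN_eq] at h
        obtain ⟨vs, h, hl, hvs⟩ := ih (by omega) h
        refine ⟨_, h, by simpa using hl, fun j hj => ?_⟩
        rcases j with _ | j
        · have hd := Nat.dvd_of_mod_eq_zero h0
          have hz := hv.mod.eq_zero_of_dvd (Nat.le_of_ble_eq_true hm) hrk hd
          refine ⟨_, hv.mod.shift hB hrk hd hz, ?_⟩
          rw [add_zero, e]
          exact lin_shift hrk u hz
        · have := hvs j (by simpa using hj)
          rw [List.getElem_cons_succ]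
          rwa [Nat.succ_eq_add_one, add_assoc, add_comm 1 j] at this
      · exact absurd h (by simp)
    · exact absurd h (by simp)

theorem eq_zero_of_zeroK {p m : ℕ} {v : ℕ → ℤ} (hv : Packs B N p m v)
    (h : zeroK B (B ^ N) p m = true) : v = 0 := by
  unfold zeroK at h
  split at h
  · rename_i h0
    have hz := hv.eq_zero_of_dvd (Nat.le_of_ble_eq_true h) le_rfl (Nat.dvd_of_mod_eq_zero h0)
    funext i
    by_cases hi : i < N
    · exact hz i hi
    · exact hv.zero i (not_lt.1 hi)
  · exact absurd h (by simp)

theorem Solves.of_finalK {t : Walker} {y : ℕ → St → ℕ → ℤ} {db : List Ent}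
    (hdb : Db B N (fun i => Pi.single i 1) t y none db) (h : finalK B (B ^ N) db relCodes = true) :
    Solves t y := by
  have hvan : ∀ {es fs l}, vanK B (B ^ N) es fs l = true → ∀ n ∈ l,
      (evalW es n false 0 0 0 0 fun p m P Q => evalW fs n true p m P Q
        fun p m _ _ => zeroK B (B ^ N) p m) = true := by
    intro es fs l
    induction l with
    | nil => simp
    | cons n l ih =>
      intro h
      unfold vanK at h
      split at h
      · rename_i h1
        intro n' hn'
        rcases List.mem_cons.1 hn' with rfl | hn'
        · exact h1
        · exact ih h n' hn'
      · exact absurd h (by simp)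
  have hrel : ∀ {l}, relsK B (B ^ N) db l = true → ∀ w ∈ l, (decK db 40 w.1 fun es =>
      decK db 40 w.2 fun fs => vanK B (B ^ N) es fs stL) = true := by
    intro l
    induction l with
    | nil => simp
    | cons w l ih =>
      intro h
      obtain ⟨a, b⟩ := w
      unfold relsK at h
      split at h
      · rename_i h1
        intro w' hw'
        rcases List.mem_cons.1 hw' with rfl | hw'
        · exact h1
        · exact ih h w' hw'
      · exact absurd h (by simp)
  have hfin : ∀ {ls}, finalK B (B ^ N) db ls = true → ∀ l ∈ ls, relsK B (B ^ N) db l = true := by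
    intro ls
    induction ls with
    | nil => simp
    | cons l ls ih =>
      intro h
      unfold finalK at h
      split at h
      · rename_i h1
        intro l' hl'
        rcases List.mem_cons.1 hl' with rfl | hl'
        · exact h1
        · exact ih h l' hl'
      · exact absurd h (by simp)
  intro r n
  rcases rel_cases r with hr | ⟨l, hl, w, hw, hr⟩
  · rw [hr]
  · have h1 := hrel (hfin h l hl) w hw
    obtain ⟨es, he, h1⟩ := of_decK h1
    obtain ⟨fs, hf, h1⟩ := of_decK h1
    have h2 := hvan h1 n (by cases n <;> simp [stL])
    obtain ⟨p, m, P, Q, h2, v, hv, e⟩ := Totals.of_words hdb he hf h2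
    rw [hr]
    rw [Option.getD_none, smul_zero, add_zero, eq_zero_of_zeroK hv h2, map_zero] at e
    exact sub_eq_zero.1 e

theorem Row.forall_of_forceK {α : Type} {P : α → Prop} {f : α → (α → Bool) → Bool}
    (hf : ∀ a k, f a k = true → P a ∧ k a = true) {r : Row α} {k : Row α → Bool}
    (h : r.forceK f k = true) : ∀ n, P (r.get n) := by
  unfold Row.forceK at h
  obtain ⟨k1, h⟩ := hf _ _ h
  obtain ⟨k2, h⟩ := hf _ _ h
  obtain ⟨k3, h⟩ := hf _ _ h
  obtain ⟨k4, h⟩ := hf _ _ h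
  obtain ⟨k5, h⟩ := hf _ _ h
  obtain ⟨k6, h⟩ := hf _ _ h
  obtain ⟨k7, h⟩ := hf _ _ h
  obtain ⟨k8, h⟩ := hf _ _ h
  obtain ⟨k9, h⟩ := hf _ _ h
  obtain ⟨k10, h⟩ := hf _ _ h
  obtain ⟨k11, h⟩ := hf _ _ h
  obtain ⟨k12, h⟩ := hf _ _ h
  obtain ⟨k13, h⟩ := hf _ _ h
  obtain ⟨k14, h⟩ := hf _ _ h
  obtain ⟨k15, h⟩ := hf _ _ h
  intro n
  cases n <;> assumption

theorem of_fullK {db : List Ent} {m : ℕ} (h : fullK db m = true) : db.length = m ∧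
    ∀ e ∈ db, ∀ n, (e.c.get n).isKnown = true := by
  induction db generalizing m with
  | nil => rcases m with _ | m <;> simp_all [fullK]
  | cons e l ih =>
    rcases m with _ | m
    · exact absurd h (by simp [fullK])
    · unfold fullK at h
      split at h
      · rename_i h1
        obtain ⟨h2, h3⟩ := ih h
        refine ⟨by simpa using h2, fun e' he' => ?_⟩
        rcases List.mem_cons.1 he' with rfl | he'
        · refine Row.forall_of_forceK (P := fun c => c.isKnown = true) (fun c k h => ?_) h1
          split at h
          · exact ⟨by assumption, h⟩
          · exact absurd h (by simp)
        · exact h3 e' he'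
      · exact absurd h (by simp)

end soundness

/-- Every solution in a quotient of the rational numbers without small torsion lifts. -/
def Liftable (t : Walker) : Prop :=
  ∀ {T : Type} [AddCommGroup T] (π : ℚ →+ T), Function.Surjective π →
    (∀ a : T, 89760 • a = 0 → a = 0) → ∀ y : ℕ → St → T, Solves t y →
    ∃ x : ℕ → St → ℚ, Solves t x ∧ ∀ s < 30, ∀ n, π (x s n) = y s n

theorem map_lsum {A C : Type*} [AddCommGroup A] [AddCommGroup C] (f : A →+ C) (y : ℕ → St → A)
    (l : List (Bool × ℕ × St)) : lsum (fun s n => f (y s n)) l = f (lsum y l) := by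
  rw [lsum, lsum, map_list_sum, List.map_map]
  exact congrArg _ (List.map_congr_left fun p _ => (map_bact f _ _).symm)

theorem Solves.map {A C : Type*} [AddCommGroup A] [AddCommGroup C] {t : Walker} {y : ℕ → St → A}
    (hy : Solves t y) (f : A →+ C) : Solves t fun s n => f (y s n) := fun r n => by
  rw [map_lsum, map_lsum, hy]

theorem Db.exists_coeffs {A : Type*} [AddCommGroup A] {B N : ℕ} {u : ℕ → A} {t : Walker}
    {y : ℕ → St → A} {db : List Ent} {m : ℕ} (hdb : Db B N u t y none db)
    (h : fullK db m = true) : ∃ c : ℕ → St → ℕ → ℤ,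
      Db B N (fun i => Pi.single i 1) t c none db ∧ ∀ s < m, ∀ n, y s n = lin N u (c s n) := by
  obtain ⟨hl, hk⟩ := of_fullK h
  have key : ∀ s n, ∃ c : ℕ → ℤ, (∀ e : Ent, db[s]? = some e →
      (e.c.get n).Sem B N (fun i => Pi.single i 1) none c) ∧ (s < m → y s n = lin N u c) := by
    intro s n
    rcases hs : db[s]? with _ | e
    · refine ⟨0, by simp, fun h => ?_⟩
      have := List.getElem?_eq_none_iff.1 hs
      omega
    · have h1 := (hdb s e hs n).2.2
      have h2 := hk e (List.mem_of_getElem? hs) n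
      cases hc : e.c.get n with
      | unk => simp [hc, Cl.isKnown] at h2
      | targ => simp [hc, Cl.isKnown] at h2
      | known p q b =>
        rw [hc] at h1
        obtain ⟨c, k1, k2, k3⟩ := h1
        refine ⟨c, fun e' he' => ?_, fun _ => k3⟩
        obtain rfl := Option.some.inj he'
        rw [hc]
        exact ⟨c, k1, k2, (lin_std k1.zero).symm⟩
  choose c hc using key
  exact ⟨c, fun s e he n => ⟨(hdb s e he n).1, (hdb s e he n).2.1, (hc s n).1 e he⟩,
    fun s hs n => (hc s n).2 hs⟩

theorem Cert.liftable {tab : List (ℕ × ℕ)} {B : ℕ} {c : Cert} (hB : 0 < B)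
    (hN : c.basis.length = c.N) (hrk : c.rows.length = c.rk) (hle : c.rk ≤ c.N)
    (hs : c.s ∣ 89760) (h : c.check tab B = true) : Liftable (.ofTab tab c.mask) := by
  intro T _ π hπ hT y hy
  obtain ⟨mask, N, rk, s, D, basis, steps, core, rows⟩ := c
  simp only at hN hrk hle hs ⊢
  subst hrk
  simp only [check, forceN_eq] at h
  have h := of_dbK h
  have hs0 : s ≠ 0 := by rintro rfl; norm_num at hs
  have hTs : ∀ a b : T, s • a = s • b → a = b := by
    intro a b e
    obtain ⟨q, hq⟩ := hs
    refine sub_eq_zero.1 (hT _ ?_)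
    rw [hq, mul_comm, mul_smul, smul_sub, e, sub_self, smul_zero]
  let u : ℕ → T := fun i => edge y (basis.getD i 0)
  have hu : ∀ i (h : i < basis.length), edge y basis[i] = u i := fun i h => by
    simp [u, h]
  obtain ⟨db, h, hdb⟩ := Db.of_initK (u := u) hB
    (Means.units 1 N 0 (by omega) (edge y) basis hN fun i hi => by
      rw [hu i hi, one_smul, zero_add]) (Db.of_tab tab mask) h
  obtain ⟨db, h, hdb⟩ := Db.of_runK hB hy hdb h
  obtain ⟨cs, h, hcs⟩ := Core.of_coreK hB hy hdb h
  obtain ⟨vs, h, hl, hvs⟩ := Means.of_pivK hB hle hcs (by omega) h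
  have hw : ∀ j, ∃ w : ℚ, s • π w = u (j + rows.length) := fun j => by
    obtain ⟨w, hw⟩ := hπ (u (j + rows.length))
    refine ⟨w / s, ?_⟩
    rw [← map_nsmul, nsmul_eq_mul, mul_div_cancel₀ _ (by exact_mod_cast hs0), hw]
  choose w hw using hw
  have hini : List.Forall₂ (fun c v => Means B (N - rows.length) (fun j => π (w j)) (edge y c) v)
      basis (vs ++ units B s (N - rows.length) 0) := by
    rw [← List.take_append_drop rows.length basis]
    refine List.rel_append ?_ ?_
    · refine List.forall₂_iff_get.2 ⟨by simp [hl]; omega, fun i h1 h2 => ?_⟩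
      have h3 : i < basis.length := by
        rw [List.length_take] at h1; omega
      obtain ⟨v, hv, e⟩ := hvs i h2
      refine ⟨v, by simpa using hv, hTs _ _ ?_⟩
      have e1 : edge y ((basis.take rows.length).get ⟨i, h1⟩) = u i := by
        simpa using hu i h3
      rw [e1, ← lin_smul]
      simp only [hw]
      rw [zero_add] at e
      exact e
    · refine Means.units s _ 0 (by omega) (edge y) _ (by simp [hN]) fun i hi => ?_
      rw [zero_add, hw, List.getElem_drop, add_comm i]
      exact hu _ _
  obtain ⟨db, h, hdb⟩ := Db.of_initK hB hini (Db.of_tab tab mask) h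
  obtain ⟨db, h, hdb⟩ := Db.of_runK hB hy hdb h
  rw [Bool.and_eq_true] at h
  obtain ⟨v, hv, hyv⟩ := hdb.exists_coeffs h.1
  refine ⟨fun s n => lin (N - rows.length) w (v s n), (Solves.of_finalK hv h.2).map _, ?_⟩
  intro s hs n
  rw [map_lin, hyv s hs n]

/-- Transitions of states under the generators and their inverses. -/
def tab : List (ℕ × ℕ) := [
  (93887941022101064268926744808790276, 10486672712618140240068686863272196),
  (135021598619563753494236098010156296, 51943581251748801178779215827701016),
  (823255126181943340095182051729375616, 823255126181943340095182051729375616),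
  (654757222848507561549545122237712131, 654757222848507561549545122237712131),
  (318683113280182787328677213174854750, 416650554790539058454872351441430125),
  (1895403295502064556354462429025294, 1895403295502064556354462429025294),
  (105250753436238694486010955545251842, 47526135600234084707636993591349777),
  (395717533424714120724985441202482793, 173461362580204413173271727099440218),
  (277550064749257500590204859920248898, 458106839369204442061156610694197873),
  (634068849344204103336839766013081427, 151047234857697561007663138955069957),
  (110806625942495235356685540027532829, 306670777833544595451397006180369724),
  (571680478063635213923261145491904275, 571681740762474991011671860412352275),
  (472906046954936577988920681319259448, 126260802008737670442002809361865738),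
  (105576539640572612158033866706190354, 130601617686115541823936620894622209),
  (256538107365076760799555704382127178, 395394282502313110262187619800858233),
  (353774431401442060955478835000519269, 298156651201304534864678751124158534),
  (215081169134690039008024862350211158, 437175699672239358765711142984366693),
  (520434751550356311715742599524789624, 379709940641297617301926628994259719),
  (547590441610225840791555417303577948, 271790650504417914621063183027602203),
  (292478392635066375302926116471665483, 209401637946824829112044569924952923),
  (598461357108537410662508586896013430, 598785880613880437824511963703359590),
  (100487954660222574116926995531637886, 583067780697459133560265367025755516),
  (183483894161855653697818221979185250, 468121136185823578409291728944124465),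
  (38642282384204012514111332505906761, 506130662375035253426823030392651096),
  (371111861204944896434997277793219153, 198672967483209745400503639771009058),
  (43185319903437548348673450301529114, 472581523468860512086527721226001704),
  (639221485088232548187880204764594464, 555821489419644226030656181502099744),
  (90686151284997814251668732855459337, 90686151284997814251668732855459337),
  (287954296291223922472612165524682317, 312842883867624199532570295643095867),
  (483636684333646080486282411976641319, 432876713341990223226062996687367274)]

/-- The certificate with mask 0. -/
def cert0 : Cert where
  mask := 0
  N := 65
  rk := 51
  s := 8
  D := 256
  basis := [
    40, 38, 36, 41, 46, 3, 43, 39, 33, 34, 42, 45, 446, 334, 83, 104, 472, 131, 451, 115, 1, 69, 6,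
    321, 410, 156, 204, 182, 147, 136, 195, 174, 172, 11, 85, 419, 196, 190, 231, 402, 162, 151,
    270, 164, 89, 262, 400, 198, 96, 194, 408, 0, 16, 20, 48, 53, 54, 64, 65, 67, 71, 72, 73, 74, 77]
  steps := [
    8, 2293811, 2296376, 2296892, 2288165, 2288684, 20492, 2052, 16416, 26652, 24600, 2285603,
    32820, 2129340, 2343857, 1443633, 1058620, 2328156, 1448268, 1042019, 1046636, 1044568, 194972,
    317896, 145813, 181137, 312284, 505467, 816846, 16905, 2322461, 2314769, 1062937, 1456141,
    2312709, 2320405, 1747486, 29722, 1958914, 2310220, 17422, 2311234, 1747022, 1042, 3094, 19466,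
    35898, 39485, 1961028, 2313286, 1061182, 141959, 144523, 454289, 197358, 449662, 220620, 402642,
    451714, 811644, 187806, 318931, 179574, 656033, 979238, 1511782, 204012, 332024, 448819, 219336,
    455091, 500337, 528774, 545208, 971033, 1442632, 507017, 213729, 328946, 405720, 455320, 817475,
    81145, 131926, 495833, 336572, 443192, 113020, 153878, 177606, 224556, 185451, 964523, 129397,
    138581, 343224, 662709, 867685, 900485, 109400, 225573, 148245, 150296, 207837, 971566, 1016745,
    1117797, 963378, 123760, 137552, 342195, 661680, 866656, 899456, 226080, 154896, 448146, 503415,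
    1021769, 445959, 814793, 996269, 1043053, 1059653, 2329175, 949096, 965416, 1096295, 183245,
    1047133, 952200, 960317, 992849, 998029, 1017630, 1125972, 331511, 456626, 546740, 812868,
    2124725, 1060661, 341675, 979561, 1116270, 1478542, 1509230, 948073, 1121465, 530313, 863911,
    75499, 126846, 135001, 202705, 217038, 137054, 198610, 219076, 107057, 118327, 225175, 112187,
    115762, 153499, 108408, 149395, 33337, 66288, 38462, 174533, 221588, 111442, 114033, 313815,
    140421, 145038, 181703, 189909, 228641, 173233, 125156, 132322, 337053, 656581, 861301, 894066,
    197781, 124069, 214215, 501876, 401616, 450688, 895873, 458173, 548279, 813895, 863073, 409809,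
    557185, 2125847, 2205203, 2127803, 2207670, 2313755, 2205771, 198885, 334589, 338615, 408285,
    445239, 457421, 76030, 133969, 1121041, 1513831, 498398, 1443149, 51444, 108914, 1020332,
    411860, 956803, 964916, 1063746, 86793, 89348, 125818, 133466, 338109, 657594, 862570, 895370,
    111965, 228138, 107892, 148762, 152861, 210390, 128675, 177844, 227108, 1017262, 1119850,
    316502, 862052, 894852, 337552, 965936, 452528, 542649, 2127290, 313289, 333563, 1061707,
    1091684, 1128359, 1430326, 2327634, 173945, 214755, 49905, 159572, 192464, 952740, 977193,
    1040464, 1094238, 1118996, 954253, 106844, 161523, 161149, 944492, 1016134, 1425723, 155894,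
    205274, 177098, 58070, 85261, 86280, 270592, 273669, 271618, 277260, 271105, 274698, 273141,
    276732, 275706, 139402, 140932, 147740, 180683, 188518, 223522, 529763, 996778, 493702, 526732,
    993704, 172210, 311387, 696410, 185241, 953766, 978221, 1512768, 955787, 994213, 527725, 560268,
    1479994, 1508194, 701403, 1431370, 152338, 1060153, 527211, 953223, 525186, 209595, 218346,
    329878, 453787, 660137, 815728, 73961, 78560, 136362, 336032, 452811, 330954, 447610, 340634,
    897657, 943522, 950688, 975147, 1042530, 1045089, 1115411, 959783, 992673, 1018135, 1114907,
    975651, 330393, 407259, 456852, 658598, 814205, 342701, 404181, 453312, 82187, 412890, 497372,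
    334017, 340136, 446584, 339102, 896118, 83715, 412375, 493267, 274183, 143766, 146333, 151895,
    184770, 192985, 227707, 150867, 183745, 191956, 226679, 154459, 187328, 195550, 224115, 137965,
    217320, 216294]
  core := [
    17, 18, 20, 21, 22, 23, 25, 26, 27, 29, 30, 35, 43, 4156, 2211, 3408, 4523, 396, 724, 2033, 310,
    2129, 663, 868, 1858, 531, 1170, 377, 1744, 341, 3974, 780, 216, 170, 803, 3748, 1894, 989, 51,
    1421, 157, 1690, 1840, 4377, 312, 643, 666, 1288, 3373, 1693, 1036]
  rows := [
    150994944, 34359738368, 524288, 2251799813685248, 9671406556917033397649408,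
    2475880078570760549798248448, 147573952589676412928, 8796093022208, 8, 2048, 576460752303423488,
    37778931862957161709568, 182541697313197410347187833929728,
    317832626622139002207903325054361825359745942435698238641313439068299891190969099636089619412557456044964378583836936,
    357080721080048875016710679646698666302191351178963313537820624367575956162521984086780809137225602783349226145065992,
    20769188981564359620847329008222208,
    40506034958360368640319502940287511747982097210041427914600643363313781758814654201999898220466593639743607632408879135,
    1395466655963228097055527264080798530535021791904577686744126809048617219569995460827406133854234919388980548022308,
    358314429434227069202288433450670310128999694726717583864931681512714363089922946841760605294548284415491067650772499,
    945648205308127305198196335873934823293928196723192986897993769621349092342342143452039914943665827723449668307862549,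
    10633823966279364762451675749907169285,
    1394865419278833508728961257579257450799272708734147271453150254697230600161101492558763111563049868643364699197728,
    316457620699117240520029067016132867574211403679005577603345813628483041569884271192331040600730764453321988768865293,
    20708591819325819690423324755526144326372924381461114954445319990296620204195954897723754378073397158038591951353316391946,
    51225852341513834883425361903112683709147934457185265568181227604009325570243455780305712166831929108114506258115798278,
    356008113646768992814447972655843080824880299105077162406859272748206100632190115615491719695812036017336794533673236,
    1231331629084429253601854434671015031100033569226978028433537891865731128818607307695914018924728121730171325192461,
    315216087221230373647663732460796134682579181696826791371691175557757588438539282698305374292159702565041473690602768,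
    40546511385055742911403257895098757742017296594575727947812975813991557491794736317296385019518338668228820542450839053,
    671221767704490399390038571099581082162095916367216518083118947458651477749127267295605375170282161613778089408284450,
    40861727453415275243208030884901638334016362865987800385820112476189846745280095486187668570331550981093373107219471872,
    316457583351464387490706407768027490896712732372811600705713419555713065132987530412640142661309358887580387986396217,
    4828750335363576714174894935773540135390693550405581848387810389558303940569933366076805742774715179881094783256,
    633825300114114700748351602688,
    317832664199109393645022556919663886556482321456124011333972742358397041038563051937363295293309473615470358777901360,
    1233729417348220052071888999961357833687754596753792006468678433278095921360839571874851117569678211404112952302098,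
    315216087148123845406704571916463440469976796306715172180609377808879317133995754737238525151809119215753861657594125,
    1231312693924014802449230701337179918362167778323999396084702369515871114633820724625410607323471380764057460542481,
    1263338913970260861479212604816160836598295978054328192452033888085300729111969827092653490967717198885294269622395455,
    316449779071642122551082096266685115976649641667217694539536242868965662588247537286675688019941636204369052443619891,
    316452190868631291358148816552719307209128870119509006910886372105284211391169069673844582335112053068580453014310921,
    40861737073266407699997917732000316828558934761914655603718355621628332240568497853275311677978006078023850303200175893,
    632894762106267655477566626972294286173243287827396689838925394462449184214658956395162479786154023669644514708695117,
    2477677426362285783684321023772296465911178485897950899411141074851547039271684320232509911888448038772918923582517,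
    356008113500271764343580705289625618907120180624618360111882334031570927565614101629132941655684659260803520844340512,
    315218463873217615259852757125425949336309778625729874505240576077527309597476201012609171161211736354711315071437331,
    2480072866978131848641273023262329451689002283320262387005726967189277665078292125374404343178833095017842198991395,
    316452829892710941283603927167823882235587117652561277235392796282205390276449212520870397750064533077835558499724549,
    354621092515676911712206162883056270114588632709985063930507805138005994275483197843917786480867926014328501171913483,
    40546516777465470874760543391059543924538262918614832625435449189216616878795921819740540455834866623780026211195435553,
    50594184082423318282306906158179607008432806790503359996275945716862308928518294375870854542083287943121750928237348122]

theorem cert0_check : cert0.check tab (18446744073709551616) = true := by decide +kernel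

/-- The certificate with mask 4. -/
def cert4 : Cert where
  mask := 4
  N := 62
  rk := 47
  s := 32
  D := 4096
  basis := [
    32, 36, 40, 39, 10, 13, 29, 34, 25, 3, 433, 436, 441, 43, 320, 125, 322, 148, 192, 158, 166,
    426, 173, 400, 230, 237, 252, 96, 418, 7, 170, 403, 438, 100, 151, 109, 149, 269, 195, 154, 422,
    188, 425, 411, 407, 206, 265, 0, 5, 16, 20, 48, 53, 54, 64, 65, 67, 71, 72, 73, 74, 77]
  steps := [
    8, 2293811, 2296376, 2296892, 2285603, 16388, 2060, 20524, 24600, 2288165, 26652, 2288678,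
    35389, 37946, 18989, 35846, 2290730, 2316821, 1747486, 2310220, 2569, 6657, 1958914, 1960466,
    2312773, 7182, 2314308, 17454, 25622, 29722, 1964622, 529, 27177, 1748034, 1958470, 2310689,
    32820, 2122686, 2128316, 2123186, 2124213, 2122160, 2126778, 1445177, 1059926, 449177, 814274,
    1448756, 1063517, 446584, 456844, 453253, 815222, 503946, 445758, 455873, 1446209, 1060952,
    339122, 658619, 863595, 896395, 955498, 963874, 994213, 996780, 1019152, 1043563, 972049,
    961313, 1022738, 964896, 342705, 662199, 867175, 899975, 977509, 1120871, 139668, 180683,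
    223602, 149841, 126327, 134491, 203742, 216513, 113175, 2311699, 78074, 138071, 201177, 220096,
    332880, 480350, 110963, 129704, 178867, 340144, 864611, 897411, 1118307, 981100, 51957, 80616,
    162683, 333905, 481364, 159059, 330322, 477785, 200148, 217538, 184728, 191894, 975147, 1042530,
    1045089, 1115411, 151831, 143488, 226599, 195485, 1114907, 975651, 142466, 146049, 943456,
    951681, 991648, 992673, 1023299, 525696, 524641, 950658, 1018183, 942946, 959283, 1020747,
    190935, 959799, 2313755, 109643, 1959435, 958779, 123104, 341147, 660683, 865401, 898170,
    404694, 140932, 141453, 504432, 499846, 493780, 560265, 452758, 543942, 1446710, 1458502,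
    2125240, 2128829, 2207671, 2213811, 2346427, 202198, 329972, 1058125, 1057080, 1459016, 1444157,
    193946, 316870, 78570, 160594, 201691, 152473, 182217, 1040489, 1041518, 313298, 198885, 338597,
    445045, 457421, 658119, 862836, 500850, 216013, 408285, 443549, 501902, 183189, 314333, 335102,
    408798, 559752, 141959, 199394, 158065, 411865, 214471, 228754, 495832, 182725, 189909, 1043029,
    1044055, 197860, 327920, 444725, 450757, 75005, 1060676, 1444677, 401616, 1445682, 85254, 88840,
    277260, 270592, 276738, 273157, 271602, 273654, 73961, 79089, 58065, 271105, 409810, 275722,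
    58616, 405651, 455320, 661676, 817278, 448636, 454856, 442993, 332537, 197082, 328283, 402122,
    447290, 475738, 188518, 701386, 811338, 1062729, 1062192, 945517, 953738, 961837, 994727,
    998830, 1021210, 527757, 860320, 1510589, 531818, 895140, 222077, 970004, 946020, 962346,
    957828, 965924, 1017117, 148826, 1479354, 131421, 125818, 1118900, 177532, 336545, 660137,
    980780, 1115926, 1482118, 1509740, 112982, 155996, 861030, 340662, 897932, 964523, 972427,
    1016228, 131809, 154012, 162166, 211416, 106873, 147740, 946600, 656076, 1511756, 948073,
    1021721, 558723, 952713, 80110, 81132, 123760, 213955, 186824, 179660, 173753, 223017, 954472,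
    962854, 993372, 1127507, 402588, 1448252, 137552, 204243, 111161, 226193, 1476401, 187806,
    697308, 1058638, 113726, 947045, 955278, 963374, 993187, 996269, 1016600, 529285, 867502,
    1512117, 526190, 1478334, 971541, 952200, 960293, 1017630, 949096, 965416, 150360, 1480888,
    129397, 138581, 337058, 206686, 221560, 144955, 146482, 153433, 186308, 194513, 227188, 65779,
    142903, 143921, 151380, 184270, 192464, 225150, 49399, 66811, 216807, 329360, 406746, 454289,
    661163, 816755, 75499, 79587, 134823, 337571, 403155, 452297, 85767, 412891, 495319, 331460,
    446071, 341650, 898683, 82691, 411356, 493269, 274187, 84228, 86798]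
  core := [
    3, 6, 16, 20, 21, 23, 27, 45, 150, 3076, 100, 4140, 7, 3061, 1891, 1932, 1812, 395, 1907, 2548,
    1294, 361, 668, 165, 249, 983, 2997, 805, 532, 795, 867, 995, 3196, 65, 3116, 163, 171, 1037,
    542, 3368, 75, 1431, 218, 211, 1683, 3258, 4298]
  rows := [
    536870912, 2199023255552, 9288674231451648, 36893488147419103232,
    339066936605060355865458446417173670544729001942165106585057702324983198828811770094351694832432961319794159194456948595889186479553500656068621502181859857539822997552,
    618970019642690137449562112, 43864523860902223805852654587015593984, 131072,
    10384594355382488013585196903301120, 32, 174224571863521131606080564540936126857216,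
    187186454779922721246585609247607068512879435374092804098096287673720988002623165199590542787162373010156270421816752783455933388965996006041488818718167753365585930,
    250805478737600665657572031650130563147920952736185746990102900446964493262615271524068820892963149870195413623550800888631129422123950670325483581276377890009578672139,
    151115727451828646838272,
    235973437765532036592884349014570525452413675228364437589283230082112921894582127533700263289686874224979793544585997635905934839215396742470257336847811606675612172339,
    176904488663509750886360351020069950609508524352438822233007059455518907495775734541141201817818100656915377191400285520628973038539679700378314983438855298563873210368,
    59058163139662266827814129283810086824809748009035772216751610154147332796088971136916734507812315820100264657714135224507040445868297645199820756689556425828378968077,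
    29502087649647522442561010280737496495338345556803915693515728305325722467962311528322652738316209158420841777229874264350153211746658260209541604948528116513819676718,
    176922494869238981514502994840605225415422724251439596826523144089568666170267665583896304771124099333748334860144301890364187614822126793129848037465524566970713280526,
    103442671673685805639351304695116585513513891263215074008041318075030588951088448635731970235895340372458020807196282049546095071181451742508638443264517217405375631374,
    73882976847603984404965756485261431729901088195051776384274005862586437220785441379294643764124708092616172319819348999087042066264782643657045981520696707288875434057,
    191750915611100585497049211452067321761906989051386632208847883214413055072786492641993058896094335058577743390518979920369805099930031127398611423241071655767610855458,
    236034615963799125805450839211740390808477684511423511164893668284349478272039310673310495067006656133801968466172018540233609739894916165835974707770790228454055153671,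
    235948237702786647563778272259410665008217685458606067771073410410689232469293625319007921707634129832767501274275712519756861596007648503597743130636707699868328984619,
    2614529362970723140586950361088,
    59011356861457860970065925913433881065132999242544240188703707355483158033142827676296480468606426811223703252041631824698566487951418473503361321062082445346478784587,
    132721560471253590506021320120655155790948481480100887488199241972546925912723449146819752859057009293123574673741930633642625425091398486973027070419702055957658075195,
    103467871740292642943113310367339084502248563196352948625764555950590127816495490800413492976919730386332837567156145115558336666205721409665913274655712064707388358683,
    377972911995785356631540153217648912265239761859999108356934367220645890331632069639926408124954001538559742574200693479557604800684150922992305286488870266950127676,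
    295175551210749811419465449448418554506719985510042121419235356943245084691166954219834452895003782208846596099885264996668368082158288922656878094757821448232586022978,
    368698618456480929932687862749922580323680392599801771236671105507588785962009659327171478779334704559392858124758695956998334147974800553468086965192602170165599866892,
    280141987899308891121977843477664360255879883194987018453370054640966509681332335725280062395294118319104773570546857257930106044430867889286988956706117644415417794571,
    471950460606640185334218563718944600046059832414023528238119817383388627694201351577063243319260223288625656152066045795360615784559834983836137387993738397398090911748,
    221404197515965810200636904840489684911200801668919349876818048942663845994139797091223537484857877703240915523145657621962595033297598753138071129339214275189712666630,
    59245299503726878259770859764689576727129759634159072968793186005927604330614863262902887697578845966886994666751788879424339678301419693139109835381580815086121357402,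
    32400096149084554405004475788657512395006513753818752993897058731886711816826271234687125948121021411169728607577559194766723137974961314360915353732444304731930661,
    44388108550618124104356848726501759798035745691337308388892463823386752506680624391739792627254940841290570872034091517709474335614571990315088998199751618614914502663,
    29541682488586241265165124903218505316608615715060725024877611501869693474335953332884262027600382885179247569380665438589711584815599564328874507813446554255443476553,
    59101341286706120084329402176446330266528725753577845193331395734494052488743214934238733266003589403585720382950462478923686838026534997673604063950204383968187093022,
    29556067580480219394505017572590142041774083821829976703994347664635578865577998967427431569684766700545397564041582400098176486580487916574942648586869578589796651018,
    235872651551348062865391200200029544880480045193870327846116950981197926625979994485985709008715558659520446843321373816778760175867902844921511316769160209210760499200,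
    250614692280384803009350398289940063082746135366984412801184626067537950053977382268493594977912808138501575774541065351632257797954070901216725571895265408871827505184,
    295132358994302314906007533963196755906002107108885640775775602229794574764973242985444191891770113003964617771874887419042012538567660810740704956728866066144554684440,
    32428214361976016199838267934592540131963133464852948865362087567425471770048686937784805870218970703622514498060130400210597788682534762389165745228346311334826005,
    103223113258560734852626288888325432104190951293539011655910083443327523351721989285798880753537496781672629728885276250316872647622512406685508147668431267370656682020,
    103226713268075997366598559967284699876890808035991217954746061473187020736798655820051181101601305346852493910123779342535265586208192723819235915862121220787384045605,
    44431294607411028122535831501104921073286495181502514830150872664228343557712742536736398452723156454456965568394202721302054824007374489447976981063690446223249784845]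

theorem cert4_check : cert4.check tab (18446744073709551616) = true := by decide +kernel

/-- The certificate with mask 5. -/
def cert5 : Cert where
  mask := 5
  N := 60
  rk := 45
  s := 40
  D := 16384
  basis := [
    35, 37, 36, 10, 42, 41, 46, 29, 446, 442, 436, 43, 39, 3, 321, 313, 308, 426, 99, 106, 428, 421,
    125, 173, 400, 230, 237, 403, 245, 97, 417, 7, 445, 151, 186, 170, 102, 149, 110, 162, 144, 195,
    420, 263, 265, 0, 5, 16, 20, 48, 53, 54, 64, 65, 67, 71, 72, 73, 74, 77]
  steps := [
    8, 2293811, 2296376, 2296892, 2285600, 2288168, 24600, 4124, 16388, 26668, 2060, 2288678, 35389,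
    37946, 19462, 2290733, 35853, 2316821, 1747486, 2310220, 27161, 29722, 2569, 6657, 1747022,
    1958914, 1960466, 2312773, 4625, 16929, 1961028, 3094, 7182, 1958470, 25634, 1748034, 2122673,
    2129340, 2126777, 2127280, 2123186, 2124213, 32820, 1446206, 1060952, 1445184, 1059926, 1448770,
    1063517, 963874, 1019152, 947555, 1044588, 1118387, 955787, 980146, 1043563, 956803, 964896,
    996490, 1020177, 1481392, 945003, 961313, 993925, 997516, 1022738, 1510075, 449177, 502902,
    506488, 814274, 863398, 453312, 445598, 864424, 446612, 817857, 342705, 662199, 867175, 899975,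
    977509, 1120871, 139668, 180683, 223602, 149841, 126327, 134491, 203742, 216513, 113175,
    2311699, 78074, 129907, 138071, 201177, 220096, 332880, 480350, 140932, 141453, 51964, 77032,
    159059, 330322, 477785, 162683, 333905, 481364, 200148, 217538, 187293, 192920, 975651, 1045088,
    1047650, 1114391, 154395, 146049, 227627, 191894, 1115411, 976167, 142466, 143488, 942946,
    951168, 959283, 992160, 992674, 1020747, 525186, 525664, 1059143, 942433, 951681, 1023299,
    190935, 959799, 2313755, 109643, 1959435, 958779, 1444157, 1459533, 2126264, 2128822, 2205619,
    2217915, 2346935, 1057608, 1058102, 1449272, 1458502, 198885, 338597, 445045, 457421, 658119,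
    862836, 500850, 216013, 408285, 443549, 501902, 183189, 314333, 335102, 408798, 559752, 199394,
    158065, 214471, 228754, 174970, 657572, 978730, 1120029, 1479565, 1514858, 111965, 895370,
    962471, 970375, 1017262, 152986, 210390, 185798, 123104, 341147, 660683, 865401, 898170, 131232,
    201878, 404694, 504432, 860525, 499846, 815814, 493780, 560265, 218346, 329972, 411865, 136530,
    201691, 495832, 152473, 185290, 188890, 953766, 1045594, 1046107, 945261, 994391, 1126997,
    182725, 189909, 197860, 327920, 338109, 444725, 450757, 75005, 133466, 177021, 655562, 978221,
    1116954, 1510730, 1060676, 1444677, 401616, 127721, 161009, 330998, 451226, 970004, 974116,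
    1062192, 1447226, 1445682, 58065, 1447753, 409810, 190418, 957828, 982196, 1041001, 1041508,
    313289, 528228, 125304, 132440, 337077, 656568, 861544, 894344, 108382, 221480, 109429, 150296,
    976677, 1512293, 952227, 149278, 206526, 178632, 1016745, 225692, 968323, 529285, 943982,
    1017678, 979758, 1478542, 317912, 996269, 144523, 1481020, 1443633, 971541, 948840, 997971,
    1124444, 1448268, 337571, 403155, 444019, 452297, 657092, 861815, 411356, 493269, 505467,
    816846, 865963, 214755, 456338, 446097, 497371, 412375, 329459, 406746, 136939, 132948, 200656,
    333563, 331511, 79591, 128884, 219076, 110135, 115249, 151447, 315342, 157566, 202705, 107570,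
    120379, 227227, 36409, 49400, 143249, 107349, 33854, 50418, 146846, 111472, 181187, 189404,
    51449, 114000, 187852, 196051, 213729, 328860, 405651, 455320, 661676, 817278, 80110, 81132,
    343214, 402636, 448636, 454856, 442993, 944492, 952713, 960809, 993704, 997291, 1016086, 526732,
    864937, 1509564, 530281, 896679, 1476281, 223097, 968988, 946534, 962854, 956294, 964396,
    1021721, 153942, 1479862, 128380, 136028, 336545, 135001, 222582, 83202, 85770, 272131, 274187,
    271629, 276748, 274696, 275713, 83717, 82176, 85254, 84228, 86798]
  core := [
    3, 16, 20, 23, 26, 27, 1057, 4516, 470, 1067, 2860, 775, 1926, 4531, 406, 2073, 4294, 4523,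
    1936, 1756, 2558, 192, 1885, 2037, 2843, 375, 4364, 2188, 438, 1000, 2952, 1032, 3969, 728, 533,
    315, 532, 343, 542, 3004, 2955, 117, 270, 844, 878]
  rows := [
    671744,
    174321083346354791243219153642433833242281104440283385601332813357033373141311048312617496264328967105170379338733972415484192071262587853652623799478346228527971834697411480891282840240417,
    10737418240, 12993418652339351365341207855104, 2882303761517117440,
    522147438677120713522713666875760293165651222531904712983388822349929729065497772040492132174084534286238886836226937940793405203983228959101930407300204931539724484212199404049737042756448,
    174049157291081754859401906837812948874244379994278894347918136324613214871564206862161762046225874123208332322550491310980315295617092504497155913005564973551665234520171903412448988234016,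
    174319357147876652918698070846419828793778328327675816137035751088107859547871942635940900660121309305722891016269919163861406032767824881812236753554836801156527634138394018800218843398489,
    174049157291081754859401906837812948874244379994278894347918136324613214871564206862161762046225874123208332322550491310980315295617092504497155857253701977225107380680876221791545222627616,
    773712524553362671811952640, 3402823682202803286973097439658890641408, 47223664828696452136960,
    175921860444160, 40,
    87023458256075725789697682638919838364898322711150751079902560975356715891610621203181248103168010929107534180868189255547014476084238950158159685217633828557861568266688268036133863030976,
    174048294191844169800316080283744213293803394310143935742647805864095456271497606216225570193593840818698540092354775178576416736879139303229104689195860457734610720662162740854778040287584,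
    174046567993363063420404064792715329647341996692729469661182573941136067787448841252647214577463278002461509790390777445169174507519310173699568119385725575729930942804319618926875561165216,
    43514293569183157095655935629683327641878172736923674164990131832929266627625220202772573381782565197138145160523928420788032815976696300670964171319068269717035382575150886496869568348185,
    65540835143764362211962089172329991829966876254423737479675732212828875536706039146863586480364576438556134843473542106677980642927476148166236584542612122551029368171741041802574428258345,
    152292417138753135938149047682495978441175564781274243139166251444695379695477860699295829482608493837286788912615250599792897718249876032174184551335255945439476552650747897496988841279840,
    130809993203192788468237676218516618891889512907442687500457081198371199595155531328273536523195637195395437636890854965750327068940030240756400012645513494933506683823649054489215367921809,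
    174320950561856092390641535036314074120082231186749614237367489746375504412316808780096340484611307290137964512436885536445139758649014268694041303090662658245452025733100246851806895685913,
    174321216130853490095796772248553592364479977693817156965298136967691241870305287845138652044046626920202794165031059294523244379858816357898024427243781689431023331633562403463785195782441,
    21755412226298382846214789644918354478064894020671218271610714033829914516183884050674475427866087954715523145803142784446733866009340999755751656649016586976387007324338088229636740218984,
    21756358396894302837972833395602290830412094045484026222026393471115570173031996538827587337657078021480643839750858076913156341718033982976155506283146137148681944204387541250147710140416,
    149382560974376549452655751213886843477498427996357882026784347263142860545568700076627397535653321849248185158725424054777166460265112640645308514675437775583361223099206270510759949,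
    283101862646413445451197690454816858587491877263203870880658426579935717681017404441632680135928954869296911680880955319030246842246674002572888307857311442705132323855393594966704450257349,
    109052987522391363975655545203308583093875800412927516430075810493905199564130266875927260537558133719025231159934870513057897115360264934932589698424330032609247555809561598074956255084705,
    149382560974376549452655751213886843477498427996357882026784347263142860545568700076627397535653321849248185158725424054777166460265112640645308514628707103856547774442431803547779085,
    152289230351317859474377183800412865938488587855493750431576728381635471277842095776830023483300491488984320091564483815941592681462722077208082364800543582399533758166402584968233399091624,
    239312340048084562831317931706778060664960305509568092305694214497349161115307640776797561187818783391260288316348570864486332349690152302305633624904626640423717943525670900488056383472232,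
    174320020989321952869562128575052325872750797728837112764215140573582940429450242066941269967962571488930460436925034523585453301900267927965493173072812825212402871451001489227351152017841,
    65268577086723944045543524885736631502531156864573245318863425972783479042196805417779661280571648018367506479363780674034782757105131255151729364345580985741169458680306877791938087026836,
    272223558942237673604080299903225333537916875068554805522622980374618407398336315448975870871055052169661894657971800844485621399212822366877129699899889036100825479078361890321501416604169,
    1211658548092044114167452230335928886450294328664631740542129131659351937634896417289909590435561347403976956569512599795597577735494152093057536206846398623687047663916464328640168025,
    76148872558375746673713437657654501723955307611898676056975356000115569562897388666765881604348401980277016310329411207791011700265641679570000423202199948631775381350274249731495470170121,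
    22028151627147511645987620245086377844881345028543591874760482424909347003536456772756712187420791107913246628140086925474110085777180986364232464190696020564934228409085179559064948654109,
    98173024093033018310382755797766910729476600574662182559788151837857086466432506856137279745809175711184592609718864289421340448792680094253493759775138165641502839711253731694834092294397,
    152290956549795997798898266596426870386991363968101319895918153365666746431503489371679376588380616456552835016516930512393601084076770040149059047654586726756840405792764144625542921716080,
    293706182135592284734851969588272938452960428436804839785410584312756912091779731421487317280804445725964911982046056572126482399177612797920637113716680706619076331828753945642603833917964,
    195805631793364782065392488589444507322746186932758486339164875380558394753630318263262046797489760540011561714394433675551870750349472448527884004645331962163278210557173826887987296993576,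
    65268444342748353072654051782659857674902540547598082897570633415129661498132501280228722558551961984133337500811518361320230825574260775935295292214138921137307911480391566185814333325464,
    1859023498522850376542122981688092959393285788520037823359129771216836465707880122817326709056107359721408153451880888540876491173779658053480414566168071483576157167767210696583889068,
    174322145541293714296842839151223348572977806086243513587402239724898261257728121616174527636027839389935752302285773193752843490820132453372793954204310753583444254271138437211133989896593,
    261073993186326596540863738102556374462088410665797007429907326529438855557197319631315435761730006729358676956500849457146820545268406713668719299724283303576394343867519535383097629016468]

theorem cert5_check : cert5.check tab (18446744073709551616) = true := by decide +kernel

/-- The certificate with mask 7. -/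
def cert7 : Cert where
  mask := 7
  N := 61
  rk := 46
  s := 68
  D := 4096
  basis := [
    40, 35, 44, 34, 39, 43, 33, 45, 42, 46, 30, 6, 18, 432, 446, 434, 80, 97, 96, 478, 408, 406,
    418, 110, 323, 177, 307, 252, 230, 7, 438, 125, 428, 121, 400, 403, 102, 186, 202, 151, 162,
    146, 204, 266, 182, 265, 0, 3, 16, 20, 48, 53, 54, 64, 65, 67, 71, 72, 73, 74, 77]
  steps := [
    8, 2293811, 2296376, 2296892, 2288165, 2285600, 24600, 4124, 20492, 26660, 2288678, 2052, 32820,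
    29722, 1747477, 2310220, 2316813, 18949, 19466, 35898, 39485, 1026, 7182, 25622, 1960477,
    1982985, 2314308, 6657, 25105, 1747022, 2312773, 16937, 537, 1744966, 1962562, 2122169, 2127290,
    2122673, 2129340, 2123188, 2124725, 2326622, 1047650, 1042516, 1045081, 1089618, 1090641,
    195485, 318400, 146049, 184770, 192985, 142466, 143488, 183745, 191956, 943456, 951681, 991648,
    992673, 525696, 524641, 950658, 942946, 1041001, 1041508, 1023251, 1508528, 150867, 209239,
    1114391, 1507655, 959267, 1058835, 1475251, 224115, 2311703, 158965, 51962, 160119, 113499,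
    175287, 226599, 154395, 162683, 211634, 1020747, 176315, 227627, 78061, 80616, 126125, 134310,
    203422, 216257, 129704, 200857, 219840, 199828, 217282, 455818, 453253, 456844, 959799, 2313755,
    109643, 1959435, 958779, 1446710, 1458502, 2125240, 2128829, 2207671, 2213811, 2346427, 1058125,
    1057080, 1459016, 1444157, 449337, 502902, 506488, 814402, 863595, 899975, 1445184, 445758,
    864611, 896395, 446772, 817985, 867175, 897411, 1059926, 1063517, 1060952, 948327, 956524,
    964896, 996778, 997797, 1020177, 1047141, 1044579, 973074, 955498, 963874, 1019152, 944747,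
    961313, 504954, 816331, 865450, 447643, 404694, 139668, 180683, 223602, 149841, 190935, 213216,
    140932, 141453, 182217, 190418, 452758, 504432, 202198, 499846, 815814, 193946, 316870, 493780,
    560265, 329972, 218346, 160594, 201691, 152473, 185290, 188890, 1045594, 1046107, 210269,
    336032, 978730, 1120029, 1479565, 1514858, 111994, 860525, 962471, 970375, 1017262, 175053,
    228245, 946020, 957828, 314333, 217833, 330998, 451226, 655549, 811338, 79089, 127869, 402129,
    447290, 978221, 1062192, 1062729, 970004, 965924, 1480372, 1019716, 1445682, 198885, 338597,
    445045, 457421, 125604, 658119, 862836, 500850, 338069, 408285, 895370, 443549, 501902, 444725,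
    450757, 953766, 199394, 335102, 408798, 559752, 974106, 1060439, 1428053, 1444677, 401616,
    945261, 124273, 214471, 411865, 327920, 482045, 698821, 409810, 228754, 312789, 495832, 76516,
    157018, 125304, 132440, 337077, 656568, 861544, 894344, 108382, 221480, 109429, 150296, 976677,
    1512293, 952227, 149278, 206526, 178632, 1016745, 225692, 968323, 529285, 943982, 1017678,
    979758, 1478542, 317912, 996269, 144523, 1481020, 1443633, 971541, 948840, 997971, 1124444,
    1448268, 198379, 341675, 407259, 448123, 456388, 661198, 865907, 412890, 497372, 503415, 814793,
    219076, 657059, 454289, 444048, 495319, 411347, 214755, 333563, 404181, 178036, 186267, 317393,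
    331511, 329459, 132948, 200656, 107570, 120379, 202471, 157566, 110135, 115249, 151447, 315342,
    33854, 50418, 146846, 36409, 49400, 118613, 143249, 114000, 187852, 196051, 51449, 111472,
    205788, 181187, 220398, 331923, 402588, 811644, 74476, 80097, 138414, 342188, 405699, 454856,
    449662, 500337, 202904, 85767, 87298, 274696, 275713, 272131, 274187, 271629, 276748, 86278,
    84741, 82176, 179574, 205148, 340649, 656033, 979238, 1119516, 1480076, 1511782, 112473, 162134,
    106873, 156028, 660156, 865132, 893830, 962984, 971033, 969001, 134823, 210617, 153878, 224556,
    944548, 956331, 864105, 896905, 84228, 86798]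
  core := [
    16, 17, 18, 23, 26, 27, 29, 12, 3838, 796, 6, 117, 1889, 2032, 2856, 3831, 4044, 2044, 2554,
    144, 362, 119, 2484, 2490, 172, 1952, 990, 243, 725, 732, 3035, 2997, 1883, 1851, 963, 417,
    2284, 3187, 532, 3753, 649, 724, 3027, 729, 1692, 171]
  rows := [

    925258745805951965798528520347496657946668438844791079493264029615181417543987601268356710528845270955697868202382290377966919237909044274541369530979610333766336692,
    69,
    925258745805951965798528520347496657946668438844791079493264029615181417543987601268356710528845270955697868202382290377966919237909044275856680822720326875846656180,
    1140850688, 4672924418048, 78398662313265594368, 278528, 321120920835135874531328,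
    19140298416324608,
    608528188539649940622301304402929767840942980041536702682919812299359386505181772197306122518261014002280723507970927670241964043040243040176378667197815623122698900,
    766893467172800953210414912375213212808513624125970855856920000253650151381764600917321748502874169139177806115378759194287070559063627231935077157120688247547298212,
    5387515211530444944078134050816,
    795665437102108901032312301142524890559678691459544343403822024255816405808240847423056682223979781262301772056206410833061123408538155489625107604462702636602621997,
    72049434296750935808202669083982525025600989829491560740366113101913482573502505025401487384128749313980390747666698688415174068182648957607716702186097100572344521,
    187173275020631700102647119313840127846197223883104143699459246211989529899481726330953895679179635715958808156753745336578656963137145904673001867449731157796246276,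
    22391781537085549002588374295379968,
    262806881082904067030507742841526752354731736535435023633363931596894922718158574280548919091130898442557624971027340095316974480730691769235501160429383087055634937,
    61197535551383079812494965413813589926269670308615288278738571251042160487609289105807077690682698089839693028562648505349534231958821977409775786949445335961182266,
    345592153993913012597654610590541486943812571246276276014482047091262058834777536496751933587788653592526678578019050308694748663157246297709479908021336210437386419,
    25239616209769856387918902195863343578321497002333330559918929754816242014486201754912189297464035956370850707787247790196942031180470767045061751744703865324544145,
    500454091487355409505070412326110449921987406922864022999532401036033803915513274429549916390620724250084929964091840245678369465393132908081777110105432673196392735,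
    79242405110279583220486683578109932296466789688294477844746225468105059459713578160025025100458098992624607003134612842127688288793713456767245586263084184816439415,
    575887342841270172756020289234408887089118529649320802812861550988788759401647856319676440285988854734323369858695618030313331767403500582093800552075753440918433931,
    694873959321488399498398585995309528455229103118393716325990099466422681052808750428604770583230528548136335914076444789827698723835541598767819439104117235346153794,
    126149718559180020442955186846349322534098934684987446654151362549493905239608028527875026073534002726158973442196709247661109237124015368958324570949130322629812632,
    266469265886855630393148380916583562949581051824375411630888552020675925454463891113018087188729634630816725408063283855295734439319253260107797169564405140114681932,
    428374817853075500382374607984411690686171393638366544493159386123576273668309909791743085682237982177053350187763178292008939882524390685879044429768318612730044733,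
    421151935167610076342052746160832620731780384126085350205723898352464602381425136336072429486688888465019206480133177112231897893846913411652669250001304844170531160,
    507706820582601870159850038414987110638878609893099521751712460844937911110679257323558215095969600930035792811685630271968338235305046225822521386969244994722283685,
    29339583209693566404686730117895257997592964064689194907036995025129608,
    255593664057474250535757400065724805713534139261273285087336061946155769001047462782769233883499706733131948164078511251083669019160218360075864111992726220761780239,
    28801839732780864551096173060239322957291619814788089097791845635375613185919400616847266374074601122582869996767469401408681799724601519576556027165707680101769238,
    86413430238313427787100968071649972591580622289838432546586506690144759645308420537581835131942014793695362440947067980708574067554642532248872619595058846823772498,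
    233954945499673249578211983947165201634945521528178362038153773796777766299721612132600174124607781405802804338561857570543709523673294751594527270231933340771729721,
    450013518809148150098780708326737308249363127760542493979966466960382063507148769560522218580278176980577746291041887868842675015824182147263221322142742120956768646,
    90095158737428677890903764744860010937875408796413117477091428039275455079895088346267276990288433881675059807919473150497701821860315629987088681609157330320425061,
    115207343696292200595872670280923082371201140059217188748033161591442635088826544549401537380033613602669759204176721247400084890802531919073778491898185660913877925,
    867714820556399792245338681818480108187362690334408394258326907592731190822353348431747953247765739201640439262987377164236354702849767179587109602981752232421605532,
    334836065517216253577514918739357613436081428166917277929389283673497555978378301334569957971302491229352491207525138760376650494993881613700729142148382625805324800,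
    183693644033941468244009214777826872326408419027256375393699065717003932237046128257154225240518038084621965216058983885605049172440680524841497934524575674873929820,
    72036239291630166638170658755302304919127678987345255594937073359511428547256905695487434263762716285802585636711637454724866605904340254562766629876931163077312713,
    28934522545517317928987784753467056041806568135811033099104902543940910441577199134692254485223232647888232065289732113405911692599180344214886544570072478224666637,
    57603676459122672061300302536817012256463101633306302414375154460525401323549260115601768163030305084599068237527850991478431454748688395202318424226532145616732661,
    1090876782709739494384441470583621690847167272228636110506961833483332268228906845223156462374832919334985854808959672423600639226202661019286979229814462279671661150,
    1011634392197891660350696762362886011653749988192626012524282194421401969381866290593689596365859512900530814978807093123716328531503854807514580113179668189719183961,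
    896367288070233823362607993376674777790779401871120873440321377448610276201735543973199279825652215013796013769219930363718357098545483628978176022181263204560290237]

theorem cert7_check : cert7.check tab (18446744073709551616) = true := by decide +kernel

/-- The certificate with mask 15. -/
def cert15 : Cert where
  mask := 15
  N := 63
  rk := 48
  s := 1760
  D := 65536
  basis := [
    32, 37, 44, 45, 41, 46, 5, 42, 58, 9, 437, 446, 441, 325, 306, 39, 320, 322, 125, 245, 101, 192,
    237, 166, 421, 43, 252, 148, 193, 96, 417, 435, 104, 334, 116, 172, 184, 269, 113, 226, 188, 50,
    55, 198, 105, 201, 423, 270, 0, 3, 16, 20, 48, 53, 54, 64, 65, 67, 71, 72, 73, 74, 77]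
  steps := [
    8, 2293811, 2296376, 2296892, 2285603, 2288168, 24600, 4124, 20492, 26660, 2288678, 2052, 32820,
    18957, 2318361, 2316821, 1747486, 29722, 2310220, 35846, 37898, 2298941, 2589, 4625, 1959938,
    1982994, 2320453, 6657, 1747022, 25121, 3094, 7182, 1744966, 2314308, 25634, 1957954, 2124212,
    2124722, 2122673, 2129340, 2122160, 2126778, 1444661, 1059413, 2075223, 2115908, 1445177,
    1059926, 1448756, 1063517, 449177, 814274, 330322, 477785, 1043053, 1047143, 1043975, 453253,
    815222, 77032, 201177, 220096, 217538, 127355, 658619, 863595, 896395, 944747, 953223, 961313,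
    994218, 1022738, 899757, 1477809, 969488, 138071, 955498, 51962, 80614, 162651, 160119, 113175,
    2311699, 2313755, 110963, 1746507, 129704, 159059, 178867, 1959435, 864611, 1118307, 200148,
    340144, 446584, 456844, 1481603, 503946, 867175, 973088, 997804, 981100, 996440, 216513, 333905,
    455838, 481364, 662199, 817985, 203742, 332880, 339122, 445758, 480350, 1121041, 980258, 184728,
    191894, 975147, 1042530, 1045089, 1115411, 151831, 143488, 226599, 195485, 1114907, 975651,
    142466, 146049, 942946, 951168, 959283, 992160, 992674, 1020747, 525186, 525664, 1059143,
    942433, 958779, 951681, 959799, 1023299, 1442632, 1465656, 2123707, 2125751, 2205629, 2213814,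
    2344888, 1057597, 1057094, 1463094, 1443149, 1042003, 1046620, 1058620, 1443633, 1448268,
    444565, 502389, 813767, 862885, 450757, 445079, 327920, 401616, 334589, 408285, 342163, 661699,
    866430, 899196, 405720, 449692, 811724, 328946, 332024, 402642, 409809, 343214, 656546, 981800,
    1120533, 1481093, 1514344, 965549, 85254, 88840, 271618, 277260, 270592, 86230, 274698, 273157,
    275713, 273654, 271089, 443032, 500360, 507017, 818376, 867685, 559758, 495833, 560262, 971566,
    996265, 332537, 662709, 457885, 501874, 1016600, 976677, 1477000, 500877, 813261, 960419,
    968323, 498398, 559236, 973598, 335102, 411860, 76005, 76516, 124273, 132440, 199645, 214471,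
    133969, 199127, 216013, 125304, 198101, 215493, 228754, 109429, 150421, 108914, 149908, 108382,
    129260, 156501, 178632, 225692, 172491, 223632, 141715, 74478, 81121, 137552, 204243, 148369,
    205788, 317912, 220620, 123760, 213955, 113726, 155038, 211286, 336545, 980780, 1115926,
    1482118, 1509740, 113020, 162166, 656054, 861030, 964523, 972427, 1016228, 526732, 155996,
    177606, 224666, 222502, 558727, 960809, 993704, 1479994, 106873, 147740, 205274, 316886, 971033,
    946278, 995419, 1129562, 1447242, 1021769, 1062192, 39995, 50419, 116057, 146843, 36409, 49399,
    66811, 118654, 143255, 2294321, 51444, 111442, 140185, 209883, 185290, 218346, 329878, 453787,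
    660137, 815728, 73961, 78560, 136362, 452811, 330954, 447610, 340634, 897657, 184270, 194513,
    948073, 955278, 979646, 1040484, 1041006, 1121465, 315344, 317380, 530313, 526190, 206802,
    182217, 214755, 333458, 404181, 452240, 659111, 814715, 77547, 79591, 341675, 407259, 456388,
    83715, 412375, 493267, 329422, 444019, 339601, 896631, 82187, 412890, 497372, 272135, 946020,
    954253, 962346, 994726, 995246, 1019668, 528260, 861859, 1511092, 527725, 893088, 1479354,
    228218, 970525, 953738, 961837, 1021210, 949610, 965924, 151380, 128884, 1510589, 127869,
    131421, 657572, 157018, 86793, 89348]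
  core := [
    21, 22, 25, 30, 35, 960, 34, 3872, 4465, 1906, 2174, 1853, 1930, 729, 2841, 2076, 3, 1870, 2213,
    540, 1908, 791, 1409, 661, 260, 1584, 2947, 1934, 1755, 167, 215, 537, 1038, 1910, 887, 2430,
    147, 964, 2187, 881, 659, 771, 210, 416, 3974, 2100, 443, 206]
  rows := [
    32466269569728810844160, 1760, 115408896,
    104258169852896197862933413909052083171178752519609873190250475223546428327142741022465425022371144154425093021469269360930408291830620100003970242908406667443509348532414692716996625630332876447971764450654514189781030625972653936,
    7559142440960, 495395959010754560,
    10447487462689134672206167082601341514213967947043449382273103607129482947635273184485637386111479872978119301516716018630438368859948237667788791576163130428505887889557443772691785594423744290463433443823270937755700570798171321,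
    104258805726323438764646292601600476697412873955733729244912361680575018096311253911175948992581294368746810475651957808330107447473966235519159793206852863666042982689998073368996000679275649561080037078052902324197630601861296177,
    104258010463474427908212169163467422188628983354591554004384004077498730552828596194305076140033875990944781392299019440463371851971203289272075941723563410490781848770466118758360290510637101339306391682002502958894369391185506401,
    93834371956811365820429201367033740388501200928853423988772481726300775561616325208818644900703357541889674234389435670902960459038519804688597635297144888404639967005171239958581892080764767176333520747832436951171565229618300105,
    2127709442521747347482869760,
    125081439562179344399374797338954932378892565919736275903192008611112268258055090055580617675742099915984739268124821326465256479741751202638627537503489123787790891891465389552713587618862192766814563896912123157498557330865862448,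
    62564568378507339421269686367834515123236554438705095119059913716685879047943618623709039458618458865514344248756271304809184593823710158905964082740929064031254760411722125335644527897035046304355786874419402918571343493300560064,
    636198718391779897586085315040815793148676792984770331358228235842840185594880577437754200216321422016400974044102016361531215903403928956297736541823062272606968904049409598909183842237131516324584562887832982163002269637505,
    20870808566465450171072214362360928286639095537986403581620028978071611945265166689390871545340631605721016515153026077359039933812991707752597285003483407520515566817970154887433263811681319936333130473275929800147338569643532336,
    203909869194363326275093630638913352282762992981794407457188679274247104260800512,
    83411528002404978554090603974879529028202503353794383633044939967769524384841930849803077655176320327461675245794262792515940902993322666295933820597802176630019755817980627958553805996472723746218865929374711122999685629861764984,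
    20847277701856088080547832480669403423046321507211372515590933162589033303212908495310265889644766737829168397211915003775101699689136354836240212144678901577343415999934431717319511388667512066053617683825796296583532013445789160,
    5212535522470557054359533572768780128618880331785244814270022691330754381827070892838782675225964427933835411739363725827320041583626844216169429385439037568170955831011841517754704854785974008977827711922198387194309065870153173,
    156375091754665902128381818820261908668706114081554433405284606778517357532117971944339537829395401162863286974647367677742411067198102075448823629185990304849020899480292776050704577832414411941242481515990625905139423522118973401,
    62564250289958811194437703958848801628528158039263473669882200892510772815769356768081280096806714314498880074313221554817651150344697969349615339754868460831395554842290886130190086887124317527208543137894536803075429292411199601,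
    88599339777575270582140847020755364840039187690355405195471044501962203609833708719392268121983872772431937337680835516262896788968792033722940254879590108157469492004043555262307594108341281056871811925136010372251715481414730829,
    10424116373690847277667532508998976469973295683474571199909043626847898588621793394459877304893733373044571415690217093305838211045781539388493630958182260473187706900578264888750135707031092961555891095814451762105494609414131704,
    62564250286428745268105715188637524607006328172831554229352962100383200276876791735585194613211694738558632787765901163643064865935190865576543984571228209873768210913057981784935946054361297013081761321183496464479688108611214449,
    119892912083472593238927307801440009219786497382315783545486344525940550457719584109807932631705710039016870405555623310548925232812438868106413873529515760426829303306460123095689286902471554123283109531549889210843237659019581237,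
    125081121800681702604462194468095666102702568113730994828111479295477350365860365317478044903641088220314178739619972283238755056446188646847856076543848452231720342840108618424021525141304818499986925000705715454702336880502929600,
    41717609135057391387865081313844364645721635699825924181477815847801600322626878783228886224757659920150162207884741155114763728360504600830464696064753434534855969082581160092242029429266705623116644617563050129704048971151845745,
    88599339774927795200670411527266533854048962585604368846472662905128383060383283513332129149784392856100989305994932735953227561089200548882675772923940133197567587166746703109837137220974715177414967254877652186465033155543830061,
    109446458426773181154893098947631220401060228830959412909663231037849498591793818279864845389590657200008224296649965364772109997435163560071606806218998878839339488403130384137383704990237447148203978157825550794345693534221311716,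
    36482497778941891995169625845410998555389935091288736783809074757868742586906045177222928978853849799498215379329832722383413945832152667562507342487976556778261207083626452982031425587010425522622078240957537847321530324379309092,
    78175939859937772797600640393385080024132477323791397487018110927447355615845122766040119726839008277056602885347412454806188446882025711039949712961434457924875095609516950204886977612703895393639141215849073703129509687466203636,
    62564727786020350578738863003506323237507211045717412284789346624495822085015811978209264700915306207016598624703020743804749388221694269536215933795747798569821264105848782741396931237096627787223274558940134284221799109570332537,
    10447487449010314366306605398256663680185881078826599285950395444013212442882903195728739961659084277112552046468539149907269907273381807202448486218330460108340355101485699072015774885515669688549070282721126275195402295465545880,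
    72964040899871303520630746770496099795329250882910443538339782761715004386228595097268894448484469643507790573816860957555425865673300405115420712537409424755677146979506243268533541895995011173545930657171231681675088385976379384,
    83387997486478452151124319743439299223738509550600566030426586414151567803716919956137358424945479057468120935452998130580369135705591213506425673706608882164982306232409014858210617891356572244473536829205063268284998833381901601,
    52141088579134209118430407154267452471760067617398618107559459021368500266601884071167823649677966643882568390397641151068595116178929105773636794054470981014586242762958966383579563600597102015078385705176695986236016404026369561,
    145951770634342577405088260261745662877613937844636050994131640374877811061379345611737554225194816280150114257795326619455275036611776522502410859156575478018483154296871729434993020235412064101378974568349636821483245674487107025,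
    36482338735991393261519320114395440082530403664976268685541852068904142591871827346984999522782156235867592474628022601577928276786557285145134715403312392947917933334789135147125528143646393641145623434469986697296446850060072068,
    78175541879284263058690802869968555880745498201985360629515593033571037674542454957193706789642906617194493395713627133141183725639766075199223380654968080440579469928908146856259558324549509232808623699475450051849494835888134340,
    41693601128364439301293680105520519550932182871259919705470445597601786634881120929803546516842078425030269887625822193168576078448685473352912996247865518041038905183534021568347190270927359339439320629290318291125123228552399992,
    10424752566231964378469584777238490831173864376289693081086115468481042091532838834248279799576963449248256313057412356091562415509434709656108282041019019804248985513088374126233661105767813350722511810803703509331733078669801209,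
    114681172495398343299645640519380559529835261115341355396420819779285325607027932356944780406413978558961468080052130427007022916803087986134176912739293692435079047258540639770743309703524312298674427129670813119260459376389991881,
    41717449719601815552383356236756594477882380142333357122627578554944678608126099523744296133431123836190100852206032709123948507276360158904723624055048828252177572657717217870209310637295816113044460623701305567269423734846458129,
    20870808224406877923559024520721828793244358411861567901118822510105475587435309822302700999976337619593541823568697610538935889157303466796411530660724943693456712842670295660151839266663775280133281980498463498501011209194575921,
    119892912041994724689230832900204927150028945529772944949850410377663429572045509934207568026176399555491624600380434718032768853387315066689005829251722830955221626295363672238474082960723750582268394067590634696770325085161587285,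
    52141088568102957026217818964846423894828940558141615184780663278654015840555359910325537545944592556704703410861357017996078666718378309018804087686816605884840296719874401832197806987053864218669640422743390943642038953134070792,
    67775831116910290711596845161907583615483627784378858118959326624516042909524872482276076098247955841399167803664031429159969683460464881905196832527746241249387768659151003945574677348253147874783016750762002965664427409509778612,
    31293970275089390566050676695486365268994655367741033632554386114646699918291308535326002973690161949671855634505298848071054244386632392151765773462033884651954218407584599864356677637415821051563072674486830529862592010413746552]

theorem cert15_check : cert15.check tab (18446744073709551616) = true := by decide +kernel

/-- The certificate with mask 9. -/
def cert9 : Cert where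
  mask := 9
  N := 60
  rk := 23
  s := 4
  D := 2048
  basis := [
    44, 40, 3, 41, 46, 2, 446, 434, 432, 305, 460, 133, 322, 166, 252, 250, 417, 126, 173, 199, 112,
    262, 265, 32, 42, 58, 313, 83, 104, 318, 412, 426, 43, 118, 140, 232, 96, 39, 136, 161, 100,
    201, 85, 429, 422, 0, 6, 16, 20, 48, 53, 54, 64, 65, 67, 71, 72, 73, 74, 77]
  steps := [
    8, 2293811, 2296376, 2296892, 2288678, 20492, 2288165, 2052, 16420, 24600, 2285603, 26652,
    32820, 19466, 35853, 37893, 2290733, 2298941, 2316821, 1747486, 2310220, 27161, 29722, 1042,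
    3094, 1958941, 1959945, 7182, 2314308, 25634, 1957954, 6657, 1747022, 2312773, 4625, 16929,
    1958470, 2122673, 2129340, 2123188, 2124725, 2122169, 2127290, 1445184, 1059926, 2328156,
    1063244, 1443662, 1448252, 1042019, 1046636, 1044568, 1061185, 186824, 195032, 187806, 318931,
    947555, 963874, 1019152, 1512627, 154960, 445598, 815296, 864424, 453273, 502909, 969505,
    994213, 814274, 1022738, 1448756, 1063517, 456852, 506488, 973088, 997804, 340144, 503946,
    817857, 897411, 1020177, 135507, 200148, 217538, 127355, 339122, 658619, 863595, 896395, 980074,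
    1117291, 80614, 162651, 333905, 481364, 203742, 216513, 51957, 78061, 332880, 480350, 159091,
    330322, 477785, 201177, 220096, 184728, 191894, 975147, 1042530, 1045089, 1115411, 143488,
    195485, 1114907, 975651, 142466, 146049, 942946, 951168, 959283, 992160, 992674, 1020747,
    525186, 525664, 942433, 951681, 1023299, 449692, 505980, 817347, 866476, 451788, 448659, 328946,
    137452, 220398, 402642, 332024, 405720, 219336, 80097, 197596, 81145, 123760, 202904, 213955,
    189329, 406233, 455091, 495753, 500337, 545208, 559758, 1442632, 1465656, 560262, 1057597,
    1057094, 126327, 138071, 342705, 662199, 867175, 899975, 113175, 226599, 110611, 151831, 977509,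
    1507655, 1120871, 2126269, 2216375, 457885, 658085, 813684, 443506, 895605, 500877, 559236,
    130422, 131926, 336572, 656054, 861030, 893830, 222502, 113020, 153878, 980780, 1509740, 956331,
    971033, 177606, 1016228, 224666, 972427, 526732, 316886, 960809, 993704, 1479994, 968988,
    946278, 1447242, 1045594, 1094747, 1062192, 1092619, 1430857, 958779, 1442235, 1458614, 1463094,
    2127367, 2205771, 2218523, 1058125, 338583, 959799, 813261, 408285, 335102, 408798, 411860,
    493782, 442518, 499834, 504441, 815814, 864937, 201952, 452811, 447643, 811210, 898218, 447130,
    218346, 329972, 213451, 330998, 123250, 328433, 402129, 136530, 201691, 180624, 311770, 73961,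
    155996, 108881, 409808, 111161, 152473, 316362, 139668, 141203, 106873, 133861, 158065, 207319,
    51262, 76002, 216013, 173511, 228754, 199645, 183189, 141959, 145539, 182217, 952713, 977081,
    1040489, 1041518, 313298, 530281, 214755, 404181, 452240, 659111, 814715, 412375, 493267,
    200656, 444019, 339601, 896631, 495322, 411356, 192407, 315342, 816846, 59123, 412891, 61175,
    407748, 142903, 143921, 216807, 50226, 65595, 161625, 60155, 407186, 812868, 49392, 75499,
    202705, 146843, 49917, 448306, 76516, 219076, 313797, 334533, 475285, 697813, 1043053, 1059653,
    1428277, 2329175, 949096, 957317, 965416, 996265, 998307, 1018645, 531336, 861346, 1514168,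
    529253, 900270, 221560, 973598, 955278, 963374, 1016600, 943982, 960293, 148309, 1476789,
    132440, 129397, 108382, 1116350, 898731, 225150, 85261, 86280, 270592, 273669, 271618, 277260,
    271105, 274698, 82187, 83715, 83207, 945517, 953738, 961837, 994727, 998830, 1021210, 527757,
    860320, 1510589, 531818, 895140, 222077, 970004, 946020, 962346, 957828, 965924, 1017117,
    148826, 1479354, 131421, 125818, 110420, 1118900, 861859, 227188, 84228, 86798]
  core := [
    21, 22, 25, 30, 659, 3166, 253, 4515, 214, 365, 73, 293, 341, 292, 151, 3262, 3256, 880, 171,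
    161, 778, 734, 1934]
  rows := [
    10240, 5, 70368744177668, 16777216, 34359738368, 1237940039285380274899124241,
    180143985094819840, 28269566516427485202565808503666781279197155446164132624165889139852699924,
    35336956460537689413973414881313520559657908911822182637240240201437348081,
    91876082759991627656829610156461867651350722993753792795534421448060662787,
    28269559783026450881674449075879570913457013742970670234040884518153480367,
    21791363768602339277285938538929333506084, 5195467222975437487414555936047104,
    1208925819614629174724620,
    120145649279711730481357897977077167090837849835924659414762615198618666439,
    120145649279711730481357897977077167090837849835924659709910520377971500487,
    6585636390436266446671150251739895589431808484659012194384576941,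
    63606516241093873806792302512092964031584205306395872938100200875915325683,
    28269559779733833848190444500839457107653941796610449317811843325426288662,
    28269566520542855103571874354210753870458855004737880143671775647825729992,
    4115369115985225064783722915349768757882686299573789592884652132,
    4113762178323856028118871456981952127541979607281819671228082320,
    35350753223945203210195350546185217997687221531627808246281593392292077814]

theorem cert9_check : cert9.check tab (18446744073709551616) = true := by decide +kernel

/-- The certificate with mask 13. -/
def cert13 : Cert where
  mask := 13
  N := 62
  rk := 27
  s := 8
  D := 1024
  basis := [
    38, 40, 32, 10, 42, 41, 46, 18, 434, 442, 3, 39, 313, 325, 87, 125, 43, 245, 140, 166, 168, 97,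
    199, 155, 188, 49, 411, 446, 322, 101, 421, 133, 321, 404, 237, 250, 439, 416, 102, 172, 113,
    422, 100, 145, 425, 269, 265, 0, 5, 16, 20, 48, 53, 54, 64, 65, 67, 71, 72, 73, 74, 77]
  steps := [
    8, 2293811, 2296376, 2296892, 2288684, 20492, 2288165, 2052, 16420, 24600, 2285603, 26652,
    35389, 37946, 19462, 2290733, 35853, 2316821, 1747486, 2310220, 27161, 29722, 1026, 7182,
    1960477, 1982985, 2314308, 3094, 17442, 1989186, 6657, 1747022, 2312773, 4625, 16929, 1958470,
    2123188, 2124725, 2122673, 2129340, 2126777, 2127280, 32820, 1445184, 1059926, 1448756, 1063517,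
    1444661, 1060676, 1429298, 2329173, 449177, 814274, 1043053, 1047143, 1043975, 330322, 477785,
    953223, 961313, 1022738, 899757, 1477809, 453312, 502902, 969488, 994218, 456852, 506488,
    530791, 973088, 997804, 503946, 996440, 817857, 1020177, 1061182, 1513655, 455838, 972066,
    139664, 149841, 182725, 190935, 223602, 77032, 138071, 201177, 220096, 200148, 217538, 127355,
    339122, 658619, 863595, 896395, 172491, 980074, 1117291, 129907, 135507, 340144, 659635, 864611,
    897411, 110611, 981100, 1118307, 2311703, 2313755, 109643, 1959435, 51964, 78054, 160119,
    332880, 480350, 162651, 333905, 481364, 203742, 216513, 187293, 192920, 975651, 1045088,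
    1047650, 1114391, 154395, 146049, 227627, 191894, 1115411, 976167, 142466, 143488, 2125747,
    2127803, 2207670, 2215864, 2346941, 942433, 950658, 958779, 991650, 992161, 1018183, 524673,
    525154, 1064259, 1442118, 943456, 959799, 951168, 959283, 1020747, 1444157, 1449272, 1443149,
    1442632, 1446710, 188890, 1045594, 1046107, 342163, 661699, 866430, 899196, 405720, 443032,
    500360, 507017, 818376, 559758, 495833, 560262, 332537, 945517, 953738, 961837, 994727, 998830,
    527757, 531818, 1477309, 970004, 962346, 994951, 1017117, 1479354, 1116954, 1510730, 974116,
    1062192, 1447226, 1447753, 457885, 658085, 813684, 443506, 133861, 338583, 895605, 444565,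
    895140, 813261, 408285, 500877, 812229, 327920, 125818, 216013, 335102, 408798, 141715, 559236,
    215268, 334589, 401616, 111965, 228245, 314333, 76002, 158065, 411860, 133466, 198101, 152986,
    210390, 214471, 228754, 493782, 185798, 341162, 404683, 447610, 453830, 123104, 865401, 452758,
    499824, 811210, 860320, 218346, 447130, 329972, 330998, 136530, 201691, 196841, 328433, 402129,
    152473, 316362, 127869, 409810, 177532, 336545, 660137, 980780, 1115926, 1482118, 1509740,
    112982, 155996, 861030, 340662, 897932, 964523, 972427, 1016228, 131809, 154012, 211416, 106873,
    147740, 946600, 656076, 1511756, 1021721, 558723, 81132, 123760, 213955, 186824, 223017, 954472,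
    962854, 993372, 1127507, 402588, 1448252, 137552, 204243, 111161, 226193, 960817, 332024,
    697308, 328946, 1058638, 113726, 155038, 318924, 74478, 162166, 37431, 66295, 115540, 144279,
    182217, 192464, 946020, 952713, 977081, 1040489, 1041518, 1118900, 313298, 315342, 528260,
    530281, 144955, 146482, 153433, 186308, 194513, 227188, 49915, 65779, 202471, 331460, 339623,
    405207, 446071, 454350, 75499, 79587, 407772, 456338, 657059, 659145, 863867, 412373, 495322,
    501363, 329360, 411347, 497371, 947045, 955278, 963374, 993187, 996269, 1016600, 529285, 867502,
    1512117, 526190, 898731, 1478334, 225150, 971541, 952200, 960293, 1017630, 949096, 965416,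
    150360, 1480888, 129397, 138581, 337058, 137054, 221560, 85254, 88840, 271618, 277260, 270592,
    273669, 271105, 274698, 83207, 87819, 83715, 84228, 86798]
  core := [
    3, 21, 22, 25, 30, 116, 3835, 2860, 3408, 4465, 2188, 221, 51, 358, 619, 3051, 168, 2099, 256,
    2947, 82, 3977, 806, 117, 259, 161, 309]
  rows := [
    8388608, 9216, 10625324595252794753024,
    14134776533051092218447950850342613561815927527321208458607745000624306199,
    56539133060881623937885020260575370909105625394347454764549434032123578451, 8589934592,
    8796093022208, 9671406556917041997021184,
    28269579996428161072952703434144330606957830769937060229069661175791622183, 10133099161583616,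
    8, 28269579996428161072952703422726349054665943161493704482153471971523168283,
    13164932717531748699061685947658408783465503806468,
    44171205277605570180980457571995398893723771747378295670406993785012159528,
    42404356529477644784055521064289513342356098730994738624546227392026873893,
    14134776518241551202557096459529909366507885374003016209855661077210228747,
    28269579996428161072952703422726349054665943161493704481000550466916321307,
    11704870884311560596030720719851361534718857187333,
    13164943867904347954232051913691709904477297316868,
    14134776518241551202557096459529909355853292220289549916111082609639049219,
    15901652227961660898426410555519887284884972448380156053368936422425453584,
    9074526551669983445048934215756996246726825254008944082841773309895012392997,
    18092527760308267015260104307996155760379015733403790755682176257954249031695,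
    18092527760308267015273908739001024170367347820096329097734773489802435186715,
    16683165442486368665670284180986838025026182043898484388707003210084095121845342,
    14134776533051092218447950856051604337961881461605018883705656034502856733,
    28269580011250557593197629747161370499015007100229922869659084686785771559]

theorem cert13_check : cert13.check tab (18446744073709551616) = true := by decide +kernel

/-- The field with four elements. -/
abbrev F4 := QuadraticAlgebra (ZMod 2) (-41) 1

/-- Reduction modulo two. -/
def red : Zw →+* F4 where
  toFun z := ⟨z.re, z.im⟩
  map_zero' := by ext <;> simp
  map_one' := by ext <;> simp [QuadraticAlgebra.re_one, QuadraticAlgebra.im_one]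
  map_add' x y := by ext <;> simp
  map_mul' x y := by ext <;> simp

/-- Half of an even element. -/
def half (z : Zw) : Zw := ⟨z.re / 2, z.im / 2⟩

theorem red_eq_zero {z : Zw} : red z = 0 ↔ 2 * half z = z := by
  have h : ∀ n : ℤ, (n : ZMod 2) = 0 ↔ 2 * (n / 2) = n := fun n => by
    rw [ZMod.intCast_zmod_eq_zero_iff_dvd]; push_cast; omega
  rw [QuadraticAlgebra.ext_iff, QuadraticAlgebra.ext_iff]
  simp only [red, RingHom.coe_mk, MonoidHom.coe_mk, OneHom.coe_mk, half, QuadraticAlgebra.re_zero,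
    QuadraticAlgebra.im_zero, h, two_mul, QuadraticAlgebra.re_add, QuadraticAlgebra.im_add]

theorem red_two_mul (z : Zw) : red (2 * z) = 0 := by
  rw [red_eq_zero, QuadraticAlgebra.ext_iff]
  simp only [half, two_mul, QuadraticAlgebra.re_add, QuadraticAlgebra.im_add]
  omega

theorem half_two_mul (z : Zw) : half (2 * z) = z := by
  rw [QuadraticAlgebra.ext_iff]
  simp only [half, two_mul, QuadraticAlgebra.re_add, QuadraticAlgebra.im_add]
  omega

theorem det_val (g : GL (Fin 2) Zw) : g.val.det = 1 ∨ g.val.det = -1 :=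
  eq_one_or_of_isUnit ((Matrix.isUnit_iff_isUnit_det _).1 g.isUnit)

theorem red_det (g : GL (Fin 2) Zw) :
    red (g.val 0 0) * red (g.val 1 1) - red (g.val 0 1) * red (g.val 1 0) = 1 := by
  rw [← map_mul, ← map_mul, ← map_sub, ← Matrix.det_fin_two]
  have h : (-1 : F4) = 1 := by decide
  rcases det_val g with h' | h' <;> rw [h'] <;> simp [h]

theorem mul_val (g h : GL (Fin 2) Zw) (i j : Fin 2) :
    (g * h).val i j = g.val i 0 * h.val 0 j + g.val i 1 * h.val 1 j := by
  rw [Units.val_mul, Matrix.mul_apply, Fin.sum_univ_two]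

/-- Matrices whose first row reduces to that of the identity. -/
def GU : Subgroup (GL (Fin 2) Zw) where
  carrier := {g | red (g.val 0 0) = 1 ∧ red (g.val 0 1) = 0}
  one_mem' := by simp
  mul_mem' := by
    rintro g h ⟨h1, h2⟩ ⟨h3, h4⟩
    simp [mul_val, h1, h2, h3, h4]
  inv_mem' := by
    rintro g ⟨h1, h2⟩
    have h0 : ∀ j, red ((g * g⁻¹).val 0 j) = red (g⁻¹.val 0 j) := fun j => by
      rw [mul_val, map_add, map_mul, map_mul, h1, h2, one_mul, zero_mul, add_zero]
    rw [Set.mem_ofPred_eq, ← h0, ← h0, mul_inv_cancel]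
    simp

theorem mem_GU {g : GL (Fin 2) Zw} : g ∈ GU ↔ red (g.val 0 0) = 1 ∧ red (g.val 0 1) = 0 := Iff.rfl

theorem red_11_of_mem_GU {g : GL (Fin 2) Zw} (hg : g ∈ GU) : red (g.val 1 1) = 1 := by
  have := red_det g
  rwa [hg.1, hg.2, one_mul, zero_mul, sub_zero] at this

/-- One if the determinant is negative. -/
def dt (g : GL (Fin 2) Zw) : ZMod 2 := if g.val.det.re = -1 then 1 else 0

theorem dt_mul (g h : GL (Fin 2) Zw) : dt (g * h) = dt g + dt h := by
  unfold dt
  rw [Units.val_mul, Matrix.det_mul]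
  rcases det_val g with h1 | h1 <;> rcases det_val h with h2 | h2 <;> rw [h1, h2] <;> simp
  decide

/-- The reduction of half of the upper right entry. -/
def ub (g : GL (Fin 2) Zw) : F4 := red (half (g.val 0 1))

/-- The reduction of the lower left entry. -/
def lc (g : GL (Fin 2) Zw) : F4 := red (g.val 1 0)

theorem ub_mul {g h : GL (Fin 2) Zw} (hg : g ∈ GU) (hh : h ∈ GU) : ub (g * h) = ub g + ub h := by
  have e1 := red_eq_zero.1 hg.2
  have e2 := red_eq_zero.1 hh.2
  have e : (g * h).val 0 1 = 2 * (g.val 0 0 * half (h.val 0 1) + half (g.val 0 1) * h.val 1 1) := by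
    rw [mul_val, ← e1, ← e2, half_two_mul, half_two_mul]; ring
  rw [ub, e, half_two_mul, map_add, map_mul, map_mul, hg.1, red_11_of_mem_GU hh, one_mul, mul_one,
    add_comm]
  rfl

theorem lc_mul {g h : GL (Fin 2) Zw} (hg : g ∈ GU) (hh : h ∈ GU) : lc (g * h) = lc g + lc h := by
  rw [lc, mul_val, map_add, map_mul, map_mul, hh.1, red_11_of_mem_GU hg, one_mul, mul_one]
  rfl

/-- The sign character with a given mask. -/
def kap (m : ℕ) (g : GL (Fin 2) Zw) : ZMod 2 :=
  m * (ub g).im + (m / 2 : ℕ) * (lc g).re + (m / 4 : ℕ) * (lc g).im + (m / 8 : ℕ) * dt g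

theorem kap_mul (m : ℕ) {g h : GL (Fin 2) Zw} (hg : g ∈ GU) (hh : h ∈ GU) :
    kap m (g * h) = kap m g + kap m h := by
  simp only [kap, ub_mul hg hh, lc_mul hg hh, dt_mul, QuadraticAlgebra.re_add,
    QuadraticAlgebra.im_add]
  ring

/-- The code of a nonzero vector. -/
def vcode (u v : F4) : ℕ := u.re.val + 2 * u.im.val + 4 * v.re.val + 8 * v.im.val

theorem vcode_inj {u v u' v' : F4} (h : vcode u v = vcode u' v') : u = u' ∧ v = v' := by
  obtain ⟨u1, u2⟩ := u
  obtain ⟨v1, v2⟩ := v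
  obtain ⟨x1, x2⟩ := u'
  obtain ⟨y1, y2⟩ := v'
  simp only [vcode] at h
  have := u1.val_lt
  have := u2.val_lt
  have := v1.val_lt
  have := v2.val_lt
  have := x1.val_lt
  have := x2.val_lt
  have := y1.val_lt
  have := y2.val_lt
  simp only [QuadraticAlgebra.mk.injEq]
  refine ⟨⟨?_, ?_⟩, ?_, ?_⟩ <;> apply ZMod.val_injective <;> omega

/-- The state of a matrix, given by the reduction of its first row. -/
def stt (g : GL (Fin 2) Zw) : St := stOf (vcode (red (g.val 0 0)) (red (g.val 0 1)) - 1)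

theorem ix_stOf {k : ℕ} (h : k < 15) : (stOf k).ix = k := by
  revert k; decide

theorem stt_eq_iff {g h : GL (Fin 2) Zw} : stt g = stt h ↔
    red (g.val 0 0) = red (h.val 0 0) ∧ red (g.val 0 1) = red (h.val 0 1) := by
  have hv : ∀ g : GL (Fin 2) Zw, vcode (red (g.val 0 0)) (red (g.val 0 1)) ≠ 0 ∧
      vcode (red (g.val 0 0)) (red (g.val 0 1)) < 16 := by
    intro g
    constructor
    · intro e
      obtain ⟨h1, h2⟩ := vcode_inj (u' := 0) (v' := 0) e
      have := red_det g
      rw [h1, h2, zero_mul, zero_mul, sub_zero] at this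
      exact absurd this (by decide)
    · have h1 := (red (g.val 0 0)).re.val_lt
      have h2 := (red (g.val 0 0)).im.val_lt
      have h3 := (red (g.val 0 1)).re.val_lt
      have h4 := (red (g.val 0 1)).im.val_lt
      unfold vcode
      omega
  constructor
  · intro e
    have e := congrArg St.ix e
    have h1 := hv g
    have h2 := hv h
    rw [stt, stt, ix_stOf (by omega), ix_stOf (by omega)] at e
    exact vcode_inj (by omega)
  · rintro ⟨h1, h2⟩
    rw [stt, stt, h1, h2]

theorem stt_mul {γ : GL (Fin 2) Zw} (hγ : γ ∈ GU) (g : GL (Fin 2) Zw) : stt (γ * g) = stt g := by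
  rw [stt_eq_iff]
  simp [mul_val, hγ.1, hγ.2]

theorem stt_mul_right {g h : GL (Fin 2) Zw} (e : stt g = stt h) (x : GL (Fin 2) Zw) :
    stt (g * x) = stt (h * x) := by
  rw [stt_eq_iff] at e ⊢
  simp [mul_val, e.1, e.2]

theorem mul_inv_mem_GU {g h : GL (Fin 2) Zw} (e : stt g = stt h) : g * h⁻¹ ∈ GU := by
  have := stt_mul_right e h⁻¹
  rw [mul_inv_cancel, stt_eq_iff] at this
  rw [mem_GU, this.1, this.2]
  simp

/-- A matrix with a given state. -/
def rawRep : St → RawM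
  | .s1 => ⟨(1, 0), (0, 0), (0, 0), (1, 0)⟩
  | .s2 => ⟨(0, 1), (-42, 2), (1, 0), (1, 1)⟩
  | .s3 => ⟨(1, 1), (-42, 2), (1, 0), (0, 1)⟩
  | .s4 => ⟨(0, 0), (-1, 0), (1, 0), (0, 0)⟩
  | .s5 => ⟨(1, 0), (1, 0), (0, 0), (1, 0)⟩
  | .s6 => ⟨(0, 1), (-1, 0), (1, 0), (0, 0)⟩
  | .s7 => ⟨(1, 1), (-1, 0), (1, 0), (0, 0)⟩
  | .s8 => ⟨(-42, 2), (0, -1), (1, 1), (-1, 0)⟩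
  | .s9 => ⟨(1, 0), (0, 1), (0, 0), (1, 0)⟩
  | .s10 => ⟨(0, 1), (-42, 1), (1, 0), (0, 1)⟩
  | .s11 => ⟨(1, 1), (0, 1), (1, 0), (1, 0)⟩
  | .s12 => ⟨(-42, 2), (-1, -1), (0, 1), (-1, 0)⟩
  | .s13 => ⟨(1, 0), (1, 1), (0, 0), (1, 0)⟩
  | .s14 => ⟨(0, 1), (-1, 1), (1, 0), (1, 0)⟩
  | .s15 => ⟨(1, 1), (-41, 3), (1, 0), (1, 1)⟩

/-- The coordinates of the generators. -/
def rawGen : ℕ → RawM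
  | 0 => rawT (1, 0)
  | 1 => rawT (0, 1)
  | 2 => rawD true
  | j + 3 => rawLetter j

theorem is_gen (s : ℕ) : RawM.Is (stdSys.gen s) (rawGen s) := by
  rcases s with _ | _ | _ | j
  · exact is_rawT _
  · exact is_rawT _
  · exact is_rawD _
  · exact is_toGL (Or.inl (det_rawLetter j))

theorem det_rawRep (m : St) : (rawRep m).det = (1, 0) := by
  cases m <;> decide

/-- The matrices representing the states. -/
noncomputable def rep (m : St) : GL (Fin 2) Zw := (rawRep m).toGL

theorem is_rep (m : St) : RawM.Is (rep m) (rawRep m) := is_toGL (Or.inl (det_rawRep m))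

/-- The parity of an integer, as a natural number. -/
def ipar (n : ℤ) : ℕ := (n % 2).toNat

theorem ipar_lt (n : ℤ) : ipar n < 2 := by unfold ipar; omega

theorem cast_ipar (n : ℤ) : ((ipar n : ℕ) : ZMod 2) = (n : ZMod 2) := by
  have h : ((ipar n : ℕ) : ℤ) = n % 2 := by unfold ipar; omega
  have := congrArg (Int.cast : ℤ → ZMod 2) h
  rw [Int.cast_natCast] at this
  rw [this, ZMod.intCast_eq_intCast_iff]
  exact Int.mod_modEq n 2

theorem val_cast (n : ℤ) : ((n : ZMod 2)).val = ipar n := by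
  rw [← cast_ipar, ZMod.val_natCast, Nat.mod_eq_of_lt (ipar_lt n)]

/-- The state in coordinates. -/
def RawM.stt (x : RawM) : St :=
  stOf (ipar x.a.1 + 2 * ipar x.a.2 + 4 * ipar x.b.1 + 8 * ipar x.b.2 - 1)

/-- The signs in coordinates. -/
def RawM.bits (x : RawM) : ℕ :=
  ipar (x.b.2 / 2) + 2 * ipar x.c.1 + 4 * ipar x.c.2 + 8 * (if x.det.1 = -1 then 1 else 0)

/-- The sign given by a number modulo two. -/
def sgn (k : ZMod 2) : Bool := decide (k = 1)

theorem sgn_add (k l : ZMod 2) : sgn (k + l) = xor (sgn k) (sgn l) := by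
  revert k l; decide

theorem RawM.Is.stt {g : GL (Fin 2) Zw} {x : RawM} (h : RawM.Is g x) : _root_.stt g = x.stt := by
  rw [_root_.stt, show g.val = x.toMat from h]
  simp [RawM.toMat, RawZ.toZ, vcode, red, val_cast, RawM.stt]

theorem sgn_eq_par : ∀ m < 16, ∀ p < 2, ∀ q < 2, ∀ r < 2, ∀ s < 2,
    sgn ((m : ℕ) * (p : ℕ) + (m / 2 : ℕ) * (q : ℕ) + (m / 4 : ℕ) * (r : ℕ) + (m / 8 : ℕ) * (s : ℕ)) =
      par (p + 2 * q + 4 * r + 8 * s) m := by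
  decide +kernel

theorem RawM.Is.kap {g : GL (Fin 2) Zw} {x : RawM} (h : RawM.Is g x) {m : ℕ} (hm : m < 16) :
    sgn (_root_.kap m g) = par x.bits m := by
  have h2 : (if x.det.1 = -1 then 1 else 0) < 2 := by split <;> norm_num
  rw [RawM.bits, ← sgn_eq_par m hm _ (ipar_lt _) _ (ipar_lt _) _ (ipar_lt _) _ h2]
  have h3 : dt g = ((if x.det.1 = -1 then 1 else 0 : ℕ) : ZMod 2) := by
    rw [dt, show g.val = x.toMat from h, RawM.det_toMat]
    split_ifs <;> simp_all [RawZ.toZ]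
  rw [_root_.kap, h3, cast_ipar, cast_ipar, cast_ipar, ub, lc, show g.val = x.toMat from h]
  simp [RawM.toMat, RawZ.toZ, red, half]

/-- The target state in a table with eight bits per state. -/
def tgtT (a : ℕ) (n : St) : St := stOf (Nat.mod (Nat.div a (Nat.pow 256 n.ix)) 16)

/-- The signs in a table with eight bits per state. -/
def bitsT (a : ℕ) (n : St) : ℕ := Nat.mod (Nat.div a (Nat.pow 256 n.ix * 16)) 16

/-- Test the tables at an edge. -/
def edgeCheck (s : ℕ) (n : St) : Bool :=
  let p := tab.getD s (0, 0)
  let m := tgtT p.1 n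
  let x := (rawRep n).mul (rawGen s)
  Nat.beq x.stt.ix m.ix && Nat.beq (bitsT p.1 n) (x.mul (rawRep m).adj).bits &&
    Nat.beq (tgtT p.2 m).ix n.ix && Nat.beq (bitsT p.2 m) (bitsT p.1 n)

theorem edgeCheck_tab : (List.range 30).all (fun s => stL.all fun n => edgeCheck s n) = true := by
  decide +kernel

theorem mem_stL (n : St) : n ∈ stL := by cases n <;> simp [stL]

theorem St.ix_inj {m n : St} (h : m.ix = n.ix) : m = n := by
  have hs : ∀ n : St, stOf n.ix = n := fun n => by cases n <;> rfl
  rw [← hs m, h, hs]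

theorem edge_spec {s : ℕ} (hs : s < 30) (n : St) :
    ((rawRep n).mul (rawGen s)).stt = tgtT (tab.getD s (0, 0)).1 n ∧
    bitsT (tab.getD s (0, 0)).1 n =
      (((rawRep n).mul (rawGen s)).mul (rawRep (tgtT (tab.getD s (0, 0)).1 n)).adj).bits ∧
    tgtT (tab.getD s (0, 0)).2 (tgtT (tab.getD s (0, 0)).1 n) = n ∧
    bitsT (tab.getD s (0, 0)).2 (tgtT (tab.getD s (0, 0)).1 n) = bitsT (tab.getD s (0, 0)).1 n := by
  have h := edgeCheck_tab
  rw [List.all_eq_true] at h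
  have h := List.all_eq_true.1 (h s (List.mem_range.2 hs)) n (mem_stL n)
  simp only [edgeCheck, Bool.and_eq_true] at h
  exact ⟨St.ix_inj (Nat.eq_of_beq_eq_true h.1.1.1), Nat.eq_of_beq_eq_true h.1.1.2,
    St.ix_inj (Nat.eq_of_beq_eq_true h.1.2), Nat.eq_of_beq_eq_true h.2⟩

theorem stt_rep (m : St) : stt (rep m) = m := by
  rw [(is_rep m).stt]
  cases m <;> rfl

/-- The part of a matrix fixing the first row modulo two. -/
noncomputable def gup (g : GL (Fin 2) Zw) : GL (Fin 2) Zw := g * (rep (stt g))⁻¹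

theorem gup_mem (g : GL (Fin 2) Zw) : gup g ∈ GU := mul_inv_mem_GU (stt_rep _).symm

theorem gup_mul_rep (g : GL (Fin 2) Zw) : gup g * rep (stt g) = g := inv_mul_cancel_right _ _

theorem gup_mul {γ : GL (Fin 2) Zw} (hγ : γ ∈ GU) (g : GL (Fin 2) Zw) : gup (γ * g) = γ * gup g := by
  rw [gup, stt_mul hγ, mul_assoc]; rfl

theorem gup_rep (m : St) : gup (rep m) = 1 := by rw [gup, stt_rep, mul_inv_cancel]

theorem kap_one (m : ℕ) : kap m 1 = 0 := by
  have := kap_mul m GU.one_mem GU.one_mem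
  rw [mul_one] at this
  simpa using this

theorem is_z : RawM.Is stdSys.z (rawN true) := is_rawN true

theorem z_mem_GU : stdSys.z ∈ GU := by
  have h : stt stdSys.z = stt 1 := by rw [is_z.stt, RawM.Is.one.stt]; rfl
  simpa using mul_inv_mem_GU h

theorem mul_z (g : GL (Fin 2) Zw) : g * stdSys.z = stdSys.z * g := (rawN_comm g).eq.symm

section compat
variable {m : ℕ}

theorem sgn_kap_gup_mul (m : ℕ) {γ : GL (Fin 2) Zw} (hγ : γ ∈ GU) (g : GL (Fin 2) Zw) :
    sgn (kap m (gup (γ * g))) = xor (sgn (kap m γ)) (sgn (kap m (gup g))) := by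
  rw [gup_mul hγ, kap_mul m hγ (gup_mem g), sgn_add]

theorem stt_mul_gen {s : ℕ} (hs : s < 30) (g : GL (Fin 2) Zw) :
    stt (g * stdSys.gen s) = tgtT (tab.getD s (0, 0)).1 (stt g) := by
  rw [stt_mul_right (stt_rep (stt g)).symm, ((is_rep _).mul (is_gen s)).stt]
  exact (edge_spec hs _).1

theorem sgn_mul_gen (hm : m < 16) {s : ℕ} (hs : s < 30) (g : GL (Fin 2) Zw) :
    sgn (kap m (gup (g * stdSys.gen s))) =
      xor (sgn (kap m (gup g))) (par (bitsT (tab.getD s (0, 0)).1 (stt g)) m) := by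
  conv_lhs => rw [← gup_mul_rep g, mul_assoc, sgn_kap_gup_mul m (gup_mem g)]
  congr 1
  rw [gup, stt_mul_gen hs, stt_rep, (edge_spec hs _).2.1]
  exact (((is_rep _).mul (is_gen s)).mul ((is_rep _).inv (det_rawRep _))).kap hm

theorem sgn_kap_z (hm : m < 16) : sgn (kap m stdSys.z) = false := by
  rw [is_z.kap hm]
  revert m; decide

theorem compat_ofTab (hm : m < 16) :
    (Walker.ofTab tab m).Compat stt fun g => sgn (kap m (gup g)) where
  nx s hs g := stt_mul_gen hs g
  sg s hs g := sgn_mul_gen hm hs g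
  nxi s hs g := by
    have h := stt_mul_gen hs (g * (stdSys.gen s)⁻¹)
    rw [inv_mul_cancel_right] at h
    show _ = tgtT (tab.getD s (0, 0)).2 (stt g)
    rw [h, (edge_spec hs _).2.2.1]
  sgi s hs g := by
    have h := stt_mul_gen hs (g * (stdSys.gen s)⁻¹)
    have h' := sgn_mul_gen hm hs (g * (stdSys.gen s)⁻¹)
    rw [inv_mul_cancel_right] at h h'
    show _ = xor _ (par (bitsT (tab.getD s (0, 0)).2 (stt g)) m)
    rw [h', h, (edge_spec hs _).2.2.2, Bool.xor_assoc, Bool.xor_self, Bool.xor_false]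
  nz g := by rw [mul_z, stt_mul z_mem_GU]
  ez g := by simp only [mul_z, sgn_kap_gup_mul m z_mem_GU, sgn_kap_z hm, Bool.false_xor]

end compat

/-- A function on a group which on a subgroup is a homomorphism twisted by signs. -/
def IsCr {G A : Type*} [Group G] [AddCommGroup A] (Δ : Subgroup G) (κ : G → ZMod 2) (f : G → A) :
    Prop :=
  ∀ x ∈ Δ, ∀ y ∈ Δ, f (x * y) = f x + bact (sgn (κ x)) (f y)

/-- Twisted homomorphisms lift. -/
def Lifts {G T : Type*} [Group G] [AddCommGroup T] (π : ℚ →+ T) (Δ : Subgroup G)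
    (κ : G → ZMod 2) : Prop :=
  ∀ f : G → T, IsCr Δ κ f → ∃ F : G → ℚ, IsCr Δ κ F ∧ ∀ x ∈ Δ, π (F x) = f x

theorem IsCr.map_one {G A : Type*} [Group G] [AddCommGroup A] {Δ : Subgroup G} {κ : G → ZMod 2}
    {f : G → A} (hf : IsCr Δ κ f) (h1 : κ 1 = 0) : f 1 = 0 := by
  have h := hf 1 Δ.one_mem 1 Δ.one_mem
  rw [mul_one, h1] at h
  simpa [sgn] using h

theorem Liftable.lifts {m : ℕ} (hm : m < 16) (h : Liftable (.ofTab tab m)) {T : Type}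
    [AddCommGroup T] {π : ℚ →+ T} (hπ : Function.Surjective π)
    (hT : ∀ a : T, 89760 • a = 0 → a = 0) : Lifts π GU (kap m) := by
  intro f hf
  have f1 : f 1 = 0 := hf.map_one (kap_one m)
  let e : GL (Fin 2) Zw → Bool := fun g => sgn (kap m (gup g))
  have hc : (Walker.ofTab tab m).Compat stt e := compat_ofTab hm
  let H : GL (Fin 2) Zw → T := fun g => f (gup g)
  have hH : ∀ γ ∈ GU, ∀ g, H (γ * g) = f γ + bact (sgn (kap m γ)) (H g) := fun γ hγ g => by
    simp only [H, gup_mul hγ]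
    exact hf γ hγ _ (gup_mem g)
  have hz : ∀ g, H (g * stdSys.z) = H g := fun g => by
    have h0 := sgn_kap_z hm
    have h1 := hf _ z_mem_GU _ z_mem_GU
    rw [stdSys.zz, f1, h0, bact_false, ← two_nsmul] at h1
    have h2 : f stdSys.z = 0 := hT _ (by
      rw [show 89760 = 44880 * 2 from rfl, mul_smul, ← h1, smul_zero])
    rw [mul_z, hH _ z_mem_GU, h0, h2, zero_add, bact_false]
  let y : ℕ → St → T := fun s n => H (rep n * stdSys.gen s)
  have hy : Solves (.ofTab tab m) y := by
    refine Solves.of_hom hc stt_rep (fun n => ?_) (σ := Coc.cob H) (fun _ => rfl)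
      (fun g => by simp [Coc.cob, hz]) (fun s _ g => ?_)
    · simp only [e, gup_rep, kap_one]; rfl
    · show H (g * stdSys.gen s) - H g = _
      conv_lhs => rw [← gup_mul_rep g, mul_assoc, hH _ (gup_mem g), hH _ (gup_mem g)]
      have h0 : H (rep (stt g)) = 0 := by simp only [H, gup_rep, f1]
      rw [h0, bact_zero, add_zero, add_sub_cancel_left]
  obtain ⟨x, hx, hxy⟩ := h π hπ hT y hy
  obtain ⟨σ, hσz, hσ⟩ := Solves.exists_hom hc hx
  have hx' : Coc.xHom.comp σ = MonoidHom.id _ := hom_ext_gen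
    (by simp [hσz, Coc.xHom]) fun s hs => by simp [hσ s hs, Coc.xHom]
  have hxg : ∀ g, (σ g).x = g := fun g => DFunLike.congr_fun hx' g
  have hmap : (Coc.map π).comp σ = Coc.cob H := hom_ext_gen
    (by simp [hσz, Coc.map, Coc.cob, hz]) fun s hs => by
      simp only [MonoidHom.comp_apply, hσ s hs]
      refine Coc.ext (funext fun g => ?_) rfl
      show π (bact (e g) (x s (stt g))) = H (g * stdSys.gen s) - H g
      rw [map_bact, hxy s hs]
      conv_rhs => rw [← gup_mul_rep g, mul_assoc, hH _ (gup_mem g), hH _ (gup_mem g)]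
      have h0 : H (rep (stt g)) = 0 := by simp only [H, gup_rep, f1]
      rw [h0, bact_zero, add_zero, add_sub_cancel_left]
  have heq : ∀ g, ∀ γ ∈ GU, ∀ k, (σ g).c (γ * k) = bact (sgn (kap m γ)) ((σ g).c k) := by
    let K : Subgroup (GL (Fin 2) Zw) :=
      { carrier := {g | ∀ γ ∈ GU, ∀ k, (σ g).c (γ * k) = bact (sgn (kap m γ)) ((σ g).c k)}
        one_mem' := fun γ _ k => by simp
        mul_mem' := fun {g h} hg hh γ hγ k => by
          rw [map_mul, Coc.mul_c, Coc.mul_c, hg γ hγ, mul_assoc, hh γ hγ, bact_add]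
        inv_mem' := fun {g} hg γ hγ k => by
          rw [map_inv, Coc.inv_c, Coc.inv_c, mul_assoc, hg γ hγ, bact_neg] }
    refine mem_of_gen K (fun γ _ k => by simp [hσz]) (fun s hs γ hγ k => ?_)
    rw [hσ s hs]
    simp only [e, stt_mul hγ, sgn_kap_gup_mul m hγ, bact_xor]
  refine ⟨fun g => (σ g).c 1, fun g hg k _ => ?_, fun g hg => ?_⟩
  · simp only [map_mul, Coc.mul_c, hxg, one_mul]
    rw [← heq k g hg 1, mul_one]
  · have h1 := congrArg (fun p : Coc (GL (Fin 2) Zw) T => p.c 1) (DFunLike.congr_fun hmap g)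
    have h2 : π ((σ g).c 1) = H (1 * g) - H 1 := h1
    have h3 : H 1 = 0 := by
      have : rep (stt 1) = 1 := by
        rw [RawM.Is.one.stt]
        exact (is_rep .s1).ext RawM.Is.one
      simp only [H, gup, this, inv_one, mul_one, f1]
    have h4 := hH g hg 1
    rw [h3, bact_zero, add_zero, mul_one] at h4
    rw [h2, one_mul, h3, sub_zero, h4]

/-- A function which is additive on a subgroup. -/
def HomOn {G Q : Type*} [Group G] [Add Q] (Δ : Subgroup G) (χ : G → Q) : Prop :=
  ∀ x ∈ Δ, ∀ y ∈ Δ, χ (x * y) = χ x + χ y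

section HomOn
variable {G Q : Type*} [Group G] [AddCommGroup Q] {Δ : Subgroup G} {χ : G → Q}

theorem HomOn.map_one (h : HomOn Δ χ) : χ 1 = 0 := by
  have := h 1 Δ.one_mem 1 Δ.one_mem
  simpa using this

theorem HomOn.map_inv (h : HomOn Δ χ) {x : G} (hx : x ∈ Δ) : χ x⁻¹ = -χ x := by
  have := h x hx _ (Δ.inv_mem hx)
  rw [mul_inv_cancel, h.map_one] at this
  exact (neg_eq_of_add_eq_zero_right this.symm).symm

theorem HomOn.mono {Δ' : Subgroup G} (h : HomOn Δ χ) (hle : Δ' ≤ Δ) : HomOn Δ' χ :=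
  fun x hx y hy => h x (hle hx) y (hle hy)

/-- The kernel of a function which is additive on a subgroup. -/
def HomOn.ker (h : HomOn Δ χ) : Subgroup G where
  carrier := {x | x ∈ Δ ∧ χ x = 0}
  one_mem' := ⟨Δ.one_mem, h.map_one⟩
  mul_mem' := fun hx hy => ⟨Δ.mul_mem hx.1 hy.1, by rw [h _ hx.1 _ hy.1, hx.2, hy.2, add_zero]⟩
  inv_mem' := fun hx => ⟨Δ.inv_mem hx.1, by rw [h.map_inv hx.1, hx.2, neg_zero]⟩

theorem HomOn.mem_ker {h : HomOn Δ χ} {x : G} : x ∈ h.ker ↔ x ∈ Δ ∧ χ x = 0 := Iff.rfl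

theorem HomOn.ker_le (h : HomOn Δ χ) : h.ker ≤ Δ := fun _ hx => hx.1

end HomOn

theorem IsCr.congr {G A : Type*} [Group G] [AddCommGroup A] {Δ : Subgroup G} {κ κ' : G → ZMod 2}
    {f : G → A} (hf : IsCr Δ κ f) (h : ∀ x ∈ Δ, κ x = κ' x) : IsCr Δ κ' f := fun x hx y hy => by
  rw [hf x hx y hy, h x hx]

theorem Lifts.congr {G T : Type*} [Group G] [AddCommGroup T] {π : ℚ →+ T} {Δ : Subgroup G}
    {κ κ' : G → ZMod 2} (h : Lifts π Δ κ) (e : ∀ x ∈ Δ, κ x = κ' x) : Lifts π Δ κ' := fun f hf =>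
  let ⟨F, hF, hπ⟩ := h f (hf.congr fun x hx => (e x hx).symm)
  ⟨F, hF.congr e, hπ⟩

/-- Transport along isomorphisms of subgroups. -/
theorem Lifts.transport {G G' T : Type*} [Group G] [Group G'] [AddCommGroup T] {π : ℚ →+ T}
    {Δ : Subgroup G} {Δ' : Subgroup G'} {κ : G → ZMod 2} {κ' : G' → ZMod 2} (h : Lifts π Δ κ)
    (φ : G' → G) (ψ : G → G') (hφ : ∀ x ∈ Δ', φ x ∈ Δ) (hψ : ∀ x ∈ Δ, ψ x ∈ Δ')
    (hm : ∀ x ∈ Δ', ∀ y ∈ Δ', φ (x * y) = φ x * φ y)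
    (hψφ : ∀ x ∈ Δ', ψ (φ x) = x) (hφψ : ∀ x ∈ Δ, φ (ψ x) = x) (hκ : ∀ x ∈ Δ', κ (φ x) = κ' x) :
    Lifts π Δ' κ' := by
  intro f hf
  obtain ⟨F, hF, hπ⟩ := h (fun x => f (ψ x)) fun x hx y hy => by
    have e : ψ (x * y) = ψ x * ψ y := by
      conv_lhs => rw [← hφψ x hx, ← hφψ y hy, ← hm _ (hψ x hx) _ (hψ y hy)]
      exact hψφ _ (Δ'.mul_mem (hψ x hx) (hψ y hy))
    show f (ψ (x * y)) = f (ψ x) + bact (sgn (κ x)) (f (ψ y))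
    rw [e, hf _ (hψ x hx) _ (hψ y hy), ← hκ _ (hψ x hx), hφψ x hx]
  refine ⟨fun x => F (φ x), fun x hx y hy => ?_, fun x hx => ?_⟩
  · show F (φ (x * y)) = F (φ x) + bact (sgn (κ' x)) (F (φ y))
    rw [hm x hx y hy, hF _ (hφ x hx) _ (hφ y hy), hκ x hx]
  · rw [hπ _ (hφ x hx), hψφ x hx]

/-- Transport along conjugation. -/
theorem Lifts.conj {G T : Type*} [Group G] [AddCommGroup T] {π : ℚ →+ T} {Δ : Subgroup G}
    {κ κ' : G → ZMod 2} (h : Lifts π Δ κ) (x : G) (hx : ∀ g ∈ Δ, x * g * x⁻¹ ∈ Δ)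
    (hx' : ∀ g ∈ Δ, x⁻¹ * g * x ∈ Δ) (hκ : ∀ g ∈ Δ, κ (x * g * x⁻¹) = κ' g) : Lifts π Δ κ' :=
  h.transport (fun g => x * g * x⁻¹) (fun g => x⁻¹ * g * x) hx hx' (fun _ _ _ _ => by group)
    (fun _ _ => by group) (fun _ _ => by group) hκ

section cor
variable {G A Q : Type*} [Group G] [AddCommGroup A] [AddCommGroup Q] [Fintype Q]

/-- Corestriction along coset representatives. -/
def cor (r : Q → G) (χ : G → Q) (κ : G → ZMod 2) (f : G → A) (g : G) : A :=
  ∑ q, bact (sgn (κ (r q))) (f ((r q)⁻¹ * g * r (q - χ g)))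

theorem bact_sum {ι : Type*} (e : Bool) (s : Finset ι) (f : ι → A) :
    bact e (∑ i ∈ s, f i) = ∑ i ∈ s, bact e (f i) := by
  cases e <;> simp

theorem isCr_cor {Δ : Subgroup G} {χ : G → Q} (hχ : HomOn Δ χ) {κ : G → ZMod 2} (hκ : HomOn Δ κ)
    {r : Q → G} (hr : ∀ q, r q ∈ Δ) (hr' : ∀ q, χ (r q) = q) {f : G → A}
    (hf : IsCr hχ.ker κ f) : IsCr Δ κ (cor r χ κ f) := by
  intro x hx y hy
  have hmem : ∀ z ∈ Δ, ∀ q, (r q)⁻¹ * z * r (q - χ z) ∈ hχ.ker := fun z hz q =>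
    ⟨Δ.mul_mem (Δ.mul_mem (Δ.inv_mem (hr q)) hz) (hr _), by
      rw [hχ _ (Δ.mul_mem (Δ.inv_mem (hr q)) hz) _ (hr _), hχ _ (Δ.inv_mem (hr q)) _ hz,
        hχ.map_inv (hr q), hr', hr']
      abel⟩
  have hsplit : ∀ q, bact (sgn (κ (r q))) (f ((r q)⁻¹ * (x * y) * r (q - χ (x * y)))) =
      bact (sgn (κ (r q))) (f ((r q)⁻¹ * x * r (q - χ x))) +
        bact (sgn (κ x)) (bact (sgn (κ (r (q - χ x))))
          (f ((r (q - χ x))⁻¹ * y * r (q - χ x - χ y)))) := fun q => by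
    have e : (r q)⁻¹ * (x * y) * r (q - χ (x * y)) =
        ((r q)⁻¹ * x * r (q - χ x)) * ((r (q - χ x))⁻¹ * y * r (q - χ x - χ y)) := by
      rw [hχ x hx y hy, sub_sub]; group
    rw [e, hf _ (hmem x hx q) _ (hmem y hy _), bact_add, ← bact_xor, ← sgn_add, ← bact_xor,
      ← sgn_add]
    congr 3
    rw [hκ _ (Δ.mul_mem (Δ.inv_mem (hr q)) hx) _ (hr _), hκ _ (Δ.inv_mem (hr q)) _ hx,
      hκ.map_inv (hr q)]
    abel
  simp only [cor]
  rw [Finset.sum_congr rfl fun q _ => hsplit q, Finset.sum_add_distrib, bact_sum]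
  congr 1
  exact Equiv.sum_comp (Equiv.subRight (χ x))
    fun q => bact (sgn (κ x)) (bact (sgn (κ (r q))) (f ((r q)⁻¹ * y * r (q - χ y))))

end cor

/-- Twisted homomorphisms on a subgroup of index two. -/
theorem Lifts.ker {G T : Type*} [Group G] [AddCommGroup T] {π : ℚ →+ T}
    (hT : ∀ a : T, 2 • a = 0 → a = 0) {Δ : Subgroup G} {χ κ : G → ZMod 2} (hχ : HomOn Δ χ)
    (hκ : HomOn Δ κ) (h : ∀ e : ZMod 2, Lifts π Δ fun g => κ g + e * χ g) :
    Lifts π hχ.ker κ := by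
  by_cases hs : ∃ s ∈ Δ, χ s = 1
  · obtain ⟨s, hs, hs'⟩ := hs
    intro f hf
    let r : ZMod 2 → G := fun q => if q = 0 then 1 else s
    have hr : ∀ q, r q ∈ Δ := fun q => by
      simp only [r]; split
      · exact Δ.one_mem
      · exact hs
    have hr' : ∀ q, χ (r q) = q := fun q => by
      have : q = 0 ∨ q = 1 := by revert q; decide
      rcases this with rfl | rfl
      · simp [r, hχ.map_one]
      · simp [r, hs']
    have hκ' : ∀ e : ZMod 2, HomOn Δ fun g => κ g + e * χ g := fun e x hx y hy => by
      simp only [hκ x hx y hy, hχ x hx y hy]; ring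
    have hex : ∀ e : ZMod 2, ∃ F : G → ℚ, IsCr Δ (fun g => κ g + e * χ g) F ∧
        ∀ x ∈ Δ, π (F x) = cor r χ (fun g => κ g + e * χ g) f x := fun e =>
      h e _ (isCr_cor hχ (hκ' e) hr hr' (hf.congr fun x hx => by rw [hx.2, mul_zero, add_zero]))
    choose F hF hπ using hex
    refine ⟨fun x => (F 0 x + F 1 x) / 2, fun x hx y hy => ?_, fun x hx => ?_⟩
    · simp only [hF _ x hx.1 y hy.1, hx.2, mul_zero, add_zero]
      cases sgn (κ x) <;> simp <;> ring
    · have e2 : 2 • π ((F 0 x + F 1 x) / 2) = π (F 0 x) + π (F 1 x) := by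
        rw [← map_nsmul, ← map_add]
        congr 1
        rw [nsmul_eq_mul]; push_cast; ring
      have e0 : ∀ e : ZMod 2, cor r χ (fun g => κ g + e * χ g) f x =
          f x + bact (sgn (κ s + e)) (f (s⁻¹ * x * s)) := fun e => by
        have h0 : sgn (κ 1) = false := by rw [hκ.map_one]; rfl
        have h1 : (Finset.univ : Finset (ZMod 2)) = {0, 1} := rfl
        rw [cor, h1, Finset.sum_pair (by decide)]
        simp [r, hx.2, hχ.map_one, h0, hs']
      refine sub_eq_zero.1 (hT _ ?_)
      rw [smul_sub, e2, hπ _ x hx.1, hπ _ x hx.1, e0, e0, sgn_add, sgn_add, bact_xor, bact_xor]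
      have s0 : sgn 0 = false := rfl
      have s1 : sgn 1 = true := rfl
      rw [s0, s1, bact_false, bact_true, bact_neg, two_smul]
      abel
  · have hle : ∀ x ∈ Δ, χ x = 0 := fun x hx => by
      have h1 : χ x ≠ 1 := fun e => hs ⟨x, hx, e⟩
      revert h1
      generalize χ x = q
      revert q; decide
    have e : hχ.ker = Δ := le_antisymm hχ.ker_le fun x hx => ⟨hx, hle x hx⟩
    rw [e]
    exact (h 0).congr fun x hx => by rw [zero_mul, add_zero]

/-- Homomorphisms on a group containing a subgroup of index three. -/
theorem Lifts.of_ker {G T : Type*} [Group G] [AddCommGroup T] {π : ℚ →+ T}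
    (hT : ∀ a : T, 3 • a = 0 → a = 0) {Δ : Subgroup G} {χ : G → ZMod 3} (hχ : HomOn Δ χ)
    {s : G} (hs : s ∈ Δ) (hs' : χ s = 1) (h : Lifts π hχ.ker 0) : Lifts π Δ 0 := by
  intro f hf
  have hs0 : sgn 0 = false := rfl
  obtain ⟨F, hF, hπ⟩ := h f fun x hx y hy => hf x hx.1 y hy.1
  let r : ZMod 3 → G := fun q => s ^ q.val
  have hr : ∀ q, r q ∈ Δ := fun q => Δ.pow_mem hs _
  have hr' : ∀ q, χ (r q) = q := fun q => by
    have hp : ∀ n : ℕ, χ (s ^ n) = n := fun n => by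
      induction n with
      | zero => simpa using hχ.map_one
      | succ n ih => rw [pow_succ, hχ _ (Δ.pow_mem hs n) _ hs, ih, hs']; push_cast; rfl
    rw [hp, ZMod.natCast_zmod_val]
  have hc : IsCr Δ 0 (cor r χ 0 F) := isCr_cor hχ (fun _ _ _ _ => (add_zero 0).symm) hr hr' hF
  have hadd : ∀ x ∈ Δ, ∀ y ∈ Δ, f (x * y) = f x + f y := hf
  have hinv : ∀ x ∈ Δ, f x⁻¹ = -f x := fun x hx => HomOn.map_inv hadd hx
  refine ⟨fun x => cor r χ 0 F x / 3, fun x hx y hy => ?_, fun x hx => ?_⟩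
  · have h1 : cor r χ 0 F (x * y) = cor r χ 0 F x + cor r χ 0 F y := hc x hx y hy
    show cor r χ 0 F (x * y) / 3 = cor r χ 0 F x / 3 + cor r χ 0 F y / 3
    rw [h1, add_div]
  · have e3 : 3 • π (cor r χ 0 F x / 3) = π (cor r χ 0 F x) := by
      rw [← map_nsmul]
      congr 1
      rw [nsmul_eq_mul]; push_cast; ring
    refine sub_eq_zero.1 (hT _ ?_)
    rw [smul_sub, e3, cor, map_sum]
    have hq : ∀ q, π (bact (sgn ((0 : G → ZMod 2) (r q))) (F ((r q)⁻¹ * x * r (q - χ x)))) =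
        f (r (q - χ x)) - f (r q) + f x := fun q => by
      rw [Pi.zero_apply, hs0, bact_false, hπ _ ⟨Δ.mul_mem (Δ.mul_mem (Δ.inv_mem (hr q)) hx) (hr _), by
        rw [hχ _ (Δ.mul_mem (Δ.inv_mem (hr q)) hx) _ (hr _), hχ _ (Δ.inv_mem (hr q)) _ hx,
          hχ.map_inv (hr q), hr', hr']
        abel⟩, hadd _ (Δ.mul_mem (Δ.inv_mem (hr q)) hx) _ (hr _),
        hadd _ (Δ.inv_mem (hr q)) _ hx, hinv _ (hr q)]
      abel
    have hsum : ∑ q, f (r (q - χ x)) = ∑ q, f (r q) :=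
      Equiv.sum_comp (Equiv.subRight (χ x)) fun q => f (r q)
    rw [Finset.sum_congr rfl fun q _ => hq q, Finset.sum_add_distrib, Finset.sum_sub_distrib, hsum,
      sub_self, zero_add, Finset.sum_const, Finset.card_univ, ZMod.card, sub_self]

theorem inv_val {h : GL (Fin 2) Zw} (hd : h.val.det = 1) :
    h⁻¹.val = !![h.val 1 1, -h.val 0 1; -h.val 1 0, h.val 0 0] := by
  rw [Matrix.coe_units_inv, Matrix.inv_def, hd, Ring.inverse_one, one_smul,
    Matrix.adjugate_fin_two]

theorem conj_val_01 {h : GL (Fin 2) Zw} (hd : h.val.det = 1) (g : GL (Fin 2) Zw) :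
    (h * g * h⁻¹).val 0 1 = h.val 0 0 ^ 2 * g.val 0 1 +
      h.val 0 0 * h.val 0 1 * (g.val 1 1 - g.val 0 0) - h.val 0 1 ^ 2 * g.val 1 0 := by
  rw [mul_val, mul_val, mul_val, inv_val hd]
  simp only [Matrix.of_apply, Matrix.cons_val', Matrix.cons_val_zero, Matrix.cons_val_one,
    Matrix.cons_val_fin_one]
  ring

theorem conj_val_10 {h : GL (Fin 2) Zw} (hd : h.val.det = 1) (g : GL (Fin 2) Zw) :
    (h * g * h⁻¹).val 1 0 = h.val 1 1 ^ 2 * g.val 1 0 +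
      h.val 1 0 * h.val 1 1 * (g.val 0 0 - g.val 1 1) - h.val 1 0 ^ 2 * g.val 0 1 := by
  rw [mul_val, mul_val, mul_val, inv_val hd]
  simp only [Matrix.of_apply, Matrix.cons_val', Matrix.cons_val_zero, Matrix.cons_val_one,
    Matrix.cons_val_fin_one]
  ring

theorem dt_conj (h g : GL (Fin 2) Zw) : dt (h * g * h⁻¹) = dt g := by
  have h1 : dt h + dt h⁻¹ = 0 := by rw [← dt_mul, mul_inv_cancel]; simp [dt]
  rw [dt_mul, dt_mul]
  linear_combination h1

theorem conj_mem_GU {h : GL (Fin 2) Zw} (hb : red (h.val 0 1) = 0) {g : GL (Fin 2) Zw}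
    (hg : g ∈ GU) : h * g * h⁻¹ ∈ GU := by
  apply mul_inv_mem_GU
  rw [stt_eq_iff]
  simp [mul_val, hg.1, hg.2, hb]

/-- A sign character, given by its coefficients. -/
def kp (i x y k : ZMod 2) (g : GL (Fin 2) Zw) : ZMod 2 :=
  i * (ub g).im + x * (lc g).re + y * (lc g).im + k * dt g

theorem homOn_kp (i x y k : ZMod 2) : HomOn GU (kp i x y k) := fun g hg h hh => by
  simp only [kp, ub_mul hg hh, lc_mul hg hh, dt_mul, QuadraticAlgebra.re_add,
    QuadraticAlgebra.im_add]
  ring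

/-- An element normalizing the congruence subgroups. -/
def rawRot : RawM := ⟨(0, 1), (4, 0), (92, 0), (9, -9)⟩

theorem det_rawRot : rawRot.det = (1, 0) := by decide

/-- An element normalizing the congruence subgroups. -/
noncomputable def rot : GL (Fin 2) Zw := rawRot.toGL

theorem rot_val : rot.val = rawRot.toMat := is_toGL (Or.inl det_rawRot)

theorem det_rot : rot.val.det = 1 := by
  rw [rot_val, RawM.det_toMat, det_rawRot]; rfl

theorem red_rot_01 : red (rot.val 0 1) = 0 := by rw [rot_val]; decide

theorem red_inv_rot_01 : red (rot⁻¹.val 0 1) = 0 := by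
  rw [inv_val det_rot]
  simp [red_rot_01]

theorem lc_conj_rot {g : GL (Fin 2) Zw} (hg : g ∈ GU) :
    lc (rot * g * rot⁻¹) = ⟨0, 1⟩ * lc g := by
  rw [lc, conj_val_10 det_rot, map_sub, map_add, map_mul, map_mul, map_mul, map_mul, hg.2, mul_zero,
    sub_zero]
  have h1 : red (rot.val 1 0) = 0 := by rw [rot_val]; decide
  have h2 : red (rot.val 1 1 ^ 2) = ⟨0, 1⟩ := by rw [rot_val]; decide
  rw [h1, h2, zero_mul, zero_mul, add_zero, lc]

/-- The matrix as an invertible one, if it is invertible. -/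
noncomputable def glOf {R : Type*} [CommRing R] (M : Matrix (Fin 2) (Fin 2) R) : GL (Fin 2) R :=
  open Classical in if h : IsUnit M.det then M.nonsingInvUnit h else 1

theorem glOf_val {R : Type*} [CommRing R] {M : Matrix (Fin 2) (Fin 2) R} (h : IsUnit M.det) :
    (glOf M).val = M := by
  rw [glOf, dif_pos h]; rfl

/-- Interchange the two divisibility conditions. -/
noncomputable def swp (g : GL (Fin 2) Zw) : GL (Fin 2) Zw :=
  glOf !![g.val 1 1, 2 * g.val 1 0; half (g.val 0 1), g.val 0 0]

theorem swp_val {g : GL (Fin 2) Zw} (hg : g ∈ GU) :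
    (swp g).val = !![g.val 1 1, 2 * g.val 1 0; half (g.val 0 1), g.val 0 0] ∧
      (swp g).val.det = g.val.det := by
  have hd : (!![g.val 1 1, 2 * g.val 1 0; half (g.val 0 1), g.val 0 0]).det = g.val.det := by
    rw [Matrix.det_fin_two_of, Matrix.det_fin_two, ← red_eq_zero.1 hg.2, half_two_mul]; ring
  have e : (swp g).val = _ := glOf_val (by
    rw [hd]; exact (Matrix.isUnit_iff_isUnit_det _).1 g.isUnit)
  exact ⟨e, by rw [e, hd]⟩

theorem swp_mem {g : GL (Fin 2) Zw} (hg : g ∈ GU) : swp g ∈ GU := by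
  rw [mem_GU, (swp_val hg).1]
  exact ⟨red_11_of_mem_GU hg, red_two_mul _⟩

theorem swp_swp {g : GL (Fin 2) Zw} (hg : g ∈ GU) : swp (swp g) = g := by
  refine Units.ext (Matrix.ext fun i j => ?_)
  rw [(swp_val (swp_mem hg)).1, (swp_val hg).1]
  fin_cases i <;> fin_cases j <;> simp [half_two_mul, red_eq_zero.1 hg.2]

theorem swp_mul {g h : GL (Fin 2) Zw} (hg : g ∈ GU) (hh : h ∈ GU) :
    swp (g * h) = swp g * swp h := by
  have e1 := red_eq_zero.1 hg.2
  have e2 := red_eq_zero.1 hh.2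
  have e : half ((g * h).val 0 1) = g.val 0 0 * half (h.val 0 1) + half (g.val 0 1) * h.val 1 1 := by
    rw [← half_two_mul (_ + _)]
    congr 1
    rw [mul_val, ← e1, ← e2, half_two_mul, half_two_mul]; ring
  refine Units.ext (Matrix.ext fun i j => ?_)
  rw [mul_val, (swp_val (GU.mul_mem hg hh)).1, (swp_val hg).1, (swp_val hh).1, e, mul_val,
    mul_val, mul_val, ← e1, ← e2, half_two_mul, half_two_mul]
  fin_cases i <;> fin_cases j <;> simp <;> ring

theorem kp_swp {g : GL (Fin 2) Zw} (hg : g ∈ GU) : kp 0 0 1 0 (swp g) = kp 1 0 0 0 g := by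
  simp [kp, lc, ub, (swp_val hg).1]

/-- Complex conjugation. -/
noncomputable def cnj (g : GL (Fin 2) Zw) : GL (Fin 2) Zw :=
  Matrix.GeneralLinearGroup.map (starRingEnd Zw) g

theorem cnj_val (g : GL (Fin 2) Zw) (i j : Fin 2) : (cnj g).val i j = star (g.val i j) := rfl

theorem red_star (z : Zw) : red (star z) = ⟨(red z).re + (red z).im, (red z).im⟩ := by
  have h : ∀ x : ZMod 2, -x = x := by decide
  ext <;> simp [red, h]

theorem cnj_mem {g : GL (Fin 2) Zw} (hg : g ∈ GU) : cnj g ∈ GU := by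
  rw [mem_GU, cnj_val, cnj_val, red_star, red_star, hg.1, hg.2]
  decide

theorem cnj_cnj (g : GL (Fin 2) Zw) : cnj (cnj g) = g := by
  refine Units.ext (Matrix.ext fun i j => ?_)
  rw [cnj_val, cnj_val, star_star]

theorem dt_cnj (g : GL (Fin 2) Zw) : dt (cnj g) = dt g := by
  have h : (cnj g).val.det = star g.val.det := (RingHom.map_det (starRingEnd Zw) g.val).symm
  rw [dt, dt, h]
  rcases det_val g with h | h <;> rw [h] <;> simp

theorem kp_cnj (k : ZMod 2) {g : GL (Fin 2) Zw} (hg : g ∈ GU) :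
    kp 1 1 1 k (cnj g) = kp 1 1 0 k g := by
  have e : ub (cnj g) = ⟨(ub g).re + (ub g).im, (ub g).im⟩ := by
    rw [ub, cnj_val, ← red_eq_zero.1 hg.2, star_mul', star_ofNat, half_two_mul, red_star, ub]
  have h : ∀ x : ZMod 2, x + x = 0 := by decide
  simp only [kp, dt_cnj, e, lc, cnj_val, red_star]
  linear_combination h (red (g.val 1 0)).im

section lifts
variable {T : Type} [AddCommGroup T] {π : ℚ →+ T}

theorem Cert.lifts {B : ℕ} {c : Cert} (hm : c.mask < 16) (hB : 0 < B)
    (hN : c.basis.length = c.N) (hrk : c.rows.length = c.rk) (hle : c.rk ≤ c.N)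
    (hs : c.s ∣ 89760) (h : c.check tab B = true) (hπ : Function.Surjective π)
    (hT : ∀ a : T, 89760 • a = 0 → a = 0) {i x y k : ZMod 2} (hi : ((c.mask : ℕ) : ZMod 2) = i)
    (hx : ((c.mask / 2 : ℕ) : ZMod 2) = x) (hy : ((c.mask / 4 : ℕ) : ZMod 2) = y)
    (hk : ((c.mask / 8 : ℕ) : ZMod 2) = k) : Lifts π GU (kp i x y k) :=
  (Liftable.lifts hm (c.liftable hB hN hrk hle hs h) hπ hT).congr fun g _ => by
    rw [kap, hi, hx, hy, hk, kp]

theorem Lifts.rot {x y : ZMod 2} (h : Lifts π GU (kp 0 x y 0)) :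
    Lifts π GU (kp 0 y (x + y) 0) := by
  refine h.conj _root_.rot (fun g hg => conj_mem_GU red_rot_01 hg) (fun g hg => ?_) fun g hg => ?_
  · simpa using conj_mem_GU red_inv_rot_01 hg
  · rw [kp, kp, lc_conj_rot hg]
    simp only [QuadraticAlgebra.re_mul, QuadraticAlgebra.im_mul]
    have h41 : (-41 : ZMod 2) = 1 := by decide
    linear_combination x * (lc g).im * h41

theorem Lifts.cnj {k : ZMod 2} (h : Lifts π GU (kp 1 1 1 k)) : Lifts π GU (kp 1 1 0 k) :=
  h.transport _root_.cnj _root_.cnj (fun _ => cnj_mem) (fun _ => cnj_mem)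
    (fun g _ h _ => map_mul (Matrix.GeneralLinearGroup.map (starRingEnd Zw)) g h)
    (fun g _ => cnj_cnj g) (fun g _ => cnj_cnj g) fun _ => kp_cnj k

theorem lifts_kp (hπ : Function.Surjective π) (hT : ∀ a : T, 89760 • a = 0 → a = 0)
    (i x y k : ZMod 2) (hik : i = 0 → k = 0) : Lifts π GU (kp i x y k) := by
  have h0 : Lifts π GU (kp 0 0 0 0) := Cert.lifts (c := cert0) (by decide) (by decide) (by decide)
    (by decide) (by decide) (by decide) cert0_check hπ hT rfl rfl rfl rfl
  have h4 : Lifts π GU (kp 0 0 1 0) := Cert.lifts (c := cert4) (by decide) (by decide) (by decide)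
    (by decide) (by decide) (by decide) cert4_check hπ hT rfl rfl rfl rfl
  have h5 : Lifts π GU (kp 1 0 1 0) := Cert.lifts (c := cert5) (by decide) (by decide) (by decide)
    (by decide) (by decide) (by decide) cert5_check hπ hT rfl rfl rfl rfl
  have h7 : Lifts π GU (kp 1 1 1 0) := Cert.lifts (c := cert7) (by decide) (by decide) (by decide)
    (by decide) (by decide) (by decide) cert7_check hπ hT rfl rfl rfl rfl
  have h9 : Lifts π GU (kp 1 0 0 1) := Cert.lifts (c := cert9) (by decide) (by decide) (by decide)
    (by decide) (by decide) (by decide) cert9_check hπ hT rfl rfl rfl rfl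
  have h13 : Lifts π GU (kp 1 0 1 1) := Cert.lifts (c := cert13) (by decide) (by decide)
    (by decide) (by decide) (by decide) (by decide) cert13_check hπ hT rfl rfl rfl rfl
  have h15 : Lifts π GU (kp 1 1 1 1) := Cert.lifts (c := cert15) (by decide) (by decide)
    (by decide) (by decide) (by decide) (by decide) cert15_check hπ hT rfl rfl rfl rfl
  have h6 : Lifts π GU (kp 0 1 1 0) := h4.rot
  have h2 : Lifts π GU (kp 0 1 0 0) := h6.rot
  have h1 : Lifts π GU (kp 1 0 0 0) := h4.transport swp swp (fun _ => swp_mem) (fun _ => swp_mem)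
    (fun _ hg _ hh => swp_mul hg hh) (fun _ => swp_swp) (fun _ => swp_swp) fun _ => kp_swp
  have h01 : ∀ e : ZMod 2, e = 0 ∨ e = 1 := by decide
  rcases h01 i with rfl | rfl
  · obtain rfl := hik rfl
    rcases h01 x with rfl | rfl <;> rcases h01 y with rfl | rfl
    exacts [h0, h4, h2, h6]
  · rcases h01 k with rfl | rfl <;> rcases h01 x with rfl | rfl <;> rcases h01 y with rfl | rfl
    exacts [h1, h5, h7.cnj, h7, h9, h13, h15.cnj, h15]

/-- The kernel of the reduction modulo two. -/
def Lam : Subgroup (GL (Fin 2) Zw) := (Matrix.GeneralLinearGroup.map red).ker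

theorem mem_Lam {g : GL (Fin 2) Zw} : g ∈ Lam ↔ g ∈ GU ∧ lc g = 0 := by
  constructor
  · intro h
    have e : ∀ i j, red (g.val i j) = (1 : Matrix (Fin 2) (Fin 2) F4) i j := fun i j =>
      congrArg (fun x : GL (Fin 2) F4 => x.val i j) (MonoidHom.mem_ker.1 h)
    exact ⟨⟨by rw [e]; rfl, by rw [e]; rfl⟩, by rw [lc, e]; rfl⟩
  · rintro ⟨h, h'⟩
    refine Units.ext (Matrix.ext fun i j => ?_)
    show red (g.val i j) = (1 : Matrix (Fin 2) (Fin 2) F4) i j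
    fin_cases i <;> fin_cases j
    exacts [h.1, h.2, h', red_11_of_mem_GU h]

theorem lifts_Lam (hπ : Function.Surjective π) (hT : ∀ a : T, 89760 • a = 0 → a = 0) (i k : ZMod 2)
    (hik : i = 0 → k = 0) : Lifts π Lam fun g => i * (ub g).im + k * dt g := by
  have h2 : ∀ a : T, 2 • a = 0 → a = 0 := fun a ha => hT a (by
    rw [show 89760 = 44880 * 2 from rfl, mul_smul, ha, smul_zero])
  have hx : HomOn GU fun g => (lc g).re := fun g hg h hh => by
    simp only [lc_mul hg hh, QuadraticAlgebra.re_add]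
  have hy : HomOn hx.ker fun g => (lc g).im := fun g hg h hh => by
    simp only [lc_mul hg.1 hh.1, QuadraticAlgebra.im_add]
  have e : hy.ker = Lam := by
    ext g
    rw [HomOn.mem_ker, HomOn.mem_ker, mem_Lam, QuadraticAlgebra.ext_iff, and_assoc]
    rfl
  rw [← e]
  refine (Lifts.ker h2 hy ((homOn_kp i 0 0 k).mono hx.ker_le) fun y => ?_).congr fun g hg => ?_
  · refine (Lifts.ker h2 hx (homOn_kp i 0 y k) fun x => ?_).congr fun g hg => ?_
    · exact (lifts_kp hπ hT i x y k hik).congr fun g _ => by simp only [kp]; ring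
    · simp only [kp]; ring
  · simp only [kp]; ring

end lifts

/-- The reduction of half of the lower left entry. -/
def lh (g : GL (Fin 2) Zw) : F4 := red (half (g.val 1 0))

theorem lh_mul {g h : GL (Fin 2) Zw} (hg : g ∈ Lam) (hh : h ∈ Lam) : lh (g * h) = lh g + lh h := by
  rw [mem_Lam] at hg hh
  have e1 := red_eq_zero.1 hg.2
  have e2 := red_eq_zero.1 hh.2
  have e : (g * h).val 1 0 = 2 * (half (g.val 1 0) * h.val 0 0 + g.val 1 1 * half (h.val 1 0)) := by
    rw [mul_val, ← e1, ← e2, half_two_mul, half_two_mul]; ring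
  rw [lh, e, half_two_mul, map_add, map_mul, map_mul, hh.1.1, red_11_of_mem_GU hg.1, one_mul,
    mul_one]
  rfl

theorem red_half_sub {g : GL (Fin 2) Zw} (hg : g ∈ Lam) :
    2 * half (g.val 1 1 - g.val 0 0) = g.val 1 1 - g.val 0 0 ∧
      red (half (g.val 1 1 - g.val 0 0)) = ⟨dt g, 0⟩ := by
  rw [mem_Lam] at hg
  obtain ⟨hg, hc⟩ := hg
  have eb := red_eq_zero.1 hg.2
  have ec := red_eq_zero.1 hc
  have ed : 2 * half (g.val 1 1 - g.val 0 0) = g.val 1 1 - g.val 0 0 :=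
    red_eq_zero.1 (by rw [map_sub, red_11_of_mem_GU hg, hg.1, sub_self])
  have ea : 2 * half (g.val 0 0 - 1) = g.val 0 0 - 1 :=
    red_eq_zero.1 (by rw [map_sub, hg.1, map_one, sub_self])
  refine ⟨ed, ?_⟩
  set D := half (g.val 1 1 - g.val 0 0)
  set A := half (g.val 0 0 - 1)
  set B := half (g.val 0 1)
  set C := half (g.val 1 0)
  have hdet : g.val.det = 1 + 2 * (D + 2 * (A + A ^ 2 + D * A - B * C)) := by
    rw [Matrix.det_fin_two, ← eb, ← ec]
    linear_combination (-g.val 0 0) * ed - (g.val 0 0 + 1 + 2 * A + 2 * D) * ea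
  have h2 : ∀ x y : Zw, 2 * x = 2 * y → x = y := fun x y h => by
    rw [← half_two_mul x, h, half_two_mul]
  rcases det_val g with h | h
  · have : D = 2 * -(A + A ^ 2 + D * A - B * C) := h2 _ _ (by linear_combination h - hdet)
    rw [this, red_two_mul, dt, h, if_neg (by decide)]; rfl
  · have : D = 1 + 2 * (-1 - (A + A ^ 2 + D * A - B * C)) := h2 _ _ (by linear_combination h - hdet)
    rw [this, map_add, red_two_mul, map_one, add_zero, dt, h, if_pos (by decide)]; rfl

theorem ub_conj {h : GL (Fin 2) Zw} (hd : h.val.det = 1) {g : GL (Fin 2) Zw} (hg : g ∈ Lam) :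
    ub (h * g * h⁻¹) = red (h.val 0 0) ^ 2 * ub g +
      red (h.val 0 0) * red (h.val 0 1) * (⟨dt g, 0⟩ : F4) -
      red (h.val 0 1) ^ 2 * lh g := by
  rw [← (red_half_sub hg).2, ub, conj_val_01 hd, ← (red_half_sub hg).1,
    ← red_eq_zero.1 (mem_Lam.1 hg).1.2, ← red_eq_zero.1 (mem_Lam.1 hg).2]
  have e : ∀ p q x y z : Zw, p ^ 2 * (2 * x) + p * q * (2 * y) - q ^ 2 * (2 * z) =
      2 * (p ^ 2 * x + p * q * y - q ^ 2 * z) := fun _ _ _ _ _ => by ring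
  rw [e, half_two_mul, map_sub, map_add, map_mul, map_mul, map_mul, map_mul, map_pow, map_pow,
    ub, lh]
  simp only [half_two_mul]

/-- A character of order two of the kernel of reduction, given by its coefficients. -/
def psi (e₁ e₂ e₃ e₄ : ZMod 2) (g : GL (Fin 2) Zw) : ZMod 2 :=
  e₁ * (ub g).re + e₂ * (ub g).im + e₃ * (lh g).re + e₄ * (lh g).im

theorem homOn_psi (e₁ e₂ e₃ e₄ : ZMod 2) : HomOn Lam (psi e₁ e₂ e₃ e₄) := fun g hg h hh => by
  simp only [psi, ub_mul (mem_Lam.1 hg).1 (mem_Lam.1 hh).1, lh_mul hg hh, QuadraticAlgebra.re_add,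
    QuadraticAlgebra.im_add]
  ring

theorem exists_row : ∀ e₁ e₂ e₃ e₄ : ZMod 2, ¬(e₁ = 0 ∧ e₂ = 0 ∧ e₃ = 0 ∧ e₄ = 0) →
    ∃ n ∈ stL, ∀ r s : ZMod 2,
      (red (rawRep n).a.toZ ^ 2 * (⟨r, s⟩ : F4)).im = e₁ * r + e₂ * s ∧
      (red (rawRep n).b.toZ ^ 2 * (⟨r, s⟩ : F4)).im = e₃ * r + e₄ * s := by
  decide +kernel

section lifts
variable {T : Type} [AddCommGroup T] {π : ℚ →+ T}

theorem lifts_psi (hπ : Function.Surjective π) (hT : ∀ a : T, 89760 • a = 0 → a = 0)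
    (e₁ e₂ e₃ e₄ : ZMod 2) : Lifts π Lam (psi e₁ e₂ e₃ e₄) := by
  by_cases he : e₁ = 0 ∧ e₂ = 0 ∧ e₃ = 0 ∧ e₄ = 0
  · obtain ⟨rfl, rfl, rfl, rfl⟩ := he
    exact (lifts_Lam hπ hT 0 0 fun _ => rfl).congr fun g _ => by simp [psi]
  · obtain ⟨n, -, hn⟩ := exists_row e₁ e₂ e₃ e₄ he
    have hd : (rep n).val.det = 1 := by
      rw [show (rep n).val = (rawRep n).toMat from is_rep n, RawM.det_toMat, det_rawRep]; rfl
    have ha : (rep n).val 0 0 = (rawRep n).a.toZ := by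
      rw [show (rep n).val = (rawRep n).toMat from is_rep n]; rfl
    have hb : (rep n).val 0 1 = (rawRep n).b.toZ := by
      rw [show (rep n).val = (rawRep n).toMat from is_rep n]; rfl
    have hN : Lam.Normal := MonoidHom.normal_ker _
    refine (lifts_Lam hπ hT 1 (red (rawRep n).a.toZ * red (rawRep n).b.toZ).im
      fun h => absurd h one_ne_zero).conj (rep n)
      (fun g hg => hN.conj_mem g hg _) (fun g hg => by simpa using hN.conj_mem g hg (rep n)⁻¹)
      fun g hg => ?_
    have h1 := (hn (ub g).re (ub g).im).1
    have h2 := (hn (lh g).re (lh g).im).2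
    have h3 : ∀ (x : F4) (d : ZMod 2), (x * (⟨d, 0⟩ : F4)).im = x.im * d := fun x d => by simp
    have h4 : ∀ x : ZMod 2, x + x = 0 := by decide
    rw [dt_conj, ub_conj hd hg, ha, hb, QuadraticAlgebra.im_sub, QuadraticAlgebra.im_add, h3, psi]
    rw [show (⟨(ub g).re, (ub g).im⟩ : F4) = ub g from rfl] at h1
    rw [show (⟨(lh g).re, (lh g).im⟩ : F4) = lh g from rfl] at h2
    rw [h1, h2]
    linear_combination h4 ((red (rawRep n).a.toZ * red (rawRep n).b.toZ).im * dt g) -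
      h4 (e₃ * (lh g).re + e₄ * (lh g).im)

end lifts

theorem four_dvd_iff {z : Zw} : 4 ∣ z ↔ red z = 0 ∧ red (half z) = 0 := by
  constructor
  · rintro ⟨w, rfl⟩
    rw [show (4 : Zw) * w = 2 * (2 * w) by ring, half_two_mul]
    exact ⟨red_two_mul _, red_two_mul _⟩
  · rintro ⟨h, hd⟩
    rw [red_eq_zero] at h hd
    exact ⟨half (half z), by linear_combination -h - 2 * hd⟩

/-- Matrices whose off-diagonal entries are divisible by four. -/
def Gam : Subgroup (GL (Fin 2) Zw) where
  carrier := {g | 4 ∣ g.val 0 1 ∧ 4 ∣ g.val 1 0}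
  one_mem' := by simp
  mul_mem' := by
    rintro g h ⟨h1, h2⟩ ⟨h3, h4⟩
    rw [Set.mem_ofPred_eq, mul_val, mul_val]
    exact ⟨dvd_add (h3.mul_left _) (h1.mul_right _), dvd_add (h2.mul_right _) (h4.mul_left _)⟩
  inv_mem' := by
    rintro g ⟨h1, h2⟩
    rw [Set.mem_ofPred_eq, Matrix.coe_units_inv, Matrix.inv_def, Matrix.adjugate_fin_two]
    exact ⟨(h1.neg_right).mul_left _, (h2.neg_right).mul_left _⟩

theorem mem_Gam {g : GL (Fin 2) Zw} : g ∈ Gam ↔ 4 ∣ g.val 0 1 ∧ 4 ∣ g.val 1 0 := Iff.rfl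

/-- The logarithm in the field with four elements. -/
def dlog (x : F4) : ZMod 3 := if x = ⟨0, 1⟩ then 1 else if x = ⟨1, 1⟩ then 2 else 0

theorem dlog_mul : ∀ r s r' s' : ZMod 2, (⟨r, s⟩ : F4) ≠ 0 → (⟨r', s'⟩ : F4) ≠ 0 →
    dlog (⟨r, s⟩ * ⟨r', s'⟩) = dlog ⟨r, s⟩ + dlog ⟨r', s'⟩ := by
  decide

theorem dlog_eq_zero : ∀ r s : ZMod 2, (⟨r, s⟩ : F4) ≠ 0 → dlog ⟨r, s⟩ = 0 → (⟨r, s⟩ : F4) = 1 := by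
  decide

theorem red_ne_zero_of_mem_Gam {g : GL (Fin 2) Zw} (hg : g ∈ Gam) : red (g.val 0 0) ≠ 0 := by
  intro h
  have := red_det g
  rw [h, (four_dvd_iff.1 hg.1).1, zero_mul, zero_mul, sub_zero] at this
  exact absurd this (by decide)

theorem homOn_dlog : HomOn Gam fun g => dlog (red (g.val 0 0)) := fun g hg h hh => by
  show dlog (red ((g * h).val 0 0)) = _
  rw [mul_val, map_add, map_mul, map_mul, (four_dvd_iff.1 hg.1).1, zero_mul, add_zero]
  exact dlog_mul _ _ _ _ (red_ne_zero_of_mem_Gam hg) (red_ne_zero_of_mem_Gam hh)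

theorem mem_ker_dlog {g : GL (Fin 2) Zw} :
    g ∈ homOn_dlog.ker ↔ g ∈ Lam ∧ ub g = 0 ∧ lh g = 0 := by
  rw [HomOn.mem_ker, mem_Gam, four_dvd_iff, four_dvd_iff, mem_Lam, mem_GU]
  constructor
  · rintro ⟨⟨⟨h1, h2⟩, h3, h4⟩, h5⟩
    exact ⟨⟨⟨dlog_eq_zero _ _ (red_ne_zero_of_mem_Gam
      (mem_Gam.2 ⟨four_dvd_iff.2 ⟨h1, h2⟩, four_dvd_iff.2 ⟨h3, h4⟩⟩)) h5, h1⟩, h3⟩, h2, h4⟩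
  · rintro ⟨⟨⟨h5, h1⟩, h3⟩, h2, h4⟩
    exact ⟨⟨⟨h1, h2⟩, h3, h4⟩, by rw [h5]; decide⟩

section lifts
variable {T : Type} [AddCommGroup T] {π : ℚ →+ T}

theorem lifts_Gam (hπ : Function.Surjective π) (hT : ∀ a : T, 89760 • a = 0 → a = 0) :
    Lifts π Gam 0 := by
  have h2 : ∀ a : T, 2 • a = 0 → a = 0 := fun a ha => hT a (by
    rw [show 89760 = 44880 * 2 from rfl, mul_smul, ha, smul_zero])
  have h3 : ∀ a : T, 3 • a = 0 → a = 0 := fun a ha => hT a (by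
    rw [show 89760 = 29920 * 3 from rfl, mul_smul, ha, smul_zero])
  have hs : rot ∈ Gam := by
    rw [mem_Gam, rot_val]
    exact ⟨⟨1, by decide⟩, ⟨23, by decide⟩⟩
  refine Lifts.of_ker h3 homOn_dlog hs (by rw [rot_val]; decide) ?_
  have c1 : HomOn Lam fun g => (ub g).re := fun g hg h hh => by
    simp only [ub_mul (mem_Lam.1 hg).1 (mem_Lam.1 hh).1, QuadraticAlgebra.re_add]
  have c2 : HomOn c1.ker fun g => (ub g).im :=
    HomOn.mono (χ := fun g => (ub g).im) (fun g hg h hh => by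
    simp only [ub_mul (mem_Lam.1 hg).1 (mem_Lam.1 hh).1, QuadraticAlgebra.im_add]) c1.ker_le
  have c3 : HomOn c2.ker fun g => (lh g).re :=
    HomOn.mono (χ := fun g => (lh g).re) (fun g hg h hh => by
    simp only [lh_mul hg hh, QuadraticAlgebra.re_add]) (c2.ker_le.trans c1.ker_le)
  have c4 : HomOn c3.ker fun g => (lh g).im :=
    HomOn.mono (χ := fun g => (lh g).im) (fun g hg h hh => by
    simp only [lh_mul hg hh, QuadraticAlgebra.im_add]) (c3.ker_le.trans (c2.ker_le.trans c1.ker_le))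
  have s1 : ∀ e₂ e₃ e₄, Lifts π c1.ker (psi 0 e₂ e₃ e₄) := fun e₂ e₃ e₄ =>
    Lifts.ker h2 c1 (homOn_psi _ _ _ _) fun e => (lifts_psi hπ hT e e₂ e₃ e₄).congr fun g _ => by
      simp only [psi]; ring
  have s2 : ∀ e₃ e₄, Lifts π c2.ker (psi 0 0 e₃ e₄) := fun e₃ e₄ =>
    Lifts.ker h2 c2 ((homOn_psi _ _ _ _).mono c1.ker_le) fun e => (s1 e e₃ e₄).congr fun g _ => by
      simp only [psi]; ring
  have s3 : ∀ e₄, Lifts π c3.ker (psi 0 0 0 e₄) := fun e₄ =>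
    Lifts.ker h2 c3 ((homOn_psi _ _ _ _).mono (c2.ker_le.trans c1.ker_le)) fun e =>
      (s2 e e₄).congr fun g _ => by simp only [psi]; ring
  have s4 : Lifts π c4.ker (psi 0 0 0 0) :=
    Lifts.ker h2 c4 ((homOn_psi _ _ _ _).mono (c3.ker_le.trans (c2.ker_le.trans c1.ker_le)))
      fun e => (s3 e).congr fun g _ => by simp only [psi]; ring
  have e : c4.ker = homOn_dlog.ker := by
    ext g
    rw [HomOn.mem_ker, HomOn.mem_ker, HomOn.mem_ker, HomOn.mem_ker, mem_ker_dlog,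
      QuadraticAlgebra.ext_iff, QuadraticAlgebra.ext_iff]
    simp only [and_assoc, QuadraticAlgebra.re_zero, QuadraticAlgebra.im_zero]
  rw [← e]
  exact s4.congr fun g _ => by simp [psi]

end lifts

theorem mem_Gamma0 {R : Type*} [CommRing R] {N : Ideal R} {g : GL (Fin 2) R} :
    g ∈ Gamma0 N ↔ g.val 1 0 ∈ N := Iff.rfl

theorem glOf_mul {R : Type*} [CommRing R] {M N : Matrix (Fin 2) (Fin 2) R} (hM : IsUnit M.det)
    (hN : IsUnit N.det) : glOf (M * N) = glOf M * glOf N := by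
  apply Units.ext
  rw [Units.val_mul, glOf_val hM, glOf_val hN, glOf_val]
  rw [Matrix.det_mul]
  exact hM.mul hN

theorem half_half_four_mul (z : Zw) : half (half (4 * z)) = z := by
  rw [show (4 : Zw) * z = 2 * (2 * z) by ring, half_two_mul, half_two_mul]

theorem four_mul_half_half {z : Zw} (h : 4 ∣ z) : 4 * half (half z) = z := by
  obtain ⟨w, rfl⟩ := h
  rw [half_half_four_mul]

/-- Conjugation by the matrix with diagonal entries one and a quarter. -/
def scaleUp (M : Matrix (Fin 2) (Fin 2) Zw) : Matrix (Fin 2) (Fin 2) Zw :=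
  !![M 0 0, 4 * M 0 1; half (half (M 1 0)), M 1 1]

/-- Conjugation by the matrix with diagonal entries one and four. -/
def scaleDown (M : Matrix (Fin 2) (Fin 2) Zw) : Matrix (Fin 2) (Fin 2) Zw :=
  !![M 0 0, half (half (M 0 1)); 4 * M 1 0, M 1 1]

theorem det_scaleUp {M : Matrix (Fin 2) (Fin 2) Zw} (h : 4 ∣ M 1 0) :
    (scaleUp M).det = M.det := by
  rw [scaleUp, Matrix.det_fin_two_of, Matrix.det_fin_two]
  linear_combination -M 0 1 * four_mul_half_half h

theorem det_scaleDown {M : Matrix (Fin 2) (Fin 2) Zw} (h : 4 ∣ M 0 1) :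
    (scaleDown M).det = M.det := by
  rw [scaleDown, Matrix.det_fin_two_of, Matrix.det_fin_two]
  linear_combination -M 1 0 * four_mul_half_half h

theorem scaleUp_mul {M N : Matrix (Fin 2) (Fin 2) Zw} (hM : 4 ∣ M 1 0) (hN : 4 ∣ N 1 0) :
    scaleUp (M * N) = scaleUp M * scaleUp N := by
  obtain ⟨m, hm⟩ := hM
  obtain ⟨n, hn⟩ := hN
  have e : (M * N) 1 0 = 4 * (m * N 0 0 + M 1 1 * n) := by
    rw [Matrix.mul_apply, Fin.sum_univ_two, hm, hn]; ring
  refine Matrix.ext fun i j => ?_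
  rw [Matrix.mul_apply, Fin.sum_univ_two, scaleUp, e, half_half_four_mul, scaleUp, scaleUp, hm, hn,
    half_half_four_mul, half_half_four_mul]
  fin_cases i <;> fin_cases j <;> simp [Matrix.mul_apply, Fin.sum_univ_two, hm, hn] <;> ring

theorem scaleDown_scaleUp {M : Matrix (Fin 2) (Fin 2) Zw} (h : 4 ∣ M 1 0) :
    scaleDown (scaleUp M) = M := by
  refine Matrix.ext fun i j => ?_
  fin_cases i <;> fin_cases j <;>
    simp [scaleDown, scaleUp, half_half_four_mul, four_mul_half_half h]

theorem scaleUp_scaleDown {M : Matrix (Fin 2) (Fin 2) Zw} (h : 4 ∣ M 0 1) :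
    scaleUp (scaleDown M) = M := by
  refine Matrix.ext fun i j => ?_
  fin_cases i <;> fin_cases j <;>
    simp [scaleDown, scaleUp, half_half_four_mul, four_mul_half_half h]

section lifts
variable {T : Type} [AddCommGroup T] {π : ℚ →+ T}

theorem Lifts.gamma0 (h : Lifts π Gam 0) : Lifts π (Gamma0 (Ideal.span {(16 : Zw)})) 0 := by
  have hu : ∀ g : GL (Fin 2) Zw, IsUnit g.val.det := fun g =>
    (Matrix.isUnit_iff_isUnit_det _).1 g.isUnit
  have h4 : ∀ g ∈ Gamma0 (Ideal.span {(16 : Zw)}), 4 ∣ g.val 1 0 := fun g hg =>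
    (Dvd.intro 4 (by norm_num)).trans (Ideal.mem_span_singleton.1 (mem_Gamma0.1 hg))
  have v1 : ∀ g ∈ Gamma0 (Ideal.span {(16 : Zw)}), (glOf (scaleUp g.val)).val = scaleUp g.val :=
    fun g hg => glOf_val (by rw [det_scaleUp (h4 g hg)]; exact hu g)
  have v2 : ∀ g ∈ Gam, (glOf (scaleDown g.val)).val = scaleDown g.val :=
    fun g hg => glOf_val (by rw [det_scaleDown hg.1]; exact hu g)
  refine h.transport (fun g => glOf (scaleUp g.val)) (fun g => glOf (scaleDown g.val))
    (fun g hg => ?_) (fun g hg => ?_) (fun g hg g' hg' => ?_) (fun g hg => ?_) (fun g hg => ?_)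
    fun _ _ => rfl
  · obtain ⟨c, hc⟩ := Ideal.mem_span_singleton.1 (mem_Gamma0.1 hg)
    rw [mem_Gam, v1 g hg]
    refine ⟨⟨g.val 0 1, rfl⟩, ⟨c, ?_⟩⟩
    show half (half (g.val 1 0)) = 4 * c
    rw [hc, show (16 : Zw) * c = 4 * (4 * c) by ring, half_half_four_mul]
  · obtain ⟨c, hc⟩ := hg.2
    rw [mem_Gamma0, v2 g hg, Ideal.mem_span_singleton]
    refine ⟨c, ?_⟩
    show 4 * g.val 1 0 = 16 * c
    rw [hc]; ring
  · rw [← glOf_mul, Units.val_mul, scaleUp_mul (h4 g hg) (h4 g' hg')]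
    · rw [det_scaleUp (h4 g hg)]; exact hu g
    · rw [det_scaleUp (h4 g' hg')]; exact hu g'
  · have e := scaleDown_scaleUp (h4 g hg)
    refine Units.ext ?_
    rw [v1 g hg, glOf_val, e]
    rw [e]; exact hu g
  · have e := scaleUp_scaleDown hg.1
    refine Units.ext ?_
    rw [v2 g hg, glOf_val, e]
    rw [e]; exact hu g

theorem Lifts.gamma0_of_equiv {R : Type*} [CommRing R] (e : R ≃+* Zw)
    (h : Lifts π (Gamma0 (Ideal.span {(16 : Zw)})) 0) :
    Lifts π (Gamma0 (Ideal.span {(16 : R)})) 0 := by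
  refine h.transport (Matrix.GeneralLinearGroup.map (e : R →+* Zw))
    (Matrix.GeneralLinearGroup.map (e.symm : Zw →+* R)) (fun g hg => ?_) (fun g hg => ?_)
    (fun g _ g' _ => map_mul _ g g') (fun g _ => ?_) (fun g _ => ?_) fun _ _ => rfl
  · obtain ⟨c, hc⟩ := Ideal.mem_span_singleton.1 (mem_Gamma0.1 hg)
    refine Ideal.mem_span_singleton.2 ⟨e c, ?_⟩
    show e (g.val 1 0) = _
    rw [hc, map_mul, map_ofNat]
  · obtain ⟨c, hc⟩ := Ideal.mem_span_singleton.1 (mem_Gamma0.1 hg)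
    refine Ideal.mem_span_singleton.2 ⟨e.symm c, ?_⟩
    show e.symm (g.val 1 0) = _
    rw [hc, map_mul, map_ofNat]
  · exact Units.ext (Matrix.ext fun i j => e.symm_apply_apply _)
  · exact Units.ext (Matrix.ext fun i j => e.apply_symm_apply _)

end lifts

section ring
variable {K : Type*} [Field K] [NumberField K]

theorem int_of_mul_sq {t : ℚ} {n : ℤ} (h : 163 * t ^ 2 = n) : ∃ k : ℤ, t = k := by
  have h1 : IsIntegral ℤ (163 * t) := by
    refine IsIntegral.of_pow (n := 2) two_pos ?_
    rw [show (163 * t) ^ 2 = ((163 * n : ℤ) : ℚ) by push_cast; rw [← h]; ring]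
    exact isIntegral_algebraMap (A := ℚ) (x := (163 * n : ℤ))
  obtain ⟨m, hm⟩ := IsIntegrallyClosed.isIntegral_iff.1 h1
  have hm : (m : ℚ) = 163 * t := hm
  have h2 : m ^ 2 = 163 * n := by
    have : (m : ℚ) ^ 2 = 163 * n := by rw [hm, ← h]; ring
    exact_mod_cast this
  have h3 : (163 : ℤ) ∣ m := Int.Prime.dvd_pow' (p := 163) (by norm_num) (Dvd.intro _ h2.symm)
  obtain ⟨k, rfl⟩ := h3
  exact ⟨k, by push_cast at hm; linarith⟩

theorem sq_add_ne_zero {sqd : K} (hsqd : sqd ^ 2 = -(163 : K)) {p q : ℚ}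
    (h : (p : K) + q * sqd = 0) : p = 0 ∧ q = 0 := by
  have h1 : (p : K) ^ 2 + 163 * (q : K) ^ 2 = 0 := by
    linear_combination (p - q * sqd) * h + (q : K) ^ 2 * hsqd
  have h2 : p ^ 2 + 163 * q ^ 2 = 0 := by exact_mod_cast h1
  constructor <;> nlinarith [sq_nonneg p, sq_nonneg q]

theorem exists_coords (hdeg : Module.finrank ℚ K = 2) {sqd : K} (hsqd : sqd ^ 2 = -(163 : K))
    (z : K) : ∃ p q : ℚ, z = p + q * sqd := by
  have hli : LinearIndependent ℚ ![(1 : K), sqd] := by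
    rw [LinearIndependent.pair_iff]
    intro p q h
    rw [Rat.smul_def, Rat.smul_def, mul_one] at h
    exact sq_add_ne_zero hsqd h
  have hs := hli.span_eq_top_of_card_eq_finrank' (by simp [hdeg])
  have hz : z ∈ Submodule.span ℚ (Set.range ![(1 : K), sqd]) := hs ▸ Submodule.mem_top
  rw [Matrix.range_cons, Matrix.range_cons, Matrix.range_empty, Set.union_empty,
    Set.singleton_union, Submodule.mem_span_pair] at hz
  obtain ⟨p, q, h⟩ := hz
  exact ⟨p, q, by rw [← h, Rat.smul_def, Rat.smul_def, mul_one]⟩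

open Polynomial in
theorem minpoly_eq_quadratic {z : K} (hz : IsIntegral ℚ z) {a b : ℚ}
    (h : z ^ 2 + a * z + b = 0) (hr : ∀ r : ℚ, (r : K) ≠ z) :
    minpoly ℚ z = X ^ 2 + C a * X + C b := by
  have hd : (X ^ 2 + C a * X + C b).natDegree = 2 := by compute_degree!
  have hm : (X ^ 2 + C a * X + C b).Monic := by monicity!
  have hdeg : 2 ≤ (minpoly ℚ z).natDegree := by
    rw [minpoly.two_le_natDegree_iff hz]
    rintro ⟨r, h1⟩
    exact hr r (by rw [← h1, eq_ratCast])
  refine (Polynomial.eq_of_monic_of_dvd_of_natDegree_le (minpoly.monic hz) hm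
    (minpoly.dvd ℚ z ?_) (by omega)).symm
  simpa only [map_add, map_mul, map_pow, aeval_X, aeval_C, eq_ratCast] using h

theorem int_trace_norm {sqd : K} (hsqd : sqd ^ 2 = -(163 : K)) {p q : ℚ}
    (h : IsIntegral ℤ ((p : K) + q * sqd)) : ∃ m n : ℤ, 2 * p = m ∧ p ^ 2 + 163 * q ^ 2 = n := by
  by_cases hq : q = 0
  · subst hq
    have h1 : IsIntegral ℤ p := by
      rw [← isIntegral_algebraMap_iff (algebraMap ℚ K).injective]
      simpa using h
    obtain ⟨m, hm⟩ := IsIntegrallyClosed.isIntegral_iff.1 h1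
    have hm : (m : ℚ) = p := hm
    exact ⟨2 * m, m ^ 2, by push_cast; rw [hm], by push_cast; rw [hm]; ring⟩
  · have hmin := minpoly_eq_quadratic (a := -(2 * p)) (b := p ^ 2 + 163 * q ^ 2) h.tower_top
      (by push_cast; linear_combination (q : K) ^ 2 * hsqd)
      (fun r hr => hq (sq_add_ne_zero hsqd (p := p - r) (q := q) (by push_cast; rw [hr]; ring)).2)
    have hc (i) : ((minpoly ℤ ((p : K) + q * sqd)).coeff i : ℚ) =
        (minpoly ℚ ((p : K) + q * sqd)).coeff i := by
      rw [minpoly.isIntegrallyClosed_eq_field_fractions' ℚ h, Polynomial.coeff_map]; rfl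
    rw [hmin] at hc
    have c1 := hc 1
    have c0 := hc 0
    simp only [Polynomial.coeff_add, Polynomial.coeff_X_pow, Polynomial.coeff_C_mul,
      Polynomial.coeff_X, Polynomial.coeff_C] at c1 c0
    norm_num at c1 c0
    exact ⟨-(minpoly ℤ ((p : K) + q * sqd)).coeff 1, (minpoly ℤ ((p : K) + q * sqd)).coeff 0,
      by push_cast; linarith, by linarith⟩

theorem exists_ringEquiv (hdeg : Module.finrank ℚ K = 2) {sqd : K} (hsqd : sqd ^ 2 = -(163 : K)) :
    Nonempty (𝓞 K ≃+* Zw) := by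
  have hw : IsIntegral ℤ ((1 + sqd) / 2) := by
    refine ⟨Polynomial.X ^ 2 + Polynomial.C (-1) * Polynomial.X + Polynomial.C 41, by monicity!, ?_⟩
    simp only [Polynomial.eval₂_add, Polynomial.eval₂_mul, Polynomial.eval₂_pow,
      Polynomial.eval₂_X, Polynomial.eval₂_C]
    rw [eq_intCast, eq_intCast]
    push_cast
    linear_combination hsqd / 4
  let w : 𝓞 K := ⟨(1 + sqd) / 2, hw⟩
  have hw2 : w * w = (-41 : ℤ) • 1 + (1 : ℤ) • w := by
    apply RingOfIntegers.ext
    change algebraMap (𝓞 K) K (w * w) = algebraMap (𝓞 K) K ((-41 : ℤ) • 1 + (1 : ℤ) • w)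
    rw [map_mul, map_add, map_zsmul, map_zsmul, map_one]
    change (1 + sqd) / 2 * ((1 + sqd) / 2) = (-41 : ℤ) • (1 : K) + (1 : ℤ) • ((1 + sqd) / 2)
    rw [zsmul_eq_mul, zsmul_eq_mul]
    push_cast
    linear_combination hsqd / 4
  let f : Zw →ₐ[ℤ] 𝓞 K := QuadraticAlgebra.lift ⟨w, hw2⟩
  have hf : ∀ z, ((f z : 𝓞 K) : K) = z.re + z.im * ((1 + sqd) / 2) := fun z => by
    change algebraMap (𝓞 K) K (z.re • 1 + z.im • w) = _
    rw [map_add, map_zsmul, map_zsmul, map_one, zsmul_eq_mul, zsmul_eq_mul, mul_one]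
    rfl
  refine ⟨(RingEquiv.ofBijective f ⟨(injective_iff_map_eq_zero f).2 fun z hz => ?_, fun z => ?_⟩).symm⟩
  · have h1 := hf z
    rw [hz, RingOfIntegers.coe_eq_algebraMap, map_zero] at h1
    have h2 : ((z.re + z.im / 2 : ℚ) : K) + ((z.im / 2 : ℚ) : K) * sqd = 0 := by
      push_cast
      linear_combination -h1
    obtain ⟨h3, h4⟩ := sq_add_ne_zero hsqd h2
    have h5 : (z.im : ℚ) = 0 := by linarith
    have h6 : (z.re : ℚ) = 0 := by linarith
    exact QuadraticAlgebra.ext (by exact_mod_cast h6) (by exact_mod_cast h5)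
  · obtain ⟨p, q, hz⟩ := exists_coords hdeg hsqd z
    have hI : IsIntegral ℤ (z : K) := z.isIntegral_coe
    rw [hz] at hI
    obtain ⟨m, n, hm, hn⟩ := int_trace_norm hsqd hI
    obtain ⟨k, hk⟩ := int_of_mul_sq (t := 2 * q) (n := 4 * n - m ^ 2) (by
      push_cast; rw [← hm, ← hn]; ring)
    have h1 : m ^ 2 + 163 * k ^ 2 = 4 * n := by
      have : (m : ℚ) ^ 2 + 163 * k ^ 2 = 4 * n := by rw [← hm, ← hk, ← hn]; ring
      exact_mod_cast this
    have h2 : (2 : ℤ) ∣ m - k := by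
      have : (2 : ℤ) ∣ (m - k) * (m - k) := ⟨2 * n - 81 * k ^ 2 - m * k, by linarith⟩
      exact (Int.prime_two.dvd_mul.1 this).elim id id
    obtain ⟨j, hj⟩ := h2
    refine ⟨⟨j, k⟩, RingOfIntegers.ext ?_⟩
    have hj' : (m : ℚ) - k = 2 * j := by exact_mod_cast hj
    rw [hf, hz, show p = j + k / 2 by linarith, show q = k / 2 by linarith]
    push_cast
    ring

end ring

/-- The rationals with denominator prime to `l`. -/
def primeToDen (l : ℕ) : AddSubgroup ℚ where
  carrier := {q | ∃ n : ℕ, n.Coprime l ∧ ∃ m : ℤ, n * q = m}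
  zero_mem' := ⟨1, Nat.coprime_one_left l, 0, by norm_num⟩
  add_mem' := by
    rintro a b ⟨n, hn, m, hm⟩ ⟨n', hn', m', hm'⟩
    refine ⟨n * n', hn.mul_left hn', n' * m + n * m', ?_⟩
    push_cast
    rw [← hm, ← hm']
    ring
  neg_mem' := by
    rintro a ⟨n, hn, m, hm⟩
    exact ⟨n, hn, -m, by push_cast; rw [← hm]; ring⟩

theorem primeToDen_saturated {l k : ℕ} (hk : k.Coprime l) (a : ℚ ⧸ primeToDen l) (ha : k • a = 0) :
    a = 0 := by
  obtain ⟨q, rfl⟩ := QuotientAddGroup.mk_surjective a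
  obtain ⟨n, hn, m, hm⟩ := (QuotientAddGroup.eq_zero_iff (k • q)).1 ha
  refine (QuotientAddGroup.eq_zero_iff q).2 ⟨n * k, hn.mul_left hk, m, ?_⟩
  rw [← hm, nsmul_eq_mul]
  push_cast
  ring

theorem exists_int_of_mem_primeToDen {l : ℕ} {q : ℚ} (hq : q ∈ primeToDen l) {k : ℤ}
    (h : l * q = k) : ∃ m : ℤ, q = m := by
  obtain ⟨n, hn, m, hm⟩ := hq
  obtain ⟨u, v, huv⟩ := Nat.isCoprime_iff_coprime.2 hn
  refine ⟨u * m + v * k, ?_⟩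
  have huv' : (u : ℚ) * n + v * l = 1 := by exact_mod_cast huv
  push_cast
  linear_combination u * hm + v * h - q * huv'

/-- The reduction of the circle away from denominators prime to `l`. -/
def reduceCircle (l : ℕ) : AddCircle (1 : ℚ) →+ ℚ ⧸ primeToDen l :=
  QuotientAddGroup.map _ _ (AddMonoidHom.id ℚ) (by
    rw [AddSubgroup.zmultiples_le]
    exact ⟨1, Nat.coprime_one_left l, 1, by norm_num⟩)

theorem reduceCircle_eq_zero {l : ℕ} {a : AddCircle (1 : ℚ)} (ha : l • a = 0)
    (h : reduceCircle l a = 0) : a = 0 := by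
  obtain ⟨q, rfl⟩ := QuotientAddGroup.mk_surjective a
  obtain ⟨k, hk⟩ := (QuotientAddGroup.eq_zero_iff (l • q)).1 ha
  have hq : q ∈ primeToDen l := (QuotientAddGroup.eq_zero_iff q).1 h
  have hk : (k : ℚ) = l * q := by simpa using hk
  obtain ⟨m, rfl⟩ := exists_int_of_mem_primeToDen hq hk.symm
  exact (QuotientAddGroup.eq_zero_iff (m : ℚ)).2 ⟨m, by simp⟩

theorem Lifts.not_orderOf {G : Type*} [Group G] {Δ : Subgroup G} {l : ℕ} (hl : l.Prime)
    (h : Lifts (QuotientAddGroup.mk' (primeToDen l)) Δ 0) :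
    ¬ ∃ x : Abelianization Δ, orderOf x = l := by
  classical
  rintro ⟨x, hx⟩
  have hx1 : Additive.ofMul x ≠ 0 := fun h0 => hl.one_lt.ne' (by
    rw [← hx, show x = 1 from h0, orderOf_one])
  have hxl : l • Additive.ofMul x = 0 := by
    rw [← hx]; exact pow_orderOf_eq_one x
  obtain ⟨c, hc⟩ := CharacterModule.exists_character_apply_ne_zero_of_ne_zero hx1
  have hcl : l • c (Additive.ofMul x) = 0 := by rw [← map_nsmul, hxl, map_zero]
  let χ : Additive (Abelianization Δ) →+ ℚ ⧸ primeToDen l := (reduceCircle l).comp c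
  obtain ⟨F, hF, hFf⟩ := h
    (fun g => if hg : g ∈ Δ then χ (Additive.ofMul (Abelianization.of ⟨g, hg⟩)) else 0)
    (fun g hg g' hg' => by
      simp only [dif_pos hg, dif_pos hg', dif_pos (Δ.mul_mem hg hg')]
      exact map_add χ (Additive.ofMul (Abelianization.of ⟨g, hg⟩))
        (Additive.ofMul (Abelianization.of ⟨g', hg'⟩)))
  have hadd : ∀ x ∈ Δ, ∀ y ∈ Δ, F (x * y) = F x + F y := hF
  let φ : Δ →* Multiplicative ℚ := MonoidHom.mk' (fun g => Multiplicative.ofAdd (F g))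
    fun g g' => congrArg Multiplicative.ofAdd (hadd g g.2 g' g'.2)
  obtain ⟨g, rfl⟩ : ∃ g, Abelianization.of g = x := QuotientGroup.mk_surjective x
  have h1 : (φ g) ^ l = 1 := by
    have h2 : Abelianization.lift φ (Abelianization.of g ^ l) = 1 := by
      rw [← hx, pow_orderOf_eq_one, map_one]
    rwa [map_pow, Abelianization.lift_apply_of] at h2
  have h3 : l • F g = 0 := h1
  have h4 : F g = 0 := (smul_eq_zero.1 h3).resolve_left hl.ne_zero
  have h5 := hFf g g.2
  rw [h4, map_zero, dif_pos g.2] at h5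
  exact hc (reduceCircle_eq_zero hcl h5.symm)

/-- For `K = ℚ(√−163)` and `N = 16𝓞_K = (2𝓞_K)⁴`, for every prime
`l ≥ 19` the abelianization of `Γ₀(N)` has no element of order `l`. -/
theorem abelianization_of_Gamma0_no_large_prime_torsion_163
    (K : Type*) [Field K] [NumberField K] (hdeg : Module.finrank ℚ K = 2)
    (sqd : K) (hsqd : sqd ^ 2 = -(163 : K)) :
    ∀ l : ℕ, l.Prime → 19 ≤ l →
      ¬ ∃ x : Abelianization (Gamma0 (Ideal.span {(16 : 𝓞 K)})), orderOf x = l := by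
  intro l hl hl19
  have hcop : Nat.Coprime 89760 l := by
    refine ((hl.coprime_iff_not_dvd).2 fun hd => ?_).symm
    rw [show 89760 = 2 ^ 5 * 3 * 5 * 11 * 17 by norm_num, hl.dvd_mul, hl.dvd_mul, hl.dvd_mul,
      hl.dvd_mul] at hd
    obtain (((hd | hd) | hd) | hd) | hd := hd
    · have := Nat.le_of_dvd two_pos (hl.dvd_of_dvd_pow hd)
      omega
    all_goals
      have := Nat.le_of_dvd (by norm_num) hd
      omega
  obtain ⟨e⟩ := exists_ringEquiv hdeg hsqd
  exact Lifts.not_orderOf hl (Lifts.gamma0_of_equiv e (Lifts.gamma0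
    (lifts_Gam (QuotientAddGroup.mk'_surjective _) (primeToDen_saturated hcop))))
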